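/- Let -2 ≤ a < b ≤ 2 be real numbers. For a prime p ≡ 2 (mod 3) let a_p(λ) := -∑_{x∈F_p} φ(x(x-1)(x-λ)). Then, as p tends to infinity through primes p ≡ 2 (mod 3), (1/p) · #{λ ∈ F_p, λ ≠ 0,1 : a ≤ φ(-1)·a_p(λ)/√p ≤ b} converges to (1/(2π)) ∫_a^b √(4-t²) dt. (For λ ≠ 0,±1 the quantity φ(-1)·a_p(λ) equals the value of the p-adic hypergeometric function ₆G₆(λ)_p considered in the paper, so this is the semicircular limiting distribution of p^{-1/2}·₆G₆(λ)_p.) -/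

import Mathlib

open Finset Filter

section PowerSeriesRepresentation
open PowerSeries

/-- The power series `P` converges to the function `F` on the open unit disc. -/
def CRep (P : ℂ⟦X⟧) (F : ℂ → ℂ) : Prop :=
  ∀ q : ℂ, ‖q‖ < 1 → HasSum (fun n => coeff n P * q ^ n) (F q)

namespace CRep
variable {P Q : ℂ⟦X⟧} {F G : ℂ → ℂ}

theorem congr (h : CRep P F) (hFG : ∀ q : ℂ, ‖q‖ < 1 → F q = G q) : CRep P G :=
  fun q hq => hFG q hq ▸ h q hq

theorem summable_norm (h : CRep P F) {q : ℂ} (hq : ‖q‖ < 1) :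
    Summable fun n => ‖coeff n P * q ^ n‖ :=
  (h q hq).summable.norm

theorem add (hP : CRep P F) (hQ : CRep Q G) : CRep (P + Q) (fun q => F q + G q) := fun q hq => by
  simpa [add_mul] using (hP q hq).add (hQ q hq)

theorem sub (hP : CRep P F) (hQ : CRep Q G) : CRep (P - Q) (fun q => F q - G q) := fun q hq => by
  simpa [sub_mul] using (hP q hq).sub (hQ q hq)

theorem mul (hP : CRep P F) (hQ : CRep Q G) : CRep (P * Q) (fun q => F q * G q) := fun q hq => by
  have h1 := hP.summable_norm hq
  have h2 := hQ.summable_norm hq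
  have e : ∀ n, coeff n (P * Q) * q ^ n =
      ∑ kl ∈ antidiagonal n, (coeff kl.1 P * q ^ kl.1) * (coeff kl.2 Q * q ^ kl.2) := by
    intro n
    rw [coeff_mul, Finset.sum_mul]
    refine Finset.sum_congr rfl fun kl hkl => ?_
    rw [← mem_antidiagonal.mp hkl, pow_add]; ring
  simp only [e]
  have hs := (summable_norm_sum_mul_antidiagonal_of_summable_norm h1 h2).of_norm
  have ht := tsum_mul_tsum_eq_tsum_sum_antidiagonal_of_summable_norm h1 h2
  rw [(hP q hq).tsum_eq, (hQ q hq).tsum_eq] at ht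
  rw [ht]
  exact hs.hasSum

theorem const (c : ℂ) : CRep (C c) (fun _ => c) := fun q _ => by
  have := hasSum_single (f := fun n => coeff n (C c) * q ^ n) 0
    (fun n hn => by simp [coeff_C, hn])
  simpa using this

theorem one : CRep 1 (fun _ => 1) := by simpa using const 1

theorem id : CRep X (fun q => q) := fun q _ => by
  have := hasSum_single (f := fun n => coeff n (X : ℂ⟦X⟧) * q ^ n) 1
    (fun n hn => by simp [coeff_X, hn])
  simpa using this

theorem pow (hP : CRep P F) (k : ℕ) : CRep (P ^ k) (fun q => F q ^ k) := by
  induction k with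
  | zero => simpa using one
  | succ k ih => simpa [pow_succ] using ih.mul hP

theorem comp_pow (hP : CRep P F) (k : ℕ) (hk : k ≠ 0) :
    CRep (expand k hk P) (fun q => F (q ^ k)) := fun q hq => by
  have hq' : ‖q ^ k‖ < 1 := by rw [norm_pow]; exact pow_lt_one₀ (norm_nonneg _) hq hk
  have h := hP _ hq'
  have inj : Function.Injective (fun n : ℕ => k * n) := fun a b h =>
    Nat.eq_of_mul_eq_mul_left (Nat.pos_of_ne_zero hk) h
  rw [← inj.hasSum_iff]
  · convert h using 2 with n
    simp [coeff_expand_mul, pow_mul]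
  · intro n hn
    rw [coeff_expand_of_not_dvd, zero_mul]
    rintro ⟨m, rfl⟩
    exact hn ⟨m, rfl⟩

theorem hasFPowerSeriesOnBall (hP : CRep P F) :
    HasFPowerSeriesOnBall F (FormalMultilinearSeries.ofScalars ℂ (fun n => coeff n P)) 0 1 := by
  refine ⟨?_, one_pos, ?_⟩
  · refine ENNReal.le_of_forall_nnreal_lt fun r hr => ?_
    have hr' : (r : ℝ) < 1 := by exact_mod_cast hr
    refine FormalMultilinearSeries.le_radius_of_summable_norm _ ?_
    have := hP.summable_norm (q := (r : ℂ)) (by simpa using hr')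
    refine this.congr fun n => ?_
    simp [FormalMultilinearSeries.ofScalars_norm]
  · intro y hy
    have hy' : ‖y‖ < 1 := by
      rw [Metric.mem_eball, edist_zero_right] at hy
      have : ‖y‖₊ < 1 := by rw [enorm_eq_nnnorm] at hy; exact_mod_cast hy
      exact_mod_cast this
    have := hP y hy'
    simp only [zero_add]
    convert this using 2 with n
    · rfl
    · simp [FormalMultilinearSeries.ofScalars_apply_eq, smul_eq_mul, mul_comm]

theorem unique' (hP : CRep P F) (hQ : CRep Q G) (h : F =ᶠ[nhds 0] G) : P = Q := by
  have := (hP.hasFPowerSeriesOnBall.hasFPowerSeriesAt.congr h).eq_formalMultilinearSeries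
    hQ.hasFPowerSeriesOnBall.hasFPowerSeriesAt
  ext n
  have h2 := congrArg (fun s : FormalMultilinearSeries ℂ ℂ ℂ => s n (fun _ => 1)) this
  simpa [FormalMultilinearSeries.ofScalars_apply_eq] using h2

theorem unique (hP : CRep P F) (hQ : CRep Q F) : P = Q := hP.unique' hQ EventuallyEq.rfl

theorem differentiableOn (hP : CRep P F) : DifferentiableOn ℂ F (Metric.ball 0 1) := by
  have := hP.hasFPowerSeriesOnBall.differentiableOn
  rwa [show (1 : ENNReal) = ENNReal.ofReal 1 by simp, Metric.eball_ofReal] at this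

theorem differentiableAt (hP : CRep P F) {q : ℂ} (hq : ‖q‖ < 1) : DifferentiableAt ℂ F q :=
  hP.differentiableOn.differentiableAt (Metric.isOpen_ball.mem_nhds (by simpa using hq))

theorem exists_of_differentiableOn (hF : DifferentiableOn ℂ F (Metric.ball 0 1)) :
    ∃ P, CRep P F := by
  refine ⟨PowerSeries.mk fun n => (n.factorial : ℂ)⁻¹ * iteratedDeriv n F 0, fun q hq => ?_⟩
  have := Complex.hasSum_taylorSeries_on_ball hF (z := q) (by simpa using hq)
  convert this using 2 with n
  · rfl
  · simp; ring

theorem eval_zero (hP : CRep P F) : F 0 = constantCoeff P := by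
  have h := hP 0 (by simp)
  have := hasSum_single (f := fun n => coeff n P * (0 : ℂ) ^ n) 0 (fun n hn => by simp [hn])
  simpa using h.unique this

theorem deriv (hP : CRep P F) : CRep (d⁄dX ℂ P) (_root_.deriv F) := by
  obtain ⟨Q, hQ⟩ := exists_of_differentiableOn
    (hP.differentiableOn.deriv Metric.isOpen_ball)
  convert hQ using 1
  ext n
  have e : ∀ (P : ℂ⟦X⟧) (F : ℂ → ℂ), CRep P F → ∀ n,
      coeff n P = iteratedDeriv n F 0 / n.factorial := by
    intro P F hP n
    have hd : DifferentiableOn ℂ F (Metric.ball 0 1) := hP.differentiableOn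
    have h2 : CRep (PowerSeries.mk fun n => (n.factorial : ℂ)⁻¹ * iteratedDeriv n F 0) F := by
      intro q hq
      have := Complex.hasSum_taylorSeries_on_ball hd (z := q) (by simpa using hq)
      convert this using 2 with n
      · rfl
      · simp; ring
    rw [hP.unique h2, coeff_mk, div_eq_inv_mul]
  rw [PowerSeries.coeff_derivative, e P F hP, e Q _ hQ, iteratedDeriv_succ']
  rw [Nat.factorial_succ]
  push_cast
  field_simp

theorem inv (hP : CRep P F) (h0 : ∀ q : ℂ, ‖q‖ < 1 → F q ≠ 0) : CRep P⁻¹ (fun q => (F q)⁻¹) := by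
  have hd : DifferentiableOn ℂ (fun q => (F q)⁻¹) (Metric.ball 0 1) :=
    hP.differentiableOn.inv fun q hq => h0 q (by simpa using hq)
  obtain ⟨Q, hQ⟩ := exists_of_differentiableOn hd
  have h1 : P * Q = 1 := (hP.mul hQ).unique
    (one.congr fun q hq => (mul_inv_cancel₀ (h0 q hq)).symm)
  have hc : constantCoeff P ≠ 0 := by rw [← hP.eval_zero]; exact h0 0 (by simp)
  have : P⁻¹ = Q := by
    rw [PowerSeries.inv_eq_iff_mul_eq_one hc, mul_comm]; exact h1
  rwa [this]

end CRep

/-- `F` is represented on the unit disc by the integral power series `P`. -/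
def IRep (P : ℤ⟦X⟧) (F : ℂ → ℂ) : Prop := CRep (PowerSeries.map (Int.castRingHom ℂ) P) F

namespace IRep
variable {P Q : ℤ⟦X⟧} {F G : ℂ → ℂ}

theorem congr (h : IRep P F) (hFG : ∀ q : ℂ, ‖q‖ < 1 → F q = G q) : IRep P G := CRep.congr h hFG
theorem add (hP : IRep P F) (hQ : IRep Q G) : IRep (P + Q) (fun q => F q + G q) := by
  unfold IRep; rw [map_add]; exact CRep.add hP hQ
theorem sub (hP : IRep P F) (hQ : IRep Q G) : IRep (P - Q) (fun q => F q - G q) := by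
  unfold IRep; rw [map_sub]; exact CRep.sub hP hQ
theorem mul (hP : IRep P F) (hQ : IRep Q G) : IRep (P * Q) (fun q => F q * G q) := by
  unfold IRep; rw [map_mul]; exact CRep.mul hP hQ
theorem pow (hP : IRep P F) (k : ℕ) : IRep (P ^ k) (fun q => F q ^ k) := by
  unfold IRep; rw [map_pow]; exact CRep.pow hP k
theorem id : IRep X (fun q => q) := by
  unfold IRep; rw [map_X]; exact CRep.id
theorem one : IRep 1 (fun _ => 1) := by
  unfold IRep; rw [map_one]; exact CRep.one
theorem const (n : ℤ) : IRep (C n) (fun _ => (n : ℂ)) := by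
  unfold IRep; rw [map_C]; exact CRep.const _
theorem comp_pow (hP : IRep P F) (k : ℕ) (hk : k ≠ 0) :
    IRep (expand k hk P) (fun q => F (q ^ k)) := by
  unfold IRep; rw [map_expand]; exact CRep.comp_pow hP k hk
theorem unique (hP : IRep P F) (hQ : IRep Q F) : P = Q :=
  PowerSeries.map_injective _ (RingHom.injective_int (Int.castRingHom ℂ)) (CRep.unique hP hQ)
theorem unique_congr (hP : IRep P F) (hQ : IRep Q G) (h : ∀ q : ℂ, ‖q‖ < 1 → F q = G q) : P = Q :=
  (hP.congr h).unique hQ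
theorem differentiableAt (hP : IRep P F) {q : ℂ} (hq : ‖q‖ < 1) : DifferentiableAt ℂ F q :=
  CRep.differentiableAt hP hq
theorem eval_zero (hP : IRep P F) : F 0 = constantCoeff P := by
  rw [CRep.eval_zero hP]; simp [← coeff_zero_eq_constantCoeff]
theorem deriv (hP : IRep P F) : IRep (d⁄dX ℤ P) (_root_.deriv F) := by
  have := CRep.deriv hP
  unfold IRep
  convert this using 1
  ext n; simp [PowerSeries.coeff_derivative]
theorem inv (hP : IRep P F) (hc : constantCoeff P = 1) (h0 : ∀ q : ℂ, ‖q‖ < 1 → F q ≠ 0) :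
    IRep (invOfUnit P 1) (fun q => (F q)⁻¹) := by
  have h := CRep.inv hP h0
  unfold IRep
  convert h using 1
  have h1 : P * invOfUnit P 1 = 1 := mul_invOfUnit P 1 (by simp [hc])
  symm
  rw [PowerSeries.inv_eq_iff_mul_eq_one, mul_comm, ← map_mul, h1, map_one]
  rw [← CRep.eval_zero hP]; exact h0 0 (by simp)
end IRep
end PowerSeriesRepresentation

section ThetaSeries
open PowerSeries

theorem summable_pow_of_natAbs_le {e : ℤ → ℕ} (he : ∀ n : ℤ, n.natAbs ≤ e n + 1) {q : ℂ}
    (hq : ‖q‖ < 1) : Summable fun n : ℤ => q ^ e n := by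
  have h1 : Summable fun n : ℕ => ‖q‖ ^ (n - 1) := by
    rw [← summable_nat_add_iff 1]
    simpa using summable_geometric_of_lt_one (norm_nonneg q) hq
  have h2 : Summable fun n : ℤ => ‖q‖ ^ (n.natAbs - 1) := by
    refine Summable.of_nat_of_neg ?_ ?_ <;> simpa using h1
  refine Summable.of_norm_bounded h2 fun n => ?_
  rw [norm_pow]
  exact pow_le_pow_of_le_one (norm_nonneg q) hq.le (by have := he n; omega)

/-- The generating series of the sizes of the fibres of `e`, where `S k` contains the fibre at `k`. -/
noncomputable def fiberSeries {ι : Type*} (e : ι → ℕ) (S : ℕ → Finset ι) : ℤ⟦X⟧ :=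
  PowerSeries.mk fun k => (((S k).filter fun n => e n = k).card : ℤ)

theorem IRep_fiberSeries {ι : Type*} {e : ι → ℕ} {S : ℕ → Finset ι} (hS : ∀ n, n ∈ S (e n))
    (he : ∀ q : ℂ, ‖q‖ < 1 → Summable fun n => q ^ e n) :
    IRep (fiberSeries e S) fun q => ∑' n, q ^ e n := fun q hq => by
  have h := (he q hq).hasSum.tsum_fiberwise e
  convert h using 2 with k
  · rfl
  have hs : (e ⁻¹' {k}) = ((S k).filter fun n => e n = k : Finset ι) := by
    ext n
    simp only [Set.mem_preimage, Set.mem_singleton_iff, coe_filter, Set.mem_ofPred_eq]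
    exact ⟨fun h => ⟨h ▸ hS n, h⟩, fun h => h.2⟩
  rw [hs, Finset.tsum_subtype' _ (fun n => q ^ e n)]
  rw [Finset.sum_congr rfl (g := fun _ => q ^ k) (fun n hn => by rw [(mem_filter.mp hn).2])]
  simp [fiberSeries]

/-- `∑ q^(n²)` over the integers. -/
noncomputable def th3 (q : ℂ) : ℂ := ∑' n : ℤ, q ^ (n ^ 2).natAbs
/-- `∑ q^(n²+n)` over the integers. -/
noncomputable def psi (q : ℂ) : ℂ := ∑' n : ℤ, q ^ (n ^ 2 + n).natAbs

theorem natAbs_le_sq (n : ℤ) : n.natAbs ≤ (n ^ 2).natAbs + 1 := by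
  rw [Int.natAbs_pow]; nlinarith [Nat.zero_le n.natAbs]

theorem sq_add_self_nonneg (n : ℤ) : 0 ≤ n ^ 2 + n := by
  rcases le_or_gt 0 n with h | h <;> nlinarith

theorem natAbs_le_sq_add (n : ℤ) : n.natAbs ≤ (n ^ 2 + n).natAbs + 1 := by
  have h := sq_add_self_nonneg n
  zify
  rw [abs_of_nonneg h]
  rcases le_or_gt 0 n with h | h
  · rw [abs_of_nonneg h]; nlinarith
  · rw [abs_of_neg h]; nlinarith

theorem th3_zero : th3 0 = 1 := by
  rw [th3, tsum_eq_single 0]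
  · simp
  · intro n hn; rw [zero_pow]; simpa using hn

theorem psi_zero : psi 0 = 2 := by
  rw [psi, tsum_eq_sum (s := {0, -1})]
  · simp; norm_num
  · intro n hn
    simp only [mem_insert, mem_singleton, not_or] at hn
    rw [zero_pow]
    rw [Int.natAbs_ne_zero, show n ^ 2 + n = n * (n + 1) by ring]
    exact mul_ne_zero hn.1 (by omega)

theorem tsum_mul_tsum_int {f g : ℤ → ℂ} (hf : Summable f) (hg : Summable g) :
    (∑' n, f n) * (∑' n, g n) = ∑' x : ℤ × ℤ, f x.1 * g x.2 :=
  tsum_mul_tsum_of_summable_norm hf.norm hg.norm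

/-- Pairs of integers, split by the parity of their sum. -/
def parityEquiv : (ℤ × ℤ) ⊕ (ℤ × ℤ) ≃ ℤ × ℤ where
  toFun := Sum.elim (fun x => (x.1 + x.2, x.1 - x.2)) (fun x => (x.1 + x.2 + 1, x.1 - x.2))
  invFun x := if (x.1 + x.2) % 2 = 0 then Sum.inl ((x.1 + x.2) / 2, (x.1 - x.2) / 2)
    else Sum.inr ((x.1 + x.2 - 1) / 2, (x.1 - x.2 - 1) / 2)
  left_inv := by
    rintro (⟨s, t⟩ | ⟨s, t⟩)
    · have h : (s + t + (s - t)) % 2 = 0 := by omega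
      simp only [Sum.elim_inl, h, if_true]
      congr 2 <;> omega
    · have h : ¬ (s + t + 1 + (s - t)) % 2 = 0 := by omega
      simp only [Sum.elim_inr, h, if_false]
      congr 2 <;> omega
  right_inv := by
    rintro ⟨m, n⟩
    dsimp only
    split_ifs with h
    · simp only [Sum.elim_inl, Prod.mk.injEq]; omega
    · simp only [Sum.elim_inr, Prod.mk.injEq]; omega

theorem tsum_parity {f : ℤ × ℤ → ℂ} (hf : Summable f) :
    ∑' x, f x = (∑' x : ℤ × ℤ, f (x.1 + x.2, x.1 - x.2)) +
      ∑' x : ℤ × ℤ, f (x.1 + x.2 + 1, x.1 - x.2) := by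
  have h := parityEquiv.summable_iff.mpr hf
  rw [← parityEquiv.tsum_eq f]
  exact Summable.tsum_sum (f := f ∘ parityEquiv) (h.comp_injective Sum.inl_injective)
    (h.comp_injective Sum.inr_injective)

theorem sq_norm_lt {q : ℂ} (hq : ‖q‖ < 1) : ‖q ^ 2‖ < 1 := by
  rw [norm_pow]; exact pow_lt_one₀ (norm_nonneg _) hq two_ne_zero

theorem th3_sq {q : ℂ} (hq : ‖q‖ < 1) :
    th3 q ^ 2 = th3 (q ^ 2) ^ 2 + q * psi (q ^ 2) ^ 2 := by
  have hq2 := sq_norm_lt hq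
  have s3 := summable_pow_of_natAbs_le natAbs_le_sq hq
  have s3' := summable_pow_of_natAbs_le natAbs_le_sq hq2
  have sp' := summable_pow_of_natAbs_le natAbs_le_sq_add hq2
  rw [sq (th3 q), sq (th3 (q ^ 2)), sq (psi (q ^ 2))]
  simp only [th3, psi]
  rw [tsum_mul_tsum_int s3 s3, tsum_mul_tsum_int s3' s3', tsum_mul_tsum_int sp' sp',
    tsum_parity (summable_mul_of_summable_norm s3.norm s3.norm), ← tsum_mul_left]
  congr 1 <;> refine tsum_congr fun ⟨s, t⟩ => ?_ <;> simp only [← pow_mul]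
  · rw [← pow_add, ← pow_add]; congr 1
    zify; simp only [abs_of_nonneg (sq_nonneg (_ : ℤ))]; ring
  · rw [← pow_add, ← pow_add, ← pow_succ']; congr 1
    zify; simp only [abs_of_nonneg (sq_nonneg (_ : ℤ)), abs_of_nonneg (sq_add_self_nonneg _)]; ring

theorem psi_sq {q : ℂ} (hq : ‖q‖ < 1) : psi q ^ 2 = 2 * (psi (q ^ 2) * th3 (q ^ 2)) := by
  have hq2 := sq_norm_lt hq
  have s3' := summable_pow_of_natAbs_le natAbs_le_sq hq2
  have sp := summable_pow_of_natAbs_le natAbs_le_sq_add hq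
  have sp' := summable_pow_of_natAbs_le natAbs_le_sq_add hq2
  rw [two_mul]
  nth_rewrite 2 [mul_comm]
  rw [sq (psi q)]
  simp only [th3, psi]
  rw [tsum_mul_tsum_int sp sp, tsum_mul_tsum_int sp' s3', tsum_mul_tsum_int s3' sp',
    tsum_parity (summable_mul_of_summable_norm sp.norm sp.norm)]
  congr 1
  · refine tsum_congr fun ⟨s, t⟩ => ?_
    simp only [← pow_mul]
    rw [← pow_add, ← pow_add]; congr 1
    zify; simp only [abs_of_nonneg (sq_nonneg (_ : ℤ)), abs_of_nonneg (sq_add_self_nonneg _)]; ring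
  · symm
    rw [← (Equiv.prodCongr (Equiv.addRight (1 : ℤ)) (Equiv.refl ℤ)).tsum_eq]
    refine tsum_congr fun ⟨s, t⟩ => ?_
    simp only [← pow_mul, Equiv.prodCongr_apply, Prod.map, Equiv.coe_addRight, Equiv.refl_apply]
    rw [← pow_add, ← pow_add]; congr 1
    zify; simp only [abs_of_nonneg (sq_nonneg (_ : ℤ)), abs_of_nonneg (sq_add_self_nonneg _)]; ring
end ThetaSeries

section ThetaFunctions
open PowerSeries

/-- The integral power series of `th3`. -/
noncomputable def th3S : ℤ⟦X⟧ :=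
  fiberSeries (fun n : ℤ => (n ^ 2).natAbs) (fun k => Icc (-(k + 1 : ℤ)) (k + 1))

theorem IRep_th3 : IRep th3S th3 :=
  IRep_fiberSeries (fun n => by have := natAbs_le_sq n; rw [mem_Icc]; omega)
    fun _ hq => summable_pow_of_natAbs_le natAbs_le_sq hq

/-- `∑ q^(n²+n)` over the natural numbers. -/
noncomputable def psi0 (q : ℂ) : ℂ := ∑' n : ℕ, q ^ (n ^ 2 + n)
/-- The integral power series of `psi0`. -/
noncomputable def psi0S : ℤ⟦X⟧ := fiberSeries (fun n : ℕ => n ^ 2 + n) (fun k => range (k + 1))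

theorem summable_psi0 {q : ℂ} (hq : ‖q‖ < 1) : Summable fun n : ℕ => q ^ (n ^ 2 + n) := by
  refine Summable.of_norm_bounded (summable_geometric_of_lt_one (norm_nonneg q) hq) fun n => ?_
  rw [norm_pow]
  exact pow_le_pow_of_le_one (norm_nonneg q) hq.le (by nlinarith)

theorem IRep_psi0 : IRep psi0S psi0 :=
  IRep_fiberSeries (fun n => by rw [mem_range]; nlinarith) fun _ hq => summable_psi0 hq

theorem psi_eq {q : ℂ} (hq : ‖q‖ < 1) : psi q = 2 * psi0 q := by
  have h := summable_psi0 hq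
  rw [psi, tsum_of_nat_of_neg_add_one (f := fun n : ℤ => q ^ (n ^ 2 + n).natAbs), two_mul]
  · congr 1 <;> refine tsum_congr fun n => ?_ <;> congr 1
    zify; rw [show (-((n : ℤ) + 1)) ^ 2 + -((n : ℤ) + 1) = n ^ 2 + n by ring, abs_of_nonneg (by positivity)]
  · refine h.congr fun n => ?_
    congr 1
  · refine h.congr fun n => ?_
    congr 1
    zify; rw [show (-((n : ℤ) + 1)) ^ 2 + -((n : ℤ) + 1) = n ^ 2 + n by ring, abs_of_nonneg (by positivity)]

theorem th3_neg_sq {q : ℂ} (hq : ‖q‖ < 1) :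
    th3 (-q) ^ 2 = th3 (q ^ 2) ^ 2 - q * psi (q ^ 2) ^ 2 := by
  have := th3_sq (q := -q) (by simpa using hq)
  rw [neg_sq] at this
  rw [this]; ring

theorem jacobi_identity {q : ℂ} (hq : ‖q‖ < 1) :
    th3 q ^ 4 = th3 (-q) ^ 4 + q * psi q ^ 4 := by
  have h1 := th3_sq hq
  have h2 := th3_neg_sq hq
  have h3 := psi_sq hq
  calc th3 q ^ 4 = (th3 q ^ 2) ^ 2 := by ring
    _ = (th3 (-q) ^ 2) ^ 2 + q * (psi q ^ 2) ^ 2 := by rw [h1, h2, h3]; ring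
    _ = _ := by ring

theorem th3_mul_th3_neg_sq {q : ℂ} (hq : ‖q‖ < 1) :
    th3 q ^ 2 * th3 (-q) ^ 2 = th3 (-q ^ 2) ^ 4 := by
  rw [th3_sq hq, th3_neg_sq hq]
  linear_combination jacobi_identity (sq_norm_lt hq)

theorem tendsto_iterated_sq {q : ℂ} (hq : ‖q‖ < 1) :
    Tendsto (fun n : ℕ => q ^ 2 ^ n) atTop (nhds 0) :=
  (tendsto_pow_atTop_nhds_zero_of_norm_lt_one hq).comp
    (tendsto_pow_atTop_atTop_of_one_lt one_lt_two)

theorem norm_iterated_sq_lt {q : ℂ} (hq : ‖q‖ < 1) (n : ℕ) : ‖q ^ 2 ^ n‖ < 1 := by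
  rw [norm_pow]; exact pow_lt_one₀ (norm_nonneg _) hq (by positivity)

/-- A continuous function on the disc whose zero set is stable under squaring has no zeros,
unless it vanishes at the origin. -/
theorem ne_zero_of_sq_stable {F : ℂ → ℂ} (hc : ContinuousAt F 0) (h0 : F 0 ≠ 0)
    (h : ∀ q : ℂ, ‖q‖ < 1 → F q = 0 → F (q ^ 2) = 0) {q : ℂ} (hq : ‖q‖ < 1) : F q ≠ 0 := by
  intro hz
  have hn : ∀ n : ℕ, F (q ^ 2 ^ n) = 0 := by
    intro n
    induction n with
    | zero => simpa using hz
    | succ n ih =>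
      have := h _ (norm_iterated_sq_lt hq n) ih
      rwa [← pow_mul, ← pow_succ] at this
  have := hc.tendsto.comp (tendsto_iterated_sq hq)
  refine h0 (tendsto_nhds_unique this ?_)
  simp [Function.comp_def, hn]

theorem eq_of_sq_invariant {F : ℂ → ℂ} (hc : ContinuousAt F 0)
    (h : ∀ q : ℂ, ‖q‖ < 1 → F q = F (q ^ 2)) {q : ℂ} (hq : ‖q‖ < 1) : F q = F 0 := by
  have hn : ∀ n : ℕ, F (q ^ 2 ^ n) = F q := by
    intro n
    induction n with
    | zero => simp
    | succ n ih => rw [← ih, h _ (norm_iterated_sq_lt hq n), ← pow_mul, ← pow_succ]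
  have := hc.tendsto.comp (tendsto_iterated_sq hq)
  refine tendsto_nhds_unique ?_ this
  simp [Function.comp_def, hn]

theorem th3_ne_zero {q : ℂ} (hq : ‖q‖ < 1) : th3 q ≠ 0 := by
  have key : ∀ q : ℂ, ‖q‖ < 1 → th3 (-q) ≠ 0 := fun q hq =>
    ne_zero_of_sq_stable (F := fun q => th3 (-q))
      (ContinuousAt.comp (f := fun q : ℂ => -q) (g := th3)
        (by simpa using (IRep_th3.differentiableAt (q := 0) (by simp)).continuousAt)
        continuousAt_id.neg)
      (by simp [th3_zero])
      (fun q hq h => by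
        have := th3_mul_th3_neg_sq hq
        rw [h] at this
        exact pow_eq_zero_iff (four_ne_zero) |>.mp (by rw [← this]; simp)) hq
  simpa using key (-q) (by simpa using hq)

theorem psi_ne_zero {q : ℂ} (hq : ‖q‖ < 1) : psi q ≠ 0 := by
  have hc : ContinuousAt psi 0 := by
    have h := (IRep_psi0.differentiableAt (q := 0) (by simp)).continuousAt
    refine (h.const_mul 2 |>.congr ?_)
    filter_upwards [Metric.ball_mem_nhds (0 : ℂ) one_pos] with q hq
    exact (psi_eq (by simpa using hq)).symm
  refine ne_zero_of_sq_stable hc (by simp [psi_zero]) (fun q hq h => ?_) hq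
  have := psi_sq hq
  rw [h] at this
  have h3 := th3_ne_zero (sq_norm_lt hq)
  simpa [h3] using this

/-- The elliptic lambda function, as a function of the nome. -/
noncomputable def lam (q : ℂ) : ℂ := q * psi q ^ 4 / th3 q ^ 4
/-- One sixteenth of the elliptic lambda function, as a function of the nome. -/
noncomputable def ell (q : ℂ) : ℂ := q * psi0 q ^ 4 / th3 q ^ 4

theorem lam_eq {q : ℂ} (hq : ‖q‖ < 1) : lam q = 16 * ell q := by
  rw [lam, ell, psi_eq hq]; ring

theorem one_sub_lam {q : ℂ} (hq : ‖q‖ < 1) : 1 - lam q = th3 (-q) ^ 4 / th3 q ^ 4 := by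
  have h := th3_ne_zero hq
  rw [lam, eq_div_iff (pow_ne_zero 4 h), sub_mul, div_mul_cancel₀ _ (pow_ne_zero 4 h)]
  linear_combination jacobi_identity hq

theorem lam_ne_one {q : ℂ} (hq : ‖q‖ < 1) : lam q ≠ 1 := by
  have h := th3_ne_zero hq
  have h' := th3_ne_zero (q := -q) (by simpa using hq)
  intro e
  have := one_sub_lam hq
  rw [e, sub_self, eq_comm, div_eq_zero_iff] at this
  simp [h, h'] at this

theorem lam_ne_zero {q : ℂ} (hq : ‖q‖ < 1) (h0 : q ≠ 0) : lam q ≠ 0 :=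
  div_ne_zero (mul_ne_zero h0 (pow_ne_zero 4 (psi_ne_zero hq))) (pow_ne_zero 4 (th3_ne_zero hq))

theorem constantCoeff_th3S : constantCoeff th3S = 1 := by
  have := IRep_th3.eval_zero
  rw [th3_zero] at this
  exact_mod_cast this.symm

theorem constantCoeff_psi0S : constantCoeff psi0S = 1 := by
  have := IRep_psi0.eval_zero
  have h2 := psi_eq (q := 0) (by simp)
  rw [psi_zero, this] at h2
  have : (2 : ℤ) = 2 * constantCoeff psi0S := by exact_mod_cast h2
  omega

/-- The inverse of `th3S`. -/
noncomputable def th3SInv : ℤ⟦X⟧ := invOfUnit th3S 1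
theorem IRep_th3_inv : IRep th3SInv (fun q => (th3 q)⁻¹) :=
  IRep_th3.inv constantCoeff_th3S fun _ => th3_ne_zero

theorem th3S_mul_inv : th3S * th3SInv = 1 := mul_invOfUnit _ _ (by simp [constantCoeff_th3S])

/-- The integral power series of `ell`, divided by the variable. -/
noncomputable def ell0S : ℤ⟦X⟧ := psi0S ^ 4 * th3SInv ^ 4
/-- The integral power series of `ell`. -/
noncomputable def ellS : ℤ⟦X⟧ := X * ell0S

/-- `ell` divided by the nome. -/
noncomputable def ell0 (q : ℂ) : ℂ := psi0 q ^ 4 * (th3 q)⁻¹ ^ 4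

theorem ell_eq (q : ℂ) : ell q = q * ell0 q := by
  rw [ell, ell0, inv_pow, div_eq_mul_inv, mul_assoc]

theorem IRep_ell0 : IRep ell0S ell0 := (IRep_psi0.pow 4).mul (IRep_th3_inv.pow 4)
theorem IRep_ell : IRep ellS ell := (IRep.id.mul IRep_ell0).congr fun q _ => (ell_eq q).symm

theorem constantCoeff_ell0S : constantCoeff ell0S = 1 := by
  have h : constantCoeff th3SInv = 1 := by
    have := congrArg constantCoeff th3S_mul_inv
    simpa [constantCoeff_th3S] using this
  simp [ell0S, constantCoeff_psi0S, h]

theorem ell0_ne_zero {q : ℂ} (hq : ‖q‖ < 1) : ell0 q ≠ 0 := by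
  have h := psi_ne_zero hq
  rw [psi_eq hq] at h
  exact mul_ne_zero (pow_ne_zero 4 (right_ne_zero_of_mul h))
    (pow_ne_zero 4 (inv_ne_zero (th3_ne_zero hq)))

theorem ell0_zero : ell0 0 = 1 := by
  rw [IRep_ell0.eval_zero, constantCoeff_ell0S]; simp

/-- The ratio `θ₂²/θ₃²` at the square of the nome. -/
noncomputable def yq (q : ℂ) : ℂ := q * psi (q ^ 2) ^ 2 / th3 (q ^ 2) ^ 2

theorem th3_sq_eq {q : ℂ} (hq : ‖q‖ < 1) : th3 q ^ 2 = (1 + yq q) * th3 (q ^ 2) ^ 2 := by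
  have h := th3_ne_zero (sq_norm_lt hq)
  rw [th3_sq hq, yq]; field_simp

theorem yq_sq (q : ℂ) : yq q ^ 2 = lam (q ^ 2) := by
  rw [yq, lam, div_pow, mul_pow, ← pow_mul, ← pow_mul]

theorem one_add_yq_ne_zero {q : ℂ} (hq : ‖q‖ < 1) : 1 + yq q ≠ 0 := by
  intro h
  have := th3_sq_eq hq
  rw [h, zero_mul] at this
  exact th3_ne_zero hq (pow_eq_zero_iff two_ne_zero |>.mp this)

theorem lam_eq_yq {q : ℂ} (hq : ‖q‖ < 1) : lam q * (1 + yq q) ^ 2 = 4 * yq q := by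
  have h := th3_ne_zero (sq_norm_lt hq)
  have h' := th3_ne_zero hq
  have h1 : psi q ^ 4 = 4 * psi (q ^ 2) ^ 2 * th3 (q ^ 2) ^ 2 := by
    rw [show psi q ^ 4 = (psi q ^ 2) ^ 2 by ring, psi_sq hq]; ring
  have h2 : th3 q ^ 4 = (1 + yq q) ^ 2 * th3 (q ^ 2) ^ 4 := by
    rw [show th3 q ^ 4 = (th3 q ^ 2) ^ 2 by ring, th3_sq_eq hq]; ring
  have h3 := one_add_yq_ne_zero hq
  rw [lam, h1, h2]
  have : yq q * th3 (q ^ 2) ^ 2 = q * psi (q ^ 2) ^ 2 := by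
    rw [yq, div_mul_cancel₀ _ (pow_ne_zero 2 h)]
  field_simp
  linear_combination -this

/-- The quotient whose constancy is the differential equation of `lam`. -/
noncomputable def lamW (q : ℂ) : ℂ :=
  (ell0 q + q * deriv ell0 q) * (ell0 q * (1 - lam q) * th3 q ^ 4)⁻¹

theorem one_sub_lam_ne_zero {q : ℂ} (hq : ‖q‖ < 1) : 1 - lam q ≠ 0 :=
  sub_ne_zero.mpr (lam_ne_one hq).symm

theorem deriv_ell {q : ℂ} (hq : ‖q‖ < 1) : deriv ell q = ell0 q + q * deriv ell0 q := by
  have h : ell = fun q => q * ell0 q := funext ell_eq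
  rw [h]
  have := (hasDerivAt_id q).mul (IRep_ell0.differentiableAt hq).hasDerivAt
  simpa using HasDerivAt.deriv (f := fun q => q * ell0 q) this

theorem lamW_spec {q : ℂ} (hq : ‖q‖ < 1) :
    q * deriv ell q = lamW q * (ell q * (1 - lam q) * th3 q ^ 4) := by
  have h1 := ell0_ne_zero hq
  have h2 := one_sub_lam_ne_zero hq
  have h3 := th3_ne_zero hq
  rw [deriv_ell hq, lamW, ell_eq]
  field_simp

theorem yq_ne_zero {q : ℂ} (hq : ‖q‖ < 1) (h0 : q ≠ 0) : yq q ≠ 0 :=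
  div_ne_zero (mul_ne_zero h0 (pow_ne_zero 2 (psi_ne_zero (sq_norm_lt hq))))
    (pow_ne_zero 2 (th3_ne_zero (sq_norm_lt hq)))

theorem yq_eq {q : ℂ} (hq : ‖q‖ < 1) :
    yq q = 4 * (q * psi0 (q ^ 2) ^ 2 * (th3 (q ^ 2))⁻¹ ^ 2) := by
  rw [yq, psi_eq (sq_norm_lt hq), inv_pow, div_eq_mul_inv]; ring

theorem differentiableAt_yq {q : ℂ} (hq : ‖q‖ < 1) : DifferentiableAt ℂ yq q := by
  have h2 : DifferentiableAt ℂ (fun q : ℂ => q ^ 2) q := differentiableAt_pow 2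
  have hp : DifferentiableAt ℂ (fun q : ℂ => psi0 (q ^ 2)) q :=
    DifferentiableAt.fun_comp' (g := psi0) q (IRep_psi0.differentiableAt (sq_norm_lt hq)) h2
  have ht : DifferentiableAt ℂ (fun q : ℂ => (th3 (q ^ 2))⁻¹) q :=
    DifferentiableAt.fun_comp' (g := fun q => (th3 q)⁻¹) q
      (IRep_th3_inv.differentiableAt (sq_norm_lt hq)) h2
  have : DifferentiableAt ℂ (fun q => 4 * (q * psi0 (q ^ 2) ^ 2 * (th3 (q ^ 2))⁻¹ ^ 2)) q :=
    ((differentiableAt_id.mul (hp.pow 2)).mul (ht.pow 2)).const_mul 4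
  refine this.congr_of_eventuallyEq ?_
  filter_upwards [(isOpen_lt continuous_norm continuous_const).mem_nhds hq] with z hz
  exact yq_eq hz

theorem lamW_sq {q : ℂ} (hq : ‖q‖ < 1) : lamW q = lamW (q ^ 2) := by
  rcases eq_or_ne q 0 with rfl | h0
  · simp
  have hq2 := sq_norm_lt hq
  set y := yq q with hy
  set y' := deriv yq q with hy'
  have dy := (differentiableAt_yq hq).hasDerivAt
  have de := (IRep_ell.differentiableAt hq).hasDerivAt
  have nhd : ∀ᶠ z : ℂ in nhds q, ‖z‖ < 1 := (isOpen_lt continuous_norm continuous_const).mem_nhds hq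
  have e1 : 2 * y * y' = 16 * (deriv ell (q ^ 2) * (2 * q)) := by
    have a := dy.pow 2
    have b : HasDerivAt (fun z : ℂ => ell (z ^ 2)) (deriv ell (q ^ 2) * (2 * q)) q := by
      have := (IRep_ell.differentiableAt hq2).hasDerivAt.comp q (hasDerivAt_pow 2 q)
      simpa [Function.comp_def] using this
    have b' := b.const_mul 16
    have := (a.congr_of_eventuallyEq (f₁ := fun z => 16 * ell (z ^ 2)) ?_).unique b'
    · simpa using this
    · filter_upwards [nhd] with z hz
      simp only [Pi.pow_apply]
      rw [yq_sq, lam_eq (sq_norm_lt hz)]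
  have e2 : 16 * (deriv ell q * (1 + y) ^ 2 + ell q * (2 * (1 + y) * y')) = 4 * y' := by
    have a := (de.mul ((dy.const_add 1).pow 2)).const_mul 16
    have b := dy.const_mul 4
    have := (b.congr_of_eventuallyEq (f₁ := fun z => 16 * (ell z * (1 + yq z) ^ 2)) ?_).unique
      (a.congr_of_eventuallyEq (f₁ := fun z => 16 * (ell z * (1 + yq z) ^ 2)) ?_)
    · rw [← hy'] at this; rw [this]; simp [← hy]
    · filter_upwards [nhd] with z hz
      rw [← lam_eq_yq hz, lam_eq hz]; ring
    · exact EventuallyEq.of_eq (by ext; simp)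
  have hyl := lam_eq_yq hq
  have hy2 := yq_sq q
  have hy1 := one_add_yq_ne_zero hq
  have hyn := yq_ne_zero hq h0
  have ht := th3_sq_eq hq
  have W1 := lamW_spec hq
  have W2 := lamW_spec hq2
  have l1 := lam_eq hq
  have l2 := lam_eq hq2
  have n2 := one_sub_lam_ne_zero hq
  rw [← hy] at hyl hy2 hy1 hyn ht
  have t4 : th3 q ^ 4 = ((1 + y) * th3 (q ^ 2) ^ 2) ^ 2 := by rw [← ht]; ring
  set g := th3 (q ^ 2) ^ 2 with hg
  have hgn : g ≠ 0 := pow_ne_zero 2 (th3_ne_zero hq2)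
  have t42 : th3 (q ^ 2) ^ 4 = g ^ 2 := by rw [hg]; ring
  rw [t4] at W1
  rw [t42, ← hy2] at W2
  have A : 4 * ell q * (1 + y) ^ 2 = y := by
    linear_combination (1 / 4) * hyl - (1 / 4) * (1 + y) ^ 2 * l1
  have B : (1 - lam q) * (1 + y) ^ 2 = (1 - y) ^ 2 := by linear_combination -hyl
  have hy3 : 1 - y ≠ 0 := by
    intro h
    rw [h, zero_pow two_ne_zero] at B
    exact mul_ne_zero n2 (pow_ne_zero 2 hy1) B
  have qy : q * y' = lamW (q ^ 2) * (y * (1 - y ^ 2) * g ^ 2) := by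
    refine mul_left_cancel₀ hyn ?_
    linear_combination (1 / 2) * q * e1 + 16 * W2 -
      lamW (q ^ 2) * (1 - y ^ 2) * g ^ 2 * (hy2 + l2)
  have qE : 16 * (q * deriv ell q) * (1 + y) ^ 3 = 4 * (q * y') * (1 - y) := by
    linear_combination q * (1 + y) * e2 - 8 * q * y' * A
  refine mul_right_cancel₀ (b := 4 * y * (1 - y) ^ 2 * (1 + y) * g ^ 2)
    (by simp [hyn, hy3, hy1, hgn]) ?_
  rw [qy, W1] at qE
  linear_combination qE - lamW q * 4 * y * (1 + y) * g ^ 2 * B -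
    4 * lamW q * (1 - lam q) * (1 + y) ^ 3 * g ^ 2 * A

theorem IRep_lam : IRep (C 16 * ellS) lam :=
  ((IRep.const 16).mul IRep_ell).congr fun q hq => by rw [lam_eq hq]; norm_num

theorem lamW_eq_one {q : ℂ} (hq : ‖q‖ < 1) : lamW q = 1 := by
  have hc : ContinuousAt lamW 0 := by
    have h0 : ‖(0 : ℂ)‖ < 1 := by simp
    refine ContinuousAt.mul ?_ (ContinuousAt.inv₀ ?_ ?_)
    · exact (IRep_ell0.differentiableAt h0).continuousAt.add
        (continuousAt_id.mul (IRep_ell0.deriv.differentiableAt h0).continuousAt)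
    · exact ((IRep_ell0.differentiableAt h0).continuousAt.mul
        (continuousAt_const.sub (IRep_lam.differentiableAt h0).continuousAt)).mul
        ((IRep_th3.differentiableAt h0).continuousAt.pow 4)
    · exact mul_ne_zero (mul_ne_zero (ell0_ne_zero h0) (one_sub_lam_ne_zero h0))
        (pow_ne_zero 4 (th3_ne_zero h0))
  rw [eq_of_sq_invariant hc (fun q => lamW_sq) hq]
  simp [lamW, ell0_zero, th3_zero, lam]

/-- The differential equation of the lambda function. -/
theorem nome_mul_deriv_ell {q : ℂ} (hq : ‖q‖ < 1) :
    q * deriv ell q = ell q * (1 - lam q) * th3 q ^ 4 := by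
  rw [lamW_spec hq, lamW_eq_one hq, one_mul]

theorem deriv_ell_ne_zero {q : ℂ} (hq : ‖q‖ < 1) : deriv ell q ≠ 0 := by
  rw [deriv_ell hq]
  have h := lamW_eq_one hq
  rw [lamW] at h
  exact left_ne_zero_of_mul (h ▸ one_ne_zero)

end ThetaFunctions

section ModularTransformations
open Complex

/-- The nome `exp (π i τ)`. -/
noncomputable def nome (τ : ℂ) : ℂ := exp (Real.pi * I * τ)

theorem nome_ne_zero (τ : ℂ) : nome τ ≠ 0 := exp_ne_zero _

theorem norm_nome (τ : ℂ) : ‖nome τ‖ = Real.exp (-Real.pi * τ.im) := by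
  rw [nome, norm_exp]; simp

theorem norm_nome_lt {τ : ℂ} (h : 0 < τ.im) : ‖nome τ‖ < 1 := by
  rw [norm_nome, Real.exp_lt_one_iff]
  nlinarith [Real.pi_pos]

theorem nome_add_one (τ : ℂ) : nome (τ + 1) = -nome τ := by
  rw [nome, mul_add, mul_one, exp_add, exp_pi_mul_I, nome]; ring

theorem nome_add_two (τ : ℂ) : nome (τ + 2) = nome τ := by
  rw [show τ + 2 = τ + 1 + 1 by ring, nome_add_one, nome_add_one, neg_neg]

theorem nome_pow (τ : ℂ) (n : ℕ) : nome τ ^ n = nome (n * τ) := by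
  rw [nome, nome, ← exp_nat_mul]; congr 1; ring

theorem differentiable_nome : Differentiable ℂ nome :=
  (differentiable_id.const_mul (Real.pi * I)).cexp

theorem hasDerivAt_nome (τ : ℂ) : HasDerivAt nome (Real.pi * I * nome τ) τ := by
  have := ((hasDerivAt_id' τ).const_mul (Real.pi * I)).cexp
  rw [mul_one, mul_comm (exp _)] at this
  exact this

/-- The square of the theta constant `θ₃`. -/
noncomputable def thc3 (τ : ℂ) : ℂ := th3 (nome τ) ^ 2
/-- The square of the theta constant `θ₄`. -/
noncomputable def thc4 (τ : ℂ) : ℂ := th3 (-nome τ) ^ 2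
/-- The square of the theta constant `θ₂`. -/
noncomputable def thc2 (τ : ℂ) : ℂ := exp (Real.pi * I * τ / 2) * psi (nome τ) ^ 2

theorem th3_nome (τ : ℂ) : th3 (nome τ) = jacobiTheta₂ 0 τ := by
  rw [th3, jacobiTheta₂]
  refine tsum_congr fun n => ?_
  rw [jacobiTheta₂_term, nome, ← exp_nat_mul]
  congr 1
  rw [← Int.cast_natCast (R := ℂ), Int.natAbs_of_nonneg (sq_nonneg n)]
  push_cast; ring

theorem th3_neg_nome (τ : ℂ) : th3 (-nome τ) = jacobiTheta₂ (1 / 2) τ := by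
  rw [← nome_add_one, th3, jacobiTheta₂]
  refine tsum_congr fun n => ?_
  rw [jacobiTheta₂_term, nome, ← exp_nat_mul, ← Int.cast_natCast (R := ℂ),
    Int.natAbs_of_nonneg (sq_nonneg n)]
  obtain ⟨k, hk⟩ := Int.even_mul_succ_self (n - 1)
  rw [exp_eq_exp_iff_exists_int]
  refine ⟨k, ?_⟩
  have hk' : ((n : ℂ) - 1) * (n - 1 + 1) = k + k := by exact_mod_cast hk
  push_cast
  linear_combination (Real.pi * I) * hk'

theorem psi_nome (τ : ℂ) : psi (nome τ) = jacobiTheta₂ (τ / 2) τ := by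
  rw [psi, jacobiTheta₂]
  refine tsum_congr fun n => ?_
  rw [jacobiTheta₂_term, nome, ← exp_nat_mul, ← Int.cast_natCast (R := ℂ),
    Int.natAbs_of_nonneg (sq_add_self_nonneg n)]
  congr 1
  push_cast; ring

theorem cpow_half_sq {z : ℂ} : (z ^ (1 / 2 : ℂ)) ^ 2 = z := by
  rw [← cpow_nat_mul]; norm_num

theorem im_neg_inv_pos {τ : ℂ} (h : 0 < τ.im) : 0 < (-1 / τ).im := by
  have hn : τ ≠ 0 := fun e => by simp [e] at h
  rw [neg_div, one_div, neg_im, inv_im, neg_div, neg_neg]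
  exact div_pos h (normSq_pos.mpr hn)

theorem ne_zero_of_im_pos {τ : ℂ} (h : 0 < τ.im) : τ ≠ 0 := fun e => by simp [e] at h

theorem neg_I_mul_ne_zero {τ : ℂ} (h : 0 < τ.im) : -I * τ ≠ 0 :=
  mul_ne_zero (neg_ne_zero.mpr I_ne_zero) (ne_zero_of_im_pos h)

theorem thc3_S {τ : ℂ} (h : 0 < τ.im) : thc3 (-1 / τ) = -I * τ * thc3 τ := by
  have := jacobiTheta₂_functional_equation 0 τ
  rw [thc3, thc3, th3_nome, th3_nome, this, mul_pow, mul_pow, div_pow, cpow_half_sq]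
  have hn := neg_I_mul_ne_zero h
  simp only [ne_eq, OfNat.ofNat_ne_zero, not_false_eq_true, zero_pow, mul_zero, zero_div, exp_zero,
    one_pow, mul_one, ← mul_assoc]
  rw [mul_one_div_cancel hn, one_mul]

theorem thc4_S {τ : ℂ} (h : 0 < τ.im) : thc4 (-1 / τ) = -I * τ * thc2 τ := by
  have hn := neg_I_mul_ne_zero h
  have hτ := ne_zero_of_im_pos h
  have := jacobiTheta₂_functional_equation (τ / 2) τ
  rw [thc4, thc2, th3_neg_nome, psi_nome, this, mul_pow, mul_pow, div_pow, cpow_half_sq,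
    show τ / 2 / τ = 1 / 2 by field_simp, ← exp_nat_mul,
    show ((2 : ℕ) : ℂ) * (-Real.pi * I * (τ / 2) ^ 2 / τ) = -(Real.pi * I * τ / 2) by
      push_cast; field_simp, one_pow, exp_neg]
  have he := exp_ne_zero (Real.pi * I * τ / 2)
  field_simp

theorem thc2_S {τ : ℂ} (h : 0 < τ.im) : thc2 (-1 / τ) = -I * τ * thc4 τ := by
  have := thc4_S (im_neg_inv_pos h)
  have hτ := ne_zero_of_im_pos h
  rw [show -1 / (-1 / τ) = τ by field_simp] at this
  rw [this]
  field_simp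
  rw [I_sq]; ring

theorem thc3_T (τ : ℂ) : thc3 (τ + 1) = thc4 τ := by rw [thc3, nome_add_one, thc4]

theorem psi_neg (q : ℂ) : psi (-q) = psi q := by
  rw [psi, psi]
  refine tsum_congr fun n => ?_
  have : Even (n ^ 2 + n).natAbs := by
    rw [Int.natAbs_even, sq]
    simpa [mul_add] using Int.even_mul_succ_self n
  exact this.neg_pow q

theorem thc2_T (τ : ℂ) : thc2 (τ + 1) = I * thc2 τ := by
  have h : exp (Real.pi * I / 2) = I := by
    rw [mul_div_right_comm]; exact exp_pi_div_two_mul_I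
  rw [thc2, thc2, nome_add_one, psi_neg, mul_add, add_div, exp_add, mul_one, h]
  ring

theorem thc3_ne_zero {τ : ℂ} (h : 0 < τ.im) : thc3 τ ≠ 0 := pow_ne_zero 2 (th3_ne_zero (norm_nome_lt h))
theorem thc4_ne_zero {τ : ℂ} (h : 0 < τ.im) : thc4 τ ≠ 0 :=
  pow_ne_zero 2 (th3_ne_zero (by simpa using norm_nome_lt h))

theorem lam_nome {τ : ℂ} : lam (nome τ) = thc2 τ ^ 2 / thc3 τ ^ 2 := by
  rw [lam, thc2, thc3, mul_pow, ← exp_nat_mul, nome]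
  congr 1
  · rw [← pow_mul]; congr 2; push_cast; ring
  · ring

theorem one_sub_lam_nome {τ : ℂ} (h : 0 < τ.im) : 1 - lam (nome τ) = thc4 τ ^ 2 / thc3 τ ^ 2 := by
  rw [one_sub_lam (norm_nome_lt h), thc4, thc3, ← pow_mul, ← pow_mul]

theorem lam_S {τ : ℂ} (h : 0 < τ.im) : lam (nome (-1 / τ)) = 1 - lam (nome τ) := by
  rw [one_sub_lam_nome h, lam_nome, thc2_S h, thc3_S h, mul_pow, mul_pow (-I * τ) (thc3 τ),
    mul_div_mul_left _ _ (pow_ne_zero 2 (neg_I_mul_ne_zero h))]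

theorem lam_T {τ : ℂ} (h : 0 < τ.im) :
    lam (nome (τ + 1)) = lam (nome τ) / (lam (nome τ) - 1) := by
  have h3 := thc3_ne_zero h
  have h4 := thc4_ne_zero h
  rw [← neg_sub 1 (lam (nome τ)), one_sub_lam_nome h, lam_nome, lam_nome, thc2_T, thc3_T,
    mul_pow, I_sq]
  field_simp

theorem lam_TS {τ : ℂ} (h : 0 < τ.im) : lam (nome (-1 / τ + 1)) = 1 - 1 / lam (nome τ) := by
  rw [lam_T (im_neg_inv_pos h), lam_S h]
  have := lam_ne_zero (norm_nome_lt h) (nome_ne_zero τ)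
  have e : 1 - lam (nome τ) - 1 = -lam (nome τ) := by ring
  rw [e]
  field_simp
  ring

end ModularTransformations

section IntegralMobius
open Complex

/-- The Möbius action of an integral matrix. -/
noncomputable def mact (M : Matrix (Fin 2) (Fin 2) ℤ) (τ : ℂ) : ℂ :=
  (M 0 0 * τ + M 0 1) / (M 1 0 * τ + M 1 1)
/-- The denominator of the Möbius action of an integral matrix. -/
def mden (M : Matrix (Fin 2) (Fin 2) ℤ) (τ : ℂ) : ℂ := M 1 0 * τ + M 1 1

variable {M N : Matrix (Fin 2) (Fin 2) ℤ} {τ : ℂ}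

theorem mden_ne_zero (hM : M.det ≠ 0) (h : 0 < τ.im) : mden M τ ≠ 0 := by
  intro e
  have him := congrArg im e
  have hre := congrArg re e
  simp [mden] at him hre
  rcases him with hc | hc
  · have hd : M 1 1 = 0 := by simpa [hc] using hre
    rw [Matrix.det_fin_two] at hM
    simp [hc, hd] at hM
  · exact h.ne' hc

theorem mact_im (hM : M.det ≠ 0) (h : 0 < τ.im) :
    (mact M τ).im = M.det * τ.im / normSq (mden M τ) := by
  have hn := normSq_pos.mpr (mden_ne_zero hM h)
  rw [mact, div_im, ← mden, Matrix.det_fin_two]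
  simp only [mden, add_re, add_im, mul_re, mul_im, intCast_re, intCast_im]
  field_simp
  push_cast
  ring

theorem mact_im_pos (hM : 0 < M.det) (h : 0 < τ.im) : 0 < (mact M τ).im := by
  rw [mact_im hM.ne' h]
  have hn := normSq_pos.mpr (mden_ne_zero hM.ne' h)
  have : (0 : ℝ) < M.det := by exact_mod_cast hM
  positivity

theorem mden_mul (hN : N.det ≠ 0) (h : 0 < τ.im) :
    mden (M * N) τ = mden M (mact N τ) * mden N τ := by
  have hn := mden_ne_zero hN h
  have e : mact N τ * mden N τ = N 0 0 * τ + N 0 1 := div_mul_cancel₀ _ hn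
  have e' : mden M (mact N τ) * mden N τ = M 1 0 * (mact N τ * mden N τ) + M 1 1 * mden N τ := by
    rw [mden]; ring
  rw [e', e]
  simp only [Matrix.mul_apply, Fin.sum_univ_two, mden]
  push_cast
  ring

theorem mact_mul (hM : 0 < M.det) (hN : 0 < N.det) (h : 0 < τ.im) :
    mact (M * N) τ = mact M (mact N τ) := by
  have hn := mden_ne_zero hN.ne' h
  have hm := mden_ne_zero hM.ne' (mact_im_pos hN h)
  rw [mact, ← mden, mact, ← mden, mden_mul hN.ne' h, mact, ← mden]
  field_simp
  simp only [Matrix.mul_apply, Fin.sum_univ_two, mden]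
  push_cast
  ring

@[simp] theorem mact_one : mact 1 τ = τ := by simp [mact]
@[simp] theorem mden_one : mden 1 τ = 1 := by simp [mden]
theorem mact_neg : mact (-M) τ = mact M τ := by
  simp only [mact, Matrix.neg_apply]
  push_cast
  rw [← neg_div_neg_eq]; congr 1 <;> ring
theorem mden_neg : mden (-M) τ = -mden M τ := by
  simp only [mden, Matrix.neg_apply]; push_cast; ring

/-- Integral matrices of determinant `n` congruent to `diag(1, n)` modulo `4`, up to even
off-diagonal entries. -/
def InM (n : ℤ) (M : Matrix (Fin 2) (Fin 2) ℤ) : Prop :=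
  M.det = n ∧ M 0 0 % 4 = 1 ∧ Even (M 0 1) ∧ Even (M 1 0)

theorem InM.mul {m n : ℤ} (hM : InM m M) (hN : InM n N) : InM (m * n) (M * N) := by
  obtain ⟨h1, h2, ⟨b, hb⟩, ⟨c, hc⟩⟩ := hM
  obtain ⟨g1, g2, ⟨b', hb'⟩, ⟨c', hc'⟩⟩ := hN
  refine ⟨by rw [Matrix.det_mul, h1, g1], ?_, ?_, ?_⟩
  · rw [Matrix.mul_apply, Fin.sum_univ_two, hb, hc', show (b + b) * (c' + c') = 4 * (b * c') by ring,
      Int.add_mul_emod_self_left, Int.mul_emod, h2, g2]; norm_num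
  · rw [Matrix.mul_apply, Fin.sum_univ_two, hb, hb']
    exact ⟨M 0 0 * b' + b * N 1 1, by ring⟩
  · rw [Matrix.mul_apply, Fin.sum_univ_two, hc, hc']
    exact ⟨c * N 0 0 + M 1 1 * c', by ring⟩

theorem InM.one : InM 1 (1 : Matrix (Fin 2) (Fin 2) ℤ) := by simp [InM]

theorem InM.det_pos {n : ℤ} (hn : 0 < n) (hM : InM n M) : 0 < M.det := hM.1 ▸ hn

theorem InM.one_one {n : ℤ} (hM : InM n M) : M 1 1 % 4 = n % 4 := by
  obtain ⟨h1, h2, ⟨b, hb⟩, ⟨c, hc⟩⟩ := hM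
  rw [Matrix.det_fin_two, hb, hc] at h1
  rw [← h1, show M 0 0 * M 1 1 - (b + b) * (c + c) = M 0 0 * M 1 1 + 4 * (-(b * c)) by ring,
    Int.add_mul_emod_self_left, Int.mul_emod, h2]
  simp

/-- The four unipotent generators. -/
def unipGens : Set (Matrix (Fin 2) (Fin 2) ℤ) :=
  {!![1, 2; 0, 1], !![1, -2; 0, 1], !![1, 0; 2, 1], !![1, 0; -2, 1]}

theorem exists_closure_mul_upper (n : ℕ) : ∀ M : Matrix (Fin 2) (Fin 2) ℤ,
    (M 0 0).natAbs + (M 1 0).natAbs ≤ n → M 0 0 % 2 = 1 → M 1 0 % 2 = 0 →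
    ∃ γ ∈ Submonoid.closure unipGens, ∃ U : Matrix (Fin 2) (Fin 2) ℤ, U 1 0 = 0 ∧ M = γ * U := by
  induction n with
  | zero => intro M h h1 h2; omega
  | succ n ih =>
    intro M h h1 h2
    by_cases hc : M 1 0 = 0
    · exact ⟨1, one_mem _, M, hc, by simp⟩
    -- one reduction step by a generator `g` with inverse `g'`
    have step : ∀ g g' : Matrix (Fin 2) (Fin 2) ℤ, g' ∈ unipGens → g' * g = 1 →
        ((g * M) 0 0).natAbs + ((g * M) 1 0).natAbs ≤ n → (g * M) 0 0 % 2 = 1 →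
        (g * M) 1 0 % 2 = 0 →
        ∃ γ ∈ Submonoid.closure unipGens, ∃ U : Matrix (Fin 2) (Fin 2) ℤ,
          U 1 0 = 0 ∧ M = γ * U := by
      intro g g' hg' hgg h3 h4 h5
      obtain ⟨γ, hγ, U, hU, e⟩ := ih (g * M) h3 h4 h5
      refine ⟨g' * γ, mul_mem (Submonoid.subset_closure hg') hγ, U, hU, ?_⟩
      rw [mul_assoc, ← e, ← mul_assoc, hgg, one_mul]
    have hA : (!![1, 2; 0, 1] : Matrix (Fin 2) (Fin 2) ℤ) * !![1, -2; 0, 1] = 1 := by decide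
    have hA' : (!![1, -2; 0, 1] : Matrix (Fin 2) (Fin 2) ℤ) * !![1, 2; 0, 1] = 1 := by decide
    have hB : (!![1, 0; 2, 1] : Matrix (Fin 2) (Fin 2) ℤ) * !![1, 0; -2, 1] = 1 := by decide
    have hB' : (!![1, 0; -2, 1] : Matrix (Fin 2) (Fin 2) ℤ) * !![1, 0; 2, 1] = 1 := by decide
    have e1 : ((!![1, 2; 0, 1] : Matrix (Fin 2) (Fin 2) ℤ) * M) 0 0 = M 0 0 + 2 * M 1 0 ∧
        ((!![1, 2; 0, 1] : Matrix (Fin 2) (Fin 2) ℤ) * M) 1 0 = M 1 0 := by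
      constructor <;> simp [Matrix.mul_apply] <;> ring
    have e2 : ((!![1, -2; 0, 1] : Matrix (Fin 2) (Fin 2) ℤ) * M) 0 0 = M 0 0 - 2 * M 1 0 ∧
        ((!![1, -2; 0, 1] : Matrix (Fin 2) (Fin 2) ℤ) * M) 1 0 = M 1 0 := by
      constructor <;> simp [Matrix.mul_apply] <;> ring
    have e3 : ((!![1, 0; 2, 1] : Matrix (Fin 2) (Fin 2) ℤ) * M) 0 0 = M 0 0 ∧
        ((!![1, 0; 2, 1] : Matrix (Fin 2) (Fin 2) ℤ) * M) 1 0 = M 1 0 + 2 * M 0 0 := by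
      constructor <;> simp [Matrix.mul_apply] <;> ring
    have e4 : ((!![1, 0; -2, 1] : Matrix (Fin 2) (Fin 2) ℤ) * M) 0 0 = M 0 0 ∧
        ((!![1, 0; -2, 1] : Matrix (Fin 2) (Fin 2) ℤ) * M) 1 0 = M 1 0 - 2 * M 0 0 := by
      constructor <;> simp [Matrix.mul_apply] <;> ring
    rcases le_or_gt (M 0 0).natAbs (M 1 0).natAbs with hac | hac
    · by_cases hs : (M 1 0 - 2 * M 0 0).natAbs < (M 1 0).natAbs
      · exact step _ _ (by simp [unipGens]) hB (by rw [e4.1, e4.2]; omega)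
          (by rw [e4.1]; omega) (by rw [e4.2]; omega)
      · exact step _ _ (by simp [unipGens]) hB' (by rw [e3.1, e3.2]; omega)
          (by rw [e3.1]; omega) (by rw [e3.2]; omega)
    · by_cases hs : (M 0 0 - 2 * M 1 0).natAbs < (M 0 0).natAbs
      · exact step _ _ (by simp [unipGens]) hA (by rw [e2.1, e2.2]; omega)
          (by rw [e2.1]; omega) (by rw [e2.2]; omega)
      · exact step _ _ (by simp [unipGens]) hA' (by rw [e1.1, e1.2]; omega)
          (by rw [e1.1]; omega) (by rw [e1.2]; omega)

theorem InM.of_mem_unipGens (h : M ∈ unipGens) : InM 1 M := by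
  rcases h with rfl | rfl | rfl | rfl <;> simp [InM, Matrix.det_fin_two] <;> decide

theorem InM.of_mem_closure (h : M ∈ Submonoid.closure unipGens) : InM 1 M := by
  induction h using Submonoid.closure_induction with
  | mem x hx => exact .of_mem_unipGens hx
  | one => exact .one
  | mul x y _ _ hx hy => simpa using hx.mul hy

/-- The adjugate, i.e. the inverse up to the determinant. -/
theorem InM.adjugate (h : InM 1 M) : InM 1 M.adjugate := by
  have := h.one_one
  obtain ⟨h1, h2, ⟨b, hb⟩, ⟨c, hc⟩⟩ := h
  refine ⟨by rw [Matrix.det_adjugate, h1]; simp, ?_, ?_, ?_⟩ <;> rw [Matrix.adjugate_fin_two]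
  · simpa using this
  · exact ⟨-b, by simp [hb]⟩
  · exact ⟨-c, by simp [hc]⟩

theorem InM.adjugate_mul (h : InM 1 M) : M.adjugate * M = 1 := by
  rw [Matrix.adjugate_mul, h.1, one_smul]

theorem InM.mul_adjugate (h : InM 1 M) : M * M.adjugate = 1 := by
  rw [Matrix.mul_adjugate, h.1, one_smul]

theorem shear_mem_closure (k : ℤ) : !![1, 2 * k; 0, 1] ∈ Submonoid.closure unipGens := by
  induction k using Int.induction_on with
  | zero =>
    have : (!![1, 2 * 0; 0, 1] : Matrix (Fin 2) (Fin 2) ℤ) = 1 := by decide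
    rw [this]; exact one_mem _
  | succ i ih =>
    have : (!![1, 2 * (i + 1 : ℤ); 0, 1] : Matrix (Fin 2) (Fin 2) ℤ) =
        !![1, 2 * (i : ℤ); 0, 1] * !![1, 2; 0, 1] := by
      ext a b; fin_cases a <;> fin_cases b <;> simp [Matrix.mul_apply]; ring
    rw [this]; exact mul_mem ih (Submonoid.subset_closure (by simp [unipGens]))
  | pred i ih =>
    have : (!![1, 2 * (-i - 1 : ℤ); 0, 1] : Matrix (Fin 2) (Fin 2) ℤ) =
        !![1, 2 * (-i : ℤ); 0, 1] * !![1, -2; 0, 1] := by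
      ext a b; fin_cases a <;> fin_cases b <;> simp [Matrix.mul_apply]; ring
    rw [this]; exact mul_mem ih (Submonoid.subset_closure (by simp [unipGens]))

/-- The group of integral matrices of determinant one under consideration is generated by
the four unipotent matrices. -/
theorem InM.mem_closure (h : InM 1 M) : M ∈ Submonoid.closure unipGens := by
  obtain ⟨γ, hγ, U, hU, e⟩ := exists_closure_mul_upper _ M le_rfl (by have := h.2.1; omega)
    (by obtain ⟨c, hc⟩ := h.2.2.2; omega)
  have hg := InM.of_mem_closure hγ
  have hUM : U = γ.adjugate * M := by rw [e, ← mul_assoc, hg.adjugate_mul, one_mul]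
  have hUin : InM 1 U := by rw [hUM]; simpa using hg.adjugate.mul h
  have hd := hUin.1
  have h11 := hUin.one_one
  obtain ⟨k, hk⟩ := hUin.2.2.1
  rw [Matrix.det_fin_two, hU, mul_zero, sub_zero] at hd
  have h00 := hUin.2.1
  have h0 : U 0 0 = 1 := by
    rcases Int.eq_one_or_neg_one_of_mul_eq_one hd with h | h <;> omega
  have h1 : U 1 1 = 1 := by rwa [h0, one_mul] at hd
  have : U = !![1, 2 * k; 0, 1] := by
    ext a b; fin_cases a <;> fin_cases b <;> simp [h0, h1, hU, hk]; ring
  rw [e, this]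
  exact mul_mem hγ (shear_mem_closure k)

end IntegralMobius

section Invariance
open Complex

variable {M N : Matrix (Fin 2) (Fin 2) ℤ} {τ : ℂ}

theorem thc3_add_two (τ : ℂ) : thc3 (τ + 2) = thc3 τ := by rw [thc3, nome_add_two, thc3]
theorem thc3_sub_two (τ : ℂ) : thc3 (τ - 2) = thc3 τ := by
  rw [← thc3_add_two (τ - 2), sub_add_cancel]
theorem nome_sub_two (τ : ℂ) : nome (τ - 2) = nome τ := by
  rw [← nome_add_two (τ - 2), sub_add_cancel]

theorem thc3_lower {t : ℂ} (ht : ∀ z, thc3 (z - t) = thc3 z) (him : t.im = 0) (h : 0 < τ.im)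
    (hn : t * τ + 1 ≠ 0) : thc3 (τ / (t * τ + 1)) = (t * τ + 1) * thc3 τ := by
  have hτ := ne_zero_of_im_pos h
  have h1 : 0 < (-1 / τ - t).im := by rw [sub_im, him, sub_zero]; exact im_neg_inv_pos h
  have := thc3_S h1
  rw [ht, thc3_S h] at this
  rw [show τ / (t * τ + 1) = -1 / (-1 / τ - t) by
    rw [show -1 / τ - t = -(t * τ + 1) / τ by field_simp; ring]
    field_simp, this]
  field_simp
  rw [I_sq]; ring

theorem lam_lower {t : ℂ} (ht : ∀ z, nome (z - t) = nome z) (him : t.im = 0) (h : 0 < τ.im)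
    (hn : t * τ + 1 ≠ 0) : lam (nome (τ / (t * τ + 1))) = lam (nome τ) := by
  have hτ := ne_zero_of_im_pos h
  have h1 : 0 < (-1 / τ - t).im := by rw [sub_im, him, sub_zero]; exact im_neg_inv_pos h
  have := lam_S h1
  rw [ht, lam_S h, sub_sub_cancel] at this
  rw [show τ / (t * τ + 1) = -1 / (-1 / τ - t) by
    rw [show -1 / τ - t = -(t * τ + 1) / τ by field_simp; ring]
    field_simp, this]

theorem invariance_of_mem_unipGens (hM : M ∈ unipGens) (h : 0 < τ.im) :
    thc3 (mact M τ) = mden M τ * thc3 τ ∧ lam (nome (mact M τ)) = lam (nome τ) := by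
  have hd := mden_ne_zero (M := M) (by rw [(InM.of_mem_unipGens hM).1]; exact one_ne_zero) h
  rcases hM with rfl | rfl | rfl | rfl
  · simp [mact, mden, thc3_add_two, nome_add_two]
  · simp [mact, mden, ← sub_eq_add_neg, thc3_sub_two, nome_sub_two]
  · simp only [mden, Matrix.of_apply, Matrix.cons_val', Matrix.cons_val_zero, Matrix.cons_val_one,
      Matrix.cons_val_fin_one, mact] at hd ⊢
    push_cast at hd ⊢
    rw [one_mul, add_zero]
    exact ⟨thc3_lower thc3_sub_two (by simp) h hd, lam_lower nome_sub_two (by simp) h hd⟩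
  · simp only [mden, Matrix.of_apply, Matrix.cons_val', Matrix.cons_val_zero, Matrix.cons_val_one,
      Matrix.cons_val_fin_one, mact] at hd ⊢
    push_cast at hd ⊢
    rw [one_mul, add_zero]
    exact ⟨thc3_lower (fun z => by rw [sub_neg_eq_add, thc3_add_two]) (by simp) h hd,
      lam_lower (fun z => by rw [sub_neg_eq_add, nome_add_two]) (by simp) h hd⟩

theorem InM.invariance (hM : InM 1 M) : ∀ {τ : ℂ}, 0 < τ.im →
    thc3 (mact M τ) = mden M τ * thc3 τ ∧ lam (nome (mact M τ)) = lam (nome τ) := by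
  have := hM.mem_closure
  clear hM
  induction this using Submonoid.closure_induction with
  | mem x hx => exact fun h => invariance_of_mem_unipGens hx h
  | one => simp
  | mul x y hx hy ihx ihy =>
    intro τ h
    have px := (InM.of_mem_closure hx).det_pos one_pos
    have py := (InM.of_mem_closure hy).det_pos one_pos
    rw [mact_mul px py h, mden_mul py.ne' h]
    have h' := mact_im_pos py h
    exact ⟨by rw [(ihx h').1, (ihy h).1, mul_assoc], by rw [(ihx h').2, (ihy h).2]⟩

theorem InM.thc3_mact (hM : InM 1 M) (h : 0 < τ.im) : thc3 (mact M τ) = mden M τ * thc3 τ :=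
  (hM.invariance h).1
theorem InM.lam_mact (hM : InM 1 M) (h : 0 < τ.im) : lam (nome (mact M τ)) = lam (nome τ) :=
  (hM.invariance h).2

theorem neg_det : (-M).det = M.det := by simp [Matrix.det_neg]

/-- The principal congruence condition modulo two, in determinant `n`. -/
def InP (n : ℤ) (M : Matrix (Fin 2) (Fin 2) ℤ) : Prop :=
  M.det = n ∧ M 0 0 % 2 = 1 ∧ Even (M 0 1) ∧ Even (M 1 0)

theorem InP.cases {n : ℤ} (hM : InP n M) : InM n M ∨ InM n (-M) := by
  obtain ⟨h1, h2, h3, h4⟩ := hM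
  rcases (by omega : M 0 0 % 4 = 1 ∨ M 0 0 % 4 = 3) with h | h
  · exact Or.inl ⟨h1, h, h3, h4⟩
  · refine Or.inr ⟨by rw [neg_det, h1], ?_, by simpa using h3, by simpa using h4⟩
    rw [Matrix.neg_apply]; omega

theorem InM.inP {n : ℤ} (hM : InM n M) : InP n M := ⟨hM.1, by have := hM.2.1; omega, hM.2.2⟩

theorem InP.neg {n : ℤ} (hM : InP n M) : InP n (-M) := by
  obtain ⟨h1, h2, h3, h4⟩ := hM
  exact ⟨by rw [neg_det, h1], by rw [Matrix.neg_apply]; omega, by simpa using h3, by simpa using h4⟩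

theorem InP.mul {m n : ℤ} (hM : InP m M) (hN : InP n N) : InP (m * n) (M * N) := by
  rcases hM.cases with h | h <;> rcases hN.cases with h' | h'
  · exact (h.mul h').inP
  · have := (h.mul h').inP.neg; simpa using this
  · have := (h.mul h').inP.neg; simpa using this
  · have := (h.mul h').inP; simpa using this

theorem InP.lam_mact (hM : InP 1 M) (h : 0 < τ.im) : lam (nome (mact M τ)) = lam (nome τ) := by
  rcases hM.cases with h' | h'
  · exact h'.lam_mact h
  · rw [← mact_neg]; exact h'.lam_mact h

theorem InP.adjugate (h : InP 1 M) : InP 1 M.adjugate := by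
  rcases h.cases with h' | h'
  · exact h'.adjugate.inP
  · have := h'.adjugate.inP.neg
    convert this using 1
    rw [Matrix.adjugate_fin_two, Matrix.adjugate_fin_two]
    ext a b; fin_cases a <;> fin_cases b <;> simp

/-- Conjugation by a matrix of determinant one preserves the congruence condition. -/
theorem InP.conj {n : ℤ} (hM : InP n M) (hN : N.det = 1) (hn : n % 2 = 1) :
    InP n (N.adjugate * M * N) := by
  obtain ⟨h1, h2, ⟨b, hb⟩, ⟨c, hc⟩⟩ := hM
  rw [Matrix.det_fin_two] at h1
  have hd : M 1 1 % 2 = 1 := by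
    rcases Int.emod_two_eq_zero_or_one (M 1 1) with h | h
    · exfalso
      have : n % 2 = 0 := by
        rw [← h1, hb, hc, Int.sub_emod, Int.mul_emod, h, mul_zero, show (b+b)*(c+c) = 2*(2*b*c) by ring]
        simp
      omega
    · exact h
  obtain ⟨a', ha⟩ : ∃ a', M 0 0 = 1 + 2 * a' := ⟨M 0 0 / 2, by omega⟩
  obtain ⟨d', hd'⟩ : ∃ a', M 1 1 = 1 + 2 * a' := ⟨M 1 1 / 2, by omega⟩
  refine ⟨?_, ?_, ?_, ?_⟩
  · rw [Matrix.det_mul, Matrix.det_mul, Matrix.det_adjugate, hN, Matrix.det_fin_two, h1]; simp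
  all_goals
    rw [Matrix.det_fin_two] at hN
    rw [Matrix.adjugate_fin_two]
    simp only [Matrix.mul_apply, Fin.sum_univ_two, Matrix.of_apply, Matrix.cons_val', Matrix.cons_val_zero,
      Matrix.cons_val_one, Matrix.cons_val_fin_one, ha, hb, hc, hd']
  · rw [show (N 1 1 * (1 + 2 * a') + -N 0 1 * (c + c)) * N 0 0 + (N 1 1 * (b + b) + -N 0 1 * (1 + 2 * d')) * N 1 0
      = (N 0 0 * N 1 1 - N 0 1 * N 1 0) +
        2 * (N 0 0 * N 1 1 * a' - N 0 0 * N 0 1 * c + N 1 1 * N 1 0 * b - N 0 1 * N 1 0 * d') by ring, hN]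
    omega
  · exact ⟨N 1 1 * N 0 1 * a' - N 0 1 * N 0 1 * c + N 1 1 * N 1 1 * b - N 0 1 * N 1 1 * d', by ring⟩
  · exact ⟨-N 1 0 * N 0 0 * a' + N 0 0 * N 0 0 * c - N 1 0 * N 1 0 * b + N 0 0 * N 1 0 * d', by ring⟩

/-- The sign `±1` congruent to `p` modulo `4`. -/
def sgn4 (p : ℕ) : ℤ := if p % 4 = 1 then 1 else -1

/-- Representatives of the integral matrices of determinant `p`. -/
def heckeRep (p : ℕ) : Option (Fin p) → Matrix (Fin 2) (Fin 2) ℤ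
  | none => sgn4 p • !![(p : ℤ), 0; 0, 1]
  | some j => !![1, 2 * (j : ℤ); 0, (p : ℤ)]

theorem sgn4_sq (p : ℕ) : sgn4 p * sgn4 p = 1 := by
  rw [sgn4]; split_ifs <;> norm_num

theorem sgn4_mul_emod {p : ℕ} (hp : p % 2 = 1) : (sgn4 p * p) % 4 = 1 := by
  rw [sgn4]; split_ifs <;> omega

theorem heckeRep_inM {p : ℕ} (hp : p % 2 = 1) (i : Option (Fin p)) : InM p (heckeRep p i) := by
  rcases i with _ | j
  · refine ⟨?_, ?_, ?_, ?_⟩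
    · rw [Matrix.det_fin_two]; simp [heckeRep]
      rw [mul_right_comm, sgn4_sq, one_mul]
    · simpa [heckeRep] using sgn4_mul_emod hp
    · simp [heckeRep]
    · simp [heckeRep]
  · refine ⟨?_, ?_, ?_, ?_⟩
    · rw [Matrix.det_fin_two]; simp [heckeRep]
    · simp [heckeRep]
    · simp [heckeRep]
    · simp [heckeRep]

theorem InM.exists_heckeRep {p : ℕ} (hp : p.Prime) (hp2 : p % 2 = 1) (hM : InM p M) :
    ∃ γ, InM 1 γ ∧ ∃ i, M = γ * heckeRep p i := by
  obtain ⟨γ, hγ, U, hU, e⟩ := exists_closure_mul_upper _ M le_rfl (by have := hM.2.1; omega)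
    (by obtain ⟨c, hc⟩ := hM.2.2.2; omega)
  have hg := InM.of_mem_closure hγ
  have hUM : U = γ.adjugate * M := by rw [e, ← mul_assoc, hg.adjugate_mul, one_mul]
  have hUin : InM p U := by rw [hUM]; simpa using hg.adjugate.mul hM
  have hd := hUin.1
  obtain ⟨k, hk⟩ := hUin.2.2.1
  rw [Matrix.det_fin_two, hU, mul_zero, sub_zero] at hd
  have h00 := hUin.2.1
  suffices H : ∃ δ, InM 1 δ ∧ ∃ i, U = δ * heckeRep p i by
    obtain ⟨δ, hδ, i, hi⟩ := H
    exact ⟨γ * δ, by simpa using hg.mul hδ, i, by rw [e, hi, mul_assoc]⟩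
  have hdvd : (U 0 0).natAbs ∣ p := by
    have : U 0 0 ∣ (p : ℤ) := ⟨_, hd.symm⟩
    simpa using Int.natAbs_dvd_natAbs.mpr this
  have hp0 : (p : ℤ) ≠ 0 := by exact_mod_cast hp.ne_zero
  rcases (Nat.dvd_prime hp).mp hdvd with h1 | h1
  · have h0 : U 0 0 = 1 := by omega
    have h11 : U 1 1 = p := by rw [← hd, h0, one_mul]
    have hpos : 0 < (p : ℤ) := by have := hp.pos; omega
    have hlt : (k % p).toNat < p := by
      have := Int.emod_lt_of_pos k hpos
      have := Int.emod_nonneg k hp0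
      omega
    refine ⟨!![1, 2 * (k / p); 0, 1], InM.of_mem_closure (shear_mem_closure _),
      some ⟨(k % p).toNat, hlt⟩, ?_⟩
    have hk' : (((k % p).toNat : ℕ) : ℤ) = k % p := Int.toNat_of_nonneg (Int.emod_nonneg k hp0)
    have hdm := Int.emod_add_mul_ediv k p
    ext a b; fin_cases a <;> fin_cases b <;> simp [heckeRep, Matrix.mul_apply, h0, hU, h11, hk, hk']
    linear_combination -2 * hdm
  · have h0 : U 0 0 = sgn4 p * p := by
      have := sgn4_mul_emod hp2
      rw [sgn4] at this ⊢
      split_ifs at this ⊢ <;> omega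
    have h11 : U 1 1 = sgn4 p := by
      rw [h0] at hd
      have := sgn4_sq p
      refine mul_left_cancel₀ hp0 ?_
      linear_combination sgn4 p * hd - p * U 1 1 * this
    refine ⟨!![1, 2 * (k * sgn4 p); 0, 1], InM.of_mem_closure (shear_mem_closure _), none, ?_⟩
    have := sgn4_sq p
    ext a b; fin_cases a <;> fin_cases b <;> simp [heckeRep, Matrix.mul_apply, h0, hU, h11, hk]
    linear_combination -2 * k * this

theorem heckeRep_unique {p : ℕ} (hp : 1 < p) {γ : Matrix (Fin 2) (Fin 2) ℤ} (hγ : InM 1 γ)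
    {i j : Option (Fin p)} (h : heckeRep p i = γ * heckeRep p j) : i = j := by
  have e : ∀ a b, heckeRep p i a b = (γ * heckeRep p j) a b := fun a b => by rw [h]
  have e00 := e 0 0
  have e01 := e 0 1
  have e10 := e 1 0
  have e11 := e 1 1
  have hg := hγ.2.1
  obtain ⟨b, hb⟩ := hγ.2.2.1
  have hs := sgn4_sq p
  have hp' : (1 : ℤ) < p := by exact_mod_cast hp
  rcases i with _ | i <;> rcases j with _ | j <;>
    simp [heckeRep, Matrix.mul_apply] at e00 e01 e10 e11 ⊢
  · rw [← e10, zero_mul, zero_add] at e11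
    have : (p : ℤ) ∣ 1 := ⟨sgn4 p * γ 1 1, by linear_combination -hs + sgn4 p * e11⟩
    have := Int.le_of_dvd one_pos this
    omega
  · have h1 : γ 0 0 * (sgn4 p * p) = 1 := by linarith
    have : (p : ℤ) ∣ 1 := ⟨γ 0 0 * sgn4 p, by linarith⟩
    have := Int.le_of_dvd one_pos this
    omega
  · rw [← e00, hb] at e01
    have hi := i.isLt
    have hj := j.isLt
    ext
    have h3 : (i : ℤ) - j = b * p := by linarith
    have h4 : b = 0 := by
      by_contra hne
      rcases lt_or_gt_of_ne hne with h | h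
      · have : b ≤ -1 := by omega
        nlinarith
      · have : 1 ≤ b := by omega
        nlinarith
    rw [h4, zero_mul] at h3
    omega

theorem exists_perm_heckeRep {p : ℕ} (hp : p.Prime) (hp2 : p % 2 = 1)
    (A : Option (Fin p) → Matrix (Fin 2) (Fin 2) ℤ) (hA : ∀ i, InM p (A i))
    (hinj : ∀ i j γ, InM 1 γ → A i = γ * A j → ∃ γ', InM 1 γ' ∧ heckeRep p i = γ' * heckeRep p j) :
    ∃ σ : Equiv.Perm (Option (Fin p)), ∀ i, ∃ γ, InM 1 γ ∧ A i = γ * heckeRep p (σ i) := by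
  choose γ hγ σ hσ using fun i => (hA i).exists_heckeRep hp hp2
  have inj : Function.Injective σ := by
    intro i j hij
    have : A i = (γ i * (γ j).adjugate) * A j := by
      rw [hσ j, mul_assoc, ← mul_assoc _ (γ j), (hγ j).adjugate_mul, one_mul, hσ i, hij]
    obtain ⟨γ', h', e⟩ := hinj i j _ (by simpa using (hγ i).mul (hγ j).adjugate) this
    exact heckeRep_unique hp.one_lt h' e
  exact ⟨Equiv.ofBijective σ (Finite.injective_iff_bijective.mp inj), fun i => ⟨γ i, hγ i, hσ i⟩⟩

/-- Right multiplication permutes the cosets. -/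
theorem exists_perm_mul {p : ℕ} (hp : p.Prime) (hp2 : p % 2 = 1) (hM : InM 1 M) :
    ∃ σ : Equiv.Perm (Option (Fin p)), ∀ i, ∃ γ, InM 1 γ ∧
      heckeRep p i * M = γ * heckeRep p (σ i) := by
  refine exists_perm_heckeRep hp hp2 _ (fun i => by simpa using (heckeRep_inM hp2 i).mul hM) ?_
  intro i j γ hγ e
  refine ⟨γ, hγ, ?_⟩
  have := congrArg (· * M.adjugate) e
  simpa [mul_assoc, hM.mul_adjugate] using this

/-- Conjugation by a matrix of determinant one permutes the cosets, up to sign. -/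
theorem exists_perm_conj {p : ℕ} (hp : p.Prime) (hp2 : p % 2 = 1) (hM : M.det = 1) :
    ∃ σ : Equiv.Perm (Option (Fin p)), ∀ i, ∃ γ, InM 1 γ ∧
      (heckeRep p i * M = M * (γ * heckeRep p (σ i)) ∨
        heckeRep p i * M = -(M * (γ * heckeRep p (σ i)))) := by
  have hMa : M * M.adjugate = 1 := by rw [Matrix.mul_adjugate, hM, one_smul]
  have hMa' : M.adjugate * M = 1 := by rw [Matrix.adjugate_mul, hM, one_smul]
  have key : ∀ i, ∃ s : ℤ, (s = 1 ∨ s = -1) ∧ InM p (s • (M.adjugate * heckeRep p i * M)) := by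
    intro i
    have := (heckeRep_inM hp2 i).inP.conj hM (by omega)
    rcases this.cases with h | h
    · exact ⟨1, Or.inl rfl, by simpa using h⟩
    · exact ⟨-1, Or.inr rfl, by simpa using h⟩
  choose s hs hin using key
  obtain ⟨σ, hσ⟩ := exists_perm_heckeRep hp hp2 _ hin (by
    intro i j γ hγ e
    have hs1 : s i * s i = 1 := by rcases hs i with h | h <;> simp [h]
    have e2 : heckeRep p i = ((s i * s j) • (M * γ * M.adjugate)) * heckeRep p j := by
      have := congrArg (fun N => s i • (M * N * M.adjugate)) e
      simp only [Matrix.mul_smul, Matrix.smul_mul, smul_smul, hs1, one_smul] at this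
      rw [mul_assoc, mul_assoc (M.adjugate * _), hMa, mul_one, ← mul_assoc, hMa, one_mul] at this
      rw [this, Matrix.smul_mul]
      congr 1
      simp only [mul_assoc, hMa, mul_one]
    refine ⟨_, ?_, e2⟩
    have hc := hγ.inP.conj (N := M.adjugate) (by rw [Matrix.det_adjugate, hM]; simp) (by norm_num)
    have haa : M.adjugate.adjugate = M := by
      rw [Matrix.adjugate_fin_two, Matrix.adjugate_fin_two]
      ext a b; fin_cases a <;> fin_cases b <;> simp
    rw [haa] at hc
    have hK : InP 1 ((s i * s j) • (M * γ * M.adjugate)) := by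
      rcases hs i with h | h <;> rcases hs j with h' | h' <;> rw [h, h']
      · simpa using hc
      · simpa using hc.neg
      · simpa using hc.neg
      · simpa using hc
    rcases hK.cases with h | h
    · exact h
    · exfalso
      have h1 := (h.mul (heckeRep_inM hp2 j)).2.1
      rw [neg_mul, ← e2, Matrix.neg_apply] at h1
      have h2 := (heckeRep_inM hp2 i).2.1
      omega)
  refine ⟨σ, fun i => ?_⟩
  obtain ⟨γ, hγ, e⟩ := hσ i
  refine ⟨γ, hγ, ?_⟩
  rw [← e]
  rcases hs i with h | h
  · left; rw [h, one_smul, mul_assoc, ← mul_assoc, hMa, one_mul]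
  · right; rw [h]; simp [← mul_assoc, hMa]

end Invariance

section Cusps
open Complex

variable {M N : Matrix (Fin 2) (Fin 2) ℤ} {τ : ℂ}

/-- Representatives of the three cusps. -/
def cuspMat : Fin 3 → Matrix (Fin 2) (Fin 2) ℤ := ![1, !![0, -1; 1, 0], !![1, -1; 1, 0]]

/-- Representatives of the cosets modulo the principal congruence subgroup of level two. -/
def sixMat : Fin 6 → Matrix (Fin 2) (Fin 2) ℤ :=
  ![1, !![0, -1; 1, 0], !![1, -1; 1, 0], !![1, 1; 0, 1], !![0, -1; 1, 1], !![1, 0; 1, 1]]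

theorem cuspMat_det (k : Fin 3) : (cuspMat k).det = 1 := by
  fin_cases k <;> simp [cuspMat, Matrix.det_fin_two]

theorem sixMat_det (k : Fin 6) : (sixMat k).det = 1 := by
  fin_cases k <;> simp [sixMat, Matrix.det_fin_two]

theorem cuspMat_det_pos (k : Fin 3) : 0 < (cuspMat k).det := by simp [cuspMat_det]

theorem exists_sixMat (hN : N.det = 1) : ∃ k, ∃ γ, InP 1 γ ∧ N = γ * sixMat k := by
  have key : ∃ k, InP 1 (N * (sixMat k).adjugate) := by
    have hd : ∀ k, (N * (sixMat k).adjugate).det = 1 := fun k => by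
      rw [Matrix.det_mul, Matrix.det_adjugate, hN, sixMat_det]; simp
    have h := hN
    rw [Matrix.det_fin_two] at h
    have h2 : (N 0 0 % 2 * (N 1 1 % 2) - N 0 1 % 2 * (N 1 0 % 2)) % 2 = 1 := by
      rw [Int.sub_emod, ← Int.mul_emod, ← Int.mul_emod, ← Int.sub_emod, h]; norm_num
    rcases Int.emod_two_eq_zero_or_one (N 0 0) with ha | ha <;>
    rcases Int.emod_two_eq_zero_or_one (N 0 1) with hb | hb <;>
    rcases Int.emod_two_eq_zero_or_one (N 1 0) with hc | hc <;>
    rcases Int.emod_two_eq_zero_or_one (N 1 1) with hd' | hd' <;>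
    rw [ha, hb, hc, hd'] at h2 <;> norm_num at h2
    · refine ⟨1, hd _, ?_⟩
      simp [sixMat, Matrix.adjugate_fin_two, Matrix.mul_apply, Int.even_iff]; omega
    · refine ⟨4, hd _, ?_⟩
      simp [sixMat, Matrix.adjugate_fin_two, Matrix.mul_apply, Int.even_iff]; omega
    · refine ⟨0, hd _, ?_⟩
      simp [sixMat, Matrix.adjugate_fin_two, Matrix.mul_apply, Int.even_iff]; omega
    · refine ⟨5, hd _, ?_⟩
      simp [sixMat, Matrix.adjugate_fin_two, Matrix.mul_apply, Int.even_iff]; omega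
    · refine ⟨3, hd _, ?_⟩
      simp [sixMat, Matrix.adjugate_fin_two, Matrix.mul_apply, Int.even_iff]; omega
    · refine ⟨2, hd _, ?_⟩
      simp [sixMat, Matrix.adjugate_fin_two, Matrix.mul_apply, Int.even_iff]; omega
  obtain ⟨k, hk⟩ := key
  refine ⟨k, _, hk, ?_⟩
  rw [mul_assoc, Matrix.adjugate_mul, sixMat_det, one_smul, mul_one]

open scoped MatrixGroups in
theorem coe_smul_eq_mact (g : SL(2, ℤ)) (z : UpperHalfPlane) : ((g • z : UpperHalfPlane) : ℂ) =
    mact g.1 z := by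
  rw [UpperHalfPlane.coe_specialLinearGroup_apply]; simp [mact]

/-- Every point is equivalent to one lying above the standard fundamental domain. -/
theorem exists_fd_rep (h : 0 < τ.im) : ∃ w : ℂ, 0 < w.im ∧ 1 ≤ normSq w ∧ |w.re| ≤ 1 / 2 ∧
    ∃ k, ∃ γ, InP 1 γ ∧ τ = mact γ (mact (sixMat k) w) := by
  obtain ⟨g, hg⟩ := ModularGroup.exists_smul_mem_fd ⟨τ, h⟩
  obtain ⟨k, γ, hγ, e⟩ := exists_sixMat (N := (g⁻¹).1) (g⁻¹).2
  refine ⟨_, (g • (⟨τ, h⟩ : UpperHalfPlane)).im_pos, hg.1, hg.2, k, γ, hγ, ?_⟩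
  rw [← mact_mul (by rw [hγ.1]; exact one_pos) (by rw [sixMat_det]; exact one_pos)
    (UpperHalfPlane.im_pos _), ← e, ← coe_smul_eq_mact, inv_smul_smul]

theorem three_quarters_le {w : ℂ} (h1 : 1 ≤ normSq w) (h2 : |w.re| ≤ 1 / 2) :
    3 / 4 ≤ w.im ^ 2 := by
  rw [normSq_apply] at h1
  have := abs_le.mp h2
  nlinarith

theorem exists_cusp_rep (h : 0 < τ.im) : ∃ w : ℂ, 1 / 2 ≤ w.im ∧ |w.re| ≤ 3 / 2 ∧
    ∃ k, ∃ γ, InP 1 γ ∧ τ = mact γ (mact (cuspMat k) w) := by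
  obtain ⟨w, hw, h1, h2, k, γ, hγ, e⟩ := exists_fd_rep h
  have h3 := three_quarters_le h1 h2
  have h4 : 1 / 2 ≤ w.im := by nlinarith
  have h5 := abs_le.mp h2
  have r0 : |w.re| ≤ 3 / 2 := by linarith
  have r1 : |(w + 1).re| ≤ 3 / 2 := by
    rw [abs_le]; simp only [add_re, one_re]; constructor <;> linarith
  have i1 : 1 / 2 ≤ (w + 1).im := by simpa using h4
  fin_cases k
  · exact ⟨w, h4, r0, 0, γ, hγ, e⟩
  · exact ⟨w, h4, r0, 1, γ, hγ, e⟩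
  · exact ⟨w, h4, r0, 2, γ, hγ, e⟩
  · exact ⟨w + 1, i1, r1, 0, γ, hγ, by rw [e]; simp [sixMat, cuspMat, mact]⟩
  · exact ⟨w + 1, i1, r1, 1, γ, hγ, by rw [e]; simp [sixMat, cuspMat, mact]⟩
  · refine ⟨w + 1, i1, r1, 2, γ, hγ, ?_⟩
    rw [e]; simp [sixMat, cuspMat, mact]

/-- A bounded periodic holomorphic function is a holomorphic function of the nome. -/
theorem exists_nome_expansion {f : ℂ → ℂ} (hd : ∀ τ : ℂ, 0 < τ.im → DifferentiableAt ℂ f τ)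
    (hp : ∀ τ : ℂ, 0 < τ.im → f (τ + 2) = f τ) {A B : ℝ}
    (hb : ∀ τ : ℂ, 0 < τ.im → A < τ.im → ‖f τ‖ ≤ B) :
    ∃ F : ℂ → ℂ, DifferentiableOn ℂ F (Metric.ball 0 1) ∧
      ∀ τ : ℂ, 0 < τ.im → f τ = F (nome τ) := by
  set g : ℂ → ℂ := fun τ => if 0 < τ.im then f τ else 0 with hg
  have hgf : ∀ τ : ℂ, 0 < τ.im → g τ = f τ := fun τ h => by simp [hg, h]
  have hper : Function.Periodic g ((2 : ℝ) : ℂ) := by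
    intro τ
    have : (τ + ((2 : ℝ) : ℂ)).im = τ.im := by simp
    by_cases h : 0 < τ.im
    · rw [hgf _ h, hgf _ (by rw [this]; exact h), ← hp τ h]; norm_num
    · simp only [hg]; rw [if_neg h, if_neg (by rw [this]; exact h)]
  have hgd : ∀ τ : ℂ, 0 < τ.im → DifferentiableAt ℂ g τ := fun τ h =>
    (hd τ h).congr_of_eventuallyEq (by
      filter_upwards [(isOpen_lt continuous_const continuous_im).mem_nhds h] with z hz
      exact hgf z hz)
  have hq : ∀ τ : ℂ, Function.Periodic.qParam 2 τ = nome τ := fun τ => by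
    rw [Function.Periodic.qParam, nome]; congr 1; push_cast; ring
  refine ⟨Function.Periodic.cuspFunction 2 g, fun q hq1 => ?_, fun τ h => ?_⟩
  · apply DifferentiableAt.differentiableWithinAt
    rcases eq_or_ne q 0 with rfl | h0
    · refine Function.Periodic.differentiableAt_cuspFunction_zero two_pos hper ?_ ?_
      · filter_upwards [(tendsto_comap.eventually (eventually_gt_atTop (0 : ℝ)) :
          ∀ᶠ z in comap im atTop, 0 < z.im)] with z hz using hgd z hz
      · refine Asymptotics.IsBigO.of_bound B ?_
        filter_upwards [(tendsto_comap.eventually (eventually_gt_atTop (0 : ℝ)) :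
          ∀ᶠ z in comap im atTop, 0 < z.im), (tendsto_comap.eventually (eventually_gt_atTop A) :
          ∀ᶠ z in comap im atTop, A < z.im)] with z hz hz'
        rw [hgf z hz]; simpa using hb z hz hz'
    · have e := Function.Periodic.qParam_right_inv (h := 2) two_ne_zero h0
      have hi : 0 < (Function.Periodic.invQParam 2 q).im := by
        rw [Function.Periodic.im_invQParam]
        have : Real.log ‖q‖ < 0 := Real.log_neg (norm_pos_iff.mpr h0) (by simpa using hq1)
        have hpi := Real.pi_pos
        rw [neg_div, neg_mul, ← mul_neg]
        have : 0 < -Real.log ‖q‖ := by linarith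
        positivity
      have := Function.Periodic.differentiableAt_cuspFunction two_ne_zero hper (hgd _ hi)
      rwa [e] at this
  · rw [← hgf τ h, ← hq]
    exact (Function.Periodic.eq_cuspFunction two_ne_zero hper τ).symm

theorem exists_nome_eq {q : ℂ} (h0 : q ≠ 0) (hq : ‖q‖ < 1) : ∃ τ : ℂ, 0 < τ.im ∧ nome τ = q := by
  refine ⟨log q / (Real.pi * I), ?_, ?_⟩
  · have : (log q / (Real.pi * I)).im = -Real.log ‖q‖ / Real.pi := by
      rw [← div_div, div_I, ← neg_mul, ← neg_div, mul_comm, I_mul_im, neg_div, neg_re, div_ofReal_re,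
        log_re, neg_div]
    rw [this]
    exact div_pos (by linarith [Real.log_neg (norm_pos_iff.mpr h0) hq]) Real.pi_pos
  · rw [nome, mul_div_cancel₀ _ (mul_ne_zero (by exact_mod_cast Real.pi_ne_zero) I_ne_zero),
      exp_log h0]

theorem mact_inv_cancel (hM : M.det = 1) (h : 0 < τ.im) : mact M (mact M.adjugate τ) = τ := by
  have hd : M.adjugate.det = 1 := by rw [Matrix.det_adjugate, hM]; simp
  rw [← mact_mul (by simp [hM]) (by simp [hd]) h, Matrix.mul_adjugate, hM, one_smul, mact_one]

theorem mact_inv_cancel' (hM : M.det = 1) (h : 0 < τ.im) : mact M.adjugate (mact M τ) = τ := by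
  have hd : M.adjugate.det = 1 := by rw [Matrix.det_adjugate, hM]; simp
  rw [← mact_mul (by simp [hd]) (by simp [hM]) h, Matrix.adjugate_mul, hM, one_smul, mact_one]

/-- Invariance passes to translates by matrices of determinant one. -/
theorem invariant_comp_mact {g : ℂ → ℂ}
    (hinv : ∀ γ, InP 1 γ → ∀ τ : ℂ, 0 < τ.im → g (mact γ τ) = g τ) (hM : M.det = 1) :
    ∀ γ, InP 1 γ → ∀ τ : ℂ, 0 < τ.im → g (mact M (mact γ τ)) = g (mact M τ) := by
  intro γ hγ τ h
  have hd : M.adjugate.det = 1 := by rw [Matrix.det_adjugate, hM]; simp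
  have haa : M.adjugate.adjugate = M := by
    rw [Matrix.adjugate_fin_two, Matrix.adjugate_fin_two]
    ext a b; fin_cases a <;> fin_cases b <;> simp
  have hc := hγ.conj hd (by norm_num)
  rw [haa] at hc
  have hp : 0 < M.det := by simp [hM]
  rw [← hinv _ hc _ (mact_im_pos hp h), ← mact_mul (by rw [hc.1]; exact one_pos) hp h,
    mul_assoc, Matrix.adjugate_mul, hM, one_smul, mul_one,
    mact_mul hp (by rw [hγ.1]; exact one_pos) h]

theorem differentiableAt_mact (hM : M.det ≠ 0) (h : 0 < τ.im) : DifferentiableAt ℂ (mact M) τ :=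
  ((differentiableAt_id.const_mul _).add_const _).div
    ((differentiableAt_id.const_mul _).add_const _) (mden_ne_zero hM h)

theorem mact_shear (k : ℤ) : mact !![1, 2 * k; 0, 1] τ = τ + 2 * k := by simp [mact]

theorem InP.shear (k : ℤ) : InP 1 !![1, 2 * k; 0, 1] := by
  simp [InP, Matrix.det_fin_two]

/-- An invariant function is a function of the nome at every cusp where it is bounded. -/
theorem exists_cusp_expansion {g : ℂ → ℂ} (hd : ∀ τ : ℂ, 0 < τ.im → DifferentiableAt ℂ g τ)
    (hinv : ∀ γ, InP 1 γ → ∀ τ : ℂ, 0 < τ.im → g (mact γ τ) = g τ) (hM : M.det = 1) {A B : ℝ}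
    (hb : ∀ τ : ℂ, 0 < τ.im → A < τ.im → ‖g (mact M τ)‖ ≤ B) :
    ∃ F : ℂ → ℂ, DifferentiableOn ℂ F (Metric.ball 0 1) ∧
      ∀ τ : ℂ, 0 < τ.im → g (mact M τ) = F (nome τ) := by
  refine exists_nome_expansion (f := fun τ => g (mact M τ)) (fun τ h => ?_) (fun τ h => ?_) hb
  · exact DifferentiableAt.fun_comp' (g := g) τ (hd _ (mact_im_pos (by simp [hM]) h))
      (differentiableAt_mact (by simp [hM]) h)
  · have := invariant_comp_mact hinv hM _ (InP.shear 1) τ h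
    rw [mact_shear] at this
    simpa using this

/-- An invariant holomorphic function bounded at all cusps is constant. -/
theorem const_of_bounded_at_cusps {g : ℂ → ℂ}
    (hd : ∀ τ : ℂ, 0 < τ.im → DifferentiableAt ℂ g τ)
    (hinv : ∀ γ, InP 1 γ → ∀ τ : ℂ, 0 < τ.im → g (mact γ τ) = g τ)
    (hb : ∀ k, ∃ A B : ℝ, ∀ τ : ℂ, 0 < τ.im → A < τ.im → ‖g (mact (cuspMat k) τ)‖ ≤ B) :
    ∃ c, ∀ τ : ℂ, 0 < τ.im → g τ = c := by
  choose A B hb using hb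
  choose F hF hgF using fun k => exists_cusp_expansion hd hinv (cuspMat_det k) (hb k)
  set r : ℝ := Real.exp (-Real.pi * (1 / 2)) with hr
  have hr1 : r < 1 := by rw [hr, Real.exp_lt_one_iff]; nlinarith [Real.pi_pos]
  have hr0 : 0 < r := Real.exp_pos _
  have hsub : Metric.closedBall (0 : ℂ) r ⊆ Metric.ball 0 1 := Metric.closedBall_subset_ball hr1
  have hmax : ∀ k, ∃ q ∈ Metric.closedBall (0 : ℂ) r,
      ∀ z ∈ Metric.closedBall (0 : ℂ) r, ‖F k z‖ ≤ ‖F k q‖ := fun k =>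
    (isCompact_closedBall (0 : ℂ) r).exists_isMaxOn ⟨0, by simp [hr0.le]⟩
      ((hF k).continuousOn.mono hsub).norm
  choose q hq hqmax using hmax
  obtain ⟨k, -, hk⟩ := Finset.exists_max_image (univ : Finset (Fin 3)) (fun k => ‖F k (q k)‖)
    ⟨0, mem_univ _⟩
  have bound : ∀ τ : ℂ, 0 < τ.im → ‖g τ‖ ≤ ‖F k (q k)‖ := by
    intro τ h
    obtain ⟨w, hw, -, k', γ, hγ, rfl⟩ := exists_cusp_rep h
    have hw' : 0 < w.im := by linarith
    rw [hinv γ hγ _ (mact_im_pos (cuspMat_det_pos k') hw'), hgF k' w hw']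
    refine (hqmax k' _ ?_).trans (hk k' (mem_univ _))
    rw [mem_closedBall_zero_iff, norm_nome, hr]
    apply Real.exp_le_exp.mpr
    nlinarith [Real.pi_pos]
  have hmaxOn : IsMaxOn (norm ∘ F k) (Metric.ball 0 1) (q k) := by
    intro z hz
    simp only [Set.mem_ofPred_eq, Function.comp]
    rcases eq_or_ne z 0 with rfl | h0
    · exact hqmax k 0 (by simp [hr0.le])
    · obtain ⟨τ, hτ, rfl⟩ := exists_nome_eq h0 (by simpa using hz)
      rw [← hgF k τ hτ]
      exact bound _ (mact_im_pos (cuspMat_det_pos k) hτ)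
  have hconst := Complex.eqOn_of_isPreconnected_of_isMaxOn_norm
    (convex_ball (0 : ℂ) 1).isPreconnected Metric.isOpen_ball (hF k) (hsub (hq k)) hmaxOn
  refine ⟨F k (q k), fun τ h => ?_⟩
  have hadj : 0 < (mact (cuspMat k).adjugate τ).im :=
    mact_im_pos (by rw [Matrix.det_adjugate, cuspMat_det]; simp) h
  rw [← mact_inv_cancel (cuspMat_det k) h, hgF k _ hadj]
  exact hconst (by simpa using norm_nome_lt hadj)

end Cusps

section Uniformization
open Complex Topology

variable {M N : Matrix (Fin 2) (Fin 2) ℤ} {τ : ℂ}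

/-- The modular function `λ / 16` on the upper half plane. -/
noncomputable def ellt (τ : ℂ) : ℂ := ell (nome τ)

theorem lam_nome_eq (h : 0 < τ.im) : lam (nome τ) = 16 * ellt τ := lam_eq (norm_nome_lt h)

theorem ellt_ne_zero (h : 0 < τ.im) : ellt τ ≠ 0 := fun e =>
  lam_ne_zero (norm_nome_lt h) (nome_ne_zero τ) (by rw [lam_nome_eq h, e, mul_zero])

theorem ellt_ne_inv (h : 0 < τ.im) : 1 - 16 * ellt τ ≠ 0 := by
  rw [← lam_nome_eq h]; exact one_sub_lam_ne_zero (norm_nome_lt h)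

theorem InP.ellt_mact (hM : InP 1 M) (h : 0 < τ.im) : ellt (mact M τ) = ellt τ := by
  have := hM.lam_mact h
  rw [lam_nome_eq h, lam_nome_eq (mact_im_pos (by rw [hM.1]; exact one_pos) h)] at this
  exact mul_left_cancel₀ (by norm_num) this

theorem hasStrictDerivAt_ellt (h : 0 < τ.im) :
    HasStrictDerivAt ellt (Real.pi * I * (ellt τ * (1 - 16 * ellt τ) * thc3 τ ^ 2)) τ := by
  have hq := norm_nome_lt h
  have h1 : AnalyticAt ℂ ell (nome τ) :=
    (IRep_ell.differentiableOn).analyticAt (Metric.isOpen_ball.mem_nhds (by simpa using hq))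
  have h2 : AnalyticAt ℂ nome τ := differentiable_nome.analyticAt τ
  have h3 := (h1.comp h2).hasStrictDerivAt
  have h4 : deriv (ell ∘ nome) τ = Real.pi * I * (ellt τ * (1 - 16 * ellt τ) * thc3 τ ^ 2) := by
    rw [((IRep_ell.differentiableAt hq).hasDerivAt.comp τ (hasDerivAt_nome τ)).deriv,
      ← lam_nome_eq h, ellt, thc3, ← pow_mul, ← nome_mul_deriv_ell hq]
    ring
  rw [h4] at h3
  exact h3

theorem deriv_ellt_ne_zero (h : 0 < τ.im) :
    Real.pi * I * (ellt τ * (1 - 16 * ellt τ) * thc3 τ ^ 2) ≠ 0 :=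
  mul_ne_zero (mul_ne_zero (by exact_mod_cast Real.pi_ne_zero) I_ne_zero)
    (mul_ne_zero (mul_ne_zero (ellt_ne_zero h) (ellt_ne_inv h)) (pow_ne_zero 2 (thc3_ne_zero h)))

theorem differentiableAt_ellt (h : 0 < τ.im) : DifferentiableAt ℂ ellt τ :=
  (hasStrictDerivAt_ellt h).hasDerivAt.differentiableAt

theorem mact_cuspMat_zero : mact (cuspMat 0) τ = τ := by simp [cuspMat, mact_one]
theorem mact_cuspMat_one : mact (cuspMat 1) τ = -1 / τ := by simp [cuspMat, mact]
theorem mact_cuspMat_two (h : 0 < τ.im) : mact (cuspMat 2) τ = -1 / τ + 1 := by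
  have := ne_zero_of_im_pos h
  simp [cuspMat, mact]; field_simp; ring

theorem ellt_cusp_one (h : 0 < τ.im) : ellt (mact (cuspMat 1) τ) = 1 / 16 - ellt τ := by
  have := lam_S h
  rw [lam_nome_eq h, lam_nome_eq (im_neg_inv_pos h)] at this
  rw [mact_cuspMat_one]
  linear_combination this / 16

theorem ellt_cusp_two (h : 0 < τ.im) :
    ellt (mact (cuspMat 2) τ) = (1 - 1 / (16 * ellt τ)) / 16 := by
  have := lam_TS h
  rw [lam_nome_eq h, lam_nome_eq (by simpa using im_neg_inv_pos h)] at this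
  rw [mact_cuspMat_two h]
  linear_combination this / 16

theorem tendsto_nome : Tendsto nome (comap im atTop) (𝓝 0) := by
  rw [tendsto_zero_iff_norm_tendsto_zero]
  simp_rw [norm_nome]
  apply Real.tendsto_exp_atBot.comp
  exact (tendsto_id.const_mul_atTop_of_neg (by linarith [Real.pi_pos])).comp tendsto_comap

instance : (comap im atTop : Filter ℂ).NeBot :=
  comap_neBot fun t ht => by
    obtain ⟨a, ha⟩ := (inferInstance : (atTop : Filter ℝ).NeBot).nonempty_of_mem ht
    exact ⟨⟨0, a⟩, ha⟩

theorem eventually_im_pos : ∀ᶠ τ : ℂ in comap im atTop, 0 < τ.im :=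
  tendsto_comap.eventually (eventually_gt_atTop 0)

theorem eventually_im_iff {P : ℂ → Prop} :
    (∀ᶠ τ in comap im atTop, P τ) ↔ ∃ A : ℝ, ∀ τ : ℂ, 0 < τ.im → A < τ.im → P τ := by
  constructor
  · intro h
    rw [(atTop_basis.comap im).eventually_iff] at h
    obtain ⟨A, -, h⟩ := h
    exact ⟨A, fun τ _ h1 => h h1.le⟩
  · rintro ⟨A, h⟩
    filter_upwards [eventually_im_pos,
      (tendsto_comap.eventually (eventually_gt_atTop A) : ∀ᶠ z in comap im atTop, A < z.im)]
      with τ h1 h2 using h τ h1 h2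

theorem tendsto_ellt : Tendsto ellt (comap im atTop) (𝓝 0) := by
  have h0 : ell 0 = 0 := by rw [ell_eq, zero_mul]
  have : ContinuousAt ell 0 := (IRep_ell.differentiableAt (by simp)).continuousAt
  have h := this.tendsto.comp tendsto_nome
  rwa [h0] at h

/-- The modular function takes every value outside `0` and `1 / 16`. -/
theorem exists_ellt_eq {c : ℂ} (h0 : c ≠ 0) (h1 : 1 - 16 * c ≠ 0) :
    ∃ τ : ℂ, 0 < τ.im ∧ ellt τ = c := by
  by_contra! hc
  obtain ⟨d, hd⟩ := const_of_bounded_at_cusps (g := fun τ => (ellt τ - c)⁻¹)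
    (fun τ h => ((differentiableAt_ellt h).sub_const c).inv (sub_ne_zero.mpr (hc τ h)))
    (fun γ hγ τ h => by simp only [hγ.ellt_mact h]) (fun k => by
      have key : ∃ c', Tendsto (fun τ => (ellt (mact (cuspMat k) τ) - c)⁻¹) (comap im atTop)
          (𝓝 c') := by
        have t0 := tendsto_ellt
        fin_cases k
        · refine ⟨(0 - c)⁻¹, ?_⟩
          simp only [Fin.zero_eta, mact_cuspMat_zero]
          exact (t0.sub_const c).inv₀ (by simpa using h0)
        · refine ⟨(1 / 16 - 0 - c)⁻¹, ?_⟩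
          refine (((t0.const_sub (1 / 16)).sub_const c).inv₀ ?_).congr' ?_
          · intro e; apply h1; linear_combination 16 * e
          · filter_upwards [eventually_im_pos] with τ h
            rw [Fin.mk_one, ellt_cusp_one h]
        · refine ⟨(16 * 0) * ((0 - 1 / 16) - c * (16 * 0))⁻¹, ?_⟩
          refine ((t0.const_mul 16).mul (((t0.sub_const (1 / 16)).sub
            ((t0.const_mul 16).const_mul c)).inv₀ (by norm_num))).congr' ?_
          filter_upwards [eventually_im_pos] with τ h
          simp only [Fin.reduceFinMk, ellt_cusp_two h]
          have := ellt_ne_zero h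
          have e : (1 - 1 / (16 * ellt τ)) / 16 - c =
              ((ellt τ - 1 / 16) - c * (16 * ellt τ)) / (16 * ellt τ) := by
            field_simp
          rw [e, inv_div]; exact (div_eq_mul_inv _ _).symm
      obtain ⟨c', hc'⟩ := key
      obtain ⟨A, hA⟩ := eventually_im_iff.mp
        (hc'.norm.eventually (eventually_le_nhds (lt_add_one ‖c'‖)))
      exact ⟨A, _, hA⟩)
  have hconst : ∀ τ : ℂ, 0 < τ.im → ellt τ = d⁻¹ + c := fun τ h => by
    rw [← hd τ h, inv_inv]; ring
  have h2 : Tendsto ellt (comap im atTop) (𝓝 (d⁻¹ + c)) :=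
    tendsto_const_nhds.congr' (by filter_upwards [eventually_im_pos] with τ h using (hconst τ h).symm)
  have h3 := tendsto_nhds_unique h2 tendsto_ellt
  exact ellt_ne_zero (τ := I) (by simp) (by rw [hconst _ (by simp), h3])

/-- Equivalence under the principal congruence subgroup of level two. -/
def LevEquiv (τ₁ τ₂ : ℂ) : Prop := ∃ γ, InP 1 γ ∧ τ₂ = mact γ τ₁

theorem InP.det_pos {n : ℤ} (hn : 0 < n) (hM : InP n M) : 0 < M.det := hM.1 ▸ hn

theorem LevEquiv.symm {τ₁ τ₂ : ℂ} (h1 : 0 < τ₁.im) (h : LevEquiv τ₁ τ₂) : LevEquiv τ₂ τ₁ := by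
  obtain ⟨γ, hγ, rfl⟩ := h
  exact ⟨γ.adjugate, hγ.adjugate, (mact_inv_cancel' hγ.1 h1).symm⟩

theorem LevEquiv.trans {τ₁ τ₂ τ₃ : ℂ} (h1 : 0 < τ₁.im) (h : LevEquiv τ₁ τ₂) (h' : LevEquiv τ₂ τ₃) :
    LevEquiv τ₁ τ₃ := by
  obtain ⟨γ, hγ, rfl⟩ := h
  obtain ⟨γ', hγ', rfl⟩ := h'
  exact ⟨γ' * γ, by simpa using hγ'.mul hγ,
    (mact_mul (hγ'.det_pos one_pos) (hγ.det_pos one_pos) h1).symm⟩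

/-- Close to a point outside `0` and `1 / 16`, fibres are represented in a compact set. -/
theorem exists_compact_rep {c : ℂ} (h0 : c ≠ 0) (h1 : 1 - 16 * c ≠ 0) :
    ∃ K : Set ℂ, IsCompact K ∧ (∀ z ∈ K, 0 < z.im) ∧
      ∀ᶠ c' in 𝓝 c, ∀ τ : ℂ, 0 < τ.im → ellt τ = c' → ∃ z ∈ K, LevEquiv z τ := by
  have key : ∀ k, ∃ A : ℝ, ∀ᶠ c' in 𝓝 c, ∀ w : ℂ, 0 < w.im →
      ellt (mact (cuspMat k) w) = c' → w.im ≤ A := by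
    intro k
    have aux : ∀ φ : ℂ → ℂ, ContinuousAt φ c → φ c ≠ 0 →
        (∀ w : ℂ, 0 < w.im → ∀ c', ellt (mact (cuspMat k) w) = c' → φ c' = ellt w ∨ φ c' = 0) →
        ∃ A : ℝ, ∀ᶠ c' in 𝓝 c, ∀ w : ℂ, 0 < w.im → ellt (mact (cuspMat k) w) = c' →
          w.im ≤ A := by
      intro φ hφ hφ0 hw
      obtain ⟨A, hA⟩ := eventually_im_iff.mp (tendsto_ellt.norm.eventually
        (eventually_lt_nhds (b := ‖φ c‖ / 2) (by simpa using hφ0)))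
      refine ⟨A, ?_⟩
      have hpos : ‖φ c‖ / 2 < ‖φ c‖ := by linarith [norm_pos_iff.mpr hφ0]
      filter_upwards [hφ.norm.eventually (eventually_gt_nhds hpos)] with c' hc' w hwi e
      by_contra! hlt
      have hl := hA w hwi hlt
      rcases hw w hwi c' e with e' | e'
      · rw [e'] at hc'; linarith
      · rw [e', norm_zero] at hc'
        linarith [norm_nonneg (φ c)]
    fin_cases k
    · refine aux id continuousAt_id h0 fun w hw c' e => Or.inl ?_
      simpa [mact_cuspMat_zero] using e.symm
    · refine aux (fun c => 1 / 16 - c) (by fun_prop) (fun e => h1 (by linear_combination 16 * e))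
        fun w hw c' e => Or.inl ?_
      simp only [Fin.mk_one, ellt_cusp_one hw] at e
      rw [← e]; ring
    · refine aux (fun c => 1 / (16 * (1 - 16 * c))) ?_ ?_ fun w hw c' e => Or.inl ?_
      · exact ContinuousAt.div (by fun_prop) (by fun_prop) (mul_ne_zero (by norm_num) h1)
      · exact one_div_ne_zero (mul_ne_zero (by norm_num) h1)
      · simp only [Fin.reduceFinMk, ellt_cusp_two hw] at e
        have := ellt_ne_zero hw
        rw [← e]; field_simp; ring
  choose A hA using key
  set B := ∑ k, |A k|
  set R : Set ℂ := (Set.Icc (-(3 / 2)) (3 / 2)) ×ℂ (Set.Icc (1 / 2) B) with hR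
  have hRc : IsCompact R := isCompact_Icc.reProdIm isCompact_Icc
  have hRi : ∀ z ∈ R, 0 < z.im := fun z hz => by
    have := (mem_reProdIm.mp hz).2.1; linarith
  refine ⟨⋃ k, mact (cuspMat k) '' R, isCompact_iUnion fun k => hRc.image_of_continuousOn
    fun z hz => (differentiableAt_mact (by simp [cuspMat_det]) (hRi z hz)).continuousAt.continuousWithinAt,
    ?_, ?_⟩
  · intro z hz
    obtain ⟨k, w, hw, rfl⟩ := Set.mem_iUnion.mp hz
    exact mact_im_pos (cuspMat_det_pos k) (hRi w hw)
  · filter_upwards [eventually_all.mpr hA] with c' hc' τ h e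
    obtain ⟨w, hw, hre, k, γ, hγ, rfl⟩ := exists_cusp_rep h
    have hw' : 0 < w.im := by linarith
    have hkw := mact_im_pos (cuspMat_det_pos k) hw'
    rw [hγ.ellt_mact hkw] at e
    refine ⟨_, Set.mem_iUnion.mpr ⟨k, w, ?_, rfl⟩, γ, hγ, rfl⟩
    rw [hR, mem_reProdIm]
    refine ⟨abs_le.mp hre, hw, (hc' k w hw' e).trans ((le_abs_self _).trans ?_)⟩
    exact single_le_sum (f := fun k => |A k|) (fun i _ => abs_nonneg _) (mem_univ k)

/-- The modular function separates inequivalent points of the fibre over `c`. -/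
def FibreGood (c : ℂ) : Prop :=
  ∀ τ₁ τ₂ : ℂ, 0 < τ₁.im → 0 < τ₂.im → ellt τ₁ = c → ellt τ₂ = c → LevEquiv τ₁ τ₂

theorem ellt_locally_injective (h : 0 < τ.im) :
    ∀ᶠ z in 𝓝 τ ×ˢ 𝓝 τ, ellt z.1 = ellt z.2 → z.1 = z.2 := by
  have hs := hasStrictDerivAt_ellt h
  have hl := hs.eventually_left_inverse (deriv_ellt_ne_zero h)
  filter_upwards [hl.prod_mk hl] with z hz e
  rw [← hz.1, ← hz.2, e]

theorem eventually_fibreGood {c : ℂ} (h0 : c ≠ 0) (h1 : 1 - 16 * c ≠ 0) (hc : FibreGood c) :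
    ∀ᶠ c' in 𝓝 c, FibreGood c' := by
  obtain ⟨K, hK, hKi, hrep⟩ := exists_compact_rep h0 h1
  by_contra hcon
  have hfr : ∃ᶠ c' in 𝓝 c, ∃ z : ℂ × ℂ, z ∈ K ×ˢ K ∧ ellt z.1 = c' ∧ ellt z.2 = c' ∧
      ¬ LevEquiv z.1 z.2 := by
    refine ((not_eventually.mp hcon).and_eventually hrep).mono fun c' hh => ?_
    obtain ⟨hb, hr⟩ := hh
    simp only [FibreGood, not_forall] at hb
    obtain ⟨τ₁, τ₂, i1, i2, e1, e2, hne⟩ := hb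
    obtain ⟨z₁, hz₁, p1⟩ := hr τ₁ i1 e1
    obtain ⟨z₂, hz₂, p2⟩ := hr τ₂ i2 e2
    refine ⟨(z₁, z₂), ⟨hz₁, hz₂⟩, ?_, ?_, fun hp => hne ?_⟩
    · obtain ⟨γ, hγ, rfl⟩ := p1
      rw [← e1, hγ.ellt_mact (hKi _ hz₁)]
    · obtain ⟨γ, hγ, rfl⟩ := p2
      rw [← e2, hγ.ellt_mact (hKi _ hz₂)]
    · exact (p1.symm (hKi _ hz₁)).trans i1 (hp.trans (hKi _ hz₁) p2)
  obtain ⟨u, hu, hP⟩ := exists_seq_forall_of_frequently hfr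
  choose z hz e1 e2 hne using hP
  obtain ⟨w, hw, φ, hφ, hlim⟩ := (hK.prod hK).tendsto_subseq hz
  have i1 := hKi _ hw.1
  have i2 := hKi _ hw.2
  have l1 : Tendsto (fun n => (z (φ n)).1) atTop (𝓝 w.1) := (continuous_fst.tendsto w).comp hlim
  have l2 : Tendsto (fun n => (z (φ n)).2) atTop (𝓝 w.2) := (continuous_snd.tendsto w).comp hlim
  have hu' : Tendsto (fun n => u (φ n)) atTop (𝓝 c) := hu.comp hφ.tendsto_atTop
  have c1 : ellt w.1 = c := tendsto_nhds_unique
    ((differentiableAt_ellt i1).continuousAt.tendsto.comp l1) (by simpa [Function.comp_def, e1] using hu')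
  have c2 : ellt w.2 = c := tendsto_nhds_unique
    ((differentiableAt_ellt i2).continuousAt.tendsto.comp l2) (by simpa [Function.comp_def, e2] using hu')
  obtain ⟨γ, hγ, hw2⟩ := hc w.1 w.2 i1 i2 c1 c2
  have l3 : Tendsto (fun n => mact γ (z (φ n)).1) atTop (𝓝 w.2) := by
    rw [hw2]
    exact (differentiableAt_mact (by simp [hγ.1]) i1).continuousAt.tendsto.comp l1
  obtain ⟨n, hn⟩ := ((l3.prodMk l2).eventually (ellt_locally_injective i2)).exists
  have hzi := hKi _ (hz (φ n)).1
  exact hne (φ n) ⟨γ, hγ, (hn (by rw [hγ.ellt_mact hzi, e1, e2])).symm⟩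

theorem entry_bound {z : ℂ} {c d : ℤ} {y B C : ℝ} (hy : 0 < y) (hz : y ≤ z.im) (hB : ‖z‖ ≤ B)
    (h : ‖(c : ℂ) * z + d‖ ≤ C) : |(c : ℝ)| ≤ C / y ∧ |(d : ℝ)| ≤ C + C / y * B := by
  have h1 : |(c : ℝ)| * z.im ≤ C := by
    have := (abs_im_le_norm ((c : ℂ) * z + d)).trans h
    simpa [abs_mul, abs_of_pos (hy.trans_le hz)] using this
  have h2 : |(c : ℝ)| ≤ C / y := by
    rw [le_div_iff₀ hy]
    exact (mul_le_mul_of_nonneg_left hz (abs_nonneg _)).trans h1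
  refine ⟨h2, ?_⟩
  have h3 : ((d : ℝ) : ℂ) = ((c : ℂ) * z + d) - (c : ℝ) * z := by push_cast; ring
  have h4 : |(d : ℝ)| = ‖((d : ℝ) : ℂ)‖ := by rw [norm_real, Real.norm_eq_abs]
  rw [h4, h3]
  refine (norm_sub_le _ _).trans (add_le_add h ?_)
  rw [norm_mul, norm_real, Real.norm_eq_abs]
  exact mul_le_mul h2 hB (norm_nonneg _) ((abs_nonneg _).trans h2)

/-- The action on the upper half plane is properly discontinuous. -/
theorem finite_mact {y B : ℝ} (hy : 0 < y) : {M : Matrix (Fin 2) (Fin 2) ℤ | M.det = 1 ∧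
    ∃ z : ℂ, y ≤ z.im ∧ ‖z‖ ≤ B ∧ y ≤ (mact M z).im ∧ ‖mact M z‖ ≤ B}.Finite := by
  set C : ℝ := 1 + B / y
  set n : ℤ := ⌈C / y + (C + C / y * B) + (B * C / y + (B * C + B * C / y * B))⌉
  have hfin : (Set.pi Set.univ fun _ : Fin 2 => Set.pi Set.univ fun _ : Fin 2 =>
      Set.Icc (-n) n).Finite := Set.Finite.pi fun _ => Set.Finite.pi fun _ => Set.finite_Icc _ _
  refine hfin.subset ?_
  rintro M ⟨hM, z, hz, hzB, hw, hwB⟩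
  have hzi : 0 < z.im := hy.trans_le hz
  have hM' : Matrix.det M = 1 := hM
  have hd := mden_ne_zero (M := M) (by rw [hM']; exact one_ne_zero) hzi
  have hB : 0 < B := hzi.trans_le ((le_abs_self _).trans ((abs_im_le_norm z).trans hzB))
  have hC : 0 < C := by positivity
  have hden : ‖mden M z‖ ≤ C := by
    have h1 := mact_im (M := M) (by rw [hM']; exact one_ne_zero) hzi
    have h2 : 0 < ‖mden M z‖ ^ 2 := by positivity
    have h3 : y * ‖mden M z‖ ^ 2 ≤ B := by
      rw [h1, hM, Int.cast_one, one_mul, normSq_eq_norm_sq, le_div_iff₀ h2] at hw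
      exact hw.trans ((le_abs_self _).trans ((abs_im_le_norm z).trans hzB))
    have h4 : ‖mden M z‖ ^ 2 ≤ B / y := by rw [le_div_iff₀ hy]; linarith
    have h5 : 0 ≤ B / y := by positivity
    nlinarith [norm_nonneg (mden M z), sq_nonneg (‖mden M z‖ - 1)]
  have hnum : ‖(M 0 0 : ℂ) * z + M 0 1‖ ≤ B * C := by
    have : (M 0 0 : ℂ) * z + M 0 1 = mact M z * mden M z := by
      exact (div_mul_cancel₀ _ hd).symm
    rw [this, norm_mul]
    exact mul_le_mul hwB hden (norm_nonneg _) hB.le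
  obtain ⟨b1, b2⟩ := entry_bound hy hz hzB hden
  obtain ⟨b3, b4⟩ := entry_bound hy hz hzB hnum
  have p1 : 0 ≤ C / y := by positivity
  have p2 : 0 ≤ C / y * B := by positivity
  have p3 : 0 ≤ B * C / y := by positivity
  have p4 : 0 ≤ B * C / y * B := by positivity
  have p5 : 0 ≤ B * C := by positivity
  have hn : C / y + (C + C / y * B) + (B * C / y + (B * C + B * C / y * B)) ≤ n := Int.le_ceil _
  have conv : ∀ x : ℤ, |(x : ℝ)| ≤ n → x ∈ Set.Icc (-n) n := fun x hx => by
    have : |x| ≤ n := by exact_mod_cast hx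
    exact abs_le.mp this
  intro i _ j _
  apply conv
  fin_cases i <;> fin_cases j <;> simp only [Fin.zero_eta, Fin.mk_one] <;> linarith

theorem eventually_not_fibreGood {c : ℂ} (hc : ¬ FibreGood c) : ∀ᶠ c' in 𝓝 c, ¬ FibreGood c' := by
  simp only [FibreGood, not_forall] at hc
  obtain ⟨τ₁, τ₂, i1, i2, e1, e2, hne⟩ := hc
  by_contra hcon
  have hfr : ∃ᶠ c' in 𝓝 c, FibreGood c' := by simpa [not_eventually] using hcon
  have s1 := hasStrictDerivAt_ellt i1
  have s2 := hasStrictDerivAt_ellt i2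
  have r1 := s1.eventually_right_inverse (deriv_ellt_ne_zero i1)
  have r2 := s2.eventually_right_inverse (deriv_ellt_ne_zero i2)
  have t1 := (s1.hasStrictFDerivAt_equiv (deriv_ellt_ne_zero i1)).localInverse_tendsto
  have t2 := (s2.hasStrictFDerivAt_equiv (deriv_ellt_ne_zero i2)).localInverse_tendsto
  set g1 := s1.localInverse ellt _ _ (deriv_ellt_ne_zero i1)
  set g2 := s2.localInverse ellt _ _ (deriv_ellt_ne_zero i2)
  change Tendsto g1 _ _ at t1
  change Tendsto g2 _ _ at t2
  rw [e1] at r1 t1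
  rw [e2] at r2 t2
  set y := min (τ₁.im / 2) (τ₂.im / 2) with hy
  have hy0 : 0 < y := lt_min (by linarith) (by linarith)
  set B := max (‖τ₁‖ + 1) (‖τ₂‖ + 1) with hB
  have ni : ∀ {g : ℂ → ℂ} {t : ℂ}, 0 < t.im → Tendsto g (𝓝 c) (𝓝 t) →
      ∀ᶠ c' in 𝓝 c, t.im / 2 ≤ (g c').im ∧ ‖g c'‖ ≤ ‖t‖ + 1 := fun {g t} ht hg =>
    (((continuous_im.tendsto t).comp hg).eventually (eventually_ge_nhds (by linarith))).and
      (hg.norm.eventually (eventually_le_nhds (by linarith)))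
  have hfin := finite_mact (B := B) hy0
  have hfr2 : ∃ᶠ c' in 𝓝 c, ∃ γ ∈ {M : Matrix (Fin 2) (Fin 2) ℤ | M.det = 1 ∧
      ∃ z : ℂ, y ≤ z.im ∧ ‖z‖ ≤ B ∧ y ≤ (mact M z).im ∧ ‖mact M z‖ ≤ B},
      InP 1 γ ∧ g2 c' = mact γ (g1 c') := by
    refine (hfr.and_eventually ((r1.and r2).and ((ni i1 t1).and (ni i2 t2)))).mono ?_
    rintro c' ⟨hg, ⟨q1, q2⟩, ⟨a1, b1⟩, a2, b2⟩
    have a1' : y ≤ (g1 c').im := (min_le_left _ _).trans a1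
    have a2' : y ≤ (g2 c').im := (min_le_right _ _).trans a2
    obtain ⟨γ, hγ, e⟩ := hg (g1 c') (g2 c') (hy0.trans_le a1') (hy0.trans_le a2') q1 q2
    exact ⟨γ, ⟨hγ.1, g1 c', a1', b1.trans (le_max_left _ _), e ▸ a2',
      e ▸ b2.trans (le_max_right _ _)⟩, hγ, e⟩
  rw [frequently_iff] at hfr2
  have : ∃ γ, ∃ᶠ c' in 𝓝 c, InP 1 γ ∧ g2 c' = mact γ (g1 c') := by
    by_contra! hno
    have hall := (hfin.eventually_all (l := 𝓝 c)
      (p := fun γ c' => ¬ (InP 1 γ ∧ g2 c' = mact γ (g1 c')))).mpr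
      fun γ _ => (hno γ).mono fun c' hh hh' => hh hh'.1 hh'.2
    obtain ⟨c', hc', γ, hγ, hh⟩ := hfr2 hall
    exact hc' γ hγ hh
  obtain ⟨γ, hγ⟩ := this
  have hγP : InP 1 γ := hγ.exists.choose_spec.1
  refine hne ⟨γ, hγP, ?_⟩
  by_contra hne'
  have t3 : Tendsto (fun c' => mact γ (g1 c')) (𝓝 c) (𝓝 (mact γ τ₁)) :=
    (differentiableAt_mact (by simp [hγP.1]) i1).continuousAt.tendsto.comp t1
  have := (t2.prodMk_nhds t3).eventually ((isClosed_diagonal.isOpen_compl).mem_nhds hne')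
  exact hγ (this.mono fun c' hc' hh => hc' hh.2)

/-- The modular function is injective on small values of the nome. -/
theorem exists_fibreGood : ∃ c : ℂ, c ≠ 0 ∧ 1 - 16 * c ≠ 0 ∧ FibreGood c := by
  set r : ℝ := Real.exp (-Real.pi * (1 / 2)) with hr
  have hr1 : r < 1 := by rw [hr, Real.exp_lt_one_iff]; nlinarith [Real.pi_pos]
  have hr0 : 0 < r := Real.exp_pos _
  have hlt : ∀ z ∈ Metric.closedBall (0 : ℂ) r, ‖z‖ < 1 := fun z hz =>
    (mem_closedBall_zero_iff.mp hz).trans_lt hr1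
  have hcont : ContinuousOn ell (Metric.closedBall (0 : ℂ) r) := fun z hz =>
    (IRep_ell.differentiableAt (hlt z hz)).continuousAt.continuousWithinAt
  have ell00 : ell 0 = 0 := by rw [ell_eq, zero_mul]
  have hinj : ∃ ε > 0, ∀ z w : ℂ, ‖z‖ < ε → ‖w‖ < ε → ell z = ell w → z = w := by
    have h1 : AnalyticAt ℂ ell 0 :=
      (IRep_ell.differentiableOn).analyticAt (Metric.isOpen_ball.mem_nhds (by simp))
    have hl := h1.hasStrictDerivAt.eventually_left_inverse (deriv_ell_ne_zero (by simp))
    obtain ⟨ε, hε, hb⟩ := Metric.eventually_nhds_iff.mp hl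
    refine ⟨ε, hε, fun z w hz hw e => ?_⟩
    have hz' := hb (y := z) (by simpa using hz)
    have hw' := hb (y := w) (by simpa using hw)
    rw [← hz', ← hw', e]
  obtain ⟨ε, hε, hinj⟩ := hinj
  have hsmall : ∃ δ > 0, ∀ z ∈ Metric.closedBall (0 : ℂ) r, ‖ell z‖ < δ → ‖z‖ < ε := by
    set S := Metric.closedBall (0 : ℂ) r ∩ {z | ε ≤ ‖z‖}
    have hS : IsCompact S := (isCompact_closedBall 0 r).inter_right
      (isClosed_le continuous_const continuous_norm)
    rcases S.eq_empty_or_nonempty with hE | hne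
    · refine ⟨1, one_pos, fun z hz _ => ?_⟩
      by_contra! hh
      have : z ∈ S := ⟨hz, hh⟩
      simp [hE] at this
    · obtain ⟨z₀, hz₀, hmin⟩ := hS.exists_isMinOn hne ((hcont.mono Set.inter_subset_left).norm)
      refine ⟨‖ell z₀‖, norm_pos_iff.mpr ?_, fun z hz hlt' => ?_⟩
      · have hn : ‖z₀‖ < 1 := hlt z₀ hz₀.1
        rw [ell_eq]
        refine mul_ne_zero (fun e => ?_) (ell0_ne_zero hn)
        have := hz₀.2
        simp only [e, norm_zero, Set.mem_ofPred_eq] at this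
        linarith
      · by_contra! hh
        exact absurd (hmin (⟨hz, hh⟩ : z ∈ S)) (not_le.mpr hlt')
  obtain ⟨δ, hδ, hsmall⟩ := hsmall
  have hone : ∃ η > 0, ∀ z ∈ Metric.closedBall (0 : ℂ) r, η ≤ ‖1 - 16 * ell z‖ := by
    obtain ⟨z₀, hz₀, hmin⟩ := (isCompact_closedBall (0 : ℂ) r).exists_isMinOn ⟨0, by simp [hr0.le]⟩
      ((continuousOn_const.sub (continuousOn_const.mul hcont)).norm :
        ContinuousOn (fun z => ‖1 - 16 * ell z‖) _)
    refine ⟨‖1 - 16 * ell z₀‖, norm_pos_iff.mpr ?_, fun z hz => hmin hz⟩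
    rw [← lam_eq (hlt z₀ hz₀)]
    exact one_sub_lam_ne_zero (hlt z₀ hz₀)
  have hbd : ∃ L > 0, ∀ z ∈ Metric.closedBall (0 : ℂ) r, ‖ell z‖ ≤ L := by
    obtain ⟨L, hL⟩ := (isCompact_closedBall (0 : ℂ) r).exists_bound_of_continuousOn hcont
    exact ⟨max L 1, by positivity, fun z hz => (hL z hz).trans (le_max_left _ _)⟩
  obtain ⟨η, hη, hone⟩ := hone
  obtain ⟨L, hL, hbd⟩ := hbd
  obtain ⟨c, hcpos, hc1, hc2, hc3, hc4⟩ : ∃ c : ℝ, 0 < c ∧ c < δ ∧ 16 * c < η ∧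
      16 * 16 * c * L < η ∧ 16 * c < 1 := by
    refine ⟨min (δ / 2) (min (η / 32) (min (η / (512 * L)) (1 / 32))), by positivity, ?_, ?_, ?_, ?_⟩
    · exact (min_le_left _ _).trans_lt (by linarith)
    · have := (min_le_right (δ / 2) _).trans (min_le_left (η / 32) (min (η / (512 * L)) (1 / 32)))
      linarith
    · have := ((min_le_right (δ / 2) _).trans (min_le_right (η / 32) _)).trans
        (min_le_left (η / (512 * L)) (1 / 32))
      rw [le_div_iff₀ (by positivity)] at this
      nlinarith
    · have := ((min_le_right (δ / 2) _).trans (min_le_right (η / 32) _)).trans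
        (min_le_right (η / (512 * L)) (1 / 32))
      linarith
  have hcn : ‖(c : ℂ)‖ = c := by rw [norm_real, Real.norm_of_nonneg hcpos.le]
  refine ⟨c, by exact_mod_cast hcpos.ne', ?_, ?_⟩
  · have : (1 - 16 * c : ℝ) ≠ 0 := by linarith
    exact_mod_cast this
  have rep : ∀ τ : ℂ, 0 < τ.im → ellt τ = c → ∃ w : ℂ, 0 < w.im ∧ ‖nome w‖ < ε ∧ ellt w = c ∧
      LevEquiv w τ := by
    intro τ h e
    obtain ⟨w, hw, hre, k, γ, hγ, rfl⟩ := exists_cusp_rep h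
    have hw' : 0 < w.im := by linarith
    have hkw := mact_im_pos (cuspMat_det_pos k) hw'
    rw [hγ.ellt_mact hkw] at e
    have hmem : nome w ∈ Metric.closedBall (0 : ℂ) r := by
      rw [mem_closedBall_zero_iff, norm_nome, hr]
      apply Real.exp_le_exp.mpr
      nlinarith [Real.pi_pos]
    have ho := hone _ hmem
    change η ≤ ‖1 - 16 * ellt w‖ at ho
    have hb : ‖ellt w‖ ≤ L := hbd _ hmem
    fin_cases k
    · simp only [Fin.zero_eta, mact_cuspMat_zero] at e ⊢
      refine ⟨w, hw', hsmall _ hmem ?_, e, γ, hγ, rfl⟩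
      change ‖ellt w‖ < δ
      rw [e, hcn]; exact hc1
    · exfalso
      simp only [Fin.mk_one, ellt_cusp_one hw'] at e
      have : 1 - 16 * ellt w = 16 * c := by linear_combination 16 * e
      rw [this, norm_mul, hcn] at ho
      norm_num at ho; linarith
    · exfalso
      simp only [Fin.reduceFinMk, ellt_cusp_two hw'] at e
      have hne := ellt_ne_zero hw'
      have : 1 - 16 * ellt w = -(16 * 16 * c * ellt w) := by
        field_simp at e
        linear_combination -e
      rw [this, norm_neg, norm_mul, norm_mul, hcn] at ho
      norm_num at ho
      nlinarith
  intro τ₁ τ₂ i1 i2 e1 e2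
  obtain ⟨w₁, j1, n1, f1, p1⟩ := rep τ₁ i1 e1
  obtain ⟨w₂, j2, n2, f2, p2⟩ := rep τ₂ i2 e2
  have hq : nome w₁ = nome w₂ := hinj _ _ n1 n2 (f1.trans f2.symm)
  have hw : LevEquiv w₁ w₂ := by
    obtain ⟨n, hn⟩ := Complex.exp_eq_exp_iff_exists_int.mp hq
    refine ⟨!![1, 2 * (-n); 0, 1], InP.shear _, ?_⟩
    rw [mact_shear]
    have hpi : (Real.pi : ℂ) * I ≠ 0 :=
      mul_ne_zero (by exact_mod_cast Real.pi_ne_zero) I_ne_zero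
    apply mul_left_cancel₀ hpi
    push_cast
    linear_combination -hn
  exact (p1.symm j1).trans i1 (hw.trans j1 p2)

/-- The modular function is injective modulo the principal congruence subgroup of level two. -/
theorem pEquiv_of_ellt_eq {τ₁ τ₂ : ℂ} (h1 : 0 < τ₁.im) (h2 : 0 < τ₂.im) (e : ellt τ₁ = ellt τ₂) :
    LevEquiv τ₁ τ₂ := by
  set S : Set ℂ := {0, 1 / 16}ᶜ with hS
  have hSm : ∀ c : ℂ, c ∈ S ↔ c ≠ 0 ∧ 1 - 16 * c ≠ 0 := fun c => by
    simp only [hS, Set.mem_compl_iff, Set.mem_insert_iff, Set.mem_singleton_iff, not_or]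
    refine and_congr_right fun _ => not_congr ⟨fun h => by rw [h]; norm_num, fun h => ?_⟩
    linear_combination -h / 16
  have hconn : IsPreconnected S := (Set.Countable.isConnected_compl_of_one_lt_rank (by simp)
    (by simp [Set.countable_insert])).isPreconnected
  have hopen : IsOpen S := (Set.Finite.isClosed (by simp)).isOpen_compl
  have hall : S ⊆ {c | c ∈ S ∧ FibreGood c} := by
    refine hconn.subset_left_of_subset_union (v := {c | c ∈ S ∧ ¬ FibreGood c}) ?_ ?_ ?_ ?_ ?_
    · rw [isOpen_iff_mem_nhds]
      rintro c ⟨hc, hg⟩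
      exact (Filter.eventually_mem_set.mpr (hopen.mem_nhds hc)).and
        (eventually_fibreGood ((hSm c).mp hc).1 ((hSm c).mp hc).2 hg)
    · rw [isOpen_iff_mem_nhds]
      rintro c ⟨hc, hg⟩
      exact (Filter.eventually_mem_set.mpr (hopen.mem_nhds hc)).and (eventually_not_fibreGood hg)
    · rw [Set.disjoint_left]; rintro c ⟨_, h⟩ ⟨_, h'⟩; exact h' h
    · intro c hc
      by_cases h : FibreGood c
      · exact Or.inl ⟨hc, h⟩
      · exact Or.inr ⟨hc, h⟩
    · obtain ⟨c, h0, h1, hg⟩ := exists_fibreGood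
      exact ⟨c, (hSm c).mpr ⟨h0, h1⟩, (hSm c).mpr ⟨h0, h1⟩, hg⟩
  exact (hall ((hSm _).mpr ⟨ellt_ne_zero h1, ellt_ne_inv h1⟩)).2 τ₁ τ₂ h1 h2 rfl e.symm

end Uniformization

section HeckeFunctions
open Complex Topology Asymptotics

variable {M N : Matrix (Fin 2) (Fin 2) ℤ} {τ : ℂ} {p : ℕ}

/-- The weight one ratio attached to an integral matrix. -/
noncomputable def rr (p : ℕ) (M : Matrix (Fin 2) (Fin 2) ℤ) (τ : ℂ) : ℂ :=
  p * thc3 (mact M τ) / (mden M τ * thc3 τ)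

theorem rr_mul_left {γ : Matrix (Fin 2) (Fin 2) ℤ} (hγ : InM 1 γ) (hM : 0 < M.det) (h : 0 < τ.im) :
    rr p (γ * M) τ = rr p M τ := by
  have h1 := mact_im_pos hM h
  have h2 := mden_ne_zero (M := γ) (by rw [hγ.1]; exact one_ne_zero) h1
  rw [rr, rr, mact_mul (hγ.det_pos one_pos) hM h, mden_mul hM.ne' h, hγ.thc3_mact h1]
  rw [mul_left_comm, mul_assoc (mden γ _), mul_div_mul_left _ _ h2]

theorem rr_mul_right {γ : Matrix (Fin 2) (Fin 2) ℤ} (hγ : InM 1 γ) (hM : 0 < M.det) (h : 0 < τ.im) :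
    rr p (M * γ) τ = rr p M (mact γ τ) := by
  rw [rr, rr, mact_mul hM (hγ.det_pos one_pos) h, mden_mul (hγ.det_pos one_pos).ne' h,
    hγ.thc3_mact h, mul_assoc]

/-- The ratio attached to a coset representative. -/
noncomputable def rI (p : ℕ) (i : Option (Fin p)) (τ : ℂ) : ℂ := rr p (heckeRep p i) τ

/-- The modular function evaluated at the translate by a coset representative. -/
noncomputable def eI (p : ℕ) (i : Option (Fin p)) (τ : ℂ) : ℂ := ellt (mact (heckeRep p i) τ)

theorem heckeRep_det_pos (hp2 : p % 2 = 1) (i : Option (Fin p)) : 0 < (heckeRep p i).det := by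
  rw [(heckeRep_inM hp2 i).1]; exact_mod_cast (by omega)

theorem exists_perm_rI (hp : p.Prime) (hp2 : p % 2 = 1) (hM : InM 1 M) :
    ∃ σ : Equiv.Perm (Option (Fin p)), ∀ i, ∀ τ : ℂ, 0 < τ.im →
      rI p i (mact M τ) = rI p (σ i) τ ∧ eI p i (mact M τ) = eI p (σ i) τ := by
  obtain ⟨σ, hσ⟩ := exists_perm_mul hp hp2 hM
  refine ⟨σ, fun i τ h => ?_⟩
  obtain ⟨γ, hγ, e⟩ := hσ i
  have hd := heckeRep_det_pos hp2
  constructor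
  · rw [rI, ← rr_mul_right hM (hd i) h, e, rr_mul_left hγ (hd _) h, rI]
  · rw [eI, ← mact_mul (hd i) (hM.det_pos one_pos) h, e,
      mact_mul (hγ.det_pos one_pos) (hd _) h, hγ.inP.ellt_mact (mact_im_pos (hd _) h), eI]

theorem exists_perm_rI_inP (hp : p.Prime) (hp2 : p % 2 = 1) (hM : InP 1 M) :
    ∃ σ : Equiv.Perm (Option (Fin p)), ∀ i, ∀ τ : ℂ, 0 < τ.im →
      rI p i (mact M τ) = rI p (σ i) τ ∧ eI p i (mact M τ) = eI p (σ i) τ := by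
  rcases hM.cases with h | h
  · exact exists_perm_rI hp hp2 h
  · simpa only [mact_neg] using exists_perm_rI hp hp2 h

theorem mden_cuspMat (k : Fin 3) (hk : k ≠ 0) : mden (cuspMat k) τ = τ := by
  fin_cases k <;> simp_all [cuspMat, mden]

theorem rr_conj {g γN R : Matrix (Fin 2) (Fin 2) ℤ} (hg : g.det = 1) (hN : 0 < γN.det)
    (hR : 0 < R.det) {s : ℤ} (hs : s = 1 ∨ s = -1) (hc : R * g = s • (g * γN))
    {φ : ℂ → ℂ} {c : ℂ} (hc0 : c ≠ 0)
    (hφ : ∀ w : ℂ, 0 < w.im → thc3 (mact g w) = c * mden g w * φ w) (h : 0 < τ.im) :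
    rr p R (mact g τ) = s * (p * φ (mact γN τ) / (mden γN τ * φ τ)) ∧
    mact R (mact g τ) = mact g (mact γN τ) := by
  have hg0 : 0 < g.det := by simp [hg]
  have hN' := mact_im_pos hN h
  have e1 : mact R (mact g τ) = mact g (mact γN τ) := by
    rw [← mact_mul hR hg0 h, ← mact_mul hg0 hN h, hc]
    rcases hs with e | e <;> rw [e]
    · rw [one_smul]
    · rw [neg_smul, one_smul, mact_neg]
  have d1 := mden_ne_zero hg0.ne' hN'
  have d2 := mden_ne_zero hg0.ne' h
  have d3 := mden_ne_zero hN.ne' h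
  have e2 := mden_mul (M := R) hg0.ne' h
  have e3 := mden_mul (M := g) hN.ne' h
  have hφ1 := hφ _ hN'
  have hφ2 := hφ _ h
  refine ⟨?_, e1⟩
  rw [hc] at e2
  rcases hs with e | e <;> rw [e] at e2 ⊢
  · rw [one_smul, e3] at e2
    have e4 : mden R (mact g τ) = mden g (mact γN τ) * mden γN τ / mden g τ := by
      rw [e2]; field_simp
    rw [rr, e1, e4, hφ1, hφ2]; push_cast; field_simp
  · rw [neg_smul, one_smul, mden_neg, e3] at e2
    have e4 : mden R (mact g τ) = -(mden g (mact γN τ) * mden γN τ / mden g τ) := by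
      rw [← neg_div, e2]; field_simp
    rw [rr, e1, e4, hφ1, hφ2]; push_cast; field_simp

theorem exists_sign_of_or {A B : Matrix (Fin 2) (Fin 2) ℤ} (h : A = B ∨ A = -B) :
    ∃ s : ℤ, (s = 1 ∨ s = -1) ∧ A = s • B := by
  rcases h with h | h
  · exact ⟨1, Or.inl rfl, by simpa using h⟩
  · exact ⟨-1, Or.inr rfl, by simpa using h⟩

theorem exists_perm_cusp_one (hp : p.Prime) (hp2 : p % 2 = 1) :
    ∃ σ : Equiv.Perm (Option (Fin p)), ∀ i, ∃ s : ℤ, (s = 1 ∨ s = -1) ∧ ∀ τ : ℂ, 0 < τ.im →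
      rI p i (mact (cuspMat 1) τ) = s * rI p (σ i) τ ∧
      eI p i (mact (cuspMat 1) τ) = 1 / 16 - eI p (σ i) τ := by
  obtain ⟨σ, hσ⟩ := exists_perm_conj hp hp2 (cuspMat_det 1)
  refine ⟨σ, fun i => ?_⟩
  obtain ⟨γ, hγ, e⟩ := hσ i
  obtain ⟨s, hs, e⟩ := exists_sign_of_or e
  refine ⟨s, hs, fun τ h => ?_⟩
  have hd := heckeRep_det_pos hp2
  have hN : 0 < (γ * heckeRep p (σ i)).det := by
    rw [Matrix.det_mul, hγ.1, one_mul]; exact hd _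
  obtain ⟨h1, h2⟩ := rr_conj (p := p) (φ := thc3) (c := -I) (cuspMat_det 1) hN (hd i) hs e (by simp)
    (fun w hw => by rw [mact_cuspMat_one, thc3_S hw, mden_cuspMat _ (by decide)]) h
  have h3 : p * thc3 (mact (γ * heckeRep p (σ i)) τ) / (mden (γ * heckeRep p (σ i)) τ * thc3 τ)
      = rI p (σ i) τ := rr_mul_left hγ (hd _) h
  refine ⟨by rwa [h3] at h1, ?_⟩
  rw [eI, h2, ellt_cusp_one (mact_im_pos hN h), mact_mul (hγ.det_pos one_pos) (hd _) h,
    hγ.inP.ellt_mact (mact_im_pos (hd _) h), eI]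

theorem thc2_sq_eq (h : 0 < τ.im) : thc2 τ ^ 2 = 16 * ellt τ * thc3 τ ^ 2 := by
  rw [← lam_nome_eq h, lam_nome, div_mul_cancel₀ _ (pow_ne_zero 2 (thc3_ne_zero h))]

theorem exists_perm_cusp_two (hp : p.Prime) (hp2 : p % 2 = 1) :
    ∃ σ : Equiv.Perm (Option (Fin p)), ∀ i, ∀ τ : ℂ, 0 < τ.im →
      rI p i (mact (cuspMat 2) τ) ^ 2 = rI p (σ i) τ ^ 2 * (eI p (σ i) τ / ellt τ) ∧
      eI p i (mact (cuspMat 2) τ) = (1 - 1 / (16 * eI p (σ i) τ)) / 16 := by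
  obtain ⟨σ, hσ⟩ := exists_perm_conj hp hp2 (cuspMat_det 2)
  refine ⟨σ, fun i τ h => ?_⟩
  obtain ⟨γ, hγ, e⟩ := hσ i
  obtain ⟨s, hs, e⟩ := exists_sign_of_or e
  have hd := heckeRep_det_pos hp2
  have hN : 0 < (γ * heckeRep p (σ i)).det := by
    rw [Matrix.det_mul, hγ.1, one_mul]; exact hd _
  obtain ⟨h1, h2⟩ := rr_conj (p := p) (φ := thc2) (c := -I) (cuspMat_det 2) hN (hd i) hs e (by simp)
    (fun w hw => by rw [mact_cuspMat_two hw, thc3_T, thc4_S hw, mden_cuspMat _ (by decide)]) h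
  have h3 : p * thc3 (mact (γ * heckeRep p (σ i)) τ) / (mden (γ * heckeRep p (σ i)) τ * thc3 τ)
      = rI p (σ i) τ := rr_mul_left hγ (hd _) h
  have h4 : ellt (mact (γ * heckeRep p (σ i)) τ) = eI p (σ i) τ := by
    rw [mact_mul (hγ.det_pos one_pos) (hd _) h, hγ.inP.ellt_mact (mact_im_pos (hd _) h), eI]
  constructor
  · have : rI p i (mact (cuspMat 2) τ) ^ 2 = (p * thc2 (mact (γ * heckeRep p (σ i)) τ) /
        (mden (γ * heckeRep p (σ i)) τ * thc2 τ)) ^ 2 := by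
      rw [rI, h1, mul_pow]
      rcases hs with e | e <;> simp [e]
    rw [this, ← h3, ← h4, div_pow, mul_pow, mul_pow, thc2_sq_eq h, thc2_sq_eq (mact_im_pos hN h)]
    have := ellt_ne_zero h
    have := thc3_ne_zero h
    have := mden_ne_zero hN.ne' h
    field_simp
  · rw [eI, h2, ellt_cusp_two (mact_im_pos hN h), h4]

end HeckeFunctions

section CuspAsymptotics
open Complex Topology Asymptotics

variable {M N : Matrix (Fin 2) (Fin 2) ℤ} {τ : ℂ} {p : ℕ}

theorem mact_heckeRep_none : mact (heckeRep p none) τ = p * τ := by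
  have h : (sgn4 p : ℂ) ≠ 0 := by
    have := sgn4_sq p
    exact_mod_cast (fun e => by simp [e] at this : sgn4 p ≠ 0)
  simp [mact, heckeRep]
  field_simp

theorem mact_heckeRep_some (j : Fin p) : mact (heckeRep p (some j)) τ = (τ + 2 * (j : ℕ)) / p := by
  simp [mact, heckeRep]

theorem mden_heckeRep_none : mden (heckeRep p none) τ = sgn4 p := by
  simp [mden, heckeRep]

theorem mden_heckeRep_some (j : Fin p) : mden (heckeRep p (some j)) τ = p := by
  simp [mden, heckeRep]

theorem tendsto_mact_heckeRep (hp : 0 < p) (i : Option (Fin p)) :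
    Tendsto (mact (heckeRep p i)) (comap im atTop) (comap im atTop) := by
  rw [tendsto_comap_iff]
  have hp' : (0 : ℝ) < p := by exact_mod_cast hp
  cases i with
  | none =>
    have : im ∘ mact (heckeRep p none) = fun τ => (p : ℝ) * τ.im := by
      ext τ; simp [mact_heckeRep_none]
    rw [this]
    exact tendsto_comap.const_mul_atTop hp'
  | some j =>
    have : im ∘ mact (heckeRep p (some j)) = fun τ : ℂ => τ.im / p := by
      ext τ
      simp [mact_heckeRep_some, Complex.div_natCast_im]
    rw [this]
    exact tendsto_comap.atTop_div_const hp'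

theorem tendsto_thc3 : Tendsto thc3 (comap im atTop) (𝓝 1) := by
  have : ContinuousAt th3 0 := (IRep_th3.differentiableAt (by simp)).continuousAt
  have h := (this.tendsto.comp tendsto_nome).pow 2
  rw [th3_zero, one_pow] at h
  exact h

theorem tendsto_ell0_nome : Tendsto (fun τ => ell0 (nome τ)) (comap im atTop) (𝓝 1) := by
  have : ContinuousAt ell0 0 := (IRep_ell0.differentiableAt (by simp)).continuousAt
  have h := this.tendsto.comp tendsto_nome
  rwa [ell0_zero] at h

theorem ellt_eq (τ : ℂ) : ellt τ = nome τ * ell0 (nome τ) := by rw [ellt, ell_eq]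

theorem tendsto_eI (hp : 0 < p) (i : Option (Fin p)) :
    Tendsto (eI p i) (comap im atTop) (𝓝 0) :=
  tendsto_ellt.comp (tendsto_mact_heckeRep hp i)

theorem tendsto_rI_none (hp : 0 < p) :
    Tendsto (rI p none) (comap im atTop) (𝓝 (sgn4 p * p)) := by
  have h1 := tendsto_thc3.comp (tendsto_mact_heckeRep hp none)
  have h := (h1.const_mul (p : ℂ)).div (tendsto_thc3.const_mul (sgn4 p : ℂ)) (by
    have := sgn4_sq p
    simp only [mul_one]
    exact_mod_cast (fun e => by simp [e] at this : sgn4 p ≠ 0))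
  have e : (p : ℂ) * 1 / ((sgn4 p : ℂ) * 1) = sgn4 p * p := by
    have : (sgn4 p : ℂ) * sgn4 p = 1 := by exact_mod_cast sgn4_sq p
    have h0 : (sgn4 p : ℂ) ≠ 0 := left_ne_zero_of_mul_eq_one this
    field_simp
    linear_combination -(p : ℂ) * this
  rw [e] at h
  refine h.congr fun τ => ?_
  simp [rI, rr, mden_heckeRep_none]

theorem tendsto_rI_some (hp : 0 < p) (j : Fin p) :
    Tendsto (rI p (some j)) (comap im atTop) (𝓝 1) := by
  have h1 := tendsto_thc3.comp (tendsto_mact_heckeRep hp (some j))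
  have h := h1.div tendsto_thc3 one_ne_zero
  rw [div_one] at h
  refine h.congr fun τ => ?_
  have : (p : ℂ) ≠ 0 := by exact_mod_cast hp.ne'
  simp only [rI, rr, mden_heckeRep_some, Function.comp_apply, Pi.div_apply]
  rw [mul_div_mul_left _ _ this]

theorem tendsto_ellt_mul_div (hp : 1 < p) :
    Tendsto (fun τ => ellt (p * τ) / ellt τ) (comap im atTop) (𝓝 0) := by
  have h1 : Tendsto (fun τ : ℂ => (p : ℂ) * τ) (comap im atTop) (comap im atTop) := by
    have := tendsto_mact_heckeRep (p := p) (by omega) none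
    simpa only [funext fun τ => mact_heckeRep_none (p := p) (τ := τ)] using this
  have h2 := (tendsto_ell0_nome.comp h1).div tendsto_ell0_nome one_ne_zero
  have h3 := (tendsto_nome.pow (p - 1)).mul h2
  rw [zero_pow (by omega), zero_mul] at h3
  refine h3.congr fun τ => ?_
  have h4 := nome_ne_zero τ
  have h5 : nome (p * τ) = nome τ ^ (p - 1) * nome τ := by
    rw [← nome_pow, ← pow_succ]; congr 1; omega
  simp only [Pi.div_apply, Function.comp_apply]
  rw [ellt_eq, ellt_eq τ, h5]
  field_simp

theorem nome_add_two_mul (τ : ℂ) (j : ℕ) : nome (τ + 2 * j) = nome τ := by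
  induction j with
  | zero => simp
  | succ n ih => rw [← ih, ← nome_add_two (τ + 2 * n)]; congr 1; push_cast; ring

theorem tendsto_eI_none_div (hp : 1 < p) :
    Tendsto (fun τ => eI p none τ / ellt τ) (comap im atTop) (𝓝 0) := by
  simp only [eI, mact_heckeRep_none]
  exact tendsto_ellt_mul_div hp

theorem tendsto_div_eI_some (hp : 1 < p) (j : Fin p) :
    Tendsto (fun τ => ellt τ / eI p (some j) τ) (comap im atTop) (𝓝 0) := by
  have := (tendsto_ellt_mul_div hp).comp (tendsto_mact_heckeRep (by omega) (some j))
  refine this.congr fun τ => ?_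
  have h0 : (p : ℂ) ≠ 0 := by exact_mod_cast (by omega)
  simp only [Function.comp_apply, eI]
  congr 1
  rw [mact_heckeRep_some, mul_div_cancel₀ _ h0, ellt, nome_add_two_mul, ellt]

theorem isBigO_inv_eI (hp : 1 < p) (i : Option (Fin p)) :
    (fun τ => (eI p i τ)⁻¹ * ellt τ ^ p) =O[comap im atTop] (fun _ => (1 : ℂ)) := by
  cases i with
  | none =>
    have h1 : Tendsto (fun τ : ℂ => (p : ℂ) * τ) (comap im atTop) (comap im atTop) := by
      have := tendsto_mact_heckeRep (p := p) (by omega) none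
      simpa only [funext fun τ => mact_heckeRep_none (p := p) (τ := τ)] using this
    have h2 := (tendsto_ell0_nome.pow p).div (tendsto_ell0_nome.comp h1) one_ne_zero
    refine (h2.isBigO_one ℂ).congr_left fun τ => ?_
    have h4 := nome_ne_zero τ
    simp only [Pi.div_apply, Function.comp_apply, eI, mact_heckeRep_none]
    rw [ellt_eq, ellt_eq, ← nome_pow, mul_pow]
    field_simp
  | some j =>
    have h := (tendsto_div_eI_some hp j).mul (tendsto_ellt.pow (p - 1))
    refine (h.isBigO_one ℂ).congr_left fun τ => ?_
    rw [div_mul_eq_mul_div, ← pow_succ', Nat.sub_add_cancel hp.le, div_eq_inv_mul]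

/-- Moderate growth at the cusp at infinity. -/
def ModGrowth (g : ℂ → ℂ) : Prop :=
  ∃ n : ℕ, (fun τ => g τ * ellt τ ^ n) =O[comap im atTop] (fun _ => (1 : ℂ))

theorem ModGrowth.of_isBigO {g : ℂ → ℂ} (h : g =O[comap im atTop] (fun _ => (1 : ℂ))) :
    ModGrowth g := ⟨0, by simpa using h⟩

theorem ModGrowth.raise {g : ℂ → ℂ} {n : ℕ} (m : ℕ)
    (h : (fun τ => g τ * ellt τ ^ n) =O[comap im atTop] (fun _ => (1 : ℂ))) :
    (fun τ => g τ * ellt τ ^ (n + m)) =O[comap im atTop] (fun _ => (1 : ℂ)) := by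
  have := h.mul ((tendsto_ellt.pow m).isBigO_one ℂ)
  simpa [pow_add, mul_assoc] using this

theorem ModGrowth.mul {g h : ℂ → ℂ} (hg : ModGrowth g) (hh : ModGrowth h) : ModGrowth (g * h) := by
  obtain ⟨n, hn⟩ := hg
  obtain ⟨m, hm⟩ := hh
  refine ⟨n + m, ?_⟩
  have := hn.mul hm
  simp only [mul_one] at this
  refine this.congr_left fun τ => ?_
  simp only [Pi.mul_apply, pow_add]; ring

theorem ModGrowth.add {g h : ℂ → ℂ} (hg : ModGrowth g) (hh : ModGrowth h) : ModGrowth (g + h) := by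
  obtain ⟨n, hn⟩ := hg
  obtain ⟨m, hm⟩ := hh
  refine ⟨n + m, ?_⟩
  refine ((ModGrowth.raise m hn).add (add_comm m n ▸ ModGrowth.raise n hm)).congr_left fun τ => ?_
  simp only [Pi.add_apply]; ring

theorem ModGrowth.neg {g : ℂ → ℂ} (hg : ModGrowth g) : ModGrowth (-g) := by
  obtain ⟨n, hn⟩ := hg
  exact ⟨n, by simpa using hn⟩

/-- Functions holomorphic on the upper half plane, bounded at two cusps and of moderate growth at
the third. -/
def cuspRing : Subring (ℂ → ℂ) where
  carrier := {g | (∀ τ : ℂ, 0 < τ.im → DifferentiableAt ℂ g τ) ∧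
    g =O[comap im atTop] (fun _ => (1 : ℂ)) ∧
    (fun τ => g (mact (cuspMat 1) τ)) =O[comap im atTop] (fun _ => (1 : ℂ)) ∧
    ModGrowth (fun τ => g (mact (cuspMat 2) τ))}
  mul_mem' {a b} ha hb := ⟨fun τ h => (ha.1 τ h).mul (hb.1 τ h),
    by simpa using ha.2.1.mul hb.2.1, by simpa using ha.2.2.1.mul hb.2.2.1, ha.2.2.2.mul hb.2.2.2⟩
  one_mem' := ⟨fun τ h => differentiableAt_const 1, isBigO_refl _ _, isBigO_refl _ _,
    .of_isBigO (isBigO_refl _ _)⟩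
  zero_mem' := ⟨fun τ h => differentiableAt_const 0, isBigO_zero _ _, isBigO_zero _ _,
    .of_isBigO (isBigO_zero _ _)⟩
  add_mem' {a b} ha hb := ⟨fun τ h => (ha.1 τ h).add (hb.1 τ h), ha.2.1.add hb.2.1,
    ha.2.2.1.add hb.2.2.1, ha.2.2.2.add hb.2.2.2⟩
  neg_mem' {a} ha := ⟨fun τ h => (ha.1 τ h).neg, by simpa using ha.2.1.neg_left,
    by simpa using ha.2.2.1.neg_left, ha.2.2.2.neg⟩

theorem const_mem_cuspRing (c : ℂ) : (fun _ => c) ∈ cuspRing :=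
  have h : (fun _ : ℂ => c) =O[comap im atTop] (fun _ => (1 : ℂ)) :=
    isBigO_const_const c one_ne_zero _
  ⟨fun _ _ => differentiableAt_const c, h, h, .of_isBigO h⟩

theorem modGrowth_inv_ellt : ModGrowth (fun τ => 1 / ellt τ) := by
  refine ⟨1, ?_⟩
  refine IsBigO.congr' (isBigO_refl (fun _ : ℂ => (1 : ℂ)) _) ?_ (EventuallyEq.refl _ _)
  filter_upwards [eventually_im_pos] with τ h
  have := ellt_ne_zero h
  field_simp

theorem ellt_mem_cuspRing : ellt ∈ cuspRing := by
  refine ⟨fun τ h => differentiableAt_ellt h, tendsto_ellt.isBigO_one ℂ, ?_, ?_⟩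
  · refine IsBigO.congr' (((tendsto_const_nhds (x := (1 / 16 : ℂ))).sub tendsto_ellt).isBigO_one ℂ)
      ?_ (EventuallyEq.refl _ _)
    filter_upwards [eventually_im_pos] with τ h
    rw [ellt_cusp_one h]
  · obtain ⟨n, hn⟩ := ((ModGrowth.of_isBigO (isBigO_const_const (1 / 16 : ℂ) one_ne_zero _)).add
      ((ModGrowth.of_isBigO (isBigO_const_const (-1 / 256 : ℂ) one_ne_zero _)).mul
        modGrowth_inv_ellt))
    refine ⟨n, IsBigO.congr' hn ?_ (EventuallyEq.refl _ _)⟩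
    filter_upwards [eventually_im_pos] with τ h
    simp only [Pi.add_apply, Pi.mul_apply]
    rw [ellt_cusp_two h]
    ring

theorem differentiableAt_thc3 (h : 0 < τ.im) : DifferentiableAt ℂ thc3 τ := by
  have : DifferentiableAt ℂ th3 (nome τ) := IRep_th3.differentiableAt (norm_nome_lt h)
  exact (this.comp τ differentiable_nome.differentiableAt).pow 2

theorem differentiableAt_rI (hp2 : p % 2 = 1) (i : Option (Fin p)) (h : 0 < τ.im) :
    DifferentiableAt ℂ (rI p i) τ := by
  have hd := heckeRep_det_pos hp2 i
  have h1 : DifferentiableAt ℂ (fun τ => thc3 (mact (heckeRep p i) τ)) τ :=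
    (differentiableAt_thc3 (mact_im_pos hd h)).fun_comp' τ (differentiableAt_mact hd.ne' h)
  have h2 : DifferentiableAt ℂ (mden (heckeRep p i)) τ :=
    (differentiableAt_id.const_mul _).add_const _
  exact (h1.const_mul (p : ℂ)).div (h2.mul (differentiableAt_thc3 h))
    (mul_ne_zero (mden_ne_zero hd.ne' h) (thc3_ne_zero h))

theorem isBigO_rI (hp : 0 < p) (i : Option (Fin p)) :
    rI p i =O[comap im atTop] (fun _ => (1 : ℂ)) := by
  cases i with
  | none => exact (tendsto_rI_none hp).isBigO_one ℂ
  | some j => exact (tendsto_rI_some hp j).isBigO_one ℂ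

theorem rI_mem_cuspRing (hp : p.Prime) (hp2 : p % 2 = 1) (i : Option (Fin p)) :
    rI p i ∈ cuspRing := by
  refine ⟨fun τ h => differentiableAt_rI hp2 i h, isBigO_rI hp.pos i, ?_, 1, ?_⟩
  · obtain ⟨σ, hσ⟩ := exists_perm_cusp_one hp hp2
    obtain ⟨s, hs, hs'⟩ := hσ i
    refine IsBigO.trans (IsBigO.of_bound 1 ?_) (isBigO_rI hp.pos (σ i))
    filter_upwards [eventually_im_pos] with τ h
    rw [(hs' τ h).1]
    rcases hs with e | e <;> simp [e]
  · obtain ⟨σ, hσ⟩ := exists_perm_cusp_two hp hp2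
    have h1 : (fun τ => rI p (σ i) τ ^ 2 * (eI p (σ i) τ * ellt τ)) =O[comap im atTop]
        (fun _ => (1 : ℂ)) := by
      have := ((isBigO_rI hp.pos (σ i)).pow 2).mul
        (((tendsto_eI hp.pos (σ i)).mul tendsto_ellt).isBigO_one ℂ)
      simpa using this
    have h2 : (fun τ => (rI p i (mact (cuspMat 2) τ) * ellt τ ^ 1) ^ 2) =O[comap im atTop]
        (fun _ => (1 : ℂ) ^ 2) := by
      simp only [one_pow]
      refine IsBigO.congr' h1 ?_ (EventuallyEq.refl _ _)
      filter_upwards [eventually_im_pos] with τ h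
      rw [mul_pow, (hσ i τ h).1]
      have := ellt_ne_zero h
      field_simp
    exact IsBigO.of_pow two_ne_zero h2

theorem eI_mem_cuspRing (hp : p.Prime) (hp2 : p % 2 = 1) (i : Option (Fin p)) :
    eI p i ∈ cuspRing := by
  have hd := heckeRep_det_pos hp2 i
  refine ⟨fun τ h => (differentiableAt_ellt (mact_im_pos hd h)).fun_comp' τ
    (differentiableAt_mact hd.ne' h), (tendsto_eI hp.pos i).isBigO_one ℂ, ?_, ?_⟩
  · obtain ⟨σ, hσ⟩ := exists_perm_cusp_one hp hp2
    refine IsBigO.congr' (((tendsto_const_nhds (x := (1 / 16 : ℂ))).sub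
      (tendsto_eI hp.pos (σ i))).isBigO_one ℂ) ?_ (EventuallyEq.refl _ _)
    filter_upwards [eventually_im_pos] with τ h
    obtain ⟨s, hs, hs'⟩ := hσ i
    rw [(hs' τ h).2]
  · obtain ⟨σ, hσ⟩ := exists_perm_cusp_two hp hp2
    have hm : ModGrowth (fun τ => (eI p (σ i) τ)⁻¹) := ⟨p, isBigO_inv_eI hp.one_lt _⟩
    obtain ⟨n, hn⟩ := ((ModGrowth.of_isBigO (isBigO_const_const (1 / 16 : ℂ) one_ne_zero _)).add
      ((ModGrowth.of_isBigO (isBigO_const_const (-1 / 256 : ℂ) one_ne_zero _)).mul hm))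
    refine ⟨n, IsBigO.congr' hn ?_ (EventuallyEq.refl _ _)⟩
    filter_upwards [eventually_im_pos] with τ h
    simp only [Pi.add_apply, Pi.mul_apply]
    rw [(hσ i τ h).2]
    ring

end CuspAsymptotics

section ModularPolynomials
open Complex Topology Asymptotics

variable {M N : Matrix (Fin 2) (Fin 2) ℤ} {τ : ℂ} {p : ℕ}

theorem exists_bound_of_isBigO {g : ℂ → ℂ} (h : g =O[comap im atTop] (fun _ => (1 : ℂ))) :
    ∃ A B : ℝ, ∀ τ : ℂ, 0 < τ.im → A < τ.im → ‖g τ‖ ≤ B := by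
  obtain ⟨B, hB⟩ := h.bound
  obtain ⟨A, hA⟩ := eventually_im_iff.mp hB
  exact ⟨A, B, fun τ h1 h2 => by simpa using hA τ h1 h2⟩

theorem isBigO_of_pole_reduction {f : ℂ → ℂ} (hd : ∀ τ : ℂ, 0 < τ.im → DifferentiableAt ℂ f τ)
    (hp : ∀ τ : ℂ, 0 < τ.im → f (τ + 2) = f τ) (h0 : Tendsto f (comap im atTop) (𝓝 0)) :
    (fun τ => f τ / ellt τ) =O[comap im atTop] (fun _ => (1 : ℂ)) := by
  obtain ⟨A, B, hb⟩ := exists_bound_of_isBigO (h0.isBigO_one ℂ)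
  obtain ⟨F, hF, hfF⟩ := exists_nome_expansion hd hp hb
  have hF0 : DifferentiableAt ℂ F 0 := hF.differentiableAt (Metric.ball_mem_nhds 0 one_pos)
  have hF00 : F 0 = 0 := by
    refine tendsto_nhds_unique (hF0.continuousAt.tendsto.comp tendsto_nome) (h0.congr' ?_)
    filter_upwards [eventually_im_pos] with τ h using hfF τ h
  have h1 : (fun q => F q) =O[𝓝 0] (fun q : ℂ => q) := by
    simpa [hF00] using hF0.isBigO_sub
  have h2 := h1.comp_tendsto tendsto_nome
  have h3 : (fun τ => nome τ / ellt τ) =O[comap im atTop] (fun _ => (1 : ℂ)) := by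
    refine ((tendsto_ell0_nome.inv₀ one_ne_zero).isBigO_one ℂ).congr_left fun τ => ?_
    have := nome_ne_zero τ
    rw [ellt_eq]; field_simp
  have h4 : (fun τ => f τ / ellt τ) =O[comap im atTop] (fun τ => nome τ / ellt τ) := by
    have := h2.mul (isBigO_refl (fun τ => (ellt τ)⁻¹) (comap im atTop))
    refine IsBigO.congr' this ?_ ?_
    · filter_upwards [eventually_im_pos] with τ h
      rw [hfF τ h, Function.comp_apply, div_eq_mul_inv]
    · exact EventuallyEq.of_eq (funext fun τ => by simp [div_eq_mul_inv])
  exact h4.trans h3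

theorem exists_polynomial_aux (n : ℕ) : ∀ {g : ℂ → ℂ},
    (∀ τ : ℂ, 0 < τ.im → DifferentiableAt ℂ g τ) →
    (∀ γ, InP 1 γ → ∀ τ : ℂ, 0 < τ.im → g (mact γ τ) = g τ) →
    g =O[comap im atTop] (fun _ => (1 : ℂ)) →
    (fun τ => g (mact (cuspMat 1) τ)) =O[comap im atTop] (fun _ => (1 : ℂ)) →
    (fun τ => g (mact (cuspMat 2) τ) * ellt τ ^ n) =O[comap im atTop] (fun _ => (1 : ℂ)) →
    ∃ P : Polynomial ℂ, ∀ τ : ℂ, 0 < τ.im → g τ = P.eval (ellt τ) := by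
  induction n with
  | zero =>
    intro g hd hinv h0 h1 h2
    obtain ⟨c, hc⟩ := const_of_bounded_at_cusps hd hinv (by
      intro k
      apply exists_bound_of_isBigO
      fin_cases k
      · simpa [mact_cuspMat_zero] using h0
      · simpa using h1
      · simpa using h2)
    exact ⟨Polynomial.C c, fun τ h => by simp [hc τ h]⟩
  | succ n ih =>
    intro g hd hinv h0 h1 h2
    have hT : ∀ {g : ℂ → ℂ} (hd : ∀ τ : ℂ, 0 < τ.im → DifferentiableAt ℂ g τ) (τ : ℂ), 0 < τ.im →
        DifferentiableAt ℂ (fun τ => g (mact (cuspMat 2) τ) * ellt τ ^ (n + 1)) τ := by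
      intro g hd τ h
      have hc := cuspMat_det_pos 2
      exact ((hd _ (mact_im_pos hc h)).fun_comp' τ (differentiableAt_mact hc.ne' h)).mul
        ((differentiableAt_ellt h).pow _)
    have hP : ∀ {g : ℂ → ℂ} (hinv : ∀ γ, InP 1 γ → ∀ τ : ℂ, 0 < τ.im → g (mact γ τ) = g τ) (τ : ℂ),
        0 < τ.im → g (mact (cuspMat 2) (τ + 2)) * ellt (τ + 2) ^ (n + 1) =
          g (mact (cuspMat 2) τ) * ellt τ ^ (n + 1) := by
      intro g hinv τ h
      have := invariant_comp_mact hinv (cuspMat_det 2) _ (InP.shear 1) τ h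
      rw [mact_shear] at this
      rw [ellt, nome_add_two, ← ellt]
      congr 1
      simpa using this
    obtain ⟨A, B, hb⟩ := exists_bound_of_isBigO h2
    obtain ⟨F, hF, hfF⟩ := exists_nome_expansion (hT hd) (hP hinv) hb
    have hF0 : DifferentiableAt ℂ F 0 := hF.differentiableAt (Metric.ball_mem_nhds 0 one_pos)
    have hlim : Tendsto (fun τ => g (mact (cuspMat 2) τ) * ellt τ ^ (n + 1)) (comap im atTop)
        (𝓝 (F 0)) := by
      refine (hF0.continuousAt.tendsto.comp tendsto_nome).congr' ?_
      filter_upwards [eventually_im_pos] with τ h using (hfF τ h).symm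
    set c : ℂ := F 0 * (-256) ^ (n + 1) with hc
    set g' : ℂ → ℂ := fun τ => g τ - c * ellt τ ^ (n + 1) with hg'
    have hel := ellt_mem_cuspRing
    have hcR : (fun τ => c * ellt τ ^ (n + 1)) ∈ cuspRing :=
      cuspRing.mul_mem (const_mem_cuspRing c) (cuspRing.pow_mem hel (n + 1))
    have hd' : ∀ τ : ℂ, 0 < τ.im → DifferentiableAt ℂ g' τ := fun τ h => (hd τ h).sub (hcR.1 τ h)
    have hinv' : ∀ γ, InP 1 γ → ∀ τ : ℂ, 0 < τ.im → g' (mact γ τ) = g' τ := by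
      intro γ hγ τ h
      simp only [hg', hinv γ hγ τ h, hγ.ellt_mact h]
    have hlim' : Tendsto (fun τ => g' (mact (cuspMat 2) τ) * ellt τ ^ (n + 1)) (comap im atTop)
        (𝓝 0) := by
      have h3 : Tendsto (fun τ => c * ((16 * ellt τ - 1) / 256) ^ (n + 1)) (comap im atTop)
          (𝓝 (c * ((16 * 0 - 1) / 256) ^ (n + 1))) :=
        ((((tendsto_ellt.const_mul 16).sub_const 1).div_const 256).pow (n + 1)).const_mul c
      have h4 := hlim.sub h3
      have h5 : F 0 - c * ((16 * 0 - 1) / 256) ^ (n + 1) = 0 := by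
        rw [hc, mul_assoc, ← mul_pow]; norm_num
      rw [h5] at h4
      refine h4.congr' ?_
      filter_upwards [eventually_im_pos] with τ h
      simp only [hg']
      rw [ellt_cusp_two h, sub_mul, mul_assoc c, ← mul_pow]
      congr 3
      have := ellt_ne_zero h
      field_simp; ring
    obtain ⟨P, hPP⟩ := ih hd' hinv' (h0.sub hcR.2.1) (h1.sub hcR.2.2.1) (by
      refine IsBigO.congr' (isBigO_of_pole_reduction (hT hd') (hP hinv') hlim') ?_
        (EventuallyEq.refl _ _)
      filter_upwards [eventually_im_pos] with τ h
      have := ellt_ne_zero h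
      rw [pow_succ, ← mul_assoc, mul_div_cancel_right₀ _ this])
    refine ⟨P + Polynomial.C c * Polynomial.X ^ (n + 1), fun τ h => ?_⟩
    have := hPP τ h
    simp only [hg'] at this
    simp only [Polynomial.eval_add, Polynomial.eval_mul, Polynomial.eval_C, Polynomial.eval_pow,
      Polynomial.eval_X]
    rw [← this]; ring

theorem exists_polynomial {g : ℂ → ℂ} (hg : g ∈ cuspRing)
    (hinv : ∀ γ, InP 1 γ → ∀ τ : ℂ, 0 < τ.im → g (mact γ τ) = g τ) :
    ∃ P : Polynomial ℂ, ∀ τ : ℂ, 0 < τ.im → g τ = P.eval (ellt τ) := by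
  obtain ⟨hd, h0, h1, n, h2⟩ := hg
  exact exists_polynomial_aux n hd hinv h0 h1 h2

/-- The power sums of the Hecke correspondence. -/
theorem exists_trace_polynomial (hp : p.Prime) (hp2 : p % 2 = 1) (a b : ℕ) :
    ∃ P : Polynomial ℂ, ∀ τ : ℂ, 0 < τ.im →
      ∑ i, rI p i τ ^ a * eI p i τ ^ b = P.eval (ellt τ) := by
  refine exists_polynomial (g := fun τ => ∑ i, rI p i τ ^ a * eI p i τ ^ b) ?_ ?_
  · have : (fun τ => ∑ i, rI p i τ ^ a * eI p i τ ^ b) = ∑ i, rI p i ^ a * eI p i ^ b := by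
      ext τ; simp
    rw [this]
    exact cuspRing.sum_mem fun i _ => cuspRing.mul_mem (cuspRing.pow_mem (rI_mem_cuspRing hp hp2 i) a)
      (cuspRing.pow_mem (eI_mem_cuspRing hp hp2 i) b)
  · intro γ hγ τ h
    obtain ⟨σ, hσ⟩ := exists_perm_rI_inP hp hp2 hγ
    simp only [(hσ _ τ h).1, (hσ _ τ h).2]
    exact Equiv.sum_comp σ (fun i => rI p i τ ^ a * eI p i τ ^ b)

/-- The modular equation. -/
theorem exists_modular_polynomial (hp : p.Prime) (hp2 : p % 2 = 1) :
    ∃ P : Polynomial ℂ, ∀ τ : ℂ, 0 < τ.im →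
      ∏ i, (eI p i τ - ellt τ) = P.eval (ellt τ) := by
  refine exists_polynomial (g := fun τ => ∏ i, (eI p i τ - ellt τ)) ?_ ?_
  · have : (fun τ => ∏ i, (eI p i τ - ellt τ)) = ∏ i, (eI p i - ellt) := by
      ext τ; simp
    rw [this]
    exact cuspRing.prod_mem fun i _ => cuspRing.sub_mem (eI_mem_cuspRing hp hp2 i) ellt_mem_cuspRing
  · intro γ hγ τ h
    obtain ⟨σ, hσ⟩ := exists_perm_rI_inP hp hp2 hγ
    simp only [(hσ _ τ h).2, hγ.ellt_mact h]
    exact Equiv.prod_comp σ (fun i => eI p i τ - ellt τ)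

theorem exists_numerator_polynomial (hp : p.Prime) (hp2 : p % 2 = 1) (a : ℕ) :
    ∃ P : Polynomial ℂ, ∀ τ : ℂ, 0 < τ.im →
      ∑ i, rI p i τ ^ a * ∏ j, (if j = i then 1 else eI p j τ - ellt τ) = P.eval (ellt τ) := by
  refine exists_polynomial
    (g := fun τ => ∑ i, rI p i τ ^ a * ∏ j, (if j = i then 1 else eI p j τ - ellt τ)) ?_ ?_
  · have : (fun τ => ∑ i, rI p i τ ^ a * ∏ j, (if j = i then 1 else eI p j τ - ellt τ)) =
        ∑ i, rI p i ^ a * ∏ j, (if j = i then 1 else eI p j - ellt) := by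
      ext τ
      simp only [Finset.sum_apply, Pi.mul_apply, Pi.pow_apply, Finset.prod_apply]
      refine Finset.sum_congr rfl fun i _ => ?_
      congr 1
      refine Finset.prod_congr rfl fun j _ => ?_
      split_ifs <;> rfl
    rw [this]
    refine cuspRing.sum_mem fun i _ => cuspRing.mul_mem
      (cuspRing.pow_mem (rI_mem_cuspRing hp hp2 i) a) (cuspRing.prod_mem fun j _ => ?_)
    split_ifs
    · exact cuspRing.one_mem
    · exact cuspRing.sub_mem (eI_mem_cuspRing hp hp2 j) ellt_mem_cuspRing
  · intro γ hγ τ h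
    obtain ⟨σ, hσ⟩ := exists_perm_rI_inP hp hp2 hγ
    simp only [(hσ _ τ h).1, (hσ _ τ h).2, hγ.ellt_mact h]
    rw [← Equiv.sum_comp σ (fun i => rI p i τ ^ a * ∏ j, (if j = i then 1 else eI p j τ - ellt τ))]
    refine Finset.sum_congr rfl fun i _ => ?_
    rw [← Equiv.prod_comp σ (fun j => if j = σ i then 1 else eI p j τ - ellt τ)]
    simp only [σ.injective.eq_iff]

end ModularPolynomials

section PartialFractions
open Polynomial Topology Bornology

theorem exists_polynomial_of_removable {N D : ℂ[X]} (hD : D ≠ 0)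
    (h : ∀ x, D.IsRoot x → ∃ L : Filter ℂ, L.NeBot ∧ Tendsto id L (𝓝 x) ∧ (∀ᶠ t in L, t ≠ x) ∧
      Tendsto (fun t => (t - x) * (N.eval t / D.eval t)) L (𝓝 0)) :
    ∃ Q : ℂ[X], N = Q * D := by
  obtain ⟨g, A, B, hco, hN, hDe⟩ : ∃ g A B : ℂ[X], IsCoprime A B ∧ N = g * A ∧ D = g * B := by
    have hg : gcd N D ≠ 0 := gcd_ne_zero_of_right hD
    obtain ⟨A, hA⟩ := gcd_dvd_left N D
    obtain ⟨B, hB⟩ := gcd_dvd_right N D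
    refine ⟨gcd N D, A, B, ?_, hA, hB⟩
    obtain ⟨u, v, huv⟩ := exists_gcd_eq_mul_add_mul N D
    refine ⟨u, v, mul_left_cancel₀ hg ?_⟩
    rw [mul_one]
    calc gcd N D * (u * A + v * B) = (gcd N D * A) * u + (gcd N D * B) * v := by ring
      _ = N * u + D * v := by rw [← hA, ← hB]
      _ = gcd N D := huv.symm
  have hg0 : g ≠ 0 := left_ne_zero_of_mul (hDe ▸ hD)
  have hB0 : B ≠ 0 := right_ne_zero_of_mul (hDe ▸ hD)
  have hB : B.degree ≤ 0 := by
    by_contra hdeg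
    obtain ⟨x, hx⟩ := Complex.exists_root (not_le.mp hdeg)
    obtain ⟨L, hL, hid, hne, hlim⟩ := h x (by rw [IsRoot, hDe, eval_mul, hx, mul_zero])
    obtain ⟨C, hC⟩ := dvd_iff_isRoot.mpr hx
    have hDx : ∀ᶠ t in L, g.eval t ≠ 0 ∧ B.eval t ≠ 0 := by
      have hfin : {t | D.eval t = 0}.Finite := by
        refine (D.roots.toFinset.finite_toSet).subset fun t ht => ?_
        simpa [hD] using ht
      have hev : ∀ᶠ t in 𝓝 x, t ∈ ({t | D.eval t = 0} \ {x})ᶜ :=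
        (hfin.subset Set.sdiff_subset).isClosed.isOpen_compl.mem_nhds (by simp)
      filter_upwards [hid.eventually hev, hne] with t h1 h2
      have : D.eval t ≠ 0 := fun e => h1 ⟨e, h2⟩
      rw [hDe, eval_mul] at this
      exact ⟨left_ne_zero_of_mul this, right_ne_zero_of_mul this⟩
    have h1 : Tendsto (fun t => A.eval t) L (𝓝 (A.eval x)) :=
      (A.continuous.tendsto x).comp hid
    have h2 : Tendsto (fun t => C.eval t) L (𝓝 (C.eval x)) :=
      (C.continuous.tendsto x).comp hid
    have h3 := hlim.mul h2
    rw [zero_mul] at h3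
    have h4 : A.eval x = 0 := by
      refine tendsto_nhds_unique h1 (h3.congr' ?_)
      filter_upwards [hDx] with t ⟨e1, e2⟩
      rw [hN, hDe, eval_mul, eval_mul, mul_div_mul_left _ _ e1]
      have e3 : B.eval t = (t - x) * C.eval t := by rw [hC]; simp
      rw [e3] at e2 ⊢
      have := left_ne_zero_of_mul e2
      have := right_ne_zero_of_mul e2
      field_simp
    obtain ⟨u, v, huv⟩ := hco
    have := congrArg (eval x) huv
    rw [IsRoot] at hx
    simp [h4, hx] at this
  rw [eq_C_of_degree_le_zero hB] at hDe hB0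
  have hb : B.coeff 0 ≠ 0 := fun e => hB0 (by rw [e, C_0])
  refine ⟨A * C (B.coeff 0)⁻¹, ?_⟩
  rw [hN, hDe]
  calc g * A = g * A * C ((B.coeff 0)⁻¹ * B.coeff 0) := by rw [inv_mul_cancel₀ hb, C_1, mul_one]
    _ = _ := by rw [C_mul]; ring

theorem exists_partial_fractions {N D : ℂ[X]} (hD : D ≠ 0) {S : Finset ℂ} {ρ : ℂ → ℂ}
    (hS : ∀ x, D.IsRoot x → x ∈ S)
    (h : ∀ x ∈ S, ∃ L : Filter ℂ, L.NeBot ∧ Tendsto id L (𝓝 x) ∧ (∀ᶠ t in L, t ≠ x) ∧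
      Tendsto (fun t => (t - x) * (N.eval t / D.eval t)) L (𝓝 (ρ x))) :
    ∃ Q : ℂ[X], ∀ t ∉ S, N.eval t / D.eval t = Q.eval t + ∑ x ∈ S, ρ x / (t - x) := by
  set E : ℂ[X] := ∏ x ∈ S, (X - C x) with hE
  have hE0 : E ≠ 0 := prod_ne_zero_iff.mpr fun x _ => X_sub_C_ne_zero x
  have hEe : ∀ t, E.eval t = ∏ x ∈ S, (t - x) := fun t => by rw [hE, eval_prod]; simp
  set R : ℂ[X] := ∑ x ∈ S, C (ρ x) * ∏ y ∈ S.erase x, (X - C y) with hR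
  have hRe : ∀ t ∉ S, R.eval t / E.eval t = ∑ x ∈ S, ρ x / (t - x) := by
    intro t ht
    rw [hR, hEe, eval_finset_sum, sum_div]
    refine sum_congr rfl fun x hx => ?_
    have h1 : t - x ≠ 0 := sub_ne_zero.mpr fun e => ht (e ▸ hx)
    have h2 : ∏ y ∈ S.erase x, (t - y) ≠ 0 :=
      prod_ne_zero_iff.mpr fun y hy => sub_ne_zero.mpr fun e => ht (e ▸ mem_of_mem_erase hy)
    rw [← mul_prod_erase S _ hx, eval_mul, eval_C, eval_prod]
    simp only [eval_sub, eval_X, eval_C]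
    rw [mul_div_mul_right _ _ h2]
  have hEt : ∀ t ∉ S, E.eval t ≠ 0 := fun t ht => by
    rw [hEe]; exact prod_ne_zero_iff.mpr fun y hy => sub_ne_zero.mpr fun e => ht (e ▸ hy)
  have hDt : ∀ t ∉ S, D.eval t ≠ 0 := fun t ht e => ht (hS t e)
  obtain ⟨Q, hQ⟩ := exists_polynomial_of_removable (N := N * E - R * D) (D := D * E)
    (mul_ne_zero hD hE0) (by
      intro x hx
      have hxS : x ∈ S := by
        rw [IsRoot, eval_mul, mul_eq_zero] at hx
        rcases hx with hx | hx
        · exact hS x hx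
        · rw [hEe, prod_eq_zero_iff] at hx
          obtain ⟨y, hy, e⟩ := hx
          rwa [sub_eq_zero.mp e]
      obtain ⟨L, hL, hid, hne, hlim⟩ := h x hxS
      refine ⟨L, hL, hid, hne, ?_⟩
      have hnS : ∀ᶠ t in L, t ∉ S := by
        have hev : ∀ᶠ t in 𝓝 x, t ∈ ((S.erase x : Finset ℂ) : Set ℂ)ᶜ :=
          (S.erase x).finite_toSet.isClosed.isOpen_compl.mem_nhds (by simp)
        filter_upwards [hid.eventually hev, hne] with t h1 h2 h3
        exact h1 (mem_coe.mpr (mem_erase.mpr ⟨h2, h3⟩))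
      have hothers : Tendsto (fun t => ∑ y ∈ S.erase x, (t - x) * (ρ y / (t - y))) L (𝓝 0) := by
        have : Tendsto (fun t => ∑ y ∈ S.erase x, (t - x) * (ρ y / (t - y))) L
            (𝓝 (∑ y ∈ S.erase x, (x - x) * (ρ y / (x - y)))) := by
          refine tendsto_finsetSum _ fun y hy => ?_
          have hid' : Tendsto (fun t : ℂ => t) L (𝓝 x) := hid
          exact (hid'.sub_const x).mul (tendsto_const_nhds.div (hid'.sub_const y)
            (sub_ne_zero.mpr (ne_of_mem_erase hy).symm))
        simpa using this
      have h1 := (hlim.sub_const (ρ x)).sub hothers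
      rw [sub_self, sub_zero] at h1
      refine h1.congr' ?_
      filter_upwards [hnS, hne] with t ht htx
      have e1 : (N * E - R * D).eval t / (D * E).eval t = N.eval t / D.eval t
          - R.eval t / E.eval t := by
        have := hEt t ht
        have := hDt t ht
        simp only [eval_sub, eval_mul]
        field_simp
      rw [e1, hRe t ht, ← add_sum_erase S _ hxS, mul_sub, mul_add, mul_sum,
        mul_div_cancel₀ _ (sub_ne_zero.mpr htx)]
      ring)
  refine ⟨Q, fun t ht => ?_⟩
  rw [← hRe t ht]
  have := congrArg (eval t) hQ
  simp only [eval_sub, eval_mul] at this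
  have h1 := hEt t ht
  have h2 := hDt t ht
  field_simp
  linear_combination this

theorem tendsto_inv_id_cobounded {L : Filter ℂ} (hL : L ≤ cobounded ℂ) :
    Tendsto (fun t : ℂ => t⁻¹) L (𝓝 0) := tendsto_inv₀_cobounded.mono_left hL

theorem exists_coeff_limit (P : ℂ[X]) (i : ℕ) {L : Filter ℂ} (hL : L ≤ cobounded ℂ) :
    ∃ Q : ℂ[X], Tendsto (fun t => P.eval t / t ^ i - t * Q.eval t) L (𝓝 (P.coeff i)) := by
  have hne : ∀ᶠ t in L, t ≠ 0 := hL (eventually_ne_cobounded 0)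
  induction P using Polynomial.induction_on' with
  | add P₁ P₂ h₁ h₂ =>
    obtain ⟨Q₁, h₁⟩ := h₁
    obtain ⟨Q₂, h₂⟩ := h₂
    refine ⟨Q₁ + Q₂, ?_⟩
    rw [coeff_add]
    refine (h₁.add h₂).congr fun t => ?_
    simp only [eval_add]; ring
  | monomial m a =>
    rw [coeff_monomial]
    rcases lt_trichotomy m i with hm | hm | hm
    · refine ⟨0, ?_⟩
      rw [if_neg hm.ne]
      have := ((tendsto_inv_id_cobounded hL).pow (i - m)).const_mul a
      rw [zero_pow (by omega), mul_zero] at this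
      refine this.congr' ?_
      filter_upwards [hne] with t ht
      obtain ⟨d, rfl⟩ := Nat.exists_eq_add_of_lt hm
      have : m + d + 1 - m = d + 1 := by omega
      rw [eval_monomial, eval_zero, mul_zero, sub_zero, this, inv_pow]
      field_simp
      ring
    · refine ⟨0, ?_⟩
      rw [if_pos hm, hm]
      refine tendsto_const_nhds.congr' ?_
      filter_upwards [hne] with t ht
      rw [eval_monomial, eval_zero, mul_zero, sub_zero, mul_div_cancel_right₀ _ (pow_ne_zero i ht)]
    · refine ⟨monomial (m - i - 1) a, ?_⟩
      rw [if_neg hm.ne']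
      refine tendsto_const_nhds.congr' ?_
      filter_upwards [hne] with t ht
      obtain ⟨d, rfl⟩ := Nat.exists_eq_add_of_lt hm
      have : i + d + 1 - i - 1 = d := by omega
      rw [eval_monomial, eval_monomial, this]
      field_simp
      ring

theorem tendsto_div_sub_cobounded (ρ x : ℂ) {L : Filter ℂ} (hL : L ≤ cobounded ℂ) :
    Tendsto (fun t => t * (ρ / (t - x))) L (𝓝 ρ) := by
  have hne : ∀ᶠ t in L, t ≠ 0 := hL (eventually_ne_cobounded 0)
  have h1 := (tendsto_const_nhds (x := ρ)).div
    (((tendsto_inv_id_cobounded hL).const_mul x).const_sub 1) (by simp)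
  rw [mul_zero, sub_zero, div_one] at h1
  refine h1.congr' ?_
  filter_upwards [hne] with t ht
  simp only [Pi.div_apply]
  by_cases htx : t = x
  · subst htx; simp [ht]
  have : t - x ≠ 0 := sub_ne_zero.mpr htx
  have h3 : 1 - x * t⁻¹ ≠ 0 := by
    intro e; apply this
    field_simp at e
    simpa using e
  field_simp

/-- The residue theorem for a rational function plus a polar part at the origin. -/
theorem sum_residues {N D : ℂ[X]} (hD : D ≠ 0) {S : Finset ℂ} {ρ : ℂ → ℂ}
    (hS : ∀ x, D.IsRoot x → x ∈ S)
    (h : ∀ x ∈ S, ∃ L : Filter ℂ, L.NeBot ∧ Tendsto id L (𝓝 x) ∧ (∀ᶠ t in L, t ≠ x) ∧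
      Tendsto (fun t => (t - x) * (N.eval t / D.eval t)) L (𝓝 (ρ x)))
    {L : Filter ℂ} [L.NeBot] (hL : L ≤ cobounded ℂ) {n : ℕ} {T : ℕ → ℂ[X]} {c : ℂ}
    (hc : Tendsto (fun t => t * (N.eval t / D.eval t) + ∑ i ∈ range n, (T i).eval t / t ^ i) L
      (𝓝 c)) :
    ∑ x ∈ S, ρ x + ∑ i ∈ range n, (T i).coeff i = c := by
  obtain ⟨Q, hQ⟩ := exists_partial_fractions hD hS h
  choose q hq using fun i => exists_coeff_limit (T i) i hL
  have hnS : ∀ᶠ t in L, t ∉ S := by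
    refine hL ?_
    have : IsBounded (S : Set ℂ) := S.finite_toSet.isBounded
    exact isBounded_def.mp this
  have h1 : Tendsto (fun t => ∑ x ∈ S, t * (ρ x / (t - x))) L (𝓝 (∑ x ∈ S, ρ x)) :=
    tendsto_finsetSum _ fun x _ => tendsto_div_sub_cobounded _ _ hL
  have h2 : Tendsto (fun t => ∑ i ∈ range n, ((T i).eval t / t ^ i - t * (q i).eval t)) L
      (𝓝 (∑ i ∈ range n, (T i).coeff i)) := tendsto_finsetSum _ fun i _ => hq i
  set W : ℂ[X] := Q + ∑ i ∈ range n, q i with hW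
  have h3 : Tendsto (fun t => (X * W).eval t) L
      (𝓝 (c - (∑ x ∈ S, ρ x + ∑ i ∈ range n, (T i).coeff i))) := by
    refine (hc.sub (h1.add h2)).congr' ?_
    filter_upwards [hnS] with t ht
    rw [hQ t ht, hW]
    simp only [eval_mul, eval_X, eval_add, eval_finset_sum, mul_add, mul_sum, sum_sub_distrib]
    ring
  by_cases hW0 : W = 0
  · simp only [hW0, mul_zero, eval_zero] at h3
    have := tendsto_nhds_unique h3 tendsto_const_nhds
    exact (sub_eq_zero.mp this).symm
  · exfalso
    have hdeg : 0 < (X * W).degree := by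
      rw [degree_mul, degree_X, degree_eq_natDegree hW0]
      exact_mod_cast (by omega)
    have h4 := tendsto_norm_atTop (X * W) hdeg (tendsto_norm_cobounded_atTop.mono_left hL)
    exact not_tendsto_nhds_of_tendsto_atTop h4 _ h3.norm

end PartialFractions

section Residues
open Complex Topology Asymptotics

variable {M N : Matrix (Fin 2) (Fin 2) ℤ} {τ : ℂ} {p : ℕ}

theorem sum_mul_prod_div {ι : Type*} [Fintype ι] [DecidableEq ι] (c x : ι → ℂ)
    (hx : ∏ i, x i ≠ 0) :
    (∑ i, c i * ∏ j, (if j = i then 1 else x j)) / ∏ i, x i = ∑ i, c i / x i := by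
  rw [sum_div]
  refine sum_congr rfl fun i _ => ?_
  have h0 := prod_ne_zero_iff.mp hx
  have h1 : ∏ j, x j = (∏ j, (if j = i then 1 else x j)) * x i := by
    have : ∀ j, x j = (if j = i then 1 else x j) * (if j = i then x j else 1) := fun j => by
      split_ifs <;> simp
    rw [prod_congr rfl fun j _ => this j, prod_mul_distrib, prod_ite_eq' univ i x]
    simp
  rw [h1] at hx ⊢
  rw [mul_comm _ (x i), mul_div_mul_right _ _ (left_ne_zero_of_mul hx)]

theorem hasDerivAt_mact (hM : M.det ≠ 0) (h : 0 < τ.im) :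
    HasDerivAt (mact M) (M.det / mden M τ ^ 2) τ := by
  have hd := mden_ne_zero hM h
  have h1 : HasDerivAt (fun τ : ℂ => (M 0 0 : ℂ) * τ + M 0 1) (M 0 0) τ := by
    simpa using ((hasDerivAt_id τ).const_mul (M 0 0 : ℂ)).add_const (M 0 1 : ℂ)
  have h2 : HasDerivAt (fun τ : ℂ => (M 1 0 : ℂ) * τ + M 1 1) (M 1 0) τ := by
    simpa using ((hasDerivAt_id τ).const_mul (M 1 0 : ℂ)).add_const (M 1 1 : ℂ)
  have h3 := h1.div h2 hd
  have e : (M.det : ℂ) / mden M τ ^ 2 = ((M 0 0 : ℂ) * mden M τ -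
      ((M 0 0 : ℂ) * τ + M 0 1) * M 1 0) / mden M τ ^ 2 := by
    congr 1
    rw [Matrix.det_fin_two, mden]; push_cast; ring
  rw [e]
  exact h3

theorem mden_root (hfix : mact M τ = τ) (hM : M.det ≠ 0) (h : 0 < τ.im) :
    mden M τ ^ 2 - (M 0 0 + M 1 1) * mden M τ + M.det = 0 := by
  have hd := mden_ne_zero hM h
  have h1 : (M 0 0 : ℂ) * τ + M 0 1 = τ * mden M τ := by
    rw [mact, div_eq_iff] at hfix
    · exact hfix
    · exact hd
  rw [Matrix.det_fin_two]
  rw [mden] at h1 ⊢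
  push_cast
  linear_combination -(M 1 0 : ℂ) * h1

theorem mden_fixed (hfix : mact M τ = τ) (hM : M.det ≠ 0) (hc : M 1 0 ≠ 0) (h : 0 < τ.im) :
    (starRingEnd ℂ) (mden M τ) + mden M τ = (M 0 0 + M 1 1 : ℤ) ∧
      (starRingEnd ℂ) (mden M τ) * mden M τ = M.det ∧
      (starRingEnd ℂ) (mden M τ) - mden M τ ≠ 0 := by
  have h1 := mden_root hfix hM h
  have h2 := congrArg (starRingEnd ℂ) h1
  simp only [map_add, map_sub, map_mul, map_pow, map_intCast, map_zero] at h2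
  set α := mden M τ with hα
  have him : α.im = M 1 0 * τ.im := by simp [hα, mden]
  have hne : (starRingEnd ℂ) α - α ≠ 0 := by
    intro e
    have := congrArg im e
    simp only [sub_im, conj_im, zero_im] at this
    have h0 : α.im = 0 := by linarith
    rw [him] at h0
    rcases mul_eq_zero.mp h0 with h0 | h0
    · exact hc (by exact_mod_cast h0)
    · exact h.ne' h0
  have h3 : (starRingEnd ℂ) α + α = (M 0 0 + M 1 1 : ℤ) := by
    push_cast
    refine mul_left_cancel₀ hne ?_
    linear_combination h2 - h1
  refine ⟨h3, ?_, hne⟩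
  push_cast at h3
  linear_combination α * h3 - h1

theorem one_zero_ne_zero_of_fixed (hfix : mact M τ = τ) {p : ℕ} (hp : p.Prime) (hM : InM p M)
    (h : 0 < τ.im) : M 1 0 ≠ 0 := by
  intro hc
  have hd := hM.1
  rw [Matrix.det_fin_two, hc, mul_zero, sub_zero] at hd
  have h0 : (M 1 1 : ℂ) ≠ 0 := by
    have : M 1 1 ≠ 0 := fun e => by
      rw [e, mul_zero] at hd; exact hp.ne_zero (by exact_mod_cast hd.symm)
    exact_mod_cast this
  rw [mact, hc] at hfix
  have h1 : (M 0 0 : ℂ) * τ + M 0 1 = τ * M 1 1 := by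
    rw [div_eq_iff (by simpa using h0)] at hfix
    simpa using hfix
  have h2 := congrArg im h1
  simp only [add_im, mul_im, intCast_re, intCast_im, zero_mul, add_zero, mul_zero, zero_add] at h2
  have h3 : (M 0 0 : ℝ) = M 1 1 := mul_right_cancel₀ h.ne' (by linarith)
  have h4 : M 0 0 = M 1 1 := by exact_mod_cast h3
  rw [h4] at hd
  have h5 : (M 1 1).natAbs * (M 1 1).natAbs = p := by
    have := congrArg Int.natAbs hd
    rwa [Int.natAbs_mul, Int.natAbs_natCast] at this
  rcases Nat.isUnit_iff.mp (hp.isUnit_or_isUnit h5.symm |>.elim id id) with h6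
  rw [h6] at h5
  exact hp.one_lt.ne (by simpa using h5)

/-- A coincidence of values of the modular function comes from an integral matrix. -/
theorem exists_fixing_matrix (hp : p.Prime) (hp2 : p % 2 = 1) {i : Option (Fin p)} (h : 0 < τ.im)
    (he : eI p i τ = ellt τ) : ∃ M γ, InM p M ∧ InM 1 γ ∧ M = γ * heckeRep p i ∧ mact M τ = τ ∧
      rI p i τ = p / mden M τ := by
  have hd := heckeRep_det_pos hp2 i
  obtain ⟨γ, hγ, e⟩ := pEquiv_of_ellt_eq (mact_im_pos hd h) h he
  obtain ⟨γ', hγ', e'⟩ : ∃ γ', InM 1 γ' ∧ τ = mact γ' (mact (heckeRep p i) τ) := by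
    rcases hγ.cases with h' | h'
    · exact ⟨γ, h', e⟩
    · exact ⟨-γ, h', by rwa [mact_neg]⟩
  have hfix : mact (γ' * heckeRep p i) τ = τ := by
    rw [mact_mul (hγ'.det_pos one_pos) hd h, ← e']
  refine ⟨_, γ', by simpa using hγ'.mul (heckeRep_inM hp2 i), hγ', rfl, hfix, ?_⟩
  rw [rI, ← rr_mul_left hγ' hd h, rr, hfix, mul_div_mul_right _ _ (thc3_ne_zero h)]

theorem sq_mden_ne (hp : p.Prime) (hM : InM p M) (hfix : mact M τ = τ) (h : 0 < τ.im) :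
    ((p : ℂ) / mden M τ) ^ 2 ≠ p ∧ (p : ℂ) / mden M τ = (starRingEnd ℂ) (mden M τ) := by
  have hp0 : (p : ℂ) ≠ 0 := by exact_mod_cast hp.ne_zero
  have hdet : M.det ≠ 0 := by rw [hM.1]; exact_mod_cast hp.ne_zero
  have hd := mden_ne_zero hdet h
  obtain ⟨-, h2, h3⟩ := mden_fixed hfix hdet (one_zero_ne_zero_of_fixed hfix hp hM h) h
  rw [hM.1, Int.cast_natCast] at h2
  have h4 : (p : ℂ) / mden M τ = (starRingEnd ℂ) (mden M τ) := by
    rw [← h2, mul_div_cancel_right₀ _ hd]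
  refine ⟨fun e => h3 ?_, h4⟩
  rw [h4, ← h2, sq] at e
  have h5 : (starRingEnd ℂ) (mden M τ) ≠ 0 := by simpa using hd
  rw [mul_left_cancel₀ h5 e, sub_self]

theorem hasDerivAt_eI (hp2 : p % 2 = 1) (i : Option (Fin p)) (h : 0 < τ.im) :
    HasDerivAt (eI p i) (Real.pi * I * (eI p i τ * (1 - 16 * eI p i τ) * thc3 τ ^ 2)
      * (rI p i τ ^ 2 / p)) τ := by
  have hd := heckeRep_det_pos hp2 i
  have h1 := (hasStrictDerivAt_ellt (mact_im_pos hd h)).hasDerivAt.comp τ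
    (hasDerivAt_mact hd.ne' h)
  refine h1.congr_deriv ?_
  have h3 := thc3_ne_zero h
  have h4 := mden_ne_zero hd.ne' h
  have h5 : (p : ℂ) ≠ 0 := by exact_mod_cast (by omega)
  rw [(heckeRep_inM hp2 i).1, rI, rr, eI]
  push_cast
  field_simp

/-- The local contribution at an interior point. -/
theorem tendsto_residue_interior (hp : p.Prime) (hp2 : p % 2 = 1) (a : ℕ) (i : Option (Fin p))
    (h : 0 < τ.im) :
    Tendsto (fun z => (ellt z - ellt τ) * (rI p i z ^ a / (eI p i z - ellt z))) (𝓝[≠] τ)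
      (𝓝 (if eI p i τ = ellt τ then p * rI p i τ ^ a / (rI p i τ ^ 2 - p) else 0)) := by
  have hr : Tendsto (rI p i) (𝓝[≠] τ) (𝓝 (rI p i τ)) :=
    (differentiableAt_rI hp2 i h).continuousAt.tendsto.mono_left nhdsWithin_le_nhds
  have hl : Tendsto ellt (𝓝[≠] τ) (𝓝 (ellt τ)) :=
    (differentiableAt_ellt h).continuousAt.tendsto.mono_left nhdsWithin_le_nhds
  have he : Tendsto (eI p i) (𝓝[≠] τ) (𝓝 (eI p i τ)) :=
    (hasDerivAt_eI hp2 i h).continuousAt.tendsto.mono_left nhdsWithin_le_nhds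
  split_ifs with heq
  · have hp0 : (p : ℂ) ≠ 0 := by exact_mod_cast hp.ne_zero
    have hl' := hasDerivAt_iff_tendsto_slope.mp (hasStrictDerivAt_ellt h).hasDerivAt
    have he' := hasDerivAt_iff_tendsto_slope.mp (hasDerivAt_eI hp2 i h)
    rw [heq] at he'
    have hD := deriv_ellt_ne_zero h
    set D := Real.pi * I * (ellt τ * (1 - 16 * ellt τ) * thc3 τ ^ 2) with hDdef
    have hne : rI p i τ ^ 2 - p ≠ 0 := by
      obtain ⟨M, γ, hM, -, -, hfix, e⟩ := exists_fixing_matrix hp hp2 h heq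
      rw [e]
      exact sub_ne_zero.mpr (sq_mden_ne hp hM hfix h).1
    have hne2 : D * (rI p i τ ^ 2 / p) - D ≠ 0 := by
      have : D * (rI p i τ ^ 2 / p) - D = D * (rI p i τ ^ 2 - p) / p := by field_simp
      rw [this]
      exact div_ne_zero (mul_ne_zero hD hne) hp0
    have h1 := (hl'.mul (hr.pow a)).div (he'.sub hl') hne2
    have e1 : D * rI p i τ ^ a / (D * (rI p i τ ^ 2 / p) - D) =
        p * rI p i τ ^ a / (rI p i τ ^ 2 - p) := by
      have : D * (rI p i τ ^ 2 / p) - D = D * (rI p i τ ^ 2 - p) / p := by field_simp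
      rw [this]; field_simp
    rw [e1] at h1
    refine h1.congr' ?_
    filter_upwards [self_mem_nhdsWithin] with z hz
    have hz' : z - τ ≠ 0 := sub_ne_zero.mpr hz
    simp only [Pi.div_apply, Pi.mul_apply, slope_def_field, heq]
    rw [← sub_div, div_mul_eq_mul_div, div_div_div_cancel_right₀ hz', ← mul_div_assoc]
    congr 1
    ring
  · have h1 := (hl.sub_const (ellt τ)).mul ((hr.pow a).div (he.sub hl) (sub_ne_zero.mpr heq))
    rwa [sub_self, zero_mul] at h1

theorem tendsto_div_sub_none (hp : p.Prime) :
    Tendsto (fun τ => ellt τ / (eI p none τ - ellt τ)) (comap im atTop) (𝓝 (-1)) := by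
  have h1 := (tendsto_const_nhds (x := (1 : ℂ))).div
    ((tendsto_eI_none_div hp.one_lt).sub_const 1) (by simp)
  norm_num at h1
  refine h1.congr' ?_
  filter_upwards [eventually_im_pos] with τ h
  have := ellt_ne_zero h
  simp only [Pi.div_apply]
  rw [div_sub_one this, one_div_div]

theorem tendsto_div_sub_some (hp : p.Prime) (hp2 : p % 2 = 1) (j : Fin p) :
    Tendsto (fun τ => ellt τ / (eI p (some j) τ - ellt τ)) (comap im atTop) (𝓝 0) := by
  have h0 := tendsto_div_eI_some hp.one_lt j
  have h1 := h0.div (h0.const_sub 1) (by simp)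
  norm_num at h1
  refine h1.congr' ?_
  filter_upwards [eventually_im_pos] with τ h
  have h2 : eI p (some j) τ ≠ 0 := ellt_ne_zero (mact_im_pos (heckeRep_det_pos hp2 _) h)
  simp only [Pi.div_apply]
  rw [one_sub_div h2, div_div_div_cancel_right₀ h2]

theorem tendsto_div_sub (hp : p.Prime) (hp2 : p % 2 = 1) (i : Option (Fin p)) :
    Tendsto (fun τ => ellt τ / (eI p i τ - ellt τ)) (comap im atTop)
      (𝓝 (if i = none then -1 else 0)) := by
  cases i with
  | none => simpa using tendsto_div_sub_none hp
  | some j => simpa using tendsto_div_sub_some hp hp2 j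

theorem tendsto_residue_infinity (hp : p.Prime) (hp2 : p % 2 = 1) (a : ℕ) (i : Option (Fin p)) :
    Tendsto (fun τ => rI p i τ ^ a * (ellt τ / (eI p i τ - ellt τ))) (comap im atTop)
      (𝓝 (if i = none then -(sgn4 p * p) ^ a else 0)) := by
  cases i with
  | none => simpa using ((tendsto_rI_none hp.pos).pow a).mul (tendsto_div_sub hp hp2 none)
  | some j => simpa using ((tendsto_rI_some hp.pos j).pow a).mul (tendsto_div_sub hp hp2 (some j))

theorem exists_residue_zero (hp : p.Prime) (hp2 : p % 2 = 1) (a : ℕ) :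
    Tendsto (fun τ => (ellt τ - 0) * ∑ i, rI p i τ ^ a / (eI p i τ - ellt τ)) (comap im atTop)
      (𝓝 (-(sgn4 p * p) ^ a)) := by
  have := tendsto_finsetSum univ fun i _ => tendsto_residue_infinity hp hp2 a i
  rw [sum_ite_eq' univ none] at this
  simp only [mem_univ, if_true] at this
  refine this.congr fun τ => ?_
  rw [sub_zero, mul_sum]
  exact sum_congr rfl fun i _ => by ring

theorem exists_residue_one (hp : p.Prime) (hp2 : p % 2 = 1) (a : ℕ) :
    ∃ s : ℤ, Tendsto (fun τ => (ellt (mact (cuspMat 1) τ) - 1 / 16) *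
      ∑ i, rI p i (mact (cuspMat 1) τ) ^ a /
        (eI p i (mact (cuspMat 1) τ) - ellt (mact (cuspMat 1) τ))) (comap im atTop)
      (𝓝 (-(s * p) ^ a)) := by
  obtain ⟨σ, hσ⟩ := exists_perm_cusp_one hp hp2
  choose s hs hs' using hσ
  have := tendsto_finsetSum univ fun i _ =>
    (tendsto_residue_infinity hp hp2 a (σ i)).const_mul ((s i : ℂ) ^ a)
  refine ⟨s (σ.symm none) * sgn4 p, ?_⟩
  have e : ∑ i, (s i : ℂ) ^ a * (if σ i = none then -(sgn4 p * p : ℂ) ^ a else 0) =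
      -((s (σ.symm none) * sgn4 p : ℤ) * p : ℂ) ^ a := by
    rw [sum_eq_single (σ.symm none)]
    · simp [mul_pow]; ring
    · intro i _ hi
      rw [if_neg (fun e => hi (by rw [← e, Equiv.symm_apply_apply])), mul_zero]
    · simp
  rw [e] at this
  refine this.congr' ?_
  filter_upwards [eventually_im_pos] with τ h
  rw [mul_sum]
  refine sum_congr rfl fun i _ => ?_
  rw [(hs' i τ h).1, (hs' i τ h).2, ellt_cusp_one h]
  have : (1 / 16 - eI p (σ i) τ - (1 / 16 - ellt τ)) = -(eI p (σ i) τ - ellt τ) := by ring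
  rw [this, mul_pow, div_neg]
  ring

end Residues

section CuspTwo
open Complex Topology Asymptotics

variable {M N : Matrix (Fin 2) (Fin 2) ℤ} {τ : ℂ} {p : ℕ}

theorem geom_add_inv {v : ℂ} (hv : v ≠ 1) (n : ℕ) :
    1 / (v - 1) + ∑ j ∈ range n, v ^ j = v ^ n / (v - 1) := by
  have h := sub_ne_zero.mpr hv
  rw [geom_sum_eq hv]
  field_simp
  ring

/-- The quotient of two values of the parameter at the third cusp. -/
noncomputable def cuspQuot (p : ℕ) (i : Option (Fin p)) (τ : ℂ) : ℂ :=
  (16 * eI p i τ - 1) / (16 * ellt τ - 1) * (ellt τ / eI p i τ)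

theorem cuspQuot_ne_zero (hp2 : p % 2 = 1) (i : Option (Fin p)) (h : 0 < τ.im) :
    cuspQuot p i τ ≠ 0 := by
  have h1 := mact_im_pos (heckeRep_det_pos hp2 i) h
  have h2 : 16 * eI p i τ - 1 ≠ 0 := fun e => ellt_ne_inv h1 (by rw [eI] at e; linear_combination -e)
  have h3 : 16 * ellt τ - 1 ≠ 0 := fun e => ellt_ne_inv h (by linear_combination -e)
  exact mul_ne_zero (div_ne_zero h2 h3) (div_ne_zero (ellt_ne_zero h) (ellt_ne_zero h1))

theorem tendsto_eI_div (hp : p.Prime) (i : Option (Fin p)) :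
    Tendsto (fun τ => (16 * eI p i τ - 1) / (16 * ellt τ - 1)) (comap im atTop) (𝓝 1) := by
  have h := (((tendsto_eI hp.pos i).const_mul 16).sub_const 1).div
    ((tendsto_ellt.const_mul 16).sub_const 1) (by norm_num)
  norm_num at h
  exact h

theorem tendsto_cuspQuot_some (hp : p.Prime) (j : Fin p) :
    Tendsto (cuspQuot p (some j)) (comap im atTop) (𝓝 0) := by
  have h := (tendsto_eI_div hp (some j)).mul (tendsto_div_eI_some hp.one_lt j)
  rw [mul_zero] at h
  exact h

theorem tendsto_inv_cuspQuot_none (hp : p.Prime) :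
    Tendsto (fun τ => (cuspQuot p none τ)⁻¹) (comap im atTop) (𝓝 0) := by
  have h := ((tendsto_eI_div hp none).inv₀ one_ne_zero).mul (tendsto_eI_none_div hp.one_lt)
  simp only [inv_one, one_mul] at h
  refine h.congr fun τ => ?_
  rw [cuspQuot, mul_inv, inv_div (ellt τ)]

theorem eventually_cuspQuot_ne_one (hp : p.Prime) (i : Option (Fin p)) :
    ∀ᶠ τ in comap im atTop, cuspQuot p i τ ≠ 1 := by
  rcases i with _ | j
  · filter_upwards [(tendsto_inv_cuspQuot_none hp).eventually_ne zero_ne_one] with τ h h1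
    exact h (by rw [h1, inv_one])
  · exact (tendsto_cuspQuot_some hp j).eventually_ne zero_ne_one

theorem tendsto_cuspQuot_div (hp : p.Prime) (hp2 : p % 2 = 1) (i : Option (Fin p)) :
    Tendsto (fun τ => cuspQuot p i τ / (cuspQuot p i τ - 1)) (comap im atTop)
      (𝓝 (if i = none then 1 else 0)) ∧
    Tendsto (fun τ => cuspQuot p i τ / (cuspQuot p i τ - 1) ^ 2) (comap im atTop) (𝓝 0) := by
  rcases i with _ | j
  · have h := tendsto_inv_cuspQuot_none hp
    have h1 := (h.const_sub 1).inv₀ (by norm_num)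
    have h2 := h.mul (h1.pow 2)
    simp only [sub_zero, inv_one, zero_mul] at h1 h2
    rw [if_pos rfl]
    constructor
    · refine h1.congr' ?_
      filter_upwards [eventually_im_pos] with τ ht
      have h0 := cuspQuot_ne_zero hp2 none ht
      rw [← inv_div]; congr 1; field_simp
    · refine h2.congr' ?_
      filter_upwards [eventually_im_pos, eventually_cuspQuot_ne_one hp none] with τ ht h3
      have h0 := cuspQuot_ne_zero hp2 none ht
      have h4 := sub_ne_zero.mpr h3
      have h5 : 1 - (cuspQuot p none τ)⁻¹ = (cuspQuot p none τ - 1) / cuspQuot p none τ := by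
        field_simp
      rw [h5]
      field_simp
  · have h := tendsto_cuspQuot_some hp j
    have h1 := h.div (h.sub_const 1) (by norm_num)
    have h2 := h.div ((h.sub_const 1).pow 2) (by norm_num)
    rw [zero_div] at h1 h2
    exact ⟨by rw [if_neg (by simp)]; exact h1, h2⟩

theorem tendsto_rI_sq (hp : p.Prime) (i : Option (Fin p)) :
    Tendsto (fun τ => rI p i τ ^ 2 * ((16 * eI p i τ - 1) / (16 * ellt τ - 1))) (comap im atTop)
      (𝓝 (if i = none then (p : ℂ) ^ 2 else 1)) := by
  have h : Tendsto (fun τ => rI p i τ ^ 2) (comap im atTop)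
      (𝓝 (if i = none then (p : ℂ) ^ 2 else 1)) := by
    rcases i with _ | j
    · have := (tendsto_rI_none hp.pos).pow 2
      rw [mul_pow] at this
      have e : ((sgn4 p : ℂ)) ^ 2 = 1 := by rw [sq]; exact_mod_cast sgn4_sq p
      simpa [e] using this
    · simpa using (tendsto_rI_some hp.pos j).pow 2
  simpa using h.mul (tendsto_eI_div hp i)

theorem cusp_term (hp2 : p % 2 = 1) {i : Option (Fin p)} (h : 0 < τ.im) {r e : ℂ}
    (he : e = (1 - 1 / (16 * eI p i τ)) / 16)
    (hv : cuspQuot p i τ ≠ 1) (a n : ℕ) :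
    let t := (1 - 1 / (16 * ellt τ)) / 16
    t ≠ 0 ∧ t * (r ^ a / (e - t)) + ∑ j ∈ range n, r ^ a * e ^ j / t ^ j =
      r ^ a * (cuspQuot p i τ ^ n / (cuspQuot p i τ - 1)) := by
  intro t
  have h1 := mact_im_pos (heckeRep_det_pos hp2 i) h
  have h3 : 16 * ellt τ - 1 ≠ 0 := fun e => ellt_ne_inv h (by linear_combination -e)
  have h4 : eI p i τ ≠ 0 := ellt_ne_zero h1
  have h5 := ellt_ne_zero h
  have ht : t = (16 * ellt τ - 1) / (256 * ellt τ) := by simp only [t]; field_simp; ring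
  have ht0 : t ≠ 0 := by rw [ht]; exact div_ne_zero h3 (by simpa using h5)
  have hve : e = cuspQuot p i τ * t := by
    rw [he, ht, cuspQuot]; field_simp; ring
  refine ⟨ht0, ?_⟩
  rw [← geom_add_inv hv, hve, mul_add]
  congr 1
  · have := sub_ne_zero.mpr hv
    have e2 : cuspQuot p i τ * t - t = (cuspQuot p i τ - 1) * t := by ring
    rw [e2]; field_simp
  · rw [mul_sum]
    refine sum_congr rfl fun j _ => ?_
    rw [mul_pow]; field_simp

theorem tendsto_zero_of_sq {α : Type*} {l : Filter α} {f : α → ℂ}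
    (h : Tendsto (fun x => f x ^ 2) l (𝓝 0)) : Tendsto f l (𝓝 0) := by
  rw [tendsto_zero_iff_norm_tendsto_zero] at h ⊢
  have := (Real.continuous_sqrt.tendsto 0).comp h
  simpa [Function.comp_def, norm_pow, Real.sqrt_sq] using this

theorem tendsto_cusp_term (hp : p.Prime) (hp2 : p % 2 = 1) (i : Option (Fin p)) {r : ℂ → ℂ}
    (hr : ∀ τ : ℂ, 0 < τ.im → r τ ^ 2 = rI p i τ ^ 2 * (eI p i τ / ellt τ)) (a : ℕ) :
    Tendsto (fun τ => r τ ^ a * (cuspQuot p i τ ^ (a / 2 + 1) / (cuspQuot p i τ - 1)))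
      (comap im atTop) (𝓝 (if i = none then (if Even a then (p : ℂ) ^ a else 0) else 0)) := by
  have key : ∀ τ : ℂ, 0 < τ.im → r τ ^ 2 * cuspQuot p i τ =
      rI p i τ ^ 2 * ((16 * eI p i τ - 1) / (16 * ellt τ - 1)) := fun τ h => by
    have h4 : eI p i τ ≠ 0 := ellt_ne_zero (mact_im_pos (heckeRep_det_pos hp2 i) h)
    have h5 := ellt_ne_zero h
    rw [hr τ h, cuspQuot]
    field_simp
  rcases Nat.even_or_odd' a with ⟨n, rfl | rfl⟩
  · have h := ((tendsto_rI_sq hp i).pow n).mul (tendsto_cuspQuot_div hp hp2 i).1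
    have e : (if i = none then (p : ℂ) ^ 2 else 1) ^ n * (if i = none then 1 else 0) =
        if i = none then (if Even (2 * n) then (p : ℂ) ^ (2 * n) else 0) else 0 := by
      split_ifs with h1 h2
      · ring
      · exact absurd (even_two_mul n) h2
      · simp
    rw [e] at h
    refine h.congr' ?_
    filter_upwards [eventually_im_pos] with τ ht
    rw [← key τ ht, show 2 * n / 2 = n by omega]
    ring
  · have h := ((tendsto_rI_sq hp i).pow (2 * n + 1)).mul (tendsto_cuspQuot_div hp hp2 i).2
    rw [mul_zero] at h
    have e : (if i = none then (if Even (2 * n + 1) then (p : ℂ) ^ (2 * n + 1) else 0) else 0) = 0 := by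
      rw [if_neg (by simp [parity_simps] : ¬ Even (2 * n + 1))]; simp
    rw [e]
    refine tendsto_zero_of_sq (h.congr' ?_)
    filter_upwards [eventually_im_pos] with τ ht
    rw [← key τ ht, show (2 * n + 1) / 2 = n by omega, mul_pow, mul_pow, div_pow]
    ring

theorem exists_residue_two (hp : p.Prime) (hp2 : p % 2 = 1) (a : ℕ) :
    Tendsto (fun τ => ellt (mact (cuspMat 2) τ) * ∑ i, rI p i (mact (cuspMat 2) τ) ^ a /
        (eI p i (mact (cuspMat 2) τ) - ellt (mact (cuspMat 2) τ)) +
      ∑ j ∈ range (a / 2 + 1), (∑ i, rI p i (mact (cuspMat 2) τ) ^ a *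
        eI p i (mact (cuspMat 2) τ) ^ j) / ellt (mact (cuspMat 2) τ) ^ j) (comap im atTop)
      (𝓝 (if Even a then (p : ℂ) ^ a else 0)) := by
  obtain ⟨σ, hσ⟩ := exists_perm_cusp_two hp hp2
  have h := tendsto_finsetSum univ fun i _ => tendsto_cusp_term hp hp2 (σ i)
    (r := fun τ => rI p i (mact (cuspMat 2) τ)) (fun τ ht => (hσ i τ ht).1) a
  rw [Equiv.sum_comp σ fun i => if i = none then (if Even a then (p : ℂ) ^ a else 0) else 0,
    sum_ite_eq' univ none, if_pos (mem_univ _)] at h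
  refine h.congr' ?_
  filter_upwards [eventually_im_pos, eventually_all.mpr fun i => eventually_cuspQuot_ne_one hp i]
    with τ ht hq
  rw [ellt_cusp_two ht, mul_sum]
  simp_rw [sum_div]
  rw [sum_comm, ← sum_add_distrib]
  exact sum_congr rfl fun i _ => (cusp_term hp2 ht (hσ i τ ht).2 (hq _) a (a / 2 + 1)).2.symm

theorem tendsto_ellt_cusp_two :
    Tendsto (fun τ => ellt (mact (cuspMat 2) τ)) (comap im atTop) (Bornology.cobounded ℂ) := by
  have h : Tendsto (fun τ => (ellt (mact (cuspMat 2) τ))⁻¹) (comap im atTop) (𝓝[≠] 0) := by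
    rw [tendsto_nhdsWithin_iff]
    have h1 := (tendsto_ellt.const_mul 256).div ((tendsto_ellt.const_mul 16).sub_const 1)
      (by norm_num)
    rw [mul_zero, zero_div] at h1
    constructor
    · refine h1.congr' ?_
      filter_upwards [eventually_im_pos] with τ ht
      have h3 : 16 * ellt τ - 1 ≠ 0 := fun e => ellt_ne_inv ht (by linear_combination -e)
      have h5 := ellt_ne_zero ht
      rw [ellt_cusp_two ht, Pi.div_apply]
      have : (1 - 1 / (16 * ellt τ)) / 16 = (16 * ellt τ - 1) / (256 * ellt τ) := by
        field_simp; ring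
      rw [this, inv_div]
    · filter_upwards [eventually_im_pos] with τ ht
      exact inv_ne_zero (ellt_ne_zero (mact_im_pos (cuspMat_det_pos 2) ht))
  simpa [Function.comp_def] using (tendsto_inv₀_nhdsNE_zero (α := ℂ)).comp h

end CuspTwo

section TraceFormula
open Complex Topology Asymptotics

variable {M N : Matrix (Fin 2) (Fin 2) ℤ} {τ : ℂ} {p : ℕ}

theorem exists_fd_preimage {x : ℂ} (h0 : x ≠ 0) (h1 : x ≠ 1 / 16) :
    ∃ τ : ℂ, 0 < τ.im ∧ ellt τ = x ∧ ∃ w : ℂ, 0 < w.im ∧ 1 ≤ normSq w ∧ |w.re| ≤ 1 / 2 ∧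
      ∃ k, τ = mact (sixMat k) w := by
  obtain ⟨τ, hτ, e⟩ := exists_ellt_eq h0 (fun e => h1 (by linear_combination -e / 16))
  obtain ⟨w, hw, hn, hr, k, γ, hγ, e2⟩ := exists_fd_rep hτ
  have hk : 0 < (sixMat k).det := by rw [sixMat_det]; exact one_pos
  exact ⟨mact (sixMat k) w, mact_im_pos hk hw, by rw [← e, e2, hγ.ellt_mact (mact_im_pos hk hw)],
    w, hw, hn, hr, k, rfl⟩

theorem tendsto_ellt_nhdsNE (h : 0 < τ.im) : Tendsto ellt (𝓝[≠] τ) (𝓝[≠] (ellt τ)) := by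
  exact (hasStrictDerivAt_ellt h).hasDerivAt.tendsto_nhdsNE (deriv_ellt_ne_zero h)

theorem eventually_eI_ne (hp : p.Prime) (hp2 : p % 2 = 1) (i : Option (Fin p)) :
    ∀ᶠ τ in comap im atTop, eI p i τ - ellt τ ≠ 0 := by
  rcases i with _ | j
  · filter_upwards [eventually_im_pos, (tendsto_eI_none_div hp.one_lt).eventually_ne zero_ne_one]
      with τ ht h e
    exact h (by rw [sub_eq_zero.mp e, div_self (ellt_ne_zero ht)])
  · filter_upwards [eventually_im_pos, (tendsto_div_eI_some hp.one_lt j).eventually_ne zero_ne_one]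
      with τ ht h e
    exact h (by rw [← sub_eq_zero.mp e, div_self]; rw [sub_eq_zero.mp e]; exact ellt_ne_zero ht)

theorem exists_trace_formula (hp : p.Prime) (hp2 : p % 2 = 1) :
    ∃ S : Finset ℂ, (∀ τ ∈ S, 0 < τ.im ∧ ∃ w : ℂ, 0 < w.im ∧ 1 ≤ normSq w ∧ |w.re| ≤ 1 / 2 ∧
      ∃ k, τ = mact (sixMat k) w) ∧ Set.InjOn ellt (S : Set ℂ) ∧
      ∀ a : ℕ, ∃ s : ℤ, ∀ T : ℕ → Polynomial ℂ, (∀ j, ∀ τ : ℂ, 0 < τ.im →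
        ∑ i, rI p i τ ^ a * eI p i τ ^ j = (T j).eval (ellt τ)) →
        ∑ τ ∈ S, ∑ i, (if eI p i τ = ellt τ then p * rI p i τ ^ a / (rI p i τ ^ 2 - p) else 0) +
          -(sgn4 p * p : ℂ) ^ a + -(s * p : ℂ) ^ a + ∑ j ∈ range (a / 2 + 1), (T j).coeff j =
          if Even a then (p : ℂ) ^ a else 0 := by
  obtain ⟨D, hDe⟩ := exists_modular_polynomial hp hp2
  have hev := eventually_all.mpr fun i => eventually_eI_ne hp hp2 i
  have hD : D ≠ 0 := by
    rintro rfl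
    obtain ⟨τ, h1, h2⟩ := (hev.and eventually_im_pos).exists
    have := hDe τ h2
    rw [Polynomial.eval_zero] at this
    exact prod_ne_zero_iff.mpr (fun i _ => h1 i) this
  set R : Finset ℂ := (D.roots.toFinset.erase 0).erase (1 / 16) with hR
  have hR' : ∀ x ∈ R, x ≠ 0 ∧ x ≠ 1 / 16 := fun x hx => by
    simp only [hR, mem_erase] at hx; exact ⟨hx.2.1, hx.1⟩
  choose! f hf using fun x (hx : x ∈ R) => exists_fd_preimage (hR' x hx).1 (hR' x hx).2
  have hinj : Set.InjOn f R := fun x hx y hy e => by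
    rw [← (hf x hx).2.1, e, (hf y hy).2.1]
  refine ⟨R.image f, ?_, ?_, fun a => ?_⟩
  · simp only [mem_image, forall_exists_index, and_imp]
    rintro τ x hx rfl
    exact ⟨(hf x hx).1, (hf x hx).2.2⟩
  · intro x hx y hy e
    simp only [coe_image, Set.mem_image, mem_coe] at hx hy
    obtain ⟨x, hx, rfl⟩ := hx
    obtain ⟨y, hy, rfl⟩ := hy
    rw [(hf x hx).2.1, (hf y hy).2.1] at e
    rw [e]
  obtain ⟨N, hN⟩ := exists_numerator_polynomial hp hp2 a
  obtain ⟨s, hs⟩ := exists_residue_one hp hp2 a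
  refine ⟨s, fun T hT => ?_⟩
  have hND : ∀ τ : ℂ, 0 < τ.im → D.eval (ellt τ) ≠ 0 →
      N.eval (ellt τ) / D.eval (ellt τ) = ∑ i, rI p i τ ^ a / (eI p i τ - ellt τ) := by
    intro τ ht h
    rw [← hN τ ht, ← hDe τ ht, sum_mul_prod_div]
    rwa [hDe τ ht]
  have hDf : ∀ x : ℂ, ∀ᶠ t in 𝓝[≠] x, D.eval t ≠ 0 := fun x => by
    have h1 : ∀ᶠ t in 𝓝[≠] x, t ∉ (D.roots.toFinset.erase x : Finset ℂ) :=
      nhdsWithin_le_nhds ((D.roots.toFinset.erase x).finite_toSet.isClosed.isOpen_compl.mem_nhds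
        (by simp))
    filter_upwards [h1, self_mem_nhdsWithin] with t h2 h3 h4
    exact h2 (by simp [hD, h4]; exact h3)
  have hDc : ∀ᶠ t in Bornology.cobounded ℂ, D.eval t ≠ 0 := by
    have h1 : ∀ᶠ t in Bornology.cobounded ℂ, t ∉ D.roots.toFinset :=
      Bornology.isBounded_def.mp D.roots.toFinset.finite_toSet.isBounded
    filter_upwards [h1] with t h2 h4
    exact h2 (by simp [hD, h4])
  have key : ∀ (x ρ : ℂ) (l : Filter ℂ) (G : ℂ → ℂ), l.NeBot → (∀ᶠ τ in l, 0 < (G τ).im) →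
      Tendsto (fun τ => ellt (G τ)) l (𝓝[≠] x) →
      Tendsto (fun τ => (ellt (G τ) - x) *
        ∑ i, rI p i (G τ) ^ a / (eI p i (G τ) - ellt (G τ))) l (𝓝 ρ) →
      ∃ L : Filter ℂ, L.NeBot ∧ Tendsto id L (𝓝 x) ∧ (∀ᶠ t in L, t ≠ x) ∧
        Tendsto (fun t => (t - x) * (N.eval t / D.eval t)) L (𝓝 ρ) := by
    intro x ρ l G hl hG h1 h2
    refine ⟨map (fun τ => ellt (G τ)) l, inferInstance, tendsto_map'
      (h1.mono_right nhdsWithin_le_nhds), eventually_map.mpr (h1.eventually self_mem_nhdsWithin),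
      tendsto_map' (h2.congr' ?_)⟩
    filter_upwards [hG, h1.eventually (hDf x)] with τ h3 h4
    rw [Function.comp_apply, hND _ h3 h4]
  have him : ∀ k, ∀ᶠ τ : ℂ in comap im atTop, 0 < (mact (cuspMat k) τ).im := fun k => by
    filter_upwards [eventually_im_pos] with τ ht using mact_im_pos (cuspMat_det_pos k) ht
  have hS := sum_residues (N := N) (D := D) hD (S := insert 0 (insert (1 / 16) R))
    (ρ := fun x => if x = 0 then -(sgn4 p * p : ℂ) ^ a else if x = 1 / 16 then -(s * p : ℂ) ^ a else
      ∑ i, (if eI p i (f x) = ellt (f x) then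
        p * rI p i (f x) ^ a / (rI p i (f x) ^ 2 - p) else 0))
    (fun x hx => by
      simp only [mem_insert, hR, mem_erase, Multiset.mem_toFinset, Polynomial.mem_roots hD, hx,
        and_true]
      tauto)
    (fun x hx => by
      simp only [mem_insert] at hx
      by_cases h0 : x = 0
      · subst h0
        simp only [if_true]
        refine key 0 _ (comap im atTop) id inferInstance eventually_im_pos ?_
          (exists_residue_zero hp hp2 a)
        refine tendsto_nhdsWithin_iff.mpr ⟨tendsto_ellt, ?_⟩
        filter_upwards [eventually_im_pos] with τ ht using ellt_ne_zero ht
      by_cases h1 : x = 1 / 16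
      · subst h1
        simp only [if_true, if_neg h0]
        refine key _ _ (comap im atTop) (mact (cuspMat 1)) inferInstance (him 1) ?_ hs
        refine tendsto_nhdsWithin_iff.mpr ⟨?_, ?_⟩
        · have := tendsto_ellt.const_sub (1 / 16)
          rw [sub_zero] at this
          refine this.congr' ?_
          filter_upwards [eventually_im_pos] with τ ht using (ellt_cusp_one ht).symm
        · filter_upwards [him 1] with τ ht e
          exact ellt_ne_inv ht (by rw [e]; norm_num)
      · have hx' : x ∈ R := by tauto
        simp only [if_neg h0, if_neg h1]
        obtain ⟨h2, h3, -⟩ := hf x hx'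
        refine key _ _ (𝓝[≠] (f x)) id inferInstance ?_ ?_ ?_
        · exact nhdsWithin_le_nhds ((isOpen_lt continuous_const continuous_im).mem_nhds h2)
        · have := tendsto_ellt_nhdsNE h2
          rwa [h3] at this
        · have := tendsto_finsetSum univ fun i _ => tendsto_residue_interior hp hp2 a i h2
          refine this.congr fun z => ?_
          rw [h3, id, mul_sum])
    (L := map (fun τ => ellt (mact (cuspMat 2) τ)) (comap im atTop)) tendsto_ellt_cusp_two
    (n := a / 2 + 1) (T := T) (c := if Even a then (p : ℂ) ^ a else 0) (by
      refine tendsto_map' ((exists_residue_two hp hp2 a).congr' ?_)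
      filter_upwards [him 2, tendsto_ellt_cusp_two.eventually hDc] with τ h3 h4
      rw [Function.comp_apply, hND _ h3 h4]
      congr 1
      exact sum_congr rfl fun j _ => by rw [hT j _ h3])
  have h0 : (0 : ℂ) ∉ insert (1 / 16) R := by
    rw [mem_insert]; rintro (h | h)
    · norm_num at h
    · exact (hR' 0 h).1 rfl
  have h1 : (1 / 16 : ℂ) ∉ R := fun h => (hR' _ h).2 rfl
  rw [sum_insert h0, sum_insert h1, if_pos rfl, if_neg (by norm_num), if_pos rfl] at hS
  rw [sum_image hinj, ← hS]
  have : ∀ x ∈ R, (if x = 0 then -(sgn4 p * p : ℂ) ^ a else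
      if x = 1 / 16 then -(s * p : ℂ) ^ a else ∑ i, (if eI p i (f x) = ellt (f x) then
        p * rI p i (f x) ^ a / (rI p i (f x) ^ 2 - p) else 0)) =
      ∑ i, (if eI p i (f x) = ellt (f x) then
        p * rI p i (f x) ^ a / (rI p i (f x) ^ 2 - p) else 0) := fun x hx => by
    rw [if_neg (hR' x hx).1, if_neg (hR' x hx).2]
  rw [sum_congr rfl this]
  ring

end TraceFormula

section FixedFamily
open Complex Topology Asymptotics

variable {M N : Matrix (Fin 2) (Fin 2) ℤ} {τ : ℂ} {p : ℕ}

/-- The complete homogeneous symmetric polynomials in the two roots of `x² - t x + p`. -/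
def symU (p t : ℤ) : ℕ → ℤ
  | 0 => 1
  | 1 => t
  | k + 2 => t * symU p t (k + 1) - p * symU p t k

theorem symU_eq {R : Type*} [CommRing R] {p t : ℤ} {α β : R} (h1 : β + α = t) (h2 : β * α = p) :
    ∀ k, (β - α) * symU p t k = β ^ (k + 1) - α ^ (k + 1)
  | 0 => by simp [symU]
  | 1 => by rw [symU, ← h1]; ring
  | k + 2 => by
    have e1 := symU_eq h1 h2 (k + 1)
    have e2 := symU_eq h1 h2 k
    rw [symU]
    push_cast
    rw [← h1, ← h2]
    linear_combination (β + α) * e1 - β * α * e2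

theorem residue_add_conj (hp : p.Prime) (hM : InM p M) (hfix : mact M τ = τ) (h : 0 < τ.im)
    {r : ℂ} (hr : r = p / mden M τ) (k : ℕ) :
    p * r ^ (k + 2) / (r ^ 2 - p) + (starRingEnd ℂ) (p * r ^ (k + 2) / (r ^ 2 - p)) =
      p * symU p M.trace k := by
  have hc := one_zero_ne_zero_of_fixed hfix hp hM h
  have hd : M.det ≠ 0 := by rw [hM.1]; exact_mod_cast hp.ne_zero
  obtain ⟨h1, h2, h3⟩ := mden_fixed hfix hd hc h
  obtain ⟨h4, h5⟩ := sq_mden_ne hp hM hfix h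
  have h0 := mden_ne_zero hd h
  rw [← hr] at h4 h5
  rw [h5]
  rw [hM.1] at h2
  set α := mden M τ
  set β := (starRingEnd ℂ) α with hβ
  have hb0 : β ≠ 0 := by simpa [hβ] using h0
  have hU := symU_eq (p := (p : ℤ)) (t := M.trace) (by rw [h1, Matrix.trace_fin_two]) h2 k
  have h2' : β * α = p := by simpa using h2
  have hb : (starRingEnd ℂ) β = α := by simp [hβ]
  simp only [map_div₀, map_mul, map_sub, map_pow, map_natCast, hb]
  have e1 : β ^ 2 - p = β * (β - α) := by rw [← h2']; ring
  have e2 : α ^ 2 - p = -(α * (β - α)) := by rw [← h2']; ring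
  rw [e1, e2]
  have e3 : (symU p M.trace k : ℂ) = (β ^ (k + 1) - α ^ (k + 1)) / (β - α) := by
    rw [← hU]; field_simp
  rw [e3]
  field_simp
  ring

theorem exists_fixed_family (hp : p.Prime) (hp2 : p % 2 = 1) :
    ∃ S : Finset (ℂ × Matrix (Fin 2) (Fin 2) ℤ),
      (∀ x ∈ S, 0 < x.1.im ∧ (∃ w : ℂ, 0 < w.im ∧ 1 ≤ normSq w ∧ |w.re| ≤ 1 / 2 ∧
        ∃ k, x.1 = mact (sixMat k) w) ∧ InM p x.2 ∧ mact x.2 x.1 = x.1) ∧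
      (∀ x ∈ S, ∀ y ∈ S, ellt x.1 = ellt y.1 → x.1 = y.1) ∧
      ∀ (k : ℕ) (T : ℕ → Polynomial ℤ), (∀ j, ∀ τ : ℂ, 0 < τ.im →
        ∑ i, rI p i τ ^ (k + 2) * eI p i τ ^ j = p * (T j).eval₂ (Int.castRingHom ℂ) (ellt τ)) →
        ∃ z : ℤ, ∑ x ∈ S, symU p x.2.trace k + 2 * ∑ j ∈ range (k / 2 + 2), (T j).coeff j =
          p * z := by
  classical
  obtain ⟨S, hS, hinj, hT⟩ := exists_trace_formula hp hp2
  set J := (S ×ˢ (univ : Finset (Option (Fin p)))).filter fun x => eI p x.2 x.1 = ellt x.1 with hJ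
  have hJm : ∀ x ∈ J, x.1 ∈ S ∧ eI p x.2 x.1 = ellt x.1 := fun x hx => by
    simpa [hJ] using hx
  choose! M γ hM hγ hMγ hfix hr using fun x (hx : x ∈ J) =>
    exists_fixing_matrix hp hp2 (hS _ (hJm x hx).1).1 (hJm x hx).2
  have hMinj : Set.InjOn (fun x => (x.1, M x)) J := by
    intro x hx y hy e
    simp only [Prod.mk.injEq] at e
    refine Prod.ext e.1 (heckeRep_unique hp.one_lt (γ := (γ x).adjugate * γ y)
      (by simpa using (hγ x hx).adjugate.mul (hγ y hy)) ?_)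
    have := e.2
    rw [hMγ x hx, hMγ y hy] at this
    rw [mul_assoc, ← this, ← mul_assoc, (hγ x hx).adjugate_mul, one_mul]
  refine ⟨J.image fun x => (x.1, M x), ?_, ?_, fun k T h => ?_⟩
  · simp only [mem_image, forall_exists_index, and_imp]
    rintro _ x hx rfl
    obtain ⟨h1, h2⟩ := hS x.1 (hJm x hx).1
    exact ⟨h1, h2, hM x hx, hfix x hx⟩
  · simp only [mem_image, forall_exists_index, and_imp]
    rintro _ x hx rfl _ y hy rfl e
    exact hinj (hJm x hx).1 (hJm y hy).1 e
  obtain ⟨s, hs⟩ := hT (k + 2)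
  have h1 := hs (fun j => (Polynomial.C (p : ℤ) * T j).map (Int.castRingHom ℂ)) fun j τ ht => by
    rw [h j τ ht, Polynomial.eval_map, Polynomial.eval₂_mul, Polynomial.eval₂_C]; simp
  have ec : ∀ j, ((Polynomial.C (p : ℤ) * T j).map (Int.castRingHom ℂ)).coeff j =
      (p : ℂ) * ((T j).coeff j : ℤ) := fun j => by
    rw [Polynomial.coeff_map, Polynomial.coeff_C_mul]; simp
  simp only [ec] at h1
  rw [sum_image hMinj]
  have e1 : ∑ τ ∈ S, ∑ i, (if eI p i τ = ellt τ then
      p * rI p i τ ^ (k + 2) / (rI p i τ ^ 2 - p) else 0) =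
      ∑ x ∈ J, p * rI p x.2 x.1 ^ (k + 2) / (rI p x.2 x.1 ^ 2 - p) := by
    rw [hJ, sum_filter, sum_product]
  rw [e1] at h1
  set Y := ∑ x ∈ J, p * rI p x.2 x.1 ^ (k + 2) / (rI p x.2 x.1 ^ 2 - p) with hY
  have e2 : Y + (starRingEnd ℂ) Y = p * ∑ x ∈ J, (symU p (M x).trace k : ℂ) := by
    rw [hY, map_sum, ← sum_add_distrib, mul_sum]
    exact sum_congr rfl fun x hx => residue_add_conj hp (hM x hx) (hfix x hx)
      (hS _ (hJm x hx).1).1 (hr x hx) k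
  have hp0 : (p : ℂ) ≠ 0 := by exact_mod_cast hp.ne_zero
  refine ⟨2 * ((if Even (k + 2) then (p : ℤ) ^ k else 0) + sgn4 p ^ (k + 2) * p ^ k +
    s ^ (k + 2) * p ^ k), ?_⟩
  have h2 := congrArg (starRingEnd ℂ) h1
  simp only [map_add, map_neg, map_pow, map_mul, map_intCast, map_natCast, map_sum,
    Int.cast_natCast] at h1 h2
  have h3 : (starRingEnd ℂ) (if Even (k + 2) then (p : ℂ) ^ (k + 2) else 0) =
      (if Even (k + 2) then (p : ℂ) ^ (k + 2) else 0) := by split_ifs <;> simp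
  rw [h3] at h2
  have h4 : (if Even (k + 2) then (p : ℂ) ^ (k + 2) else 0) =
    p ^ 2 * (((if Even (k + 2) then (p : ℤ) ^ k else 0 : ℤ)) : ℂ) := by
    split_ifs
    · push_cast; ring
    · simp
  rw [h4] at h1 h2
  rw [show (k + 2) / 2 + 1 = k / 2 + 2 by omega] at h1 h2
  rw [← mul_sum] at h1 h2
  have : ((∑ x ∈ J, symU p (M x).trace k + 2 * ∑ j ∈ range (k / 2 + 2), (T j).coeff j : ℤ) : ℂ) =
      (p * (2 * ((if Even (k + 2) then (p : ℤ) ^ k else 0) + sgn4 p ^ (k + 2) * p ^ k +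
        s ^ (k + 2) * p ^ k)) : ℤ) := by
    refine mul_left_cancel₀ hp0 ?_
    simp only [Int.cast_add, Int.cast_sum, Int.cast_mul, Int.cast_pow, Int.cast_natCast,
      Int.cast_ofNat] at h1 h2 ⊢
    linear_combination h1 + h2 - e2
  exact_mod_cast this

end FixedFamily

section
open PowerSeries
variable {R : Type*} [CommRing R] {p : ℕ}

/-- The operator `∑ aₙ qⁿ ↦ ∑ a_{pn} qⁿ` on power series. -/
noncomputable def usec (R : Type*) [CommRing R] (p : ℕ) : R⟦X⟧ →ₗ[R] R⟦X⟧ where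
  toFun A := PowerSeries.mk fun n => coeff (p * n) A
  map_add' A B := by ext n; simp
  map_smul' r A := by ext n; simp

@[simp] theorem coeff_usec (A : R⟦X⟧) (n : ℕ) : coeff n (usec R p A) = coeff (p * n) A := by
  simp [usec]

theorem usec_map {S : Type*} [CommRing S] (φ : R →+* S) (A : R⟦X⟧) :
    usec S p (PowerSeries.map φ A) = PowerSeries.map φ (usec R p A) := by
  ext n; simp

theorem usec_expand_mul (hp : p ≠ 0) (A B : R⟦X⟧) :
    usec R p (expand p hp A * B) = A * usec R p B := by
  ext n
  rw [coeff_usec, coeff_mul, coeff_mul]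
  symm
  apply Finset.sum_of_injOn (fun x => (p * x.1, p * x.2))
  · rintro ⟨a, b⟩ _ ⟨c, d⟩ _ h
    simp only [Prod.mk.injEq] at h ⊢
    exact ⟨Nat.eq_of_mul_eq_mul_left (by omega) h.1, Nat.eq_of_mul_eq_mul_left (by omega) h.2⟩
  · rintro ⟨a, b⟩ h
    simp only [mem_coe, HasAntidiagonal.mem_antidiagonal] at h ⊢
    rw [← mul_add, h]
  · rintro ⟨a, b⟩ h hn
    simp only [HasAntidiagonal.mem_antidiagonal] at h
    by_cases ha : p ∣ a
    · obtain ⟨a', rfl⟩ := ha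
      obtain ⟨b', rfl⟩ : p ∣ b := (Nat.dvd_add_right (dvd_mul_right p a')).1 (h ▸ dvd_mul_right p n)
      refine absurd ⟨(a', b'), ?_, rfl⟩ hn
      simp only [mem_coe, HasAntidiagonal.mem_antidiagonal]
      exact Nat.eq_of_mul_eq_mul_left (Nat.pos_of_ne_zero hp) (by rw [mul_add, h])
    · simp [coeff_expand_of_not_dvd p hp _ ha]
  · rintro ⟨a, b⟩ _
    simp [coeff_expand_mul]

theorem usec_expand (hp : p ≠ 0) (A : R⟦X⟧) : usec R p (expand p hp A) = A := by
  ext n; simp [coeff_expand_mul]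

/-- The Euler operator `q d/dq`. -/
noncomputable def euler (A : R⟦X⟧) : R⟦X⟧ := X * d⁄dX R A

theorem coeff_euler (A : R⟦X⟧) (n : ℕ) : coeff n (euler A) = n * coeff n A := by
  rw [euler]
  cases n with
  | zero => simp
  | succ n => rw [coeff_succ_X_mul, coeff_derivative]; push_cast; ring

theorem euler_add (A B : R⟦X⟧) : euler (A + B) = euler A + euler B := by simp [euler, mul_add]

theorem euler_mul (A B : R⟦X⟧) : euler (A * B) = euler A * B + A * euler B := by
  simp only [euler, Derivation.leibniz, smul_eq_mul]; ring

theorem euler_pow (A : R⟦X⟧) (n : ℕ) : euler (A ^ n) = n * A ^ (n - 1) * euler A := by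
  simp only [euler, derivative_pow]; ring

theorem euler_natCast_mul (m : ℕ) (A : R⟦X⟧) :
    euler ((m : R⟦X⟧) * A) = (m : R⟦X⟧) * euler A := by
  ext n
  rw [← map_natCast (C (R := R)), coeff_euler, coeff_C_mul, coeff_C_mul, coeff_euler]; ring

theorem euler_map {S : Type*} [CommRing S] (φ : R →+* S) (A : R⟦X⟧) :
    euler (PowerSeries.map φ A) = PowerSeries.map φ (euler A) := by
  ext n; simp [coeff_euler]

theorem euler_expand (hp : p ≠ 0) (A : R⟦X⟧) :
    euler (expand p hp A) = (p : R⟦X⟧) * expand p hp (euler A) := by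
  ext n
  rw [← map_natCast (C (R := R)), coeff_euler, coeff_C_mul]
  by_cases h : p ∣ n
  · obtain ⟨k, rfl⟩ := h
    rw [coeff_expand_mul, coeff_expand_mul, coeff_euler]; push_cast; ring
  · simp [coeff_expand_of_not_dvd p hp _ h]

variable [hp : Fact p.Prime]

theorem expand_zmod_eq_pow (A : (ZMod p)⟦X⟧) : expand p hp.out.ne_zero A = A ^ p := by
  have h := MvPowerSeries.map_frobenius_expand p hp.out.ne_zero (f := A)
  rw [ZMod.frobenius_zmod] at h
  rw [← h]
  exact (MvPowerSeries.map_id (R := ZMod p) ▸ rfl)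

theorem usec_euler (A : (ZMod p)⟦X⟧) : usec (ZMod p) p (euler A) = 0 := by
  ext n; simp [coeff_euler]

theorem map_zmod_eq_zero_iff (A : ℤ⟦X⟧) :
    PowerSeries.map (Int.castRingHom (ZMod p)) A = 0 ↔ ∃ B, A = p * B := by
  constructor
  · intro h
    have : ∀ n, ∃ z : ℤ, coeff n A = p * z := fun n => by
      have := congr_arg (coeff n) h
      simp only [coeff_map, eq_intCast, map_zero, ZMod.intCast_zmod_eq_zero_iff_dvd] at this
      exact this
    choose z hz using this
    refine ⟨PowerSeries.mk z, ?_⟩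
    ext n
    rw [← map_natCast (C (R := ℤ)), coeff_C_mul, hz]
    simp
  · rintro ⟨B, rfl⟩
    have : (p : (ZMod p)⟦X⟧) = 0 := by
      rw [← map_natCast (C (R := ZMod p)), CharP.cast_eq_zero, map_zero]
    simp [this]

/-- A Cartier-type identity: `e^{p-1} θe` and `θe` agree under the section operator. -/
theorem usec_pow_mul_euler (e : ℤ⟦X⟧) :
    usec (ZMod p) p (PowerSeries.map (Int.castRingHom (ZMod p)) (e ^ (p - 1) * euler e)) =
      PowerSeries.map (Int.castRingHom (ZMod p)) (euler e) := by
  obtain ⟨g, hg⟩ := (map_zmod_eq_zero_iff (p := p) (e ^ p - expand p hp.out.ne_zero e)).1 (by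
    rw [map_sub, map_pow, map_expand, expand_zmod_eq_pow, sub_self])
  have h1 : euler (e ^ p) = (p : ℤ⟦X⟧) * (expand p hp.out.ne_zero (euler e) + euler g) := by
    rw [sub_eq_iff_eq_add.1 hg, euler_add, euler_expand, euler_natCast_mul]; ring
  rw [euler_pow, mul_assoc] at h1
  have h2 : e ^ (p - 1) * euler e = expand p hp.out.ne_zero (euler e) + euler g := by
    have hp0 : (p : ℤ⟦X⟧) ≠ 0 := by
      rw [← map_natCast (C (R := ℤ))]
      intro h
      have := congr_arg constantCoeff h
      simp [hp.out.ne_zero] at this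
    exact mul_left_cancel₀ hp0 h1
  rw [h2, map_add, map_expand, ← euler_map _ e,
    ← euler_map _ g, map_add, usec_expand, usec_euler, add_zero]

end

section
open PowerSeries
variable {p : ℕ} [hp : Fact p.Prime]

/-- Reduction of an integral power series modulo `p`. -/
noncomputable abbrev redp (p : ℕ) : ℤ⟦X⟧ →+* (ZMod p)⟦X⟧ := PowerSeries.map (Int.castRingHom (ZMod p))

theorem IRep_euler {A : ℤ⟦X⟧} {F : ℂ → ℂ} (h : IRep A F) : IRep (euler A) (fun q => q * deriv F q) :=
  IRep.id.mul h.deriv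

/-- The logarithmic derivative `(1 - λ) θ₃⁴` of the modular function `λ`. -/
noncomputable def dlogS : ℤ⟦X⟧ := (1 - C 16 * ellS) * th3S ^ 4

theorem euler_ellS : euler ellS = ellS * dlogS := by
  refine IRep.unique_congr (IRep_euler IRep_ell)
    (IRep_ell.mul ((IRep.one.sub IRep_lam).mul (IRep_th3.pow 4))) fun q hq => ?_
  rw [nome_mul_deriv_ell hq, mul_assoc]

theorem ell0S_mul_dlogS : ell0S * dlogS = ell0S + euler ell0S := by
  have h := euler_ellS
  have hX : euler (X : ℤ⟦X⟧) = X := by simp [euler]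
  rw [ellS, euler_mul, hX, mul_assoc, ← mul_add] at h
  exact (mul_left_cancel₀ X_ne_zero h).symm

theorem constantCoeff_redp (A : ℤ⟦X⟧) :
    constantCoeff (redp p A) = (constantCoeff A : ℤ) := by
  rw [← coeff_zero_eq_constantCoeff_apply, coeff_map]; simp

theorem redp_ne_zero {A : ℤ⟦X⟧} (h : constantCoeff A = 1) : redp p A ≠ 0 := by
  intro h0
  have := constantCoeff_redp (p := p) A
  rw [h0, h] at this
  simp at this

theorem redp_ellS_ne_zero : redp p ellS ≠ 0 := by
  rw [ellS, map_mul, map_X]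
  exact mul_ne_zero X_ne_zero (redp_ne_zero constantCoeff_ell0S)

theorem usec_dlogS : usec (ZMod p) p (redp p dlogS) = redp p dlogS := by
  apply mul_left_cancel₀ (redp_ne_zero (p := p) constantCoeff_ell0S)
  rw [← usec_expand_mul hp.out.ne_zero, expand_zmod_eq_pow, ← map_mul, ell0S_mul_dlogS, map_add,
    ← usec_pow_mul_euler, ← map_pow, ← map_mul]
  have : ell0S ^ p * dlogS = ell0S ^ p + ell0S ^ (p - 1) * euler ell0S := by
    obtain ⟨k, hk⟩ : ∃ k, p = k + 1 := ⟨p - 1, by have := hp.out.pos; omega⟩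
    rw [hk, pow_succ, mul_assoc, ell0S_mul_dlogS]
    simp only [Nat.add_sub_cancel]
    ring
  rw [this, map_add, map_add, map_pow, ← expand_zmod_eq_pow, usec_expand]

theorem usec_ellS_pow_mul_dlogS (m : ℕ) :
    usec (ZMod p) p (redp p ellS ^ m * redp p dlogS) =
      if p ∣ m then redp p ellS ^ (m / p) * redp p dlogS else 0 := by
  split_ifs with h
  · obtain ⟨k, rfl⟩ := h
    rw [Nat.mul_div_cancel_left _ hp.out.pos, mul_comm p k, pow_mul, ← expand_zmod_eq_pow,
      usec_expand_mul, usec_dlogS]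
  · have hm : (m : ZMod p) ≠ 0 := by rwa [Ne, ZMod.natCast_eq_zero_iff]
    have h1 : euler (redp p ellS ^ m) = (m : ZMod p) • (redp p ellS ^ m * redp p dlogS) := by
      obtain ⟨k, rfl⟩ : ∃ k, m = k + 1 := ⟨m - 1, by
        have : m ≠ 0 := by rintro rfl; simp at h
        omega⟩
      rw [euler_pow, euler_map, euler_ellS, smul_eq_C_mul, map_natCast, map_mul]
      simp only [Nat.add_sub_cancel]
      ring
    have h2 := usec_euler (p := p) (redp p ellS ^ m)
    rw [h1, map_smul] at h2
    exact (smul_eq_zero.1 h2).resolve_left hm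

/-- The polynomial `∑ C(m, i)² Xⁱ` with `m = (p - 1) / 2`. -/
noncomputable def hasseP (p : ℕ) : Polynomial (ZMod p) :=
  ∑ i ∈ range ((p - 1) / 2 + 1), Polynomial.monomial i (((p - 1) / 2).choose i ^ 2 : ZMod p)

theorem sum_choose_sq_mul_pow {R : Type*} [CommRing R] (y : R) (m : ℕ) :
    ∑ i ∈ range (m + 1), (m.choose i ^ 2 : R) * y ^ (2 * i) =
      ∑ j ∈ range (m + 1), (m.choose j * (2 * j).choose j : R) * (-y) ^ j *
        (1 + y) ^ (2 * (m - j)) := by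
  have key : ((1 - Polynomial.C y * Polynomial.X) * (Polynomial.X - Polynomial.C y)) ^ m =
      (Polynomial.X * Polynomial.C ((1 + y) ^ 2) -
        Polynomial.C y * (1 + Polynomial.X) ^ 2 : Polynomial R) ^ m := by
    congr 1
    simp only [map_pow, map_add, map_one]; ring
  have h := congr_arg (fun P => Polynomial.coeff P m) key
  have e1 : ∀ i ≤ m, ((1 - Polynomial.C y * Polynomial.X : Polynomial R) ^ m).coeff i =
      m.choose i * (-y) ^ i := by
    intro i hi
    have : (1 - Polynomial.C y * Polynomial.X : Polynomial R) =
        (1 + Polynomial.X : Polynomial R).comp (Polynomial.C (-y) * Polynomial.X) := by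
      simp [sub_eq_add_neg]
    rw [this, ← Polynomial.pow_comp, Polynomial.comp_C_mul_X_coeff, add_comm (1 : Polynomial R),
      Polynomial.coeff_X_add_one_pow]
  have e2 : ∀ i ≤ m, ((Polynomial.X - Polynomial.C y : Polynomial R) ^ m).coeff (m - i) =
      m.choose i * (-y) ^ i := by
    intro i hi
    rw [sub_eq_add_neg, ← Polynomial.C_neg, Polynomial.coeff_X_add_C_pow, Nat.sub_sub_self hi,
      Nat.choose_symm hi]; ring
  simp only [mul_pow] at h
  rw [Polynomial.coeff_mul, Nat.sum_antidiagonal_eq_sum_range_succ_mk] at h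
  rw [Finset.sum_congr rfl fun i hi => by
    rw [e1 i (by simp at hi; omega), e2 i (by simp at hi; omega)]] at h
  convert h using 1
  · refine sum_congr rfl fun i _ => ?_
    rw [mul_comm 2 i, pow_mul]
    rw [← neg_sq (y ^ i)]
    rw [show (-y) ^ i = (-1) ^ i * y ^ i by rw [← mul_pow]; simp]
    have : ((-1 : R) ^ i) * (-1) ^ i = 1 := by rw [← mul_pow]; simp
    linear_combination (-(m.choose i : R) ^ 2 * (y ^ i) ^ 2) * this
  · rw [sub_eq_neg_add, add_pow, Polynomial.finsetSum_coeff]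
    refine sum_congr rfl fun j hj => ?_
    have hj' : j ≤ m := by simp at hj; omega
    have : (-(Polynomial.C y * (1 + Polynomial.X) ^ 2)) ^ j *
        (Polynomial.X * Polynomial.C (1 + y) ^ 2) ^ (m - j) * (m.choose j : Polynomial R) =
        Polynomial.C ((m.choose j : R) * (-y) ^ j * (1 + y) ^ (2 * (m - j))) *
          ((Polynomial.X + 1) ^ (2 * j) * Polynomial.X ^ (m - j)) := by
      rw [← neg_mul, mul_pow, mul_pow, pow_mul, ← pow_mul, ← pow_mul, ← pow_mul]
      simp only [map_mul, map_pow, map_neg, map_natCast, map_add, map_one]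
      ring
    rw [Polynomial.C_pow, this, Polynomial.coeff_C_mul]
    have e3 : ((Polynomial.X + 1 : Polynomial R) ^ (2 * j) * Polynomial.X ^ (m - j)).coeff m =
        ((2 * j).choose j : R) := by
      rw [Polynomial.coeff_mul_X_pow', if_pos (Nat.sub_le _ _), Nat.sub_sub_self hj',
        Polynomial.coeff_X_add_one_pow]
    rw [e3]; ring

theorem choose_two_mul_zmod {m : ℕ} (hm : p = 2 * m + 1) :
    ∀ j ≤ m, ((2 * j).choose j : ZMod p) = (-4) ^ j * m.choose j := by
  have h2m : (2 * m + 1 : ZMod p) = 0 := by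
    have : ((2 * m + 1 : ℕ) : ZMod p) = 0 := by rw [← hm]; exact CharP.cast_eq_zero _ _
    exact_mod_cast this
  intro j
  induction j with
  | zero => simp
  | succ j ih =>
    intro hj
    have ih := ih (by omega)
    have h1 : ((j + 1) * (2 * (j + 1)).choose (j + 1) : ZMod p) =
        2 * (2 * j + 1) * (2 * j).choose j := by
      have := Nat.succ_mul_centralBinom_succ j
      rw [Nat.centralBinom, Nat.centralBinom] at this
      exact_mod_cast congr_arg (Nat.cast (R := ZMod p)) this
    have h2 : (m.choose (j + 1) * (j + 1) : ZMod p) = m.choose j * (m - j) := by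
      have := Nat.choose_succ_right_eq m j
      rw [← Nat.cast_sub (by omega)]
      exact_mod_cast congr_arg (Nat.cast (R := ZMod p)) this
    have h0 : (j + 1 : ZMod p) ≠ 0 := by
      have : ((j + 1 : ℕ) : ZMod p) ≠ 0 := by
        rw [Ne, ZMod.natCast_eq_zero_iff]
        intro h
        have := Nat.le_of_dvd (by omega) h
        omega
      exact_mod_cast this
    apply mul_left_cancel₀ h0
    rw [h1, ih]
    linear_combination (-(-4) ^ (j + 1)) * h2 + (2 * (-4) ^ j * (m.choose j : ZMod p)) * h2m

end

section
open PowerSeries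
variable {p : ℕ} [hp : Fact p.Prime]

/-- The `q`-series of `y = √λ(q²)`. -/
noncomputable def yqS : ℤ⟦X⟧ :=
  C 4 * (X * expand 2 two_ne_zero psi0S ^ 2 * expand 2 two_ne_zero th3SInv ^ 2)

theorem IRep_yq : IRep yqS yq :=
  ((IRep.const 4).mul ((IRep.id.mul ((IRep_psi0.comp_pow 2 two_ne_zero).pow 2)).mul
    ((IRep_th3_inv.comp_pow 2 two_ne_zero).pow 2))).congr fun q hq => by
      rw [yq_eq hq]; push_cast; ring

theorem th3S_sq_eq : th3S ^ 2 = (1 + yqS) * expand 2 two_ne_zero (th3S ^ 2) :=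
  IRep.unique_congr (IRep_th3.pow 2) ((IRep.one.add IRep_yq).mul
    ((IRep_th3.pow 2).comp_pow 2 two_ne_zero)) fun _ hq => th3_sq_eq hq

theorem yqS_sq : yqS ^ 2 = expand 2 two_ne_zero (C 16 * ellS) :=
  IRep.unique_congr (IRep_yq.pow 2) (IRep_lam.comp_pow 2 two_ne_zero) fun q _ => yq_sq q

theorem lamS_mul_one_add_yqS_sq : C 16 * ellS * (1 + yqS) ^ 2 = C 4 * yqS :=
  IRep.unique_congr (IRep_lam.mul ((IRep.one.add IRep_yq).pow 2)) ((IRep.const 4).mul IRep_yq)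
    fun q hq => by rw [lam_eq_yq hq]; norm_num

theorem redp_C_ofNat (n : ℕ) [n.AtLeastTwo] :
    redp p (C (OfNat.ofNat n : ℤ)) = C (OfNat.ofNat n : ZMod p) := by
  rw [PowerSeries.map_C]; simp

theorem eq_one_of_expand_eq {R : Type*} [CommRing R] {G : R⟦X⟧}
    (h : G = expand 2 two_ne_zero G) (h0 : constantCoeff G = 1) : G = 1 := by
  have : ∀ n, coeff n G = coeff n (1 : R⟦X⟧) := by
    intro n
    induction n using Nat.strong_induction_on with
    | _ n ih =>
      rcases Nat.eq_zero_or_pos n with rfl | hn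
      · simpa using h0
      · rw [h]
        by_cases hd : 2 ∣ n
        · obtain ⟨k, rfl⟩ := hd
          rw [coeff_expand_mul, ih k (by omega), coeff_one, coeff_one]
          simp
        · rw [coeff_expand_of_not_dvd _ _ _ hd, coeff_one, if_neg (by omega)]
  exact PowerSeries.ext this

theorem aeval_hasseP {A : Type*} [CommRing A] [Algebra (ZMod p) A] (x : A) :
    Polynomial.aeval x (hasseP p) =
      ∑ i ∈ range ((p - 1) / 2 + 1), (((p - 1) / 2).choose i ^ 2 : A) * x ^ i := by
  simp [hasseP, Polynomial.aeval_monomial]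

/-- `θ₃^{2(p-1)} H(λ) = 1` modulo `p`, where `H` is the Hasse polynomial. -/
theorem th3S_pow_mul_hasseP (hp2 : p % 2 = 1) :
    redp p (th3S ^ 2) ^ (p - 1) * Polynomial.aeval (redp p (C 16 * ellS)) (hasseP p) = 1 := by
  set m := (p - 1) / 2 with hm
  have hpm : p = 2 * m + 1 := by omega
  have hpm' : p - 1 = 2 * m := by omega
  have key : (1 + redp p yqS) ^ (2 * m) * Polynomial.aeval (redp p (C 16 * ellS)) (hasseP p) =
      Polynomial.aeval (redp p yqS ^ 2) (hasseP p) := by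
    rw [aeval_hasseP, aeval_hasseP, ← hm]
    simp only [← pow_mul]
    rw [sum_choose_sq_mul_pow, mul_sum]
    refine sum_congr rfl fun j hj => ?_
    have hj' : j ≤ m := by simp at hj; omega
    have h1 := congr_arg (redp p) lamS_mul_one_add_yqS_sq
    rw [map_mul, map_pow, map_add, map_one, map_mul _ (C 4), redp_C_ofNat] at h1
    have h2 := congr_arg (C (R := ZMod p)) (choose_two_mul_zmod hpm j hj')
    simp only [map_mul, map_pow, map_natCast, map_neg] at h2
    rw [h2, show 2 * m = 2 * j + 2 * (m - j) by omega, pow_add]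
    have h4 : (redp p (C 16 * ellS)) ^ j * ((1 + redp p yqS) ^ (2 * j)) =
        C 4 ^ j * redp p yqS ^ j := by
      rw [pow_mul, ← mul_pow, h1, mul_pow]
    have h5 : (-C (4 : ZMod p)) ^ j * (-redp p yqS) ^ j = C 4 ^ j * redp p yqS ^ j := by
      rw [← mul_pow, neg_mul_neg, mul_pow]
    linear_combination ((m.choose j : (ZMod p)⟦X⟧) ^ 2 * (1 + redp p yqS) ^ (2 * (m - j))) * (h4 - h5)
  apply eq_one_of_expand_eq
  · rw [hpm', map_mul (expand 2 two_ne_zero)]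
    conv_lhs => rw [th3S_sq_eq, map_mul _ (1 + yqS), map_add, map_one, mul_pow, mul_right_comm, key, map_expand]
    rw [mul_comm, ← map_pow, ← map_pow, ← map_pow _ yqS, yqS_sq, ← Polynomial.aeval_algHom_apply, map_expand]
  · rw [map_mul, map_pow, constantCoeff_redp, aeval_hasseP, map_sum, sum_range_succ']
    simp [constantCoeff_th3S, constantCoeff_redp, ellS, constantCoeff_X]

/-- The polynomial `H(16X)^k (1 - 16X)^{p-1}`. -/
noncomputable def hasseW (p k : ℕ) : Polynomial (ZMod p) :=
  (hasseP p).comp (Polynomial.C 16 * Polynomial.X) ^ k *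
    (1 - Polynomial.C 16 * Polynomial.X) ^ (p - 1)

theorem usec_aeval_mul_dlogS (P : Polynomial (ZMod p)) :
    usec (ZMod p) p (Polynomial.aeval (redp p ellS) P * redp p dlogS) =
      Polynomial.aeval (redp p ellS) (Polynomial.contract p P) * redp p dlogS := by
  induction P using Polynomial.induction_on' with
  | add P Q hP hQ =>
    have : Polynomial.contract p (P + Q) = Polynomial.contract p P + Polynomial.contract p Q := by
      ext n; simp [Polynomial.coeff_contract hp.out.ne_zero]
    rw [map_add, add_mul, map_add, hP, hQ, this, map_add, add_mul]
  | monomial m a =>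
    rw [Polynomial.aeval_monomial, mul_assoc, PowerSeries.algebraMap_apply, Algebra.algebraMap_self,
      RingHom.id_apply, ← smul_eq_C_mul, map_smul, usec_ellS_pow_mul_dlogS]
    have hc : Polynomial.contract p (Polynomial.monomial m a) =
        if p ∣ m then Polynomial.monomial (m / p) a else 0 := by
      ext n
      rw [Polynomial.coeff_contract hp.out.ne_zero, Polynomial.coeff_monomial]
      split_ifs with h1 h2 h2
      · subst h1; rw [Polynomial.coeff_monomial, if_pos (Nat.mul_div_cancel _ hp.out.pos)]
      · exact absurd (h1 ▸ dvd_mul_left p n) h2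
      · rw [Polynomial.coeff_monomial, if_neg]
        rintro rfl
        exact h1 (Nat.div_mul_cancel h2).symm
      · simp
    rw [hc]
    split_ifs
    · rw [Polynomial.aeval_monomial, PowerSeries.algebraMap_apply, Algebra.algebraMap_self, RingHom.id_apply,
        smul_eq_C_mul, mul_assoc]
    · simp

theorem usec_th3S_pow_mul (hp2 : p % 2 = 1) (k j : ℕ) :
    usec (ZMod p) p (redp p ((th3S ^ 2) ^ (k + 2) * ellS ^ j)) =
      redp p ((th3S ^ 2) ^ (k + 2)) * Polynomial.aeval (redp p ellS)
        (Polynomial.contract p (hasseW p k * Polynomial.X ^ j)) := by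
  set f := redp p (th3S ^ 2) with hf
  set x := redp p ellS with hx
  set u : (ZMod p)⟦X⟧ := 1 - C 16 * x with hu
  set H : (ZMod p)⟦X⟧ := Polynomial.aeval (redp p (C 16 * ellS)) (hasseP p) with hH
  have hD : redp p dlogS = u * f ^ 2 := by
    rw [dlogS, hu, hx, hf, ← map_pow, map_mul, map_sub, map_mul, map_one, ← pow_mul, redp_C_ofNat]
  have hHx : H = Polynomial.aeval x ((hasseP p).comp (Polynomial.C 16 * Polynomial.X)) := by
    rw [Polynomial.aeval_comp, hH, map_mul, redp_C_ofNat]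
    simp [hx]
  have hfH : f = expand p hp.out.ne_zero f * H := by
    have h := th3S_pow_mul_hasseP hp2
    have h2 : f ^ p = f * f ^ (p - 1) := by
      rw [← pow_succ', Nat.sub_add_cancel hp.out.one_le]
    rw [expand_zmod_eq_pow, h2, mul_assoc, h, mul_one]
  have hW : Polynomial.aeval x (hasseW p k * Polynomial.X ^ j) = H ^ k * u ^ (p - 1) * x ^ j := by
    rw [hasseW, map_mul, map_mul, map_pow, ← hHx]
    simp [hu]
  have hu0 : u ≠ 0 := by
    intro h
    have := congr_arg constantCoeff h
    simp [hu, hx, ellS] at this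
  apply mul_left_cancel₀ hu0
  rw [← usec_expand_mul hp.out.ne_zero]
  have : expand p hp.out.ne_zero u * redp p ((th3S ^ 2) ^ (k + 2) * ellS ^ j) =
      expand p hp.out.ne_zero (f ^ k) *
        (Polynomial.aeval x (hasseW p k * Polynomial.X ^ j) * redp p dlogS) := by
    have hup : u ^ p = u * u ^ (p - 1) := by
      rw [← pow_succ', Nat.sub_add_cancel hp.out.one_le]
    rw [hW, hD, expand_zmod_eq_pow u, hup, map_mul, map_pow _ (th3S ^ 2), map_pow _ ellS, ← hf,
      ← hx, map_pow]
    conv_lhs => rw [hfH]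
    rw [mul_pow]
    have : expand p hp.out.ne_zero f ^ 2 * H ^ 2 = f ^ 2 := by rw [← mul_pow, ← hfH]
    linear_combination (u ^ (p - 1) * u * (expand p hp.out.ne_zero f) ^ k * H ^ k * x ^ j) * this
  rw [this, usec_expand_mul, usec_aeval_mul_dlogS, hD, map_pow _ (th3S ^ 2), ← hf]
  ring

end

section
open PowerSeries

theorem CRep_aeval {A : ℂ⟦X⟧} {F : ℂ → ℂ} (h : CRep A F) (P : Polynomial ℂ) :
    CRep (Polynomial.aeval A P) (fun q => P.eval (F q)) := by
  induction P using Polynomial.induction_on' with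
  | add P Q hP hQ =>
    rw [map_add]
    exact (hP.add hQ).congr fun q _ => by rw [Polynomial.eval_add]
  | monomial m a =>
    rw [Polynomial.aeval_monomial]
    exact ((CRep.const a).mul (h.pow m)).congr fun q _ => by rw [Polynomial.eval_monomial]

theorem exists_IRep_usec {p : ℕ} (hp : 0 < p) {A : ℤ⟦X⟧} {F : ℂ → ℂ} (h : IRep A F) :
    ∃ G : ℂ → ℂ, IRep (usec ℤ p A) G ∧ ∀ τ : ℂ, 0 < τ.im →
      ∑ i : Fin p, F (nome ((τ + 2 * (i : ℕ)) / p)) = p * G (nome τ) := by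
  have inj : Function.Injective (fun n : ℕ => p * n) := fun a b h =>
    Nat.eq_of_mul_eq_mul_left hp h
  have hs : ∀ q : ℂ, ‖q‖ < 1 → Summable fun n : ℕ => ((coeff (p * n) A : ℤ) : ℂ) * q ^ n := by
    intro q hq
    obtain ⟨z, hz⟩ := IsAlgClosed.exists_pow_nat_eq q hp
    have hz1 : ‖z‖ < 1 := by
      by_contra hc
      rw [← hz, norm_pow] at hq
      exact absurd hq (not_lt.2 (one_le_pow₀ (not_lt.1 hc)))
    have := (h z hz1).summable.comp_injective inj
    refine this.congr fun n => ?_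
    simp [pow_mul, hz]
  refine ⟨fun q => ∑' n : ℕ, ((coeff (p * n) A : ℤ) : ℂ) * q ^ n, fun q hq => ?_, fun τ hτ => ?_⟩
  · simpa using (hs q hq).hasSum
  have hpC : (p : ℂ) ≠ 0 := by exact_mod_cast hp.ne'
  have him : ∀ i : ℕ, 0 < ((τ + 2 * (i : ℂ)) / p).im := fun i => by
    rw [Complex.div_natCast_im]
    simp only [Complex.add_im, Complex.mul_im, Complex.re_ofNat, Complex.natCast_im,
      Complex.im_ofNat, Complex.natCast_re]
    have : (0 : ℝ) < p := by exact_mod_cast hp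
    field_simp
    linarith
  have h1 := hasSum_sum (s := (univ : Finset (Fin p)))
    (fun i _ => h (nome ((τ + 2 * (i : ℕ)) / p)) (norm_nome_lt (him i)))
  refine h1.unique ?_
  have hζ : IsPrimitiveRoot (nome (2 / p)) p := by
    have : nome (2 / p) = Complex.exp (2 * Real.pi * Complex.I / p) := by
      rw [nome]; congr 1; ring
    rw [this]; exact Complex.isPrimitiveRoot_exp p hp.ne'
  have hsplit : ∀ i : ℕ, nome ((τ + 2 * (i : ℂ)) / p) = nome (τ / p) * nome (2 / p) ^ i := fun i => by
    rw [nome_pow, nome, nome, nome, ← Complex.exp_add]; congr 1; ring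
  have hτp : nome (τ / p) ^ p = nome τ := by
    rw [nome_pow]; congr 1; field_simp
  have h2 : ∀ n, ∑ i : Fin p, coeff n (PowerSeries.map (Int.castRingHom ℂ) A) *
      nome ((τ + 2 * (i : ℕ)) / p) ^ n = coeff n A * nome (τ / p) ^ n *
        ∑ i ∈ range p, (nome (2 / p) ^ n) ^ i := fun n => by
    rw [← Fin.sum_univ_eq_sum_range, mul_sum]
    refine sum_congr rfl fun i _ => ?_
    rw [hsplit, mul_pow, ← pow_mul, ← pow_mul, mul_comm (i : ℕ) n]
    simp; ring
  simp only [h2]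
  rw [← inj.hasSum_iff]
  · have h3 := (hs _ (norm_nome_lt hτ)).hasSum.mul_left (p : ℂ)
    refine (congr_arg (fun f : ℕ → ℂ => HasSum f _) (funext fun n => ?_)).mpr h3
    rw [Function.comp_apply, pow_mul, hτp, pow_mul (nome (2 / p)), hζ.pow_eq_one]
    simp; ring
  · intro n hn
    have hd : ¬ p ∣ n := fun ⟨m, hm⟩ => hn ⟨m, hm.symm⟩
    have hne : nome (2 / p) ^ n ≠ 1 := fun h => hd ((hζ.pow_eq_one_iff_dvd n).1 h)
    have : ∑ i ∈ range p, (nome (2 / p) ^ n) ^ i = 0 := by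
      rw [geom_sum_eq hne, ← pow_mul, mul_comm, pow_mul, hζ.pow_eq_one]; simp
    rw [this, mul_zero]

theorem exists_int_polynomial (P : Polynomial ℂ) : ∀ Q : ℤ⟦X⟧,
    Polynomial.aeval (PowerSeries.map (Int.castRingHom ℂ) ellS) P =
      PowerSeries.map (Int.castRingHom ℂ) Q →
    ∃ T : Polynomial ℤ, P = T.map (Int.castRingHom ℂ) ∧ Polynomial.aeval ellS T = Q := by
  have hinj : Function.Injective (PowerSeries.map (Int.castRingHom ℂ)) := by
    intro A B h
    ext n
    have := congr_arg (coeff n) h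
    simpa using this
  suffices H : ∀ n, ∀ P : Polynomial ℂ, P.natDegree ≤ n → ∀ Q : ℤ⟦X⟧,
      Polynomial.aeval (PowerSeries.map (Int.castRingHom ℂ) ellS) P =
        PowerSeries.map (Int.castRingHom ℂ) Q → ∃ T : Polynomial ℤ, P = T.map (Int.castRingHom ℂ) by
    intro Q hQ
    obtain ⟨T, hT⟩ := H _ P le_rfl Q hQ
    refine ⟨T, hT, hinj ?_⟩
    rw [← hQ, hT, ← algebraMap_int_eq, Polynomial.aeval_map_algebraMap]
    rw [Polynomial.aeval_def, Polynomial.aeval_def, Polynomial.hom_eval₂]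
    congr 1
  have hcoeff : ∀ P : Polynomial ℂ, ∀ Q : ℤ⟦X⟧,
      Polynomial.aeval (PowerSeries.map (Int.castRingHom ℂ) ellS) P =
        PowerSeries.map (Int.castRingHom ℂ) Q → P.coeff 0 = (constantCoeff Q : ℤ) := by
    intro P Q h
    rw [← P.divX_mul_X_add] at h
    have := congr_arg constantCoeff h
    simp only [map_add, map_mul, Polynomial.aeval_X, Polynomial.aeval_C, ellS, map_X,
      constantCoeff_X, zero_mul, mul_zero, zero_add, PowerSeries.algebraMap_apply,
      Algebra.algebraMap_self, RingHom.id_apply, constantCoeff_C] at this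
    rw [this, ← coeff_zero_eq_constantCoeff_apply, coeff_map]
    simp
  intro n
  induction n with
  | zero =>
    intro P hP Q hQ
    refine ⟨Polynomial.C (constantCoeff Q), ?_⟩
    rw [Polynomial.map_C, Polynomial.eq_C_of_natDegree_le_zero hP, hcoeff P Q hQ]
    rfl
  | succ n ih =>
    intro P hP Q hQ
    have h0 := hcoeff P Q hQ
    obtain ⟨Q1, hQ1⟩ : (X : ℤ⟦X⟧) ∣ Q - C (constantCoeff Q) := by
      rw [X_dvd_iff]; simp
    have hu : ell0S * invOfUnit ell0S 1 = 1 := mul_invOfUnit _ _ (by simp [constantCoeff_ell0S])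
    have h3 : PowerSeries.map (Int.castRingHom ℂ) Q =
        X * PowerSeries.map (Int.castRingHom ℂ) Q1 + C ((constantCoeff Q : ℤ) : ℂ) := by
      conv_lhs => rw [sub_eq_iff_eq_add.1 hQ1]
      rw [map_add, PowerSeries.map_C, map_mul, map_X]
      rfl
    have h1 := hQ
    rw [← P.divX_mul_X_add, map_add, map_mul, Polynomial.aeval_X, Polynomial.aeval_C, h0, h3] at h1
    have h2 : (Polynomial.aeval (PowerSeries.map (Int.castRingHom ℂ) ellS)) P.divX *
        PowerSeries.map (Int.castRingHom ℂ) ell0S = PowerSeries.map (Int.castRingHom ℂ) Q1 := by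
      apply mul_left_cancel₀ (X_ne_zero (R := ℂ))
      have h4 := add_right_cancel h1
      have : PowerSeries.map (Int.castRingHom ℂ) ellS =
          X * PowerSeries.map (Int.castRingHom ℂ) ell0S := by rw [ellS, map_mul, map_X]
      rw [← h4]
      conv_rhs => rw [mul_comm, this, mul_assoc]
      rw [mul_comm (PowerSeries.map (Int.castRingHom ℂ) ell0S), this]
    obtain ⟨T, hT⟩ := ih P.divX (by rw [Polynomial.natDegree_divX_eq_natDegree_tsub_one]; omega)
      (Q1 * invOfUnit ell0S 1) (by rw [map_mul, ← h2, mul_assoc, ← map_mul, hu, map_one, mul_one])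
    refine ⟨T * Polynomial.X + Polynomial.C (constantCoeff Q), ?_⟩
    rw [← P.divX_mul_X_add, hT, h0]
    simp
end

section
open PowerSeries
variable {p : ℕ}

theorem rI_some {τ : ℂ} (hp : 0 < p) (i : Fin p) :
    rI p (some i) τ = thc3 ((τ + 2 * (i : ℕ)) / p) / thc3 τ := by
  have : (p : ℂ) ≠ 0 := by exact_mod_cast hp.ne'
  rw [rI, rr, mact_heckeRep_some, mden_heckeRep_some, mul_div_mul_left _ _ this]

theorem rI_none {τ : ℂ} : rI p none τ = sgn4 p * p * (thc3 (p * τ) / thc3 τ) := by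
  have h : ((sgn4 p : ℤ) : ℂ) * sgn4 p = 1 := by exact_mod_cast sgn4_sq p
  have h0 : ((sgn4 p : ℤ) : ℂ) ≠ 0 := left_ne_zero_of_mul_eq_one h
  rw [rI, rr, mact_heckeRep_none, mden_heckeRep_none, mul_div_mul_comm]
  rw [div_eq_mul_inv, inv_eq_of_mul_eq_one_left h]
  ring

/-- The integral `q`-expansion of `p⁻¹ ∑ᵢ rᵢ^{k+2} eᵢ^j`. -/
noncomputable def traceS (p : ℕ) (hp : p ≠ 0) (k j : ℕ) : ℤ⟦X⟧ :=
  (usec ℤ p ((th3S ^ 2) ^ (k + 2) * ellS ^ j) + C (sgn4 p ^ (k + 2) * (p : ℤ) ^ (k + 1)) *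
    expand p hp ((th3S ^ 2) ^ (k + 2) * ellS ^ j)) * (th3SInv ^ 2) ^ (k + 2)

theorem exists_IRep_traceS (hp : 0 < p) (k j : ℕ) :
    ∃ G : ℂ → ℂ, IRep (traceS p hp.ne' k j) G ∧ ∀ τ : ℂ, 0 < τ.im →
      ∑ i, rI p i τ ^ (k + 2) * eI p i τ ^ j = p * G (nome τ) := by
  have hA := ((IRep_th3.pow 2).pow (k + 2)).mul (IRep_ell.pow j)
  obtain ⟨U, hU, hU'⟩ := exists_IRep_usec hp hA
  refine ⟨_, (hU.add ((IRep.const _).mul (hA.comp_pow p hp.ne'))).mul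
    ((IRep_th3_inv.pow 2).pow (k + 2)), fun τ hτ => ?_⟩
  have h3 : th3 (nome τ) ≠ 0 := th3_ne_zero (norm_nome_lt hτ)
  rw [Fintype.sum_option]
  have h1 : ∑ i : Fin p, rI p (some i) τ ^ (k + 2) * eI p (some i) τ ^ j =
      p * U (nome τ) / thc3 τ ^ (k + 2) := by
    rw [← hU' τ hτ, sum_div]
    refine sum_congr rfl fun i _ => ?_
    rw [rI_some hp, eI, mact_heckeRep_some, div_pow, thc3, ellt]
    ring
  rw [h1, rI_none, eI, mact_heckeRep_none, ellt, thc3, thc3, ← nome_pow]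
  push_cast
  rw [mul_pow, div_pow, mul_pow, inv_pow, inv_pow]
  generalize (th3 (nome τ) ^ 2) ^ (k + 2) = A
  ring

theorem exists_trace_family [hp : Fact p.Prime] (hp2 : p % 2 = 1) (k j : ℕ) :
    ∃ T : Polynomial ℤ, (∀ τ : ℂ, 0 < τ.im → ∑ i, rI p i τ ^ (k + 2) * eI p i τ ^ j =
      p * T.eval₂ (Int.castRingHom ℂ) (ellt τ)) ∧
      T.map (Int.castRingHom (ZMod p)) =
        Polynomial.contract p (hasseW p k * Polynomial.X ^ j) := by
  obtain ⟨P, hP⟩ := exists_trace_polynomial hp.out hp2 (k + 2) j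
  obtain ⟨G, hG, hG'⟩ := exists_IRep_traceS hp.out.pos k j
  have hpC : (p : ℂ) ≠ 0 := by exact_mod_cast hp.out.ne_zero
  have hS : Polynomial.aeval (PowerSeries.map (Int.castRingHom ℂ) ellS)
      (Polynomial.C (p : ℂ)⁻¹ * P) =
      PowerSeries.map (Int.castRingHom ℂ) (traceS p hp.out.ne_zero k j) := by
    apply mul_left_cancel₀ (X_ne_zero (R := ℂ))
    refine (CRep.id.mul (CRep_aeval IRep_ell _)).unique ((CRep.id.mul hG).congr fun q hq => ?_)
    rcases eq_or_ne q 0 with rfl | h0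
    · simp
    · obtain ⟨τ, hτ, rfl⟩ := exists_nome_eq h0 hq
      have h1 := (hP τ hτ).symm.trans (hG' τ hτ)
      rw [ellt] at h1
      rw [Polynomial.eval_mul, Polynomial.eval_C, h1, inv_mul_cancel_left₀ hpC]
  obtain ⟨T, hT, hTS⟩ := exists_int_polynomial _ _ hS
  refine ⟨T, fun τ hτ => ?_, ?_⟩
  · rw [hP τ hτ, ← Polynomial.eval_map, ← hT, Polynomial.eval_mul, Polynomial.eval_C,
      mul_inv_cancel_left₀ hpC]
  have h1 : Polynomial.aeval (redp p ellS) (T.map (Int.castRingHom (ZMod p))) =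
      Polynomial.aeval (redp p ellS) (Polynomial.contract p (hasseW p k * Polynomial.X ^ j)) := by
    have h2 : Polynomial.aeval (redp p ellS) (T.map (Int.castRingHom (ZMod p))) =
        redp p (Polynomial.aeval ellS T) := by
      rw [← algebraMap_int_eq, Polynomial.aeval_map_algebraMap, Polynomial.aeval_def,
        Polynomial.aeval_def, Polynomial.hom_eval₂]
      congr 1
    have h3 : redp p (C (sgn4 p ^ (k + 2) * (p : ℤ) ^ (k + 1))) = 0 := by
      rw [PowerSeries.map_C]; simp
    have h4 : redp p ((th3S ^ 2) ^ (k + 2)) * redp p ((th3SInv ^ 2) ^ (k + 2)) = 1 := by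
      rw [← map_mul, ← mul_pow, ← mul_pow, th3S_mul_inv, one_pow, one_pow, map_one]
    rw [h2, hTS, traceS, map_mul, map_add, map_mul (redp p) (C _), h3, zero_mul, add_zero,
      ← usec_map, usec_th3S_pow_mul hp2, mul_right_comm, h4, one_mul]
  have hinj : ∀ R : Polynomial (ZMod p), Polynomial.aeval (redp p ellS) R = 0 → R = 0 := by
    intro R hR
    by_contra hne
    obtain ⟨S, hS, hS0⟩ := Polynomial.exists_eq_pow_rootMultiplicity_mul_and_not_dvd R hne 0
    rw [Polynomial.C_0, sub_zero] at hS hS0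
    rw [hS, map_mul, map_pow, Polynomial.aeval_X] at hR
    have h5 := (mul_eq_zero.1 hR).resolve_left (pow_ne_zero _ redp_ellS_ne_zero)
    apply hS0
    rw [Polynomial.X_dvd_iff]
    have h6 := congr_arg constantCoeff h5
    rw [← S.divX_mul_X_add] at h6
    simpa [ellS] using h6
  exact sub_eq_zero.1 (hinj _ (by rw [map_sub, h1, sub_self]))

theorem hasseP_natDegree_le : (hasseP p).natDegree ≤ (p - 1) / 2 := by
  refine Polynomial.natDegree_sum_le_of_forall_le _ _ fun i hi => ?_
  exact (Polynomial.natDegree_monomial_le _).trans (by simp at hi; omega)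

theorem hasseW_natDegree_le (k : ℕ) :
    (hasseW p k).natDegree ≤ k * ((p - 1) / 2) + (p - 1) := by
  refine Polynomial.natDegree_mul_le.trans (add_le_add ?_ ?_)
  · refine Polynomial.natDegree_pow_le.trans (Nat.mul_le_mul_left _ ?_)
    refine Polynomial.natDegree_comp_le.trans ?_
    calc _ ≤ ((p - 1) / 2) * 1 := Nat.mul_le_mul hasseP_natDegree_le
            ((Polynomial.natDegree_C_mul_le _ _).trans Polynomial.natDegree_X_le)
      _ = _ := mul_one _
  · refine Polynomial.natDegree_pow_le.trans ?_
    calc _ ≤ (p - 1) * 1 := Nat.mul_le_mul_left _ (by compute_degree)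
      _ = _ := mul_one _

variable [hp : Fact p.Prime]

theorem sum_units_eval (W : Polynomial (ZMod p)) (n : ℕ) (hW : W.natDegree < (p - 1) * n) :
    ∑ a with a ≠ (0 : ZMod p), W.eval a = -∑ j ∈ range n, W.coeff ((p - 1) * j) := by
  have hpp : 0 < p - 1 := by have := hp.out.two_le; omega
  simp only [Polynomial.eval_eq_sum_range' hW]
  rw [sum_comm, ← sum_neg_distrib]
  have h1 : ∀ i, ∑ a with a ≠ (0 : ZMod p), W.coeff i * a ^ i =
      if p - 1 ∣ i then - W.coeff i else 0 := fun i => by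
    have h2 := FiniteField.sum_pow_units (K := ZMod p) i
    rw [ZMod.card] at h2
    have h3 : ∑ a with a ≠ (0 : ZMod p), a ^ i = ∑ u : (ZMod p)ˣ, (u : ZMod p) ^ i := by
      symm
      refine sum_bij (fun u _ => (u : ZMod p)) (by simp) (fun u _ v _ h => Units.ext h) ?_ (by simp)
      intro b hb
      exact ⟨Units.mk0 b (by simpa using hb), by simp, rfl⟩
    rw [← mul_sum, h3]
    simp only [← Units.val_pow_eq_pow_val] at h2 ⊢
    rw [h2]
    split_ifs <;> simp
  simp only [h1]
  symm
  apply sum_of_injOn (fun j => (p - 1) * j)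
  · intro a _ b _ h
    exact Nat.eq_of_mul_eq_mul_left hpp h
  · intro j hj
    simp only [coe_range, Set.mem_Iio] at hj ⊢
    exact Nat.mul_lt_mul_of_pos_left hj hpp
  · intro i hi hn
    rw [if_neg]
    rintro ⟨j, rfl⟩
    refine hn ⟨j, ?_, rfl⟩
    simp only [mem_range, coe_range, Set.mem_Iio] at hi ⊢
    exact Nat.lt_of_mul_lt_mul_left hi
  · intro j _
    rw [if_pos (dvd_mul_right _ _)]

theorem sum_coeff_contract (hp2 : p % 2 = 1) (k : ℕ) :
    ∑ j ∈ range (k / 2 + 2), (Polynomial.contract p (hasseW p k * Polynomial.X ^ j)).coeff j =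
      -∑ a with a ≠ (0 : ZMod p) ∧ a ≠ 1, (hasseP p).eval a ^ k := by
  have hp3 : 3 ≤ p := by have := hp.out.two_le; omega
  have h1 : ∀ j, (Polynomial.contract p (hasseW p k * Polynomial.X ^ j)).coeff j =
      (hasseW p k).coeff ((p - 1) * j) := fun j => by
    rw [Polynomial.coeff_contract hp.out.ne_zero,
      show j * p = (p - 1) * j + j by rw [← add_one_mul, Nat.sub_add_cancel hp.out.one_le, mul_comm],
      Polynomial.coeff_mul_X_pow]
  simp only [h1]
  rw [eq_neg_iff_add_eq_zero, add_comm, ← eq_neg_iff_add_eq_zero, ← sum_units_eval]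
  · have h16 : (16 : ZMod p) ≠ 0 := by
      have h : ((2 ^ 4 : ℕ) : ZMod p) ≠ 0 := by
        rw [Ne, ZMod.natCast_eq_zero_iff]
        intro h
        have := Nat.le_of_dvd two_pos (hp.out.dvd_of_dvd_pow h)
        omega
      norm_num at h
      exact h
    symm
    have h2 : ∀ a : ZMod p, (hasseW p k).eval a =
        if 16 * a = 1 then 0 else (hasseP p).eval (16 * a) ^ k := fun a => by
      rw [hasseW, Polynomial.eval_mul, Polynomial.eval_pow, Polynomial.eval_comp,
        Polynomial.eval_pow]
      simp only [Polynomial.eval_mul, Polynomial.eval_C, Polynomial.eval_X, Polynomial.eval_sub,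
        Polynomial.eval_one]
      split_ifs with h
      · rw [h, sub_self, zero_pow (by omega), mul_zero]
      · rw [ZMod.pow_card_sub_one_eq_one (sub_ne_zero.2 (Ne.symm h)), mul_one]
    simp only [h2]
    have h3 : ∑ a with a ≠ (0 : ZMod p) ∧ a ≠ 1, (hasseP p).eval a ^ k =
        ∑ a with a ≠ (0 : ZMod p), if a = 1 then 0 else (hasseP p).eval a ^ k := by
      rw [← filter_filter, sum_filter]
      exact sum_congr rfl fun a _ => by by_cases h : a = 1 <;> simp [h]
    rw [h3]
    refine sum_bij (fun a _ => 16 * a) (fun a ha => by simpa [h16] using ha) (fun a _ b _ h => mul_left_cancel₀ h16 h)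
      (fun b hb => ⟨16⁻¹ * b, ?_, mul_inv_cancel_left₀ h16 b⟩) (fun a _ => rfl)
    simpa [h16] using hb
  · refine (hasseW_natDegree_le k).trans_lt ?_
    obtain ⟨m, hm⟩ : ∃ m, p = 2 * m + 1 := ⟨p / 2, by omega⟩
    rw [hm, Nat.add_sub_cancel, Nat.mul_div_cancel_left _ two_pos]
    have : 0 < m := by omega
    have : k < 2 * (k / 2 + 1) := by omega
    nlinarith

end

section
variable {p : ℕ} [hp : Fact p.Prime]

theorem symU_zmod (t : ℤ) : ∀ k, (symU p t k : ZMod p) = (t : ZMod p) ^ k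
  | 0 => by simp [symU]
  | 1 => by simp [symU]
  | k + 2 => by
    rw [symU]
    push_cast
    rw [symU_zmod t (k + 1)]
    simp
    ring

theorem exists_trace_set (hp2 : p % 2 = 1) :
    ∃ S : Finset (ℂ × Matrix (Fin 2) (Fin 2) ℤ),
      (∀ x ∈ S, 0 < x.1.im ∧ (∃ w : ℂ, 0 < w.im ∧ 1 ≤ Complex.normSq w ∧ |w.re| ≤ 1 / 2 ∧
        ∃ k, x.1 = mact (sixMat k) w) ∧ InM p x.2 ∧ mact x.2 x.1 = x.1) ∧
      ∀ F : Polynomial (ZMod p), ∑ x ∈ S, F.eval (x.2.trace : ZMod p) =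
        2 * ∑ a with a ≠ (0 : ZMod p) ∧ a ≠ 1, F.eval ((hasseP p).eval a) := by
  obtain ⟨S, h1, -, h3⟩ := exists_fixed_family hp.out hp2
  refine ⟨S, h1, fun F => ?_⟩
  have pow : ∀ k : ℕ, ∑ x ∈ S, (x.2.trace : ZMod p) ^ k =
      2 * ∑ a with a ≠ (0 : ZMod p) ∧ a ≠ 1, (hasseP p).eval a ^ k := by
    intro k
    choose T hT1 hT2 using exists_trace_family (p := p) hp2 k
    obtain ⟨z, hz⟩ := h3 k T hT1
    have := congr_arg (Int.cast (R := ZMod p)) hz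
    push_cast at this
    simp only [symU_zmod] at this
    have e := sum_coeff_contract (p := p) hp2 k
    simp only [← hT2, Polynomial.coeff_map, eq_intCast] at e
    rw [e] at this
    rw [CharP.cast_eq_zero, zero_mul] at this
    linear_combination this
  induction F using Polynomial.induction_on' with
  | add f g hf hg => simp only [Polynomial.eval_add, sum_add_distrib, hf, hg, mul_add]
  | monomial n c =>
    simp only [Polynomial.eval_monomial, ← mul_sum, pow]
    ring

theorem sum_indicator_eval {ι : Type*} (S : Finset ι) (f : ι → ZMod p) (s : ZMod p) :
    ∑ x ∈ S, ((1 : Polynomial (ZMod p)) - (Polynomial.X - Polynomial.C s) ^ (p - 1)).eval (f x) =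
      ((S.filter fun x => f x = s).card : ZMod p) := by
  rw [card_filter, Nat.cast_sum]
  refine sum_congr rfl fun x _ => ?_
  simp only [Polynomial.eval_sub, Polynomial.eval_one, Polynomial.eval_pow, Polynomial.eval_X,
    Polynomial.eval_C]
  split_ifs with h
  · simp [h, (Nat.sub_pos_of_lt hp.out.one_lt).ne']
  · rw [ZMod.pow_card_sub_one_eq_one (sub_ne_zero.2 h)]
    simp

theorem hasseP_coeff_half : (hasseP p).coeff ((p - 1) / 2) = 1 := by
  rw [hasseP, Polynomial.finsetSum_coeff, sum_eq_single ((p - 1) / 2)]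
  · simp
  · intro b _ hb
    rw [Polynomial.coeff_monomial, if_neg hb]
  · simp

theorem card_hasseP_eq_le (hp2 : p % 2 = 1) (s : ZMod p) :
    (univ.filter fun a : ZMod p => (hasseP p).eval a = s).card ≤ (p - 1) / 2 := by
  have hm : 0 < (p - 1) / 2 := by have := hp.out.two_le; omega
  have h0 : hasseP p - Polynomial.C s ≠ 0 := by
    intro h
    have := congr_arg (Polynomial.coeff · ((p - 1) / 2)) h
    simp [hasseP_coeff_half, Polynomial.coeff_C, hm.ne'] at this
  calc _ ≤ (hasseP p - Polynomial.C s).roots.toFinset.card := by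
        refine card_le_card fun a ha => ?_
        simp only [mem_filter, mem_univ, true_and] at ha
        rw [Multiset.mem_toFinset, Polynomial.mem_roots h0]
        simp [ha]
    _ ≤ (hasseP p - Polynomial.C s).roots.card := Multiset.toFinset_card_le _
    _ ≤ _ := (Polynomial.card_roots' _).trans (by
        rw [Polynomial.natDegree_sub_C]; exact hasseP_natDegree_le)

theorem exists_trace_set_card (hp2 : p % 2 = 1) :
    ∃ S : Finset (ℂ × Matrix (Fin 2) (Fin 2) ℤ),
      (∀ x ∈ S, 0 < x.1.im ∧ (∃ w : ℂ, 0 < w.im ∧ 1 ≤ Complex.normSq w ∧ |w.re| ≤ 1 / 2 ∧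
        ∃ k, x.1 = mact (sixMat k) w) ∧ InM p x.2 ∧ mact x.2 x.1 = x.1) ∧
      ∀ s : ZMod p, 2 * #{a : ZMod p | (a ≠ 0 ∧ a ≠ 1) ∧ (hasseP p).eval a = s} ≤
        #{x ∈ S | (x.2.trace : ZMod p) = s} := by
  obtain ⟨S, h1, h2⟩ := exists_trace_set (p := p) hp2
  refine ⟨S, h1, fun s => ?_⟩
  have h := h2 (1 - (Polynomial.X - Polynomial.C s) ^ (p - 1))
  rw [sum_indicator_eval, sum_indicator_eval, filter_filter] at h
  have h' : ((#{x ∈ S | (x.2.trace : ZMod p) = s} : ℕ) : ZMod p) =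
      ((2 * #{a : ZMod p | (a ≠ 0 ∧ a ≠ 1) ∧ (hasseP p).eval a = s} : ℕ) : ZMod p) := by
    push_cast
    exact h
  have hle : 2 * #{a : ZMod p | (a ≠ 0 ∧ a ≠ 1) ∧ (hasseP p).eval a = s} < p := by
    have h3 := (card_le_card (monotone_filter_right univ
      (p := fun a : ZMod p => (a ≠ 0 ∧ a ≠ 1) ∧ (hasseP p).eval a = s)
      (q := fun a : ZMod p => (hasseP p).eval a = s) fun a ha h => h.2)).trans
        (card_hasseP_eq_le hp2 s)
    have := hp.out.two_le
    omega
  rw [ZMod.natCast_eq_natCast_iff'] at h'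
  rw [Nat.mod_eq_of_lt hle] at h'
  rw [← h']
  exact Nat.mod_le _ _

end

section
variable {p : ℕ} [hp : Fact p.Prime]

def legTrace (l : ZMod p) : ℤ :=
  quadraticChar (ZMod p) (-1) * (-∑ x : ZMod p, quadraticChar (ZMod p) (x * (x - 1) * (x - l)))

theorem quadraticChar_zmod_cast (hp2 : p % 2 = 1) (a : ZMod p) :
    ((quadraticChar (ZMod p) a : ℤ) : ZMod p) = a ^ ((p - 1) / 2) := by
  have h : ringChar (ZMod p) ≠ 2 := by rw [ZMod.ringChar_zmod_n]; omega
  rw [quadraticChar_eq_pow_of_char_ne_two' h, ZMod.card]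
  congr 1
  omega

theorem coeff_legendre_family (m : ℕ) (l : ZMod p) :
    ((Polynomial.X - 1) ^ m * (Polynomial.X - Polynomial.C l) ^ m).coeff m =
      (-1) ^ m * ∑ i ∈ range (m + 1), (m.choose i : ZMod p) ^ 2 * l ^ i := by
  rw [Polynomial.coeff_mul, Finset.Nat.sum_antidiagonal_eq_sum_range_succ_mk, mul_sum]
  refine sum_congr rfl fun i hi => ?_
  have hi : i ≤ m := by simpa [Nat.lt_succ_iff] using hi
  have e1 := Polynomial.coeff_X_add_C_pow (-1 : ZMod p) m i
  have e2 := Polynomial.coeff_X_add_C_pow (-l) m (m - i)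
  rw [Polynomial.C_neg, ← sub_eq_add_neg] at e1 e2
  rw [Polynomial.C_1] at e1
  simp only
  rw [e1, e2, Nat.sub_sub_self hi, Nat.choose_symm hi, neg_pow l]
  obtain ⟨j, rfl⟩ := Nat.exists_eq_add_of_le hi
  rw [Nat.add_sub_cancel_left, pow_add]
  ring

theorem legTrace_zmod (hp2 : p % 2 = 1) (l : ZMod p) :
    (legTrace l : ZMod p) = (hasseP p).eval l := by
  have h2 := hp.out.two_le
  set m := (p - 1) / 2 with hm
  have hpm : p - 1 = 2 * m := by omega
  have hm0 : m ≠ 0 := by omega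
  set Q : Polynomial (ZMod p) := (Polynomial.X - 1) ^ m * (Polynomial.X - Polynomial.C l) ^ m
  have hdeg : (Polynomial.X ^ m * Q).natDegree < (p - 1) * 2 := by
    have e1 : ((Polynomial.X - 1 : Polynomial (ZMod p)) ^ m).natDegree ≤ m := by
      have := Polynomial.natDegree_pow_le_of_le m (Polynomial.natDegree_X_sub_C_le (1 : ZMod p))
      rwa [Polynomial.C_1, mul_one] at this
    have e2 := Polynomial.natDegree_pow_le_of_le m (Polynomial.natDegree_X_sub_C_le l)
    rw [mul_one] at e2
    have e3 := Polynomial.natDegree_mul_le_of_le e1 e2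
    have e4 : (Polynomial.X ^ m * Q).natDegree ≤ m + (m + m) := by
      simpa [mul_one] using Polynomial.natDegree_mul_le_of_le (Polynomial.natDegree_X_pow_le (R := ZMod p) m) e3
    omega
  have key := sum_units_eval _ 2 hdeg
  have hE : ∀ a, (Polynomial.X ^ m * Q).eval a = (a * (a - 1) * (a - l)) ^ m := by
    intro a
    simp [Q, mul_pow, mul_assoc]
  simp only [hE, sum_range_succ, range_zero, sum_empty, mul_zero, zero_add, mul_one, hpm] at key
  rw [two_mul m, Polynomial.coeff_X_pow_mul, Polynomial.coeff_X_pow_mul', if_neg (by omega),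
    coeff_legendre_family, sum_filter] at key
  have key' : ∑ a : ZMod p, (a * (a - 1) * (a - l)) ^ m =
      -((-1) ^ m * ∑ i ∈ range (m + 1), (m.choose i : ZMod p) ^ 2 * l ^ i) := by
    rw [← zero_add ((-1) ^ m * _), ← key]
    refine sum_congr rfl fun a _ => ?_
    split_ifs with h
    · rfl
    · simp [not_not.1 h, hm0]
  rw [legTrace]
  push_cast
  simp only [quadraticChar_zmod_cast hp2, ← hm]
  rw [key', hasseP, Polynomial.eval_finsetSum, ← hm, neg_neg, ← mul_assoc, ← mul_pow]
  simp

theorem odd_quadraticChar {a : ZMod p} (ha : a ≠ 0) : (quadraticChar (ZMod p) a : ℤ) % 2 = 1 := by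
  rcases quadraticChar_dichotomy ha with h | h <;> rw [h] <;> rfl

theorem legTrace_even (hp2 : p % 2 = 1) {l : ZMod p} (h0 : l ≠ 0) (h1 : l ≠ 1) :
    legTrace l % 2 = 0 := by
  have h : (∑ x : ZMod p, (quadraticChar (ZMod p) (x * (x - 1) * (x - l)) : ℤ)) % 2 =
      ((p : ℤ) - 3) % 2 := by
    rw [Finset.sum_int_mod]
    have : ∀ x : ZMod p, (quadraticChar (ZMod p) (x * (x - 1) * (x - l)) : ℤ) % 2 =
        if x ∈ ({0, 1, l} : Finset (ZMod p)) then 0 else 1 := by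
      intro x
      split_ifs with hx
      · simp only [mem_insert, mem_singleton] at hx
        rcases hx with rfl | rfl | rfl <;> simp
      · simp only [mem_insert, mem_singleton, not_or] at hx
        exact odd_quadraticChar (mul_ne_zero (mul_ne_zero hx.1 (sub_ne_zero.2 hx.2.1))
          (sub_ne_zero.2 hx.2.2))
    rw [sum_congr rfl fun x _ => this x]
    have hc : #({0, 1, l} : Finset (ZMod p)) = 3 := by
      rw [card_insert_of_notMem (by simp [h0.symm]), card_pair h1.symm]
    have hs : (∑ x : ZMod p, if x ∈ ({0, 1, l} : Finset (ZMod p)) then (0 : ℤ) else 1) =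
        (p : ℤ) - 3 := by
      have := Finset.sum_ite_mem univ ({0, 1, l} : Finset (ZMod p)) (fun _ => (1 : ℤ))
      simp only [univ_inter, sum_const, hc] at this
      have h4 : ∀ x : ZMod p, (if x ∈ ({0, 1, l} : Finset (ZMod p)) then (0 : ℤ) else 1) =
          1 - if x ∈ ({0, 1, l} : Finset (ZMod p)) then 1 else 0 := by
        intro x; split_ifs <;> rfl
      simp only [h4, sum_sub_distrib, this]
      simp
    rw [hs]
  have hq := odd_quadraticChar (p := p) (a := -1) (by simp)
  rw [legTrace, Int.mul_emod, hq, Int.neg_emod_two, h]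
  omega

theorem abs_quadraticChar_le (a : ZMod p) : |(quadraticChar (ZMod p) a : ℤ)| ≤ 1 := by
  by_cases h : a = 0
  · simp [h]
  · rcases quadraticChar_dichotomy h with h | h <;> rw [h] <;> simp

theorem abs_legTrace_le (l : ZMod p) : |legTrace l| ≤ p := by
  rw [legTrace, abs_mul, abs_neg]
  calc _ ≤ 1 * ∑ x : ZMod p, (1 : ℤ) :=
        mul_le_mul (abs_quadraticChar_le _) ((abs_sum_le_sum_abs _ _).trans
          (sum_le_sum fun x _ => abs_quadraticChar_le _)) (abs_nonneg _) zero_le_one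
    _ = p := by simp

theorem trace_sq_lt {M : Matrix (Fin 2) (Fin 2) ℤ} {τ : ℂ} (hM : InM p M) (h : 0 < τ.im)
    (hfix : mact M τ = τ) : M.trace ^ 2 < 4 * p := by
  have hc := one_zero_ne_zero_of_fixed hfix hp.out hM h
  have hd : M.det ≠ 0 := by rw [hM.1]; exact_mod_cast hp.out.ne_zero
  obtain ⟨e1, e2, e3⟩ := mden_fixed hfix hd hc h
  set z := mden M τ
  have f1 := congr_arg Complex.re e1
  have f2 := congr_arg Complex.re e2
  simp at f1 f2
  have f3 : z.im ≠ 0 := by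
    intro h
    apply e3
    apply Complex.ext <;> simp [h]
  rw [hM.1] at f2
  have : ((M.trace : ℤ) : ℝ) ^ 2 < 4 * p := by
    rw [Matrix.trace_fin_two]
    push_cast
    rw [← f1]
    push_cast at f2
    nlinarith [sq_nonneg z.im, sq_pos_of_ne_zero f3]
  exact_mod_cast this

theorem trace_even (hp2 : p % 2 = 1) {M : Matrix (Fin 2) (Fin 2) ℤ} (hM : InM p M) :
    M.trace % 2 = 0 := by
  rw [Matrix.trace_fin_two]
  have h1 := hM.one_one
  have h2 := hM.2.1
  omega

theorem exists_trace_set_int (hp5 : 5 ≤ p) :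
    ∃ S : Finset (ℂ × Matrix (Fin 2) (Fin 2) ℤ),
      (∀ x ∈ S, 0 < x.1.im ∧ (∃ w : ℂ, 0 < w.im ∧ 1 ≤ Complex.normSq w ∧ |w.re| ≤ 1 / 2 ∧
        ∃ k, x.1 = mact (sixMat k) w) ∧ InM p x.2 ∧ mact x.2 x.1 = x.1) ∧
      ∀ I : Set ℤ, 2 * Set.ncard {l : ZMod p | l ≠ 0 ∧ l ≠ 1 ∧ legTrace l ∈ I} ≤
        Set.ncard {x | x ∈ S ∧ x.2.trace ∈ I} := by
  classical
  have hp2 : p % 2 = 1 := hp.out.eq_two_or_odd.resolve_left (by omega)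
  obtain ⟨S, h1, h2⟩ := exists_trace_set_card (p := p) hp2
  refine ⟨S, h1, fun I => ?_⟩
  have e1 : {l : ZMod p | l ≠ 0 ∧ l ≠ 1 ∧ legTrace l ∈ I} =
      ((univ.filter fun l : ZMod p => l ≠ 0 ∧ l ≠ 1 ∧ legTrace l ∈ I : Finset (ZMod p)) :
        Set (ZMod p)) := by ext; simp
  have e2 : {x | x ∈ S ∧ x.2.trace ∈ I} = (S.filter fun x => x.2.trace ∈ I : Finset _) := by
    ext; simp
  rw [e1, e2, Set.ncard_coe_finset, Set.ncard_coe_finset]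
  have m1 : ∀ l ∈ (univ.filter fun l : ZMod p => l ≠ 0 ∧ l ≠ 1 ∧ legTrace l ∈ I), legTrace l ∈
      univ.image (legTrace (p := p)) := fun l _ => mem_image_of_mem _ (mem_univ _)
  rw [card_eq_sum_card_fiberwise m1, mul_sum]
  set J := univ.image (legTrace (p := p))
  have m2 : ∑ t ∈ J, #{x ∈ {x ∈ S | x.2.trace ∈ I} | x.2.trace = t} ≤ #{x ∈ S | x.2.trace ∈ I} := by
    rw [← card_biUnion]
    · exact card_le_card (biUnion_subset.2 fun t _ => filter_subset _ _)
    · intro s _ t _ hst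
      exact disjoint_filter.2 fun x _ h h' => hst (h.symm.trans h')
  refine le_trans (sum_le_sum fun t ht => ?_) m2
  rcases (filter (fun l => legTrace l = t)
    {l : ZMod p | l ≠ 0 ∧ l ≠ 1 ∧ legTrace l ∈ I}).eq_empty_or_nonempty with h | ⟨l, hl⟩
  · rw [h]
    simp
  simp only [mem_filter, mem_univ, true_and] at hl
  obtain ⟨⟨hl0, hl1, hlI⟩, rfl⟩ := hl
  calc _ ≤ 2 * #{a : ZMod p | (a ≠ 0 ∧ a ≠ 1) ∧ (hasseP p).eval a = (legTrace l : ZMod p)} := by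
        refine Nat.mul_le_mul_left 2 (card_le_card fun a ha => ?_)
        simp only [mem_filter, mem_univ, true_and] at ha ⊢
        exact ⟨⟨ha.1.1, ha.1.2.1⟩, by rw [← legTrace_zmod hp2, ha.2]⟩
    _ ≤ _ := h2 _
    _ ≤ _ := by
        refine card_le_card fun x hx => ?_
        simp only [mem_filter] at hx ⊢
        obtain ⟨hxS, hx⟩ := hx
        obtain ⟨him, -, hM, hfix⟩ := h1 x hxS
        have hlt := trace_sq_lt hM him hfix
        have : x.2.trace = legTrace l := by
          have d1 := trace_even hp2 hM
          have d2 := legTrace_even hp2 hl0 hl1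
          obtain ⟨d3, d3'⟩ := abs_le.1 (abs_legTrace_le l)
          rw [ZMod.intCast_eq_intCast_iff_dvd_sub] at hx
          obtain ⟨k, hk⟩ := hx
          have hp5' : (5 : ℤ) ≤ p := by exact_mod_cast hp5
          have hlt' := abs_lt_of_sq_lt_sq (a := x.2.trace) (b := (p : ℤ)) (by nlinarith) (by omega)
          obtain ⟨d4, d5⟩ := abs_lt.1 hlt'
          have hk2 : k % 2 = 0 := by
            have hw : (p : ℤ) = 2 * (p / 2) + 1 := by omega
            rw [hw] at hk
            refine Int.emod_eq_zero_of_dvd ⟨legTrace l / 2 - x.2.trace / 2 - p / 2 * k, ?_⟩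
            have d6 : legTrace l - x.2.trace = 2 * (legTrace l / 2) - 2 * (x.2.trace / 2) := by
              omega
            linarith
          have k1 : k < 2 := by nlinarith
          have k2 : -2 < k := by nlinarith
          have : k = 0 := by omega
          rw [this] at hk
          omega
        exact ⟨⟨hxS, this ▸ hlI⟩, this⟩

end

section
variable {p : ℕ} {M N g : Matrix (Fin 2) (Fin 2) ℤ} {w w' : ℂ}

theorem fixed_coords (hfix : mact M w = w) (hM : M.det ≠ 0) (hc : M 1 0 ≠ 0) (h : 0 < w.im) :
    2 * (M 1 0 : ℝ) * w.re = M 0 0 - M 1 1 ∧ (M 1 0 : ℝ) * Complex.normSq w = -M 0 1 := by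
  obtain ⟨e1, e2, -⟩ := mden_fixed hfix hM hc h
  have f1 := congr_arg Complex.re e1
  have f2 := congr_arg Complex.re e2
  simp [mden, Matrix.det_fin_two] at f1 f2
  have hc' : (M 1 0 : ℝ) ≠ 0 := by exact_mod_cast hc
  have k1 : 2 * (M 1 0 : ℝ) * w.re = M 0 0 - M 1 1 := by linarith
  refine ⟨k1, mul_left_cancel₀ hc' ?_⟩
  rw [Complex.normSq_apply]
  linear_combination f2 - M 1 1 * k1

theorem fixed_unique (hfix : mact M w = w) (hfix' : mact M w' = w') (hM : M.det ≠ 0)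
    (hc : M 1 0 ≠ 0) (h : 0 < w.im) (h' : 0 < w'.im) : w = w' := by
  obtain ⟨a1, a2⟩ := fixed_coords hfix hM hc h
  obtain ⟨b1, b2⟩ := fixed_coords hfix' hM hc h'
  have hc' : (M 1 0 : ℝ) ≠ 0 := by exact_mod_cast hc
  have e1 : w.re = w'.re := mul_left_cancel₀ (mul_ne_zero two_ne_zero hc') (a1.trans b1.symm)
  have e2 := mul_left_cancel₀ hc' (a2.trans b2.symm)
  rw [Complex.normSq_apply, Complex.normSq_apply, e1] at e2
  have e3 : (w.im - w'.im) * (w.im + w'.im) = 0 := by linarith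
  rcases mul_eq_zero.1 e3 with e | e
  · exact Complex.ext e1 (by linarith)
  · linarith

def RedTriple (p : ℕ) (a₀ b₀ c₀ : ℤ) (x : ℤ × ℤ × ℤ) : Prop :=
  0 < x.1 ∧ x.1 % 4 = c₀ ∧ x.2.1 % 4 = a₀ ∧ 4 * x.1 ∣ x.2.1 * x.2.2 - p - b₀ * x.1 ∧
    |x.2.1 - x.2.2| ≤ x.1 ∧
    (x.2.1 + x.2.2) ^ 2 + 4 * x.1 ^ 2 ≤ 4 * p + (x.2.1 - x.2.2) ^ 2

theorem redTriple_of_fixed {b₀ : ℤ} (hdet : M.det = p) (hc : 0 < M 1 0) (hp : p ≠ 0)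
    (hfix : mact M w = w)
    (h : 0 < w.im) (h1 : 1 ≤ Complex.normSq w) (h2 : |w.re| ≤ 1 / 2) (hb : M 0 1 % 4 = b₀) :
    RedTriple p (M 0 0 % 4) b₀ (M 1 0 % 4) (M 1 0, M 0 0, M 1 1) := by
  obtain ⟨e1, e2⟩ := fixed_coords hfix (by rw [hdet]; exact_mod_cast hp) hc.ne' h
  have hc' : (0 : ℝ) < M 1 0 := by exact_mod_cast hc
  have hbc : M 1 0 ≤ -M 0 1 := by
    have : (M 1 0 : ℝ) ≤ -M 0 1 := by rw [← e2]; nlinarith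
    exact_mod_cast this
  rw [Matrix.det_fin_two] at hdet
  refine ⟨hc, rfl, rfl, ?_, ?_, ?_⟩
  · refine ⟨M 0 1 / 4, ?_⟩
    have : M 0 1 = 4 * (M 0 1 / 4) + b₀ := by omega
    linear_combination hdet + M 1 0 * this
  · have : |(M 0 0 - M 1 1 : ℝ)| ≤ M 1 0 := by
      rw [← e1, abs_mul, abs_of_pos (by positivity)]
      nlinarith
    exact_mod_cast this
  · simp only
    nlinarith

theorem mod_four_conj (h : ∀ i j, M i j % 4 = N i j % 4) (i j : Fin 2) :
    (g.adjugate * M * g) i j % 4 = (g.adjugate * N * g) i j % 4 := by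
  have hk : ∃ K : Matrix (Fin 2) (Fin 2) ℤ, M = N + (4 : ℤ) • K := by
    refine ⟨Matrix.of fun i j => M i j / 4 - N i j / 4, ?_⟩
    ext i j
    have := h i j
    simp only [Matrix.add_apply, Matrix.smul_apply, smul_eq_mul, Matrix.of_apply]
    omega
  obtain ⟨K, rfl⟩ := hk
  rw [mul_add, add_mul, Matrix.mul_smul, Matrix.smul_mul, Matrix.add_apply, Matrix.smul_apply,
    smul_eq_mul, Int.add_mul_emod_self_left]

theorem adjugate_mact_fixed (hdet : 0 < M.det) (hfix : mact M w = w) (h : 0 < w.im) :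
    mact M.adjugate w = w := by
  have hd : 0 < M.adjugate.det := by rw [Matrix.det_adjugate]; simpa using hdet
  conv_lhs => rw [← hfix]
  rw [← mact_mul hd hdet h, Matrix.adjugate_mul]
  have : (M.det : ℂ) ≠ 0 := by exact_mod_cast hdet.ne'
  simp [mact]
  field_simp

end

section
variable {p : ℕ}

theorem redTriple_fiber_card {I : Set ℤ} {B : ℕ} (hp : p.Prime) (hp2 : p % 2 = 1)
    (hB : ∀ a₀ b₀ c₀ : ℤ, a₀ = 1 ∨ a₀ = 3 → b₀ = 0 ∨ b₀ = 2 → c₀ = 0 ∨ c₀ = 2 →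
      ∀ T : Finset (ℤ × ℤ × ℤ), (∀ x ∈ T, RedTriple p a₀ b₀ c₀ x ∧ x.2.1 + x.2.2 ∈ I) →
        #T ≤ B)
    (U : Finset (Matrix (Fin 2) (Fin 2) ℤ)) (N : Matrix (Fin 2) (Fin 2) ℤ)
    (hU : ∀ M ∈ U, InP p M ∧ (∀ i j, M i j % 4 = N i j % 4) ∧ 0 < M 1 0 ∧ M.trace ∈ I ∧
      ∃ w : ℂ, 0 < w.im ∧ 1 ≤ Complex.normSq w ∧ |w.re| ≤ 1 / 2 ∧ mact M w = w) :
    #U ≤ B := by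
  rcases U.eq_empty_or_nonempty with rfl | ⟨M₀, h₀⟩
  · simp
  have hN : N 0 0 % 2 = 1 ∧ N 0 1 % 2 = 0 ∧ N 1 0 % 2 = 0 := by
    obtain ⟨⟨-, h1, h2, h3⟩, h4, -⟩ := hU M₀ h₀
    have e1 := h4 0 0
    have e2 := h4 0 1
    have e3 := h4 1 0
    rw [Int.even_iff] at h2 h3
    omega
  rw [← card_image_of_injOn (f := fun M : Matrix (Fin 2) (Fin 2) ℤ => (M 1 0, M 0 0, M 1 1))]
  · refine hB (N 0 0 % 4) (N 0 1 % 4) (N 1 0 % 4) (by omega) (by omega) (by omega) _ fun x hx => ?_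
    obtain ⟨M, hM, rfl⟩ := mem_image.1 hx
    obtain ⟨h1, h2, h3, h4, w, w1, w2, w3, w4⟩ := hU M hM
    refine ⟨?_, by rwa [Matrix.trace_fin_two] at h4⟩
    rw [← h2 0 0, ← h2 1 0]
    exact redTriple_of_fixed h1.1 h3 hp.ne_zero w4 w1 w2 w3 (h2 0 1)
  · intro M hM M' hM' h
    obtain ⟨⟨h1, -⟩, -, h3, -⟩ := hU M hM
    obtain ⟨⟨k1, -⟩, -⟩ := hU M' hM'
    simp only [Prod.mk.injEq] at h
    obtain ⟨e1, e2, e3⟩ := h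
    rw [Matrix.det_fin_two, ← k1, Matrix.det_fin_two, ← e1, ← e2, ← e3] at h1
    have e4 : M 0 1 = M' 0 1 := mul_right_cancel₀ h3.ne' (by linarith)
    ext i j
    fin_cases i <;> fin_cases j <;> assumption

theorem card_legTrace_le [Fact p.Prime] (hp5 : 5 ≤ p) {I : Set ℤ} {B : ℕ}
    (hB : ∀ a₀ b₀ c₀ : ℤ, a₀ = 1 ∨ a₀ = 3 → b₀ = 0 ∨ b₀ = 2 → c₀ = 0 ∨ c₀ = 2 →
      ∀ T : Finset (ℤ × ℤ × ℤ), (∀ x ∈ T, RedTriple p a₀ b₀ c₀ x ∧ x.2.1 + x.2.2 ∈ I) →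
        #T ≤ B) :
    2 * Set.ncard {l : ZMod p | l ≠ 0 ∧ l ≠ 1 ∧ legTrace l ∈ I} ≤ 48 * B := by
  classical
  have hp : p.Prime := Fact.out
  have hp2 : p % 2 = 1 := hp.eq_two_or_odd.resolve_left (by omega)
  obtain ⟨S, h1, h2⟩ := exists_trace_set_int (p := p) hp5
  refine (h2 I).trans ?_
  have e2 : {x | x ∈ S ∧ x.2.trace ∈ I} = (S.filter fun x => x.2.trace ∈ I : Finset _) := by
    ext; simp
  rw [e2, Set.ncard_coe_finset]
  have h3 : ∀ x : ℂ × Matrix (Fin 2) (Fin 2) ℤ, ∃ k, x ∈ S → ∃ w : ℂ, 0 < w.im ∧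
      1 ≤ Complex.normSq w ∧ |w.re| ≤ 1 / 2 ∧ x.1 = mact (sixMat k) w := by
    intro x
    by_cases hx : x ∈ S
    · obtain ⟨-, ⟨w, w1, w2, w3, k, w4⟩, -⟩ := h1 x hx
      exact ⟨k, fun _ => ⟨w, w1, w2, w3, w4⟩⟩
    · exact ⟨0, fun h => absurd h hx⟩
  choose κ hκ using h3
  let R : ℂ × Matrix (Fin 2) (Fin 2) ℤ → Matrix (Fin 2) (Fin 2) ℤ := fun x =>
    (sixMat (κ x)).adjugate * x.2 * sixMat (κ x)
  have hR : ∀ x ∈ S, InP p (R x) ∧ (R x).trace = x.2.trace ∧ R x 1 0 ≠ 0 ∧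
      ∃ w : ℂ, 0 < w.im ∧ 1 ≤ Complex.normSq w ∧ |w.re| ≤ 1 / 2 ∧
        x.1 = mact (sixMat (κ x)) w ∧ mact (R x) w = w := by
    intro x hx
    obtain ⟨him, -, hM, hfix⟩ := h1 x hx
    obtain ⟨w, w1, w2, w3, w4⟩ := hκ x hx
    have hg := sixMat_det (κ x)
    have hg' : (sixMat (κ x)).adjugate.det = 1 := by rw [Matrix.det_adjugate, hg]; simp
    have hd : 0 < x.2.det := by rw [hM.1]; exact_mod_cast hp.pos
    have hP := InP.conj hM.inP hg (by omega)
    have hfix' : mact (R x) w = w := by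
      have hdd : 0 < ((sixMat (κ x)).adjugate * x.2).det := by
        rw [Matrix.det_mul, hg', one_mul]; exact hd
      rw [show R x = (sixMat (κ x)).adjugate * x.2 * sixMat (κ x) from rfl,
        mact_mul hdd (by simp [hg]) w1, ← w4, mact_mul (by simp [hg']) hd him, hfix, w4,
        mact_inv_cancel' hg w1]
    refine ⟨hP, ?_, ?_, w, w1, w2, w3, w4, hfix'⟩
    · rw [Matrix.trace_mul_comm, ← Matrix.mul_assoc, Matrix.mul_adjugate, hg]
      simp
    · rcases hP.cases with h | h
      · exact one_zero_ne_zero_of_fixed hfix' hp h w1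
      · have := one_zero_ne_zero_of_fixed (by rw [mact_neg]; exact hfix') hp h w1
        simpa using this
  let f : ℂ × Matrix (Fin 2) (Fin 2) ℤ → Fin 6 × Bool × Bool × Bool := fun x =>
    (κ x, decide (x.2 0 1 % 4 = 0), decide (x.2 1 0 % 4 = 0), decide (0 < R x 1 0))
  have hinj : ∀ x ∈ S, ∀ y ∈ S, κ x = κ y → R x = R y → x = y := by
    intro x hx y hy hk hxy
    obtain ⟨⟨hd, -⟩, -, hc, w, w1, -, -, w4, w5⟩ := hR x hx
    obtain ⟨-, -, -, w', w1', -, -, w4', w5'⟩ := hR y hy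
    have hww := fixed_unique w5 (hxy ▸ w5') (by rw [hd]; exact_mod_cast hp.ne_zero) hc w1 w1'
    refine Prod.ext (by rw [w4, w4', hk, hww]) ?_
    have e : ∀ z, z.2 = sixMat (κ z) * R z * (sixMat (κ z)).adjugate := by
      intro z
      simp only [R]
      rw [← Matrix.mul_assoc, ← Matrix.mul_assoc, Matrix.mul_adjugate, Matrix.mul_assoc,
        Matrix.mul_adjugate, sixMat_det]
      simp
    rw [e x, e y, hk, hxy]
  have hcard : ∀ t ∈ image f (S.filter fun x => x.2.trace ∈ I),
      #{x ∈ S.filter fun x => x.2.trace ∈ I | f x = t} ≤ B := by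
    intro t ht
    obtain ⟨x₀, hx₀, rfl⟩ := mem_image.1 ht
    rw [mem_filter] at hx₀
    have hmod : ∀ x ∈ S, f x = f x₀ → ∀ i j, x.2 i j % 4 = x₀.2 i j % 4 := by
      intro x hx hf i j
      obtain ⟨-, -, hM, -⟩ := h1 x hx
      obtain ⟨-, -, hM₀, -⟩ := h1 x₀ hx₀.1
      simp only [f, Prod.mk.injEq, decide_eq_decide] at hf
      have d1 := hM.one_one
      have d2 := hM₀.one_one
      obtain ⟨-, a1, a2, a3⟩ := hM
      obtain ⟨-, b1, b2, b3⟩ := hM₀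
      rw [Int.even_iff] at a2 a3 b2 b3
      fin_cases i <;> fin_cases j <;> simp only [Fin.zero_eta, Fin.mk_one, Fin.isValue] <;> omega
    have hmodR : ∀ x ∈ S, f x = f x₀ → ∀ i j, R x i j % 4 = R x₀ i j % 4 := by
      intro x hx hf i j
      have hk : κ x = κ x₀ := congr_arg Prod.fst hf
      simp only [R]
      rw [hk]
      exact mod_four_conj (hmod x hx hf) i j
    by_cases hs : 0 < R x₀ 1 0
    · rw [← card_image_of_injOn (f := R)]
      · refine redTriple_fiber_card hp hp2 hB _ (R x₀) fun M hM => ?_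
        obtain ⟨x, hx, rfl⟩ := mem_image.1 hM
        simp only [mem_filter] at hx
        obtain ⟨⟨hxS, hxI⟩, hf⟩ := hx
        obtain ⟨c1, c2, c3, w, w1, w2, w3, w4, w5⟩ := hR x hxS
        simp only [f, Prod.mk.injEq, decide_eq_decide] at hf
        exact ⟨c1, hmodR x hxS (by simp only [f, Prod.mk.injEq, decide_eq_decide]; exact hf),
          hf.2.2.2.2 hs, by rwa [c2], w, w1, w2, w3, w5⟩
      · intro x hx y hy h
        simp only [coe_filter, Set.mem_ofPred_eq, mem_filter] at hx hy
        exact hinj x hx.1.1 y hy.1.1 ((congr_arg Prod.fst hx.2).trans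
          (congr_arg Prod.fst hy.2).symm) h
    · rw [← card_image_of_injOn (f := fun x => (R x).adjugate)]
      · refine redTriple_fiber_card hp hp2 hB _ (R x₀).adjugate fun M hM => ?_
        obtain ⟨x, hx, rfl⟩ := mem_image.1 hM
        simp only [mem_filter] at hx
        obtain ⟨⟨hxS, hxI⟩, hf⟩ := hx
        obtain ⟨c1, c2, c3, w, w1, w2, w3, w4, w5⟩ := hR x hxS
        have hmm := hmodR x hxS hf
        simp only [f, Prod.mk.injEq, decide_eq_decide] at hf
        have hlt : R x 1 0 < 0 := lt_of_le_of_ne (not_lt.1 fun h => hs (hf.2.2.2.1 h)) c3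
        have k1 := c1
        obtain ⟨k0, k1, k2, k3⟩ := k1
        rw [Int.even_iff] at k2 k3
        have k4 : R x 1 1 % 2 = 1 := by
          rw [Matrix.det_fin_two] at k0
          have : (R x 0 0 * R x 1 1) % 2 = 1 := by
            obtain ⟨u, hu⟩ := Int.dvd_of_emod_eq_zero k2
            rw [hu] at k0
            have : (2 * u * R x 1 0) = 2 * (u * R x 1 0) := by ring
            omega
          rw [Int.mul_emod, k1] at this
          omega
        refine ⟨⟨?_, ?_, ?_, ?_⟩, fun i j => ?_, ?_, ?_, w, w1, w2, w3,
          adjugate_mact_fixed (by rw [k0]; exact_mod_cast hp.pos) w5 w1⟩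
        · rw [Matrix.det_adjugate, k0]; simp
        · simpa [Matrix.adjugate_fin_two] using k4
        · simpa [Matrix.adjugate_fin_two, Int.even_iff] using k2
        · simpa [Matrix.adjugate_fin_two, Int.even_iff] using k3
        · have m1 := hmm 0 0
          have m2 := hmm 0 1
          have m3 := hmm 1 0
          have m4 := hmm 1 1
          rw [Matrix.adjugate_fin_two, Matrix.adjugate_fin_two]
          fin_cases i <;> fin_cases j <;> simp <;> omega
        · simpa [Matrix.adjugate_fin_two] using hlt
        · rw [← c2, Matrix.trace_fin_two] at hxI
          rw [Matrix.trace_fin_two, Matrix.adjugate_fin_two]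
          simpa [add_comm] using hxI
      · intro x hx y hy h
        simp only [coe_filter, Set.mem_ofPred_eq, mem_filter] at hx hy
        refine hinj x hx.1.1 y hy.1.1 ((congr_arg Prod.fst hx.2).trans
          (congr_arg Prod.fst hy.2).symm) ?_
        have h' := congr_arg Matrix.adjugate h
        simpa [Matrix.adjugate_adjugate'] using h'
  calc _ ≤ B * #(image f (S.filter fun x => x.2.trace ∈ I)) := card_le_mul_card_image _ _ hcard
    _ ≤ B * 48 := Nat.mul_le_mul_left _ ((card_le_univ _).trans_eq (by simp))
    _ = 48 * B := mul_comm _ _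

end

section

theorem succ_pow_four_le (e : ℕ) : (e + 1) ^ 4 ≤ 41 * 2 ^ e := by
  by_cases h : e < 5
  · interval_cases e <;> norm_num
  · obtain ⟨k, rfl⟩ := Nat.exists_eq_add_of_le (not_lt.1 h)
    clear h
    induction k with
    | zero => norm_num
    | succ k ih =>
      have : (5 + (k + 1) + 1) ^ 4 ≤ 2 * (5 + k + 1) ^ 4 := by
        ring_nf
        nlinarith [pow_nonneg k.zero_le 4]
      calc _ ≤ _ := this
        _ ≤ 2 * (41 * 2 ^ (5 + k)) := Nat.mul_le_mul_left _ ih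
        _ = _ := by ring

theorem card_divisors_pow_four_le {n : ℕ} (hn : n ≠ 0) : #n.divisors ^ 4 ≤ 41 ^ 16 * n := by
  rw [Nat.card_divisors hn, ← prod_pow]
  calc ∏ x ∈ n.primeFactors, (n.factorization x + 1) ^ 4
      ≤ ∏ x ∈ n.primeFactors, ((if x < 16 then 41 else 1) * x ^ n.factorization x) := by
        refine prod_le_prod' fun x hx => ?_
        have hx2 := (Nat.prime_of_mem_primeFactors hx).two_le
        split_ifs with h
        · exact (succ_pow_four_le _).trans
            (Nat.mul_le_mul_left _ (Nat.pow_le_pow_left hx2 _))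
        · rw [one_mul]
          calc _ ≤ (2 ^ n.factorization x) ^ 4 := Nat.pow_le_pow_left Nat.lt_two_pow_self _
            _ = (2 ^ 4) ^ n.factorization x := by rw [← pow_mul, ← pow_mul, mul_comm]
            _ ≤ _ := Nat.pow_le_pow_left (not_lt.1 h) _
    _ = (∏ x ∈ n.primeFactors, if x < 16 then 41 else 1) * n := by
        rw [prod_mul_distrib]
        congr 1
        exact Nat.prod_factorization_pow_eq_self hn
    _ ≤ _ := by
        refine Nat.mul_le_mul_right _ ?_
        rw [← prod_filter, prod_const]
        refine Nat.pow_le_pow_right (by norm_num) ?_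
        calc _ ≤ #(range 16) := card_le_card fun x hx => by
              rw [mem_range]; exact (mem_filter.1 hx).2
          _ = 16 := card_range _

variable {q : ℕ} [NeZero q]

theorem card_le_gcd_mul_le (D : ℕ) :
    #{w : ZMod q | D ≤ w.val.gcd q} * D ≤ #q.divisors * q := by
  have hq := NeZero.ne q
  have h1 : #{w : ZMod q | D ≤ w.val.gcd q} ≤ ∑ d ∈ q.divisors with D ≤ d, q / d := by
    calc _ ≤ #((q.divisors.filter (D ≤ ·)).biUnion fun d => {w : ZMod q | d ∣ w.val}) := by
          refine card_le_card fun w hw => ?_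
          simp only [mem_filter, mem_univ, true_and] at hw
          simp only [mem_biUnion, mem_filter, mem_univ, true_and, Nat.mem_divisors]
          exact ⟨w.val.gcd q, ⟨⟨Nat.gcd_dvd_right _ _, hq⟩, hw⟩, Nat.gcd_dvd_left _ _⟩
      _ ≤ _ := card_biUnion_le.trans (sum_le_sum fun d hd => ?_)
    have hdq := Nat.dvd_of_mem_divisors (mem_filter.1 hd).1
    have hd0 : 0 < d := Nat.pos_of_dvd_of_pos hdq (Nat.pos_of_ne_zero hq)
    rw [← card_range (q / d)]
    refine card_le_card_of_injOn (fun w => w.val / d) (fun w hw => ?_) fun w hw w' hw' h => ?_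
    · simp only [coe_range, Set.mem_Iio]
      exact Nat.div_lt_div_of_lt_of_dvd hdq (ZMod.val_lt w)
    · simp only [coe_filter, mem_univ, true_and, Set.mem_ofPred_eq] at hw hw'
      apply ZMod.val_injective q
      rw [← Nat.div_mul_cancel hw, ← Nat.div_mul_cancel hw']
      exact congr_arg (· * d) h
  calc _ ≤ (∑ d ∈ q.divisors with D ≤ d, q / d) * D := Nat.mul_le_mul_right _ h1
    _ = ∑ d ∈ q.divisors with D ≤ d, q / d * D := sum_mul _ _ _
    _ ≤ ∑ d ∈ q.divisors with D ≤ d, q := sum_le_sum fun d hd =>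
        (Nat.mul_le_mul_left _ (mem_filter.1 hd).2).trans (Nat.div_mul_le_self _ _)
    _ ≤ _ := by
        rw [sum_const, smul_eq_mul]
        exact Nat.mul_le_mul_right _ (card_filter_le _ _)

theorem card_cubic_mul_le {D : ℕ} (hD : D ^ 3 ≤ q) :
    #{x : ZMod q × ZMod q | (x.1 + x.2) * (x.1 - 1) * (x.2 - 1) = 0} * D ≤
      3 * (#q.divisors * q ^ 2) := by
  classical
  set G : Finset (ZMod q) := {w : ZMod q | D ≤ w.val.gcd q} with hG
  have hsub : ({x : ZMod q × ZMod q | (x.1 + x.2) * (x.1 - 1) * (x.2 - 1) = 0} : Finset _) ⊆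
      ({x : ZMod q × ZMod q | x.1 + x.2 ∈ G} : Finset _) ∪
        ({x : ZMod q × ZMod q | x.1 - 1 ∈ G} : Finset _) ∪
        ({x : ZMod q × ZMod q | x.2 - 1 ∈ G} : Finset _) := by
    rintro ⟨u, v⟩ h
    simp only [mem_filter, mem_univ, true_and, mem_union, hG] at h ⊢
    by_contra! hc
    obtain ⟨⟨h1, h2⟩, h3⟩ := hc
    generalize u + v = a at h h1
    generalize u - 1 = b at h h2
    generalize v - 1 = c at h h3
    have hdvd : q ∣ a.val * b.val * c.val := by
      rw [← ZMod.natCast_eq_zero_iff]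
      push_cast
      simpa using h
    have h4 : q ∣ a.val.gcd q * b.val.gcd q * c.val.gcd q := by
      have e1 : q ∣ (a.val * b.val * c.val).gcd q := Nat.dvd_gcd hdvd dvd_rfl
      have e2 := Nat.gcd_mul_right_dvd_mul_gcd q (a.val * b.val) c.val
      have e3 := Nat.gcd_mul_right_dvd_mul_gcd q a.val b.val
      simp only [Nat.gcd_comm q] at e2 e3
      exact e1.trans (e2.trans (Nat.mul_dvd_mul_right e3 _))
    have hpos : ∀ w : ZMod q, 0 < w.val.gcd q := fun w =>
      Nat.gcd_pos_of_pos_right _ (Nat.pos_of_ne_zero (NeZero.ne q))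
    have h5 := Nat.le_of_dvd (Nat.mul_pos (Nat.mul_pos (hpos a) (hpos b)) (hpos c)) h4
    have h6 : a.val.gcd q * b.val.gcd q * c.val.gcd q < D * D * D :=
      Nat.mul_lt_mul'' (Nat.mul_lt_mul'' h1 h2) h3
    have : D * D * D = D ^ 3 := by ring
    omega
  have hcard : ∀ f : ZMod q × ZMod q → ZMod q × ZMod q, Function.Injective f →
      #({x : ZMod q × ZMod q | (f x).1 ∈ G} : Finset _) ≤ #G * q := by
    intro f hf
    have : #(G ×ˢ (univ : Finset (ZMod q))) = #G * q := by
      rw [card_product, card_univ, ZMod.card]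
    rw [← this]
    refine card_le_card_of_injOn f (fun x hx => ?_) hf.injOn
    simp only [coe_filter, mem_univ, true_and, Set.mem_ofPred_eq] at hx
    simpa using hx
  have k1 := hcard (fun x => (x.1 + x.2, x.2)) (by
    rintro ⟨a, b⟩ ⟨c, d⟩ h
    simp only [Prod.mk.injEq] at h ⊢
    obtain ⟨h1, rfl⟩ := h
    exact ⟨add_right_cancel h1, rfl⟩)
  have k2 := hcard (fun x => (x.1 - 1, x.2)) (by
    rintro ⟨a, b⟩ ⟨c, d⟩ h
    simpa using h)
  have k3 := hcard (fun x => (x.2 - 1, x.1)) (by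
    rintro ⟨a, b⟩ ⟨c, d⟩ h
    simpa [and_comm] using h)
  simp only at k1 k2 k3
  have k4 : #{x : ZMod q × ZMod q | (x.1 + x.2) * (x.1 - 1) * (x.2 - 1) = 0} ≤ 3 * (#G * q) := by
    refine (card_le_card hsub).trans ((card_union_le _ _).trans ?_)
    have := card_union_le ({x : ZMod q × ZMod q | x.1 + x.2 ∈ G} : Finset _)
      ({x : ZMod q × ZMod q | x.1 - 1 ∈ G} : Finset _)
    omega
  have k5 := card_le_gcd_mul_le (q := q) D
  rw [← hG] at k5
  calc _ ≤ 3 * (#G * q) * D := Nat.mul_le_mul_right _ k4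
    _ = 3 * ((#G * D) * q) := by ring
    _ ≤ 3 * ((#q.divisors * q) * q) := by gcongr
    _ = _ := by ring

end

section
open ZMod
variable {q : ℕ} [NeZero q]

theorem norm_sq_sum_stdAddChar {ι : Type*} (s : Finset ι) (f g : ι → ZMod q) :
    ∑ x : ZMod q × ZMod q, ‖∑ i ∈ s, stdAddChar (x.1 * f i + x.2 * g i)‖ ^ 2 =
      q ^ 2 * #{y ∈ s ×ˢ s | f y.1 = f y.2 ∧ g y.1 = g y.2} := by
  have hc : ∀ x : ZMod q × ZMod q,
      ((‖∑ i ∈ s, stdAddChar (x.1 * f i + x.2 * g i)‖ ^ 2 : ℝ) : ℂ) =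
        ∑ y ∈ s ×ˢ s, stdAddChar (x.1 * (f y.1 - f y.2)) * stdAddChar (x.2 * (g y.1 - g y.2)) := by
    intro x
    rw [Complex.ofReal_pow, ← Complex.mul_conj', map_sum, sum_mul_sum, ← sum_product']
    refine sum_congr rfl fun y _ => ?_
    rw [← AddChar.map_neg_eq_conj, ← AddChar.map_add_eq_mul, ← AddChar.map_add_eq_mul]
    congr 1
    ring
  have h : ((∑ x : ZMod q × ZMod q, ‖∑ i ∈ s, stdAddChar (x.1 * f i + x.2 * g i)‖ ^ 2 : ℝ) : ℂ) =
      ((q ^ 2 * #{y ∈ s ×ˢ s | f y.1 = f y.2 ∧ g y.1 = g y.2} : ℝ) : ℂ) := by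
    rw [Complex.ofReal_sum, sum_congr rfl fun x _ => hc x, sum_comm, card_filter]
    push_cast
    rw [mul_sum]
    refine sum_congr rfl fun y _ => ?_
    rw [Fintype.sum_prod_type]
    simp only [← mul_sum, ← sum_mul]
    rw [AddChar.sum_mulShift _ (isPrimitive_stdAddChar q),
      AddChar.sum_mulShift _ (isPrimitive_stdAddChar q), ZMod.card]
    simp only [sub_eq_zero]
    by_cases h1 : f y.1 = f y.2 <;> by_cases h2 : g y.1 = g y.2 <;> simp [h1, h2, sq]
  exact_mod_cast h

def unitClass (h : 4 ∣ q) (α : (ZMod 4)ˣ) : Finset (ZMod q)ˣ :=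
  {u | unitsMap h u = α}

theorem two_mul_card_unitClass (h : 4 ∣ q) (α : (ZMod 4)ˣ) :
    2 * #(unitClass h α) = q.totient := by
  have hs := unitsMap_surjective h
  have e : ∀ β : (ZMod 4)ˣ, #(unitClass h β) = #(unitClass h α) := fun β =>
    MonoidHom.card_fiber_eq_of_mem_range (unitsMap h) (hs β) (hs α)
  have h2 := card_eq_sum_card_fiberwise (s := (univ : Finset (ZMod q)ˣ)) (t := univ)
    (f := unitsMap h) (fun _ _ => mem_univ _)
  rw [card_univ, ZMod.card_units_eq_totient] at h2
  rw [h2]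
  change _ = ∑ β, #(unitClass h β)
  rw [sum_congr rfl fun β _ => e β, sum_const, card_univ, ZMod.card_units_eq_totient]
  rfl

noncomputable def kls (h : 4 ∣ q) (α : (ZMod 4)ˣ) (m n : ZMod q) : ℂ :=
  ∑ u ∈ unitClass h α, stdAddChar (m * u.val + n * u⁻¹.val)

theorem kls_mul (h : 4 ∣ q) (α : (ZMod 4)ˣ) (m n : ZMod q) {v : (ZMod q)ˣ}
    (hv : v ∈ unitClass h 1) : kls h α (m * v.val) (n * v⁻¹.val) = kls h α m n := by
  have hv : unitsMap h v = 1 := by simpa [unitClass] using hv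
  refine sum_bij (fun u _ => v * u) (fun u hu => ?_) (fun u _ u' _ h => mul_left_cancel h)
    (fun u hu => ⟨v⁻¹ * u, ?_, mul_inv_cancel_left _ _⟩) fun u hu => ?_
  · simpa [unitClass, hv] using hu
  · simpa [unitClass, hv] using hu
  · rw [mul_inv, Units.val_mul, Units.val_mul, mul_assoc, mul_assoc]

theorem card_quadruple_le (A : Finset (ZMod q)ˣ) :
    #{y ∈ (A ×ˢ A) ×ˢ (A ×ˢ A) | y.1.1.val + y.1.2.val = y.2.1.val + y.2.2.val ∧
      y.1.1⁻¹.val + y.1.2⁻¹.val = y.2.1⁻¹.val + y.2.2⁻¹.val} ≤ q.totient *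
        #{x : ZMod q × ZMod q | (x.1 + x.2) * (x.1 - 1) * (x.2 - 1) = 0} := by
  rw [← ZMod.card_units_eq_totient, ← card_univ, ← card_product]
  refine card_le_card_of_injOn
    (fun y => (y.2.1, ((y.1.1 * y.2.1⁻¹).val, (y.1.2 * y.2.1⁻¹).val)))
    (fun y hy => ?_) fun y hy z hz hyz => ?_
  · obtain ⟨⟨a, b⟩, c, d⟩ := y
    simp only [coe_filter, Set.mem_ofPred_eq] at hy
    obtain ⟨-, h1, h2⟩ := hy
    simp only [coe_product, coe_univ, coe_filter, mem_univ, true_and, Set.mem_prod, Set.mem_univ,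
      Set.mem_ofPred_eq, Units.val_mul]
    have ha := a.mul_inv
    have hb := b.mul_inv
    have hc := c.mul_inv
    have hd := d.mul_inv
    have h3 : (a.val + b.val) * (c.val * d.val) = (c.val + d.val) * (a.val * b.val) := by
      linear_combination (a.val * b.val * c.val * d.val) * h2 - b.val * c.val * d.val * ha -
        a.val * c.val * d.val * hb + d.val * a.val * b.val * hc + c.val * a.val * b.val * hd
    have h4 : (a.val + b.val) * ((a.val - c.val) * (b.val - c.val)) = 0 := by
      linear_combination (a.val * b.val - (a.val + b.val) * c.val) * h1 - h3
    calc _ = (a.val * c⁻¹.val + b.val * c⁻¹.val) * (a.val * c⁻¹.val - c.val * c⁻¹.val) *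
          (b.val * c⁻¹.val - c.val * c⁻¹.val) := by rw [hc]
      _ = c⁻¹.val ^ 3 * ((a.val + b.val) * ((a.val - c.val) * (b.val - c.val))) := by ring
      _ = 0 := by rw [h4, mul_zero]
  · obtain ⟨⟨a, b⟩, c, d⟩ := y
    obtain ⟨⟨a', b'⟩, c', d'⟩ := z
    simp only [coe_filter, Set.mem_ofPred_eq] at hy hz
    simp only [Prod.mk.injEq, Units.val_inj] at hyz ⊢
    obtain ⟨rfl, h2, h3⟩ := hyz
    obtain rfl := mul_right_cancel h2
    obtain rfl := mul_right_cancel h3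
    refine ⟨⟨rfl, rfl⟩, rfl, Units.ext (add_left_cancel (hy.2.1.symm.trans hz.2.1))⟩

theorem sum_norm_kls_pow_four (h : 4 ∣ q) (α : (ZMod 4)ˣ) :
    ∑ x : ZMod q × ZMod q, ‖kls h α x.1 x.2‖ ^ 4 ≤ q ^ 2 * (q.totient *
      #{x : ZMod q × ZMod q | (x.1 + x.2) * (x.1 - 1) * (x.2 - 1) = 0}) := by
  have e1 : ∀ x : ZMod q × ZMod q, ‖kls h α x.1 x.2‖ ^ 4 =
      ‖∑ y ∈ unitClass h α ×ˢ unitClass h α, stdAddChar (x.1 * (y.1.val + y.2.val) +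
        x.2 * (y.1⁻¹.val + y.2⁻¹.val))‖ ^ 2 := by
    intro x
    rw [show 4 = 2 * 2 from rfl, pow_mul, ← norm_pow, sq (kls _ _ _ _), kls, sum_mul_sum,
      ← sum_product']
    congr 2
    refine sum_congr rfl fun y _ => ?_
    rw [← AddChar.map_add_eq_mul]
    congr 1
    ring
  rw [sum_congr rfl fun x _ => e1 x, norm_sq_sum_stdAddChar]
  refine mul_le_mul_of_nonneg_left ?_ (by positivity)
  exact_mod_cast card_quadruple_le (unitClass h α)

theorem norm_kls_pow_four_le (h : 4 ∣ q) (α : (ZMod 4)ˣ) (m n : ZMod q) {g : ℕ}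
    (hg : ∀ y : ZMod q × ZMod q, #{v : (ZMod q)ˣ | (m * v.val, n * v⁻¹.val) = y} ≤ g)
    {D : ℕ} (hD : D ^ 3 ≤ q) :
    ‖kls h α m n‖ ^ 4 * D ≤ 6 * g * #q.divisors * q ^ 4 := by
  set E := #{x : ZMod q × ZMod q | (x.1 + x.2) * (x.1 - 1) * (x.2 - 1) = 0} with hE
  have h1 : (#(unitClass h 1) : ℝ) * ‖kls h α m n‖ ^ 4 ≤ g * (q ^ 2 * (q.totient * E)) := by
    calc _ = ∑ v ∈ unitClass h 1, ‖kls h α (m * v.val) (n * v⁻¹.val)‖ ^ 4 := by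
          rw [sum_congr rfl fun v hv => by rw [kls_mul h α m n hv], sum_const, nsmul_eq_mul]
      _ ≤ ∑ v : (ZMod q)ˣ, ‖kls h α (m * v.val) (n * v⁻¹.val)‖ ^ 4 :=
          sum_le_sum_of_subset_of_nonneg (subset_univ _) fun _ _ _ => by positivity
      _ = ∑ y : ZMod q × ZMod q, ∑ v : (ZMod q)ˣ with (m * v.val, n * v⁻¹.val) = y,
            ‖kls h α y.1 y.2‖ ^ 4 := by
          rw [← sum_fiberwise univ (fun v : (ZMod q)ˣ => (m * v.val, n * v⁻¹.val))]
          refine sum_congr rfl fun y _ => sum_congr rfl fun v hv => ?_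
          rw [← (mem_filter.1 hv).2]
      _ ≤ ∑ y : ZMod q × ZMod q, g * ‖kls h α y.1 y.2‖ ^ 4 := by
          refine sum_le_sum fun y _ => ?_
          rw [sum_const, nsmul_eq_mul]
          exact mul_le_mul_of_nonneg_right (by exact_mod_cast hg y) (by positivity)
      _ ≤ _ := by
          rw [← mul_sum]
          exact mul_le_mul_of_nonneg_left (sum_norm_kls_pow_four h α) (by positivity)
  have h2 : (2 : ℝ) * #(unitClass h 1) = q.totient := by
    exact_mod_cast two_mul_card_unitClass h 1
  have h3 : (0 : ℝ) < q.totient := by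
    exact_mod_cast Nat.totient_pos.2 (Nat.pos_of_ne_zero (NeZero.ne q))
  have h4 : ‖kls h α m n‖ ^ 4 ≤ 2 * g * q ^ 2 * E := by
    refine le_of_mul_le_mul_left ?_ h3
    calc _ = 2 * (#(unitClass h 1) * ‖kls h α m n‖ ^ 4) := by rw [← h2]; ring
      _ ≤ 2 * (g * (q ^ 2 * (q.totient * E))) := by linarith
      _ = _ := by ring
  have h5 : (E * D : ℝ) ≤ 3 * (#q.divisors * q ^ 2) := by exact_mod_cast card_cubic_mul_le hD
  calc ‖kls h α m n‖ ^ 4 * D ≤ 2 * g * q ^ 2 * E * D := mul_le_mul_of_nonneg_right h4 (by positivity)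
    _ = 2 * g * q ^ 2 * (E * D) := by ring
    _ ≤ 2 * g * q ^ 2 * (3 * (#q.divisors * q ^ 2)) :=
        mul_le_mul_of_nonneg_left h5 (by positivity)
    _ = 6 * g * #q.divisors * q ^ 4 := by ring

end

section
open ZMod
variable {q : ℕ} [NeZero q]

theorem card_natCast_mul_eq_le {n : ℕ} (hn : n ≠ 0) (y : ZMod q) :
    #{v : (ZMod q)ˣ | (n : ZMod q) * v.val = y} ≤ n := by
  refine (card_le_card_of_injOn (fun v => n * v.val.val / q) (t := range n)
    (fun v _ => ?_) fun v hv w hw h => ?_).trans_eq (card_range n)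
  · simp only [coe_range, Set.mem_Iio]
    exact Nat.div_lt_of_lt_mul (by
      rw [mul_comm q]
      exact Nat.mul_lt_mul_of_pos_left (ZMod.val_lt _) (Nat.pos_of_ne_zero hn))
  · have key : ∀ v : (ZMod q)ˣ, v ∈ ({v | (n : ZMod q) * v.val = y} : Finset (ZMod q)ˣ) →
        n * v.val.val % q = y.val := by
      intro v hv
      rw [← (mem_filter.1 hv).2, ← ZMod.val_natCast]
      push_cast
      rw [ZMod.natCast_zmod_val]
    have e : n * v.val.val = n * w.val.val := by
      rw [← Nat.div_add_mod (n * v.val.val) q, ← Nat.div_add_mod (n * w.val.val) q, key v hv,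
        key w hw]
      rw [show n * v.val.val / q = n * w.val.val / q from h]
    exact Units.ext (ZMod.val_injective q (Nat.eq_of_mul_eq_mul_left (Nat.pos_of_ne_zero hn) e))

theorem card_intCast_mul_eq_le {n : ℤ} (hn : n ≠ 0) (y : ZMod q) :
    #{v : (ZMod q)ˣ | (n : ZMod q) * v.val = y} ≤ n.natAbs := by
  rcases Int.natAbs_eq n with h | h
  · have h := card_natCast_mul_eq_le (Int.natAbs_ne_zero.2 hn) y
    rwa [← Int.cast_natCast, show ((n.natAbs : ℕ) : ℤ) = n by omega] at h
  · have h := card_natCast_mul_eq_le (Int.natAbs_ne_zero.2 hn) (-y)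
    rw [← Int.cast_natCast, show ((n.natAbs : ℕ) : ℤ) = -n by omega] at h
    refine le_trans (card_le_card fun v hv => ?_) h
    simp only [mem_filter, mem_univ, true_and] at hv ⊢
    push_cast
    rw [← hv]; ring

theorem norm_kls_intCast_pow_four_le (h : 4 ∣ q) (α : (ZMod 4)ˣ) {m n : ℤ} {H : ℕ}
    (hmn : m ≠ 0 ∨ n ≠ 0) (hm : m.natAbs ≤ H) (hn : n.natAbs ≤ H) (N : (ZMod q)ˣ)
    {D : ℕ} (hD : D ^ 3 ≤ q) :
    ‖kls h α m (n * N.val)‖ ^ 4 * D ≤ 6 * H * #q.divisors * q ^ 4 := by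
  refine norm_kls_pow_four_le h α _ _ (fun y => ?_) hD
  rcases hmn with h0 | h0
  · refine (card_le_card fun v hv => ?_).trans ((card_intCast_mul_eq_le h0 y.1).trans hm)
    simp only [mem_filter, mem_univ, true_and] at hv ⊢
    rw [← hv]
  · refine (card_le_card_of_injOn (fun v => v⁻¹) (fun v hv => ?_)
      (fun v _ w _ h => inv_injective h)).trans
      ((card_intCast_mul_eq_le h0 (y.2 * N⁻¹.val)).trans hn)
    simp only [coe_filter, mem_univ, true_and, Set.mem_ofPred_eq] at hv ⊢
    rw [← hv]
    linear_combination (-(n : ZMod q) * v⁻¹.val) * N.mul_inv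

end

open ZMod in
theorem exists_norm_kls_le (H : ℕ) {ε : ℝ} (hε : 0 < ε) :
    ∃ q₀ : ℕ, ∀ (q : ℕ) [NeZero q], q₀ ≤ q → ∀ (h : 4 ∣ q) (α : (ZMod 4)ˣ) (m n : ℤ),
      (m ≠ 0 ∨ n ≠ 0) → m.natAbs ≤ H → n.natAbs ≤ H → ∀ N : (ZMod q)ˣ,
      ‖kls h α m (n * N.val)‖ ≤ ε * q := by
  obtain ⟨M, hM⟩ := exists_nat_ge (8 * (6 * H) ^ 4 * 41 ^ 16 / ε ^ 16)
  refine ⟨(M + 1) ^ 3, fun q _ hq h α m n hmn hm hn N => ?_⟩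
  set D := Nat.findGreatest (fun k => k ^ 3 ≤ q) q with hD
  have hMq : M + 1 ≤ q := (Nat.le_self_pow (by norm_num) _).trans hq
  have h1 : D ^ 3 ≤ q := Nat.findGreatest_spec (P := fun k => k ^ 3 ≤ q) hMq hq
  have h2 : M + 1 ≤ D := Nat.le_findGreatest hMq hq
  have h3 : q ≤ 8 * D ^ 3 := by
    have hDq : D + 1 ≤ q ∨ q < D + 1 := le_or_gt _ _
    have : q ≤ (D + 1) ^ 3 := by
      rcases hDq with h | h
      · exact (not_le.1 (Nat.findGreatest_is_greatest (P := fun k => k ^ 3 ≤ q)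
          (Nat.lt_succ_self _) h)).le
      · exact h.le.trans (Nat.le_self_pow (by norm_num) _)
    calc q ≤ (D + 1) ^ 3 := this
      _ ≤ (2 * D) ^ 3 := Nat.pow_le_pow_left (by omega) 3
      _ = 8 * D ^ 3 := by ring
  have h4 := norm_kls_intCast_pow_four_le h α hmn hm hn N h1
  have hq0 : (0 : ℝ) < q := by exact_mod_cast NeZero.pos q
  have hD0 : (0 : ℝ) < D := by exact_mod_cast (by omega : 0 < D)
  have h5 : (6 * H * #q.divisors : ℝ) ≤ ε ^ 4 * D := by
    refine le_of_pow_le_pow_left₀ (n := 4) (by norm_num) (by positivity) ?_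
    have h6 : (#q.divisors : ℝ) ^ 4 ≤ 41 ^ 16 * q := by
      exact_mod_cast card_divisors_pow_four_le (NeZero.ne q)
    have h7 : (q : ℝ) ≤ 8 * D ^ 3 := by exact_mod_cast h3
    have h8 : 8 * (6 * H) ^ 4 * 41 ^ 16 ≤ ε ^ 16 * D := by
      rw [div_le_iff₀ (by positivity)] at hM
      have : (M : ℝ) ≤ D := by exact_mod_cast (by omega : M ≤ D)
      rw [mul_comm (ε ^ 16)]
      exact hM.trans (mul_le_mul_of_nonneg_right this (by positivity))
    calc (6 * H * #q.divisors : ℝ) ^ 4 = (6 * H : ℝ) ^ 4 * (#q.divisors : ℝ) ^ 4 := by ring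
      _ ≤ (6 * H : ℝ) ^ 4 * (41 ^ 16 * (8 * D ^ 3)) :=
          mul_le_mul_of_nonneg_left (h6.trans (by linarith)) (by positivity)
      _ = (8 * (6 * H : ℝ) ^ 4 * 41 ^ 16) * D ^ 3 := by ring
      _ ≤ (ε ^ 16 * D) * D ^ 3 := by gcongr
      _ = _ := by ring
  refine le_of_pow_le_pow_left₀ (n := 4) (by norm_num) (by positivity)
    (le_of_mul_le_mul_right (h4.trans ?_) hD0)
  calc _ ≤ ε ^ 4 * D * (q : ℝ) ^ 4 := by gcongr
    _ = _ := by ring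

section
open ZMod UnitAddTorus MeasureTheory

theorem mFourier_sub {d : Type*} [Fintype d] (n : d → ℤ) (x s : UnitAddTorus d) :
    mFourier n (x - s) = mFourier n x * mFourier n (-s) := by
  simp only [mFourier, ContinuousMap.coe_mk, ← prod_mul_distrib]
  refine prod_congr rfl fun i _ => ?_
  rw [fourier_apply, fourier_apply, fourier_apply, ← Circle.coe_mul, ← AddCircle.toCircle_add,
    ← smul_add, Pi.neg_apply, ← sub_eq_add_neg, Pi.sub_apply]

noncomputable abbrev torusMeasure : Measure (UnitAddTorus (Fin 2)) :=
  Measure.pi fun _ => AddCircle.haarAddCircle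

theorem integral_fourier_of_ne_zero {n : ℤ} (hn : n ≠ 0) :
    ∫ x : UnitAddCircle, fourier n x ∂AddCircle.haarAddCircle = 0 := by
  have h := (orthonormal_iff_ite.1 (orthonormal_fourier (T := 1))) 0 n
  rw [if_neg (Ne.symm hn)] at h
  rw [← h, fourierLp, ContinuousMap.inner_toLp]
  simp

theorem integral_mFourier_of_ne_zero {n : Fin 2 → ℤ} (hn : n ≠ 0) :
    ∫ x, mFourier n x ∂torusMeasure = 0 := by
  obtain ⟨i, hi⟩ := Function.ne_iff.1 hn
  simp only [mFourier, ContinuousMap.coe_mk]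
  rw [integral_fintype_prod_eq_prod (fun (i : Fin 2) (x : UnitAddCircle) => fourier (n i) x)]
  exact prod_eq_zero (mem_univ i) (integral_fourier_of_ne_zero hi)

theorem fourier_toAddCircle {q : ℕ} [NeZero q] (n : ℤ) (j : ZMod q) :
    fourier n (toAddCircle j) = stdAddChar ((n : ZMod q) * j) := by
  rw [fourier_apply, ← map_zsmul, zsmul_eq_mul]
  rfl

noncomputable def torusPoint {q : ℕ} [NeZero q] (N u : (ZMod q)ˣ) : UnitAddTorus (Fin 2) :=
  ![toAddCircle u.val, toAddCircle (u.val + N.val * u⁻¹.val)]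

theorem sum_mFourier_torusPoint {q : ℕ} [NeZero q] (h : 4 ∣ q) (α : (ZMod 4)ˣ) (N : (ZMod q)ˣ)
    (n : Fin 2 → ℤ) : ∑ u ∈ unitClass h α, mFourier n (torusPoint N u) =
      kls h α (n 0 + n 1 : ℤ) (n 1 * N.val) := by
  refine sum_congr rfl fun u _ => ?_
  simp only [mFourier, ContinuousMap.coe_mk, Fin.prod_univ_two, torusPoint,
    Matrix.cons_val_zero, Matrix.cons_val_one, fourier_toAddCircle]
  rw [← AddChar.map_add_eq_mul]
  congr 1
  push_cast
  ring

theorem card_unitClass_le {q : ℕ} [NeZero q] (h : 4 ∣ q) (α : (ZMod 4)ˣ) :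
    #(unitClass h α) ≤ q := by
  have h1 := two_mul_card_unitClass h α
  have h2 := Nat.totient_le q
  omega

def Equidistributed (F : C(UnitAddTorus (Fin 2), ℂ)) : Prop :=
  ∀ ε : ℝ, 0 < ε → ∃ q₀ : ℕ, ∀ (q : ℕ) [NeZero q], q₀ ≤ q → ∀ (h : 4 ∣ q) (α : (ZMod 4)ˣ)
    (N : (ZMod q)ˣ) (s : UnitAddTorus (Fin 2)),
    ‖∑ u ∈ unitClass h α, F (torusPoint N u - s) - #(unitClass h α) * ∫ x, F x ∂torusMeasure‖ ≤ ε * q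

theorem equidistributed_mFourier (n : Fin 2 → ℤ) : Equidistributed (mFourier n) := by
  intro ε hε
  rcases eq_or_ne n 0 with rfl | hn
  · refine ⟨0, fun q _ _ h α N s => ?_⟩
    simp only [mFourier_zero, ContinuousMap.one_apply, sum_const, integral_const, probReal_univ]
    simp
    positivity
  · obtain ⟨q₀, hq₀⟩ := exists_norm_kls_le ((n 0).natAbs + (n 1).natAbs) hε
    refine ⟨q₀, fun q _ hq h α N s => ?_⟩
    have hn' : n 0 + n 1 ≠ 0 ∨ n 1 ≠ 0 := by
      by_contra! h0
      exact hn (funext fun i => by fin_cases i <;> simp <;> omega)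
    rw [integral_mFourier_of_ne_zero hn, mul_zero, sub_zero,
      sum_congr rfl fun u _ => mFourier_sub n _ s, ← sum_mul, sum_mFourier_torusPoint, norm_mul]
    refine (mul_le_of_le_one_right (norm_nonneg _) ?_).trans
      (hq₀ q hq h α _ _ hn' (Int.natAbs_add_le _ _) (Nat.le_add_left _ _) N)
    exact ((mFourier n).norm_coe_le_norm _).trans_eq mFourier_norm

theorem Equidistributed.zero : Equidistributed 0 := by
  intro ε hε
  refine ⟨0, fun q _ _ h α N s => ?_⟩
  simp
  positivity

theorem integrable_torus (F : C(UnitAddTorus (Fin 2), ℂ)) : Integrable F torusMeasure :=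
  F.continuous.integrable_of_hasCompactSupport (HasCompactSupport.of_compactSpace F)

theorem Equidistributed.add {F G : C(UnitAddTorus (Fin 2), ℂ)} (hF : Equidistributed F)
    (hG : Equidistributed G) : Equidistributed (F + G) := by
  intro ε hε
  obtain ⟨q₁, h₁⟩ := hF (ε / 2) (by positivity)
  obtain ⟨q₂, h₂⟩ := hG (ε / 2) (by positivity)
  refine ⟨max q₁ q₂, fun q _ hq h α N s => ?_⟩
  have e1 := h₁ q ((le_max_left _ _).trans hq) h α N s
  have e2 := h₂ q ((le_max_right _ _).trans hq) h α N s
  have e3 : ∫ x, (F + G) x ∂torusMeasure = (∫ x, F x ∂torusMeasure) + ∫ x, G x ∂torusMeasure :=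
    integral_add (integrable_torus F) (integrable_torus G)
  rw [e3]
  simp only [ContinuousMap.add_apply, sum_add_distrib]
  calc _ = ‖(∑ u ∈ unitClass h α, F (torusPoint N u - s) - #(unitClass h α) * ∫ x, F x ∂torusMeasure) +
        (∑ u ∈ unitClass h α, G (torusPoint N u - s) - #(unitClass h α) * ∫ x, G x ∂torusMeasure)‖ := by
        congr 1; ring
    _ ≤ ε / 2 * q + ε / 2 * q := (norm_add_le _ _).trans (add_le_add e1 e2)
    _ = ε * q := by ring

theorem Equidistributed.smul {F : C(UnitAddTorus (Fin 2), ℂ)} (hF : Equidistributed F) (c : ℂ) :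
    Equidistributed (c • F) := by
  intro ε hε
  obtain ⟨q₁, h₁⟩ := hF (ε / (‖c‖ + 1)) (by positivity)
  refine ⟨q₁, fun q _ hq h α N s => ?_⟩
  have e1 := h₁ q hq h α N s
  have e3 : ∫ x, (c • F) x ∂torusMeasure = c * ∫ x, F x ∂torusMeasure := integral_smul c _
  rw [e3]
  simp only [ContinuousMap.smul_apply, smul_eq_mul, ← mul_sum]
  calc _ = ‖c‖ * ‖∑ u ∈ unitClass h α, F (torusPoint N u - s) -
        #(unitClass h α) * ∫ x, F x ∂torusMeasure‖ := by
        rw [← norm_mul]; congr 1; ring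
    _ ≤ (‖c‖ + 1) * (ε / (‖c‖ + 1) * q) := by gcongr; linarith
    _ = ε * q := by field_simp

theorem equidistributed (F : C(UnitAddTorus (Fin 2), ℂ)) : Equidistributed F := by
  intro ε hε
  have hF : F ∈ (Submodule.span ℂ (Set.range (mFourier (d := Fin 2)))).topologicalClosure := by
    rw [span_mFourier_closure_eq_top]; trivial
  obtain ⟨G, hG, hFG⟩ := Metric.mem_closure_iff.1 hF (ε / 3) (by positivity)
  have hGe : Equidistributed G := by
    refine Submodule.span_induction (p := fun G _ => Equidistributed G) ?_ .zero
      (fun _ _ _ _ => .add) (fun c _ _ h => h.smul c) hG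
    rintro _ ⟨n, rfl⟩
    exact equidistributed_mFourier n
  obtain ⟨q₀, hq₀⟩ := hGe (ε / 3) (by positivity)
  refine ⟨q₀, fun q _ hq h α N s => ?_⟩
  have e1 := hq₀ q hq h α N s
  have hd : ∀ x, ‖F x - G x‖ ≤ ε / 3 := fun x => by
    rw [← dist_eq_norm]
    exact (ContinuousMap.dist_apply_le_dist x).trans hFG.le
  have e2 : ‖(∫ x, F x ∂torusMeasure) - ∫ x, G x ∂torusMeasure‖ ≤ ε / 3 := by
    rw [← integral_sub (integrable_torus F) (integrable_torus G)]
    refine (norm_integral_le_of_norm_le_const (Eventually.of_forall hd)).trans_eq ?_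
    rw [probReal_univ, mul_one]
  have hA : (#(unitClass h α) : ℝ) ≤ q := by exact_mod_cast card_unitClass_le h α
  have e3 : ‖∑ u ∈ unitClass h α, (F (torusPoint N u - s) - G (torusPoint N u - s))‖ ≤
      q * (ε / 3) := by
    refine (norm_sum_le_of_le _ fun u _ => hd _).trans ?_
    rw [sum_const, nsmul_eq_mul]
    gcongr
  have e4 : ‖(#(unitClass h α) : ℂ) * ((∫ x, F x ∂torusMeasure) - ∫ x, G x ∂torusMeasure)‖ ≤ q * (ε / 3) := by
    rw [norm_mul, Complex.norm_natCast]
    gcongr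
  rw [sum_sub_distrib] at e3
  calc _ = ‖(∑ u ∈ unitClass h α, F (torusPoint N u - s) -
          ∑ u ∈ unitClass h α, G (torusPoint N u - s)) +
        (∑ u ∈ unitClass h α, G (torusPoint N u - s) - #(unitClass h α) * ∫ x, G x ∂torusMeasure) -
        (#(unitClass h α) : ℂ) * ((∫ x, F x ∂torusMeasure) - ∫ x, G x ∂torusMeasure)‖ := by congr 1; ring
    _ ≤ q * (ε / 3) + ε / 3 * q + q * (ε / 3) :=
        (norm_sub_le _ _).trans (add_le_add ((norm_add_le _ _).trans (add_le_add e3 e1)) e4)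
    _ = ε * q := by ring

end

section
open ZMod UnitAddTorus MeasureTheory

noncomputable def bump (L δ : ℝ) : C(UnitAddCircle, ℝ) where
  toFun x := max 0 (min 1 (1 + (L / 2 - ‖x‖) / δ))
  continuous_toFun := by fun_prop

theorem bump_nonneg (L δ : ℝ) (x : UnitAddCircle) : 0 ≤ bump L δ x := le_max_left _ _

theorem bump_le_one (L δ : ℝ) (x : UnitAddCircle) : bump L δ x ≤ 1 :=
  max_le zero_le_one (min_le_left _ _)

theorem bump_eq_one {L δ : ℝ} (hδ : 0 < δ) {x : UnitAddCircle} (hx : ‖x‖ ≤ L / 2) :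
    bump L δ x = 1 := by
  have : 0 ≤ (L / 2 - ‖x‖) / δ := div_nonneg (by linarith) hδ.le
  change max 0 (min 1 (1 + (L / 2 - ‖x‖) / δ)) = 1
  rw [min_eq_left (by linarith), max_eq_right zero_le_one]

theorem bump_eq_zero {L δ : ℝ} (hδ : 0 < δ) {x : UnitAddCircle} (hx : L / 2 + δ < ‖x‖) :
    bump L δ x = 0 := by
  have : (L / 2 - ‖x‖) / δ ≤ -1 := by
    rw [div_le_iff₀ hδ]; linarith
  change max 0 (min 1 (1 + (L / 2 - ‖x‖) / δ)) = 0
  exact max_eq_left ((min_le_right _ _).trans (by linarith))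

theorem integral_bump_nonneg (L δ : ℝ) : 0 ≤ ∫ x, bump L δ x ∂AddCircle.haarAddCircle :=
  integral_nonneg (bump_nonneg L δ)

theorem integral_bump_le {L δ : ℝ} (hL : 0 ≤ L) (hδ : 0 < δ) :
    ∫ x, bump L δ x ∂AddCircle.haarAddCircle ≤ L + 2 * δ := by
  have hB : MeasurableSet (Metric.closedBall (0 : UnitAddCircle) (L / 2 + δ)) :=
    Metric.isClosed_closedBall.measurableSet
  have h1 : ∀ x, bump L δ x ≤
      (Metric.closedBall (0 : UnitAddCircle) (L / 2 + δ)).indicator (fun _ => (1 : ℝ)) x := by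
    intro x
    by_cases hx : x ∈ Metric.closedBall (0 : UnitAddCircle) (L / 2 + δ)
    · rw [Set.indicator_of_mem hx]; exact bump_le_one L δ x
    · rw [Set.indicator_of_notMem hx]
      rw [Metric.mem_closedBall, dist_zero_right, not_le] at hx
      exact (bump_eq_zero hδ hx).le
  refine (integral_mono ?_ ?_ h1).trans ?_
  · exact (bump L δ).continuous.integrable_of_hasCompactSupport (HasCompactSupport.of_compactSpace _)
  · exact (integrable_const _).indicator hB
  · rw [integral_indicator hB, setIntegral_const, smul_eq_mul, mul_one]
    have hv : AddCircle.haarAddCircle (T := 1) =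
        (volume : Measure (AddCircle (1 : ℝ))) := by
      rw [AddCircle.volume_eq_smul_haarAddCircle]; simp
    rw [hv, measureReal_def, AddCircle.volume_closedBall,
      ENNReal.toReal_ofReal (le_min zero_le_one (by positivity))]
    exact (min_le_right _ _).trans_eq (by ring)

noncomputable def bumpTorus (L₁ L₂ δ : ℝ) : C(UnitAddTorus (Fin 2), ℂ) where
  toFun x := ((bump L₁ δ (x 0) : ℝ) : ℂ) * ((bump L₂ δ (x 1) : ℝ) : ℂ)
  continuous_toFun := by fun_prop

theorem integral_bumpTorus (L₁ L₂ δ : ℝ) : ∫ x, bumpTorus L₁ L₂ δ x ∂torusMeasure =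
    (((∫ x, bump L₁ δ x ∂AddCircle.haarAddCircle) *
      ∫ x, bump L₂ δ x ∂AddCircle.haarAddCircle : ℝ) : ℂ) := by
  have h := integral_fintype_prod_eq_prod (𝕜 := ℂ)
    (fun (i : Fin 2) (x : UnitAddCircle) => ((bump (![L₁, L₂] i) δ x : ℝ) : ℂ))
    (μ := fun _ => AddCircle.haarAddCircle)
  simp only [Fin.prod_univ_two, Matrix.cons_val_zero, Matrix.cons_val_one] at h
  rw [Complex.ofReal_mul, ← integral_complex_ofReal, ← integral_complex_ofReal, ← h]
  rfl

theorem norm_coe_unitAddCircle_le (r : ℝ) : ‖(r : UnitAddCircle)‖ ≤ |r| :=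
  QuotientAddGroup.norm_mk_le_norm

variable {q : ℕ} [NeZero q]

def InBox (h : 4 ∣ q) (α : (ZMod 4)ˣ) (N : (ZMod q)ˣ) (L₁ L₂ x y : ℝ) (z : ℤ × ℤ) : Prop :=
  (∃ u ∈ unitClass h α, (z.1 : ZMod q) = u.val ∧ (z.2 : ZMod q) = u.val + N.val * u⁻¹.val) ∧
    |z.1 / q - x| ≤ L₁ / 2 ∧ |z.2 / q - y| ≤ L₂ / 2

theorem eq_of_intCast_eq {q : ℕ} [NeZero q] {a b : ℤ} (h : (a : ZMod q) = b) {x L : ℝ}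
    (hL : L < 1) (ha : |a / q - x| ≤ L / 2) (hb : |b / q - x| ≤ L / 2) : a = b := by
  have hq0 : (0 : ℝ) < q := by exact_mod_cast NeZero.pos q
  have h1 : |((a - b : ℤ) : ℝ)| < q := by
    have h2 : |(a / q - x) - (b / q - x)| < (1 : ℝ) := by
      refine (abs_sub _ _).trans_lt ?_
      linarith
    have h3 : (a / q - x) - (b / q - x) = ((a - b : ℤ) : ℝ) / q := by push_cast; ring
    rwa [h3, abs_div, abs_of_pos hq0, div_lt_one hq0] at h2
  have h4 : (q : ℤ) ∣ a - b := by
    rw [← ZMod.intCast_zmod_eq_zero_iff_dvd, Int.cast_sub, h, sub_self]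
  have h5 : |a - b| < q := by exact_mod_cast h1
  exact sub_eq_zero.1 (Int.eq_zero_of_abs_lt_dvd h4 h5)

theorem InBox.exists_injOn {h : 4 ∣ q} {α : (ZMod 4)ˣ} {N : (ZMod q)ˣ} {L₁ L₂ x y : ℝ}
    (h₁ : L₁ < 1) (h₂ : L₂ < 1) {S : Finset (ℤ × ℤ)} (hS : ∀ z ∈ S, InBox h α N L₁ L₂ x y z) :
    ∃ f : ℤ × ℤ → (ZMod q)ˣ, Set.InjOn f S ∧ ∀ z ∈ S, f z ∈ unitClass h α ∧
      (z.1 : ZMod q) = (f z).val ∧ (z.2 : ZMod q) = (f z).val + N.val * (f z)⁻¹.val := by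
  have h0 : ∀ z ∈ S, ∃ u ∈ unitClass h α,
    (z.1 : ZMod q) = u.val ∧ (z.2 : ZMod q) = u.val + N.val * u⁻¹.val := fun z hz => (hS z hz).1
  choose! f hf1 hf2 hf3 using h0
  refine ⟨f, fun z hz w hw hzw => ?_, fun z hz => ⟨hf1 z hz, hf2 z hz, hf3 z hz⟩⟩
  refine Prod.ext (eq_of_intCast_eq ?_ h₁ (hS z hz).2.1 (hS w hw).2.1)
    (eq_of_intCast_eq ?_ h₂ (hS z hz).2.2 (hS w hw).2.2)
  · rw [hf2 z hz, hf2 w hw, hzw]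
  · rw [hf3 z hz, hf3 w hw, hzw]

theorem card_le_of_inBox {h : 4 ∣ q} {α : (ZMod 4)ˣ} {N : (ZMod q)ˣ} {L₁ L₂ x y : ℝ}
    (h₁ : L₁ < 1) (h₂ : L₂ < 1) {S : Finset (ℤ × ℤ)} (hS : ∀ z ∈ S, InBox h α N L₁ L₂ x y z) :
    #S ≤ q := by
  obtain ⟨f, hf, hf'⟩ := InBox.exists_injOn h₁ h₂ hS
  exact (card_le_card_of_injOn f (fun z hz => (hf' z hz).1) hf).trans (card_unitClass_le h α)

theorem bumpTorus_torusPoint_eq_one {L₁ L₂ δ : ℝ} (hδ : 0 < δ) {N u : (ZMod q)ˣ} {z : ℤ × ℤ}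
    {x y : ℝ} (h1 : (z.1 : ZMod q) = u.val) (h2 : (z.2 : ZMod q) = u.val + N.val * u⁻¹.val)
    (h3 : |z.1 / q - x| ≤ L₁ / 2) (h4 : |z.2 / q - y| ≤ L₂ / 2) :
    bumpTorus L₁ L₂ δ (torusPoint N u - ![(x : UnitAddCircle), (y : UnitAddCircle)]) = 1 := by
  have e1 : bump L₁ δ (toAddCircle u.val - (x : UnitAddCircle)) = 1 := by
    refine bump_eq_one hδ ?_
    rw [← h1, toAddCircle_intCast, ← AddCircle.coe_sub]
    exact (norm_coe_unitAddCircle_le _).trans h3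
  have e2 : bump L₂ δ (toAddCircle (u.val + N.val * u⁻¹.val) - (y : UnitAddCircle)) = 1 := by
    refine bump_eq_one hδ ?_
    rw [← h2, toAddCircle_intCast, ← AddCircle.coe_sub]
    exact (norm_coe_unitAddCircle_le _).trans h4
  change ((bump L₁ δ (toAddCircle u.val - (x : UnitAddCircle)) : ℝ) : ℂ) *
    ((bump L₂ δ (toAddCircle (u.val + N.val * u⁻¹.val) - (y : UnitAddCircle)) : ℝ) : ℂ) = 1
  rw [e1, e2]; simp

end

section
open ZMod UnitAddTorus MeasureTheory

theorem exists_card_inBox_le {L₁ L₂ ε : ℝ} (hL₁ : 0 ≤ L₁) (h₁ : L₁ < 1) (hL₂ : 0 ≤ L₂)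
    (h₂ : L₂ < 1) (hε : 0 < ε) : ∃ q₀ : ℕ, ∀ (q : ℕ) [NeZero q], q₀ ≤ q → ∀ (h : 4 ∣ q)
      (α : (ZMod 4)ˣ) (N : (ZMod q)ˣ) (x y : ℝ) (S : Finset (ℤ × ℤ)),
      (∀ z ∈ S, InBox h α N L₁ L₂ x y z) → (#S : ℝ) ≤ q.totient / 2 * (L₁ * L₂) + ε * q := by
  set δ := min 1 (ε / 16) with hδ
  have hδ0 : 0 < δ := lt_min zero_lt_one (by positivity)
  obtain ⟨q₀, hq₀⟩ := equidistributed (bumpTorus L₁ L₂ δ) (ε / 2) (by positivity)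
  refine ⟨q₀, fun q _ hq h α N x y S hS => ?_⟩
  have e1 := hq₀ q hq h α N ![(x : UnitAddCircle), (y : UnitAddCircle)]
  obtain ⟨f, hf, hf'⟩ := InBox.exists_injOn h₁ h₂ hS
  set b : (ZMod q)ˣ → ℝ := fun u =>
    bump L₁ δ (torusPoint N u 0 - (x : UnitAddCircle)) *
      bump L₂ δ (torusPoint N u 1 - (y : UnitAddCircle)) with hb
  have hbF : ∀ u, bumpTorus L₁ L₂ δ (torusPoint N u -
      ![(x : UnitAddCircle), (y : UnitAddCircle)]) = ((b u : ℝ) : ℂ) := fun u => by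
    rw [hb]; push_cast; rfl
  have e2 : (#S : ℝ) ≤ ∑ u ∈ unitClass h α, b u := by
    calc (#S : ℝ) = ∑ z ∈ S, b (f z) := by
          rw [card_eq_sum_ones, Nat.cast_sum]
          refine sum_congr rfl fun z hz => ?_
          have := bumpTorus_torusPoint_eq_one (δ := δ) hδ0 (hf' z hz).2.1 (hf' z hz).2.2
            (hS z hz).2.1 (hS z hz).2.2
          rw [hbF] at this
          rw [Nat.cast_one]
          exact_mod_cast this.symm
      _ = ∑ u ∈ S.image f, b u := (sum_image hf).symm
      _ ≤ _ := sum_le_sum_of_subset_of_nonneg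
          (image_subset_iff.2 fun z hz => (hf' z hz).1)
          fun u _ _ => mul_nonneg (bump_nonneg _ _ _) (bump_nonneg _ _ _)
  simp only [hbF, integral_bumpTorus] at e1
  have e3 : ∑ u ∈ unitClass h α, b u ≤ #(unitClass h α) *
      ((∫ x, bump L₁ δ x ∂AddCircle.haarAddCircle) *
        ∫ x, bump L₂ δ x ∂AddCircle.haarAddCircle) + ε / 2 * q := by
    have e4 : |∑ u ∈ unitClass h α, b u - #(unitClass h α) *
      ((∫ x, bump L₁ δ x ∂AddCircle.haarAddCircle) *
        ∫ x, bump L₂ δ x ∂AddCircle.haarAddCircle)| ≤ ε / 2 * q := by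
      rw [← Real.norm_eq_abs, ← Complex.norm_real]
      convert e1 using 2
      push_cast
      rfl
    linarith [le_abs_self (∑ u ∈ unitClass h α, b u - #(unitClass h α) *
      ((∫ x, bump L₁ δ x ∂AddCircle.haarAddCircle) *
        ∫ x, bump L₂ δ x ∂AddCircle.haarAddCircle))]
  have hA : (2 : ℝ) * #(unitClass h α) = q.totient := by
    exact_mod_cast two_mul_card_unitClass h α
  have hAq : (#(unitClass h α) : ℝ) ≤ q := by exact_mod_cast card_unitClass_le h α
  have e5 : (∫ x, bump L₁ δ x ∂AddCircle.haarAddCircle) *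
      ∫ x, bump L₂ δ x ∂AddCircle.haarAddCircle ≤ L₁ * L₂ + ε / 2 := by
    refine (mul_le_mul (integral_bump_le hL₁ hδ0) (integral_bump_le hL₂ hδ0)
      (integral_bump_nonneg _ _) (by positivity)).trans ?_
    have hδ1 : δ ≤ 1 := min_le_left _ _
    have hδ2 : δ ≤ ε / 16 := min_le_right _ _
    nlinarith [mul_nonneg hδ0.le (sub_nonneg.2 hδ1), mul_nonneg hδ0.le (sub_nonneg.2 h₁.le),
      mul_nonneg hδ0.le (sub_nonneg.2 h₂.le)]
  calc (#S : ℝ) ≤ #(unitClass h α) * (L₁ * L₂ + ε / 2) + ε / 2 * q := by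
        refine (e2.trans e3).trans ?_
        gcongr
    _ = q.totient / 2 * (L₁ * L₂) + (#(unitClass h α) * (ε / 2) + ε / 2 * q) := by
        rw [← hA]; ring
    _ ≤ q.totient / 2 * (L₁ * L₂) + (q * (ε / 2) + ε / 2 * q) := by gcongr
    _ = _ := by ring

end

section
open ZMod

def InSlab (p : ℕ) (a₀ b₀ : ℤ) (c : ℕ) (x₀ x₁ t₀ t₁ : ℝ) (z : ℤ × ℤ) : Prop :=
  z.1 % 4 = a₀ ∧ (4 * c : ℤ) ∣ z.1 * z.2 - p - b₀ * c ∧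
    (x₀ ≤ (z.1 - z.2) / (2 * c) ∧ (z.1 - z.2) / (2 * c) ≤ x₁) ∧
    t₀ * Real.sqrt p ≤ z.1 + z.2 ∧ z.1 + z.2 ≤ t₁ * Real.sqrt p

theorem isUnit_slab_const {p : ℕ} (hp : p.Prime) (hp2 : p ≠ 2) {b₀ : ℤ} (hb : Even b₀) {c : ℕ}
    (hc : 0 < c) (hcp : c < p) : IsUnit ((p + b₀ * c : ℤ) : ZMod (4 * c)) := by
  have h1 : IsCoprime (p + b₀ * c : ℤ) (c : ℤ) := by
    rw [IsCoprime.add_mul_right_left_iff]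
    exact Nat.isCoprime_iff_coprime.2 (Nat.coprime_of_lt_prime hc.ne' hcp hp)
  have h2 : IsCoprime (p + b₀ * c : ℤ) (4 : ℤ) := by
    have : IsCoprime (p + b₀ * c : ℤ) (2 : ℤ) := by
      rw [Int.isCoprime_iff_gcd_eq_one, ← Int.isCoprime_iff_gcd_eq_one, isCoprime_comm,
        Int.isCoprime_two_left]
      have h3 : Odd (p : ℤ) := by exact_mod_cast hp.odd_of_ne_two hp2
      exact h3.add_even (hb.mul_right _)
    simpa using this.pow_right (n := 2)
  rw [ZMod.coe_int_isUnit_iff_isCoprime]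
  push_cast
  exact (h2.mul_right h1).symm

theorem InSlab.inBox {p : ℕ} {a₀ b₀ : ℤ} {c : ℕ} [NeZero (4 * c)] {x₀ x₁ t₀ t₁ : ℝ} {z : ℤ × ℤ}
    (hz : InSlab p a₀ b₀ c x₀ x₁ t₀ t₁ z) {α : (ZMod 4)ˣ} (hα : α.val = a₀)
    {N : (ZMod (4 * c))ˣ} (hN : N.val = (p + b₀ * c : ℤ)) {η y : ℝ}
    (hy : |((z.1 + z.2 : ℤ) : ℝ) / (4 * c : ℕ) - y| ≤ η / 2) :
    InBox (Dvd.intro c rfl : 4 ∣ 4 * c) α N (η / 2 + (x₁ - x₀) / 4) η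
      (y / 2 + (x₀ + x₁) / 8) y (z.1, z.1 + z.2) := by
  obtain ⟨h1, h2, h3, h4⟩ := hz
  have hc : (c : ℝ) ≠ 0 := by
    have := NeZero.ne (4 * c)
    exact_mod_cast (by omega : c ≠ 0)
  have hm : ((z.1 : ZMod (4 * c)) * z.2) = N.val := by
    rw [hN, ← Int.cast_mul, ← sub_eq_zero, ← Int.cast_sub, ZMod.intCast_zmod_eq_zero_iff_dvd]
    push_cast
    rwa [← sub_sub]
  have hu : IsUnit (z.1 : ZMod (4 * c)) := isUnit_of_mul_isUnit_left (hm ▸ N.isUnit)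
  refine ⟨⟨hu.unit, ?_, rfl, ?_⟩, ?_, hy⟩
  · simp only [unitClass, mem_filter, mem_univ, true_and]
    refine Units.ext ?_
    rw [ZMod.unitsMap_val, hα, ← h1]
    change ZMod.cast (z.1 : ZMod (4 * c)) = _
    rw [ZMod.cast_intCast (Dvd.intro c rfl : 4 ∣ 4 * c)]
    exact (ZMod.intCast_mod z.1 4).symm
  · rw [← hm]
    push_cast
    congr 1
    have := hu.unit.mul_inv
    rw [IsUnit.unit_spec] at this
    linear_combination (-(z.2 : ZMod (4 * c))) * this
  · have e : (z.1 : ℝ) / (4 * c : ℕ) - (y / 2 + (x₀ + x₁) / 8) =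
        (((z.1 + z.2 : ℤ) : ℝ) / (4 * c : ℕ) - y) / 2 +
          ((z.1 - z.2) / (2 * c) - (x₀ + x₁) / 2) / 4 := by
      push_cast; field_simp; ring
    change |(z.1 : ℝ) / (4 * c : ℕ) - (y / 2 + (x₀ + x₁) / 8)| ≤ _
    rw [e]
    rw [abs_le] at hy ⊢
    constructor <;> linarith [hy.1, hy.2, h3.1, h3.2]

theorem card_slab_le_mul {p : ℕ} {a₀ b₀ : ℤ} {c : ℕ} [NeZero (4 * c)] {x₀ x₁ t₀ t₁ : ℝ}
    (ht : t₀ ≤ t₁) {α : (ZMod 4)ˣ} (hα : α.val = a₀) {N : (ZMod (4 * c))ˣ}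
    (hN : N.val = (p + b₀ * c : ℤ)) {η B : ℝ} (hη : 0 < η) (hB0 : 0 ≤ B)
    (hB : ∀ (x y : ℝ) (S : Finset (ℤ × ℤ)), (∀ z ∈ S, InBox (Dvd.intro c rfl : 4 ∣ 4 * c) α N
      (η / 2 + (x₁ - x₀) / 4) η x y z) → (#S : ℝ) ≤ B)
    {T : Finset (ℤ × ℤ)} (hT : ∀ z ∈ T, InSlab p a₀ b₀ c x₀ x₁ t₀ t₁ z) :
    (#T : ℝ) ≤ ((t₁ - t₀) * Real.sqrt p / (η * (4 * c : ℕ)) + 1) * B := by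
  have hq : (0 : ℝ) < (4 * c : ℕ) := by exact_mod_cast NeZero.pos (4 * c)
  have hηq : 0 < η * (4 * c : ℕ) := mul_pos hη hq
  set f : ℤ × ℤ → ℕ := fun z => ⌊((z.1 + z.2 : ℤ) - t₀ * Real.sqrt p) / (η * (4 * c : ℕ))⌋₊
    with hf
  set K : ℕ := ⌊(t₁ - t₀) * Real.sqrt p / (η * (4 * c : ℕ))⌋₊ + 1 with hK
  have hfK : ∀ z ∈ T, f z ∈ range K := by
    intro z hz
    rw [mem_range, hK, Nat.lt_succ_iff]
    refine Nat.floor_mono ?_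
    have := (hT z hz).2.2.2.2
    gcongr
    push_cast
    linarith
  have hfib : ∀ k ∈ range K, (#{z ∈ T | f z = k} : ℝ) ≤ B := by
    intro k _
    have hinj : Set.InjOn (fun z : ℤ × ℤ => (z.1, z.1 + z.2)) ({z ∈ T | f z = k} : Finset _) := by
      intro z _ w _ h
      simp only [Prod.mk.injEq] at h
      exact Prod.ext h.1 (by omega)
    rw [← card_image_of_injOn hinj]
    refine hB ((t₀ * Real.sqrt p / (4 * c : ℕ) + (k + 1 / 2) * η) / 2 + (x₀ + x₁) / 8)
      (t₀ * Real.sqrt p / (4 * c : ℕ) + (k + 1 / 2) * η) _ fun w hw => ?_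
    obtain ⟨z, hz, rfl⟩ := mem_image.1 hw
    rw [mem_filter] at hz
    refine (hT z hz.1).inBox hα hN ?_
    have h0 : 0 ≤ ((z.1 + z.2 : ℤ) - t₀ * Real.sqrt p) / (η * (4 * c : ℕ)) := by
      refine div_nonneg ?_ hηq.le
      have := (hT z hz.1).2.2.2.1
      push_cast
      linarith
    have h1 := Nat.floor_le h0
    have h2 := Nat.lt_floor_add_one (((z.1 + z.2 : ℤ) - t₀ * Real.sqrt p) / (η * (4 * c : ℕ)))
    rw [show ⌊((z.1 + z.2 : ℤ) - t₀ * Real.sqrt p) / (η * (4 * c : ℕ))⌋₊ = k from hz.2,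
      show ((z.1 + z.2 : ℤ) - t₀ * Real.sqrt p) / (η * (4 * c : ℕ)) =
        (((z.1 + z.2 : ℤ) : ℝ) / (4 * c : ℕ) - t₀ * Real.sqrt p / (4 * c : ℕ)) / η by
        field_simp] at h1 h2
    rw [le_div_iff₀ hη] at h1
    rw [div_lt_iff₀ hη] at h2
    rw [abs_le]
    constructor <;> linarith
  calc (#T : ℝ) = ∑ k ∈ range K, (#{z ∈ T | f z = k} : ℝ) := by
        rw [card_eq_sum_card_fiberwise hfK, Nat.cast_sum]
    _ ≤ K * B := by
        refine (sum_le_sum hfib).trans_eq ?_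
        rw [sum_const, card_range, nsmul_eq_mul]
    _ ≤ _ := by
        refine mul_le_mul_of_nonneg_right ?_ hB0
        rw [hK]
        rw [Nat.cast_add, Nat.cast_one]
        gcongr
        exact Nat.floor_le (div_nonneg (mul_nonneg (by linarith) (Real.sqrt_nonneg _)) hηq.le)

theorem exists_card_slab_le {x₀ x₁ t₀ t₁ ε : ℝ} (hx : x₀ ≤ x₁) (hx1 : x₁ - x₀ ≤ 1) (ht : t₀ ≤ t₁)
    (ht1 : t₁ - t₀ ≤ 4) (hε : 0 < ε) : ∃ (c₁ : ℕ) (C : ℝ), 0 ≤ C ∧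
      ∀ (p : ℕ) (_ : p.Prime) (_ : p ≠ 2) (a₀ b₀ : ℤ) (_ : a₀ = 1 ∨ a₀ = 3) (_ : Even b₀) (c : ℕ)
        (_ : 0 < c) (_ : c < p) (T : Finset (ℤ × ℤ)),
        (∀ z ∈ T, InSlab p a₀ b₀ c x₀ x₁ t₀ t₁ z) → (#T : ℝ) ≤ C * (Real.sqrt p + c) ∧
          (c₁ ≤ c → (#T : ℝ) ≤ (t₁ - t₀) * (x₁ - x₀) * Real.sqrt p / 8 *
            ((4 * c).totient / (4 * c : ℕ)) + ε * (Real.sqrt p + c)) := by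
  set η : ℝ := min (1 / 2) (ε / 6) with hη
  have hη0 : 0 < η := lt_min (by norm_num) (by positivity)
  have hη1 : η ≤ 1 / 2 := min_le_left _ _
  have hη2 : η ≤ ε / 6 := min_le_right _ _
  have hL0 : 0 ≤ η / 2 + (x₁ - x₀) / 4 := by linarith
  have hL1 : η / 2 + (x₁ - x₀) / 4 < 1 := by linarith
  have hη3 : η < 1 := by linarith
  obtain ⟨q₀, hq₀⟩ := exists_card_inBox_le hL0 hL1 hη0.le hη3 (ε := η ^ 2) (by positivity)
  refine ⟨q₀, 4 / η + 4, by positivity, fun p hp hp2 a₀ b₀ ha hb c hc hcp T hT => ?_⟩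
  haveI : NeZero (4 * c) := ⟨by omega⟩
  obtain ⟨α, hα⟩ : ∃ α : (ZMod 4)ˣ, α.val = a₀ := by
    rcases ha with rfl | rfl
    · exact ⟨1, by simp⟩
    · exact ⟨-1, by decide⟩
  set N := (isUnit_slab_const hp hp2 hb hc hcp).unit with hN
  have hs := Real.sqrt_nonneg p
  have hc0 : (0 : ℝ) < c := by exact_mod_cast hc
  have hqc : ((4 * c : ℕ) : ℝ) = 4 * c := by push_cast; ring
  have hNv : N.val = (p + b₀ * c : ℤ) := rfl
  constructor
  · refine (card_slab_le_mul ht hα hNv hη0 (B := (4 * c : ℕ)) (by positivity)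
      (fun x y S hS => by exact_mod_cast card_le_of_inBox hL1 hη3 hS) hT).trans ?_
    have e : ((t₁ - t₀) * Real.sqrt p / (η * (4 * c : ℕ)) + 1) * (4 * c : ℕ) =
        (t₁ - t₀) / η * Real.sqrt p + 4 * c := by
      rw [hqc]; field_simp
    rw [e]
    have h1 : (t₁ - t₀) / η * Real.sqrt p ≤ 4 / η * Real.sqrt p := by gcongr
    have h2 : 0 ≤ 4 / η * c := by positivity
    linarith
  · intro hcc
    refine (card_slab_le_mul ht hα hNv hη0 (B := (4 * c).totient / 2 *
      ((η / 2 + (x₁ - x₀) / 4) * η) + η ^ 2 * (4 * c : ℕ)) (by positivity)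
      (fun x y S hS => hq₀ (4 * c) (by omega) _ α N x y S hS) hT).trans ?_
    set r : ℝ := (4 * c).totient / (4 * c : ℕ) with hr
    have hr0 : 0 ≤ r := by positivity
    have hr1 : r ≤ 1 := div_le_one_of_le₀ (by exact_mod_cast Nat.totient_le _) (by positivity)
    have hφ : ((4 * c).totient : ℝ) = r * (4 * c) := by
      rw [hr, hqc]; field_simp
    rw [hφ, hqc]
    set s := Real.sqrt p
    set D := t₁ - t₀
    set X := x₁ - x₀
    have e : (D * s / (η * (4 * c)) + 1) * (r * (4 * c) / 2 * ((η / 2 + X / 4) * η) +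
        η ^ 2 * (4 * c)) = D * X * s / 8 * r + D * s * r * (η / 4) + D * s * η +
          (2 * r * (η / 2 + X / 4)) * (c * η) + 4 * η * (c * η) := by
      field_simp
      ring
    rw [e]
    have hD0 : 0 ≤ D := sub_nonneg.2 ht
    have h1 : D * s * r * (η / 4) ≤ 4 * s * 1 * (η / 4) := by gcongr
    have h2 : D * s * η ≤ 4 * s * η := by gcongr
    have h3 : (2 * r * (η / 2 + X / 4)) * (c * η) ≤ (2 * 1 * 1) * (c * η) := by gcongr
    have h4 : 4 * η * (c * η) ≤ 4 * 1 * (c * η) := by gcongr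
    have h5 : s * η ≤ s * (ε / 6) := by gcongr
    have h6 : c * η ≤ c * (ε / 6) := by gcongr
    have h7 : 0 ≤ s * ε := by positivity
    linarith

end

section
open Topology ArithmeticFunction

theorem totient_div_eq_sum_moebius {n : ℕ} (hn : 0 < n) :
    (n.totient : ℝ) / n = ∑ d ∈ n.divisors, (moebius d : ℝ) / d := by
  have h := (sum_eq_iff_sum_mul_moebius_eq (R := ℝ) (f := fun n => (n.totient : ℝ))
    (g := fun n => (n : ℝ))).1 (fun n _ => by exact_mod_cast n.sum_totient) n hn
  rw [← h, Nat.sum_divisorsAntidiagonal (fun i j => (moebius i : ℝ) * (j : ℝ)), Finset.sum_div]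
  refine Finset.sum_congr rfl fun d hd => ?_
  have hd' := Nat.dvd_of_mem_divisors hd
  have hd0 : (d : ℝ) ≠ 0 := by
    have := Nat.pos_of_mem_divisors hd
    positivity
  have hn0 : (n : ℝ) ≠ 0 := by positivity
  rw [Nat.cast_div hd' hd0]
  field_simp

theorem totient_four_mul_div {c : ℕ} (hc : 0 < c) :
    ((4 * c).totient : ℝ) / (4 * c : ℕ) =
      1 / 2 * ∑ d ∈ c.divisors with Odd d, (moebius d : ℝ) / d := by
  obtain ⟨k, m, hm, rfl⟩ := Nat.exists_eq_two_pow_mul_odd hc.ne'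
  have hm0 : 0 < m := hm.pos
  have hdiv : {d ∈ (2 ^ k * m).divisors | Odd d} = m.divisors := by
    ext d
    simp only [Finset.mem_filter, Nat.mem_divisors]
    constructor
    · rintro ⟨⟨h, -⟩, ho⟩
      exact ⟨Nat.Coprime.dvd_of_dvd_mul_left
        ((Nat.coprime_two_right.2 ho).pow_right k) h, hm0.ne'⟩
    · rintro ⟨h, -⟩
      exact ⟨⟨h.mul_left _, hc.ne'⟩, hm.of_dvd_nat h⟩
  rw [hdiv, ← totient_div_eq_sum_moebius hm0]
  have e : 4 * (2 ^ k * m) = 2 ^ (k + 2) * m := by ring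
  have hcop : Nat.Coprime (2 ^ (k + 2)) m := (Nat.coprime_two_left.2 hm).pow_left _
  rw [e, Nat.totient_mul hcop, Nat.totient_prime_pow Nat.prime_two (by omega)]
  have h2 : (m : ℝ) ≠ 0 := by positivity
  push_cast
  field_simp
  ring

theorem card_Ioc_mod_four (n c₀ : ℕ) (hc₀ : c₀ = 0 ∨ c₀ = 2) :
    #{k ∈ Ioc 0 n | k % 4 = c₀} = (n + c₀) / 4 := by
  induction n with
  | zero => rcases hc₀ with rfl | rfl <;> simp
  | succ n ih =>
    rw [← Finset.insert_Ioc_right_eq_Ioc_add_one (by omega), Finset.filter_insert]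
    split_ifs with h
    · rw [Finset.card_insert_of_notMem (by simp), ih]
      rcases hc₀ with rfl | rfl <;> omega
    · rw [ih]
      rcases hc₀ with rfl | rfl <;> omega

theorem card_Ioc_mod_four_dvd (X c₀ d : ℕ) (hc₀ : c₀ = 0 ∨ c₀ = 2) (hd : Odd d) :
    #{c ∈ Ioc 0 X | c % 4 = c₀ ∧ d ∣ c} = (X / d + c₀) / 4 := by
  rw [← card_Ioc_mod_four _ _ hc₀]
  have hd0 : 0 < d := hd.pos
  have key : ∀ k, (d * k) % 4 = c₀ ↔ k % 4 = c₀ := by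
    intro k
    have h4 : d % 4 = 1 ∨ d % 4 = 3 := by have := Nat.odd_iff.1 hd; omega
    have hk : k % 4 = 0 ∨ k % 4 = 1 ∨ k % 4 = 2 ∨ k % 4 = 3 := by omega
    rw [Nat.mul_mod]
    rcases h4 with h | h <;> rcases hk with h' | h' | h' | h' <;> rw [h, h'] <;>
      rcases hc₀ with rfl | rfl <;> norm_num
  symm
  refine Finset.card_bij (fun k _ => d * k) ?_ ?_ ?_
  · intro k hk
    simp only [Finset.mem_filter, Finset.mem_Ioc] at hk ⊢
    refine ⟨⟨by have := hk.1.1; positivity, ?_⟩, (key k).2 hk.2, dvd_mul_right _ _⟩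
    rw [mul_comm]; exact (Nat.le_div_iff_mul_le hd0).1 hk.1.2
  · intro a _ b _ h
    exact Nat.eq_of_mul_eq_mul_left hd0 h
  · rintro c hc
    simp only [Finset.mem_filter, Finset.mem_Ioc] at hc
    obtain ⟨⟨h1, h2⟩, h3, k, rfl⟩ := hc
    refine ⟨k, ?_, rfl⟩
    simp only [Finset.mem_filter, Finset.mem_Ioc]
    refine ⟨⟨Nat.pos_of_mul_pos_left h1 |> fun h => ?_, ?_⟩, (key k).1 h3⟩
    · exact Nat.pos_of_ne_zero (by rintro rfl; simp at h1)
    · rw [Nat.le_div_iff_mul_le hd0, mul_comm]; exact h2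

noncomputable def moebiusTerm (c₀ X d : ℕ) : ℝ :=
  if Odd d then (moebius d : ℝ) / d * (((X / d + c₀) / 4 : ℕ) / X) else 0

theorem sum_totient_four_mul (X c₀ : ℕ) (hc₀ : c₀ = 0 ∨ c₀ = 2) :
    (∑ c ∈ Ioc 0 X with c % 4 = c₀, ((4 * c).totient : ℝ) / (4 * c : ℕ)) / X =
      1 / 2 * ∑' d, moebiusTerm c₀ X d := by
  rw [tsum_eq_sum (s := Ioc 0 X)]
  · have h1 : ∀ c ∈ Ioc 0 X, c % 4 = c₀ → ((4 * c).totient : ℝ) / (4 * c : ℕ) =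
        1 / 2 * ∑ d ∈ Ioc 0 X, if Odd d ∧ d ∣ c then (moebius d : ℝ) / d else 0 := by
      intro c hc _
      rw [Finset.mem_Ioc] at hc
      rw [totient_four_mul_div hc.1, ← Finset.sum_filter]
      congr 2
      ext d
      simp only [Finset.mem_filter, Nat.mem_divisors, Finset.mem_Ioc]
      constructor
      · rintro ⟨⟨h, _⟩, ho⟩
        exact ⟨⟨ho.pos, (Nat.le_of_dvd hc.1 h).trans hc.2⟩, ho, h⟩
      · rintro ⟨_, ho, h⟩
        exact ⟨⟨h, hc.1.ne'⟩, ho⟩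
    rw [Finset.sum_congr rfl (g := fun c => 1 / 2 * ∑ d ∈ Ioc 0 X,
      if Odd d ∧ d ∣ c then (moebius d : ℝ) / d else 0)
      (fun c hc => h1 c (Finset.mem_filter.1 hc).1 (Finset.mem_filter.1 hc).2),
      ← Finset.mul_sum, mul_div_assoc, Finset.sum_comm, Finset.sum_div]
    congr 1
    refine Finset.sum_congr rfl fun d _ => ?_
    unfold moebiusTerm
    split_ifs with ho
    · simp only [ho, true_and]
      rw [← card_Ioc_mod_four_dvd X c₀ d hc₀ ho, ← Finset.sum_filter, Finset.filter_filter,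
        Finset.sum_const, nsmul_eq_mul]
      ring
    · simp [ho]
  · intro d hd
    unfold moebiusTerm
    split_ifs with ho
    · have : X < d := by
        by_contra h
        exact hd (Finset.mem_Ioc.2 ⟨ho.pos, by omega⟩)
      rw [Nat.div_eq_of_lt this]
      rcases hc₀ with rfl | rfl <;> simp
    · rfl

theorem tsum_odd_moebius :
    ∑' d : ℕ, (if Odd d then (moebius d : ℝ) / d * (1 / (4 * d)) else 0) = 2 / Real.pi ^ 2 := by
  have hs : 1 < (2 : ℂ).re := by norm_num
  have h := DirichletCharacter.LSeries.mul_mu_eq_one (1 : DirichletCharacter ℂ 2) hs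
  have hL := DirichletCharacter.LFunctionTrivChar_eq_mul_riemannZeta (N := 2) (s := 2) (by norm_num)
  rw [DirichletCharacter.LFunctionTrivChar, DirichletCharacter.LFunction_eq_LSeries _ hs,
    riemannZeta_two, Nat.Prime.primeFactors Nat.prime_two, Finset.prod_singleton] at hL
  have e : ((2 : ℕ) : ℂ) ^ (-2 : ℂ) = 1 / 4 := by
    rw [Complex.cpow_neg]; norm_num
  rw [e] at hL
  rw [hL] at h
  have hpi : (Real.pi : ℂ) ≠ 0 := by exact_mod_cast Real.pi_ne_zero
  have h2 : LSeries ((fun n : ℕ => (1 : DirichletCharacter ℂ 2) n) *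
      fun n : ℕ => ((moebius n : ℤ) : ℂ)) 2 = 8 / Real.pi ^ 2 := by
    rw [eq_div_iff (by positivity)]
    field_simp at h ⊢
    linear_combination (1 / 3 : ℂ) * h
  have h3 : ((∑' d : ℕ, (if Odd d then (moebius d : ℝ) / d * (1 / (4 * d)) else 0) : ℝ) : ℂ) =
      1 / 4 * (8 / Real.pi ^ 2) := by
    rw [← h2, LSeries, Complex.ofReal_tsum, ← tsum_mul_left]
    refine tsum_congr fun d => ?_
    rw [LSeries.term_def]
    split_ifs with ho hz hz
    · subst hz; simp at ho
    · have hu : IsUnit ((d : ℕ) : ZMod 2) := by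
        rw [ZMod.isUnit_iff_coprime]; exact Nat.coprime_two_right.2 ho
      simp only [Pi.mul_apply, MulChar.one_apply hu]
      push_cast
      have : (d : ℂ) ≠ 0 := by exact_mod_cast hz
      have e2 : (d : ℂ) ^ (2 : ℂ) = d ^ 2 := by exact_mod_cast Complex.cpow_natCast (d : ℂ) 2
      rw [e2]
      field_simp
    · simp
    · have hu : ¬ IsUnit ((d : ℕ) : ZMod 2) := by
        rw [ZMod.isUnit_iff_coprime, Nat.coprime_two_right]; exact ho
      simp [MulChar.map_nonunit _ hu]
  have h4 : ((∑' d : ℕ, (if Odd d then (moebius d : ℝ) / d * (1 / (4 * d)) else 0) : ℝ) : ℂ) =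
      ((2 / Real.pi ^ 2 : ℝ) : ℂ) := by
    rw [h3]; push_cast; ring
  exact_mod_cast h4

theorem tendsto_mean_totient (c₀ : ℕ) (hc₀ : c₀ = 0 ∨ c₀ = 2) :
    Tendsto (fun X : ℕ => (∑ c ∈ Ioc 0 X with c % 4 = c₀,
      ((4 * c).totient : ℝ) / (4 * c : ℕ)) / X) atTop (𝓝 (1 / Real.pi ^ 2)) := by
  have h : Tendsto (fun X => ∑' d, moebiusTerm c₀ X d) atTop
      (𝓝 (∑' d : ℕ, (if Odd d then (moebius d : ℝ) / d * (1 / (4 * d)) else 0))) := by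
    refine tendsto_tsum_of_dominated_convergence
      (bound := fun d : ℕ => 1 / (d : ℝ) ^ 2) ?_ ?_ ?_
    · exact Real.summable_one_div_nat_pow.2 one_lt_two
    · intro d
      unfold moebiusTerm
      split_ifs with ho
      · refine Tendsto.const_mul _ ?_
        have hd : 0 < (d : ℝ) := by have := ho.pos; positivity
        have hl : Tendsto (fun X : ℕ => 1 / (4 * (d : ℝ)) - 2 / (X : ℝ)) atTop
            (𝓝 (1 / (4 * (d : ℝ)) - 0)) :=
          tendsto_const_nhds.sub (tendsto_const_div_atTop_nhds_zero_nat 2)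
        have hr : Tendsto (fun X : ℕ => 1 / (4 * (d : ℝ)) + 2 / (X : ℝ)) atTop
            (𝓝 (1 / (4 * (d : ℝ)) + 0)) :=
          tendsto_const_nhds.add (tendsto_const_div_atTop_nhds_zero_nat 2)
        rw [sub_zero] at hl
        rw [add_zero] at hr
        refine tendsto_of_tendsto_of_tendsto_of_le_of_le' hl hr ?_ ?_
        · filter_upwards [eventually_gt_atTop 0] with X hX
          have hX' : (0 : ℝ) < X := by positivity
          have h1 : X < d * (X / d + 1) := Nat.lt_mul_div_succ X ho.pos
          have h2 : X / d < 4 * ((X / d + c₀) / 4) + 4 := by omega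
          have h1' : (X : ℝ) < d * ((X / d : ℕ) + 1) := by exact_mod_cast h1
          have h2' : ((X / d : ℕ) : ℝ) + 1 ≤ 4 * ((X / d + c₀) / 4 : ℕ) + 4 := by
            exact_mod_cast h2
          rw [le_div_iff₀ hX', sub_mul, div_mul_cancel₀ _ hX'.ne', sub_le_iff_le_add,
            div_mul_eq_mul_div, div_le_iff₀ (by positivity)]
          nlinarith
        · filter_upwards [eventually_gt_atTop 0] with X hX
          have hX' : (0 : ℝ) < X := by positivity
          have h1 : d * (X / d) ≤ X := Nat.mul_div_le X d
          have h2 : 4 * ((X / d + c₀) / 4) ≤ X / d + 2 := by omega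
          have h1' : (d : ℝ) * ((X / d : ℕ)) ≤ X := by exact_mod_cast h1
          have h2' : 4 * (((X / d + c₀) / 4 : ℕ) : ℝ) ≤ (X / d : ℕ) + 2 := by exact_mod_cast h2
          rw [div_le_iff₀ hX', add_mul, div_mul_cancel₀ _ hX'.ne', div_mul_eq_mul_div,
            div_add' _ _ _ (by positivity), le_div_iff₀ (by positivity)]
          nlinarith
      · exact tendsto_const_nhds
    · refine Eventually.of_forall fun X d => ?_
      unfold moebiusTerm
      split_ifs with ho
      · have hd : 0 < (d : ℝ) := by have := ho.pos; positivity
        have hmu : |(moebius d : ℝ)| ≤ 1 := by exact_mod_cast abs_moebius_le_one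
        have hc : (((X / d + c₀) / 4 : ℕ) : ℝ) / X ≤ 1 / d := by
          rcases Nat.eq_zero_or_pos X with rfl | hX
          · simp
          · have hX' : (0 : ℝ) < X := by positivity
            rw [div_le_div_iff₀ hX' hd, one_mul]
            have hn : (X / d + c₀) / 4 ≤ X / d := by
              generalize X / d = n
              omega
            have : (X / d + c₀) / 4 * d ≤ X :=
              (Nat.mul_le_mul_right d hn).trans
                (Nat.div_mul_le_self X d)
            exact_mod_cast this
        rw [Real.norm_eq_abs, abs_mul, abs_div, abs_of_pos hd,
          abs_of_nonneg (show (0 : ℝ) ≤ (((X / d + c₀) / 4 : ℕ) : ℝ) / X by positivity)]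
        calc |(moebius d : ℝ)| / d * ((((X / d + c₀) / 4 : ℕ) : ℝ) / X)
            ≤ 1 / d * (1 / d) := by gcongr
          _ = 1 / (d : ℝ) ^ 2 := by field_simp
      · simp
  rw [tsum_odd_moebius] at h
  have := h.const_mul (1 / 2 : ℝ)
  rw [show (1 / 2 : ℝ) * (2 / Real.pi ^ 2) = 1 / Real.pi ^ 2 by ring] at this
  exact this.congr fun X => (sum_totient_four_mul X c₀ hc₀).symm

end

section
open Topology

def InCell (p : ℕ) (a₀ b₀ c₀ : ℤ) (Z x₀ x₁ t₀ t₁ : ℝ) (w : ℤ × ℤ × ℤ) : Prop :=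
  0 < w.1 ∧ (w.1 : ℝ) ≤ Z * √p ∧ w.1 % 4 = c₀ ∧ InSlab p a₀ b₀ w.1.toNat x₀ x₁ t₀ t₁ w.2

theorem exists_sum_totient_le (c₀ : ℕ) (hc₀ : c₀ = 0 ∨ c₀ = 2) {δ : ℝ} (hδ : 0 < δ) :
    ∃ X₀ : ℕ, ∀ X : ℕ, ∑ c ∈ Ioc 0 X with c % 4 = c₀, ((4 * c).totient : ℝ) / (4 * c : ℕ) ≤
      (1 / Real.pi ^ 2 + δ) * X + X₀ := by
  have h := (tendsto_mean_totient c₀ hc₀).eventually_lt_const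
    (show 1 / Real.pi ^ 2 < 1 / Real.pi ^ 2 + δ by linarith)
  obtain ⟨X₀, hX₀⟩ := (h.and (eventually_gt_atTop 0)).exists_forall_of_atTop
  refine ⟨X₀, fun X => ?_⟩
  have hpos : 0 ≤ (1 / Real.pi ^ 2 + δ) * X := by positivity
  rcases le_total X₀ X with hX | hX
  · obtain ⟨h1, h2⟩ := hX₀ X hX
    rw [div_lt_iff₀ (by exact_mod_cast h2)] at h1
    have : (0 : ℝ) ≤ X₀ := by positivity
    linarith
  · have h1 : ∑ c ∈ Ioc 0 X with c % 4 = c₀, ((4 * c).totient : ℝ) / (4 * c : ℕ) ≤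
        ∑ c ∈ Ioc 0 X with c % 4 = c₀, 1 := by
      refine Finset.sum_le_sum fun c _ => div_le_one_of_le₀ ?_ (by positivity)
      exact_mod_cast Nat.totient_le _
    have h2 : #{c ∈ Ioc 0 X | c % 4 = c₀} ≤ X₀ :=
      ((Finset.card_filter_le _ _).trans (by simp)).trans hX
    have h2' : ((#{c ∈ Ioc 0 X | c % 4 = c₀} : ℕ) : ℝ) ≤ X₀ := by exact_mod_cast h2
    simp only [Finset.sum_const, nsmul_eq_mul, mul_one] at h1
    linarith

theorem card_inCell_le_sum {p : ℕ} {a₀ b₀ : ℤ} {c₀ : ℕ} {Z x₀ x₁ t₀ t₁ : ℝ}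
    {T : Finset (ℤ × ℤ × ℤ)} (hT : ∀ w ∈ T, InCell p a₀ b₀ c₀ Z x₀ x₁ t₀ t₁ w)
    {f : ℕ → ℝ} (hf : ∀ c : ℕ, 0 < c → (c : ℝ) ≤ Z * √p → ∀ S : Finset (ℤ × ℤ),
      (∀ z ∈ S, InSlab p a₀ b₀ c x₀ x₁ t₀ t₁ z) → (#S : ℝ) ≤ f c) :
    (#T : ℝ) ≤ ∑ c ∈ Ioc 0 ⌊Z * √p⌋₊ with c % 4 = c₀, f c := by
  have hmap : ∀ w ∈ T, w.1.toNat ∈ {c ∈ Ioc 0 ⌊Z * √p⌋₊ | c % 4 = c₀} := by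
    intro w hw
    obtain ⟨h1, h2, h3, -⟩ := hT w hw
    simp only [Finset.mem_filter, Finset.mem_Ioc]
    have e : ((w.1.toNat : ℕ) : ℝ) = w.1 := by
      have : ((w.1.toNat : ℕ) : ℤ) = w.1 := Int.toNat_of_nonneg h1.le
      exact_mod_cast this
    refine ⟨⟨by omega, Nat.le_floor (by rw [e]; exact h2)⟩, by omega⟩
  rw [Finset.card_eq_sum_card_fiberwise hmap]
  push_cast
  refine Finset.sum_le_sum fun c hc => ?_
  simp only [Finset.mem_filter, Finset.mem_Ioc] at hc
  obtain ⟨⟨hc0, hcX⟩, hc4⟩ := hc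
  have hcZ : (c : ℝ) ≤ Z * √p := by
    have := (Nat.le_floor_iff' hc0.ne').1 hcX
    exact this
  rw [← Finset.card_image_of_injOn (f := Prod.snd)]
  · refine hf c hc0 hcZ _ fun z hz => ?_
    obtain ⟨w, hw, rfl⟩ := Finset.mem_image.1 hz
    obtain ⟨hwT, rfl⟩ := Finset.mem_filter.1 hw
    exact (hT w hwT).2.2.2
  · intro w hw v hv h
    obtain ⟨hw, hw'⟩ := Finset.mem_filter.1 (Finset.mem_coe.1 hw)
    obtain ⟨hv, hv'⟩ := Finset.mem_filter.1 (Finset.mem_coe.1 hv)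
    have h1 := (hT w hw).1
    have h2 := (hT v hv).1
    exact Prod.ext (by omega) h

set_option maxHeartbeats 800000 in
theorem exists_card_inCell_le {x₀ x₁ t₀ t₁ Z ε : ℝ} (hx : x₀ ≤ x₁) (hx1 : x₁ - x₀ ≤ 1)
    (ht : t₀ ≤ t₁) (ht1 : t₁ - t₀ ≤ 4) (hZ : 0 ≤ Z) (hε : 0 < ε) :
    ∃ P₀ : ℕ, ∀ (p : ℕ) (_ : p.Prime) (_ : P₀ ≤ p) (a₀ b₀ : ℤ) (c₀ : ℕ) (_ : a₀ = 1 ∨ a₀ = 3)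
      (_ : Even b₀) (_ : c₀ = 0 ∨ c₀ = 2) (T : Finset (ℤ × ℤ × ℤ)),
      (∀ w ∈ T, InCell p a₀ b₀ c₀ Z x₀ x₁ t₀ t₁ w) →
      (#T : ℝ) ≤ p * ((x₁ - x₀) * (t₁ - t₀) * Z / (8 * Real.pi ^ 2) + ε) := by
  set A : ℝ := (t₁ - t₀) * (x₁ - x₀) / 8 with hA
  have hA0 : 0 ≤ A := by
    have := sub_nonneg.2 hx; have := sub_nonneg.2 ht; positivity
  set δ : ℝ := ε / 2 / (A * Z + Z + Z ^ 2 + 1) with hδ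
  have hδ0 : 0 < δ := by positivity
  have hδε : δ * (A * Z + Z + Z ^ 2) ≤ ε / 2 := by
    rw [hδ, div_mul_eq_mul_div, div_le_iff₀ (by positivity)]
    nlinarith
  obtain ⟨c₁, C, hC0, hC⟩ := exists_card_slab_le hx hx1 ht ht1 hδ0
  obtain ⟨X₀, hX₀⟩ := exists_sum_totient_le 0 (Or.inl rfl) hδ0
  obtain ⟨X₂, hX₂⟩ := exists_sum_totient_le 2 (Or.inr rfl) hδ0
  have hmean : ∀ c₀ : ℕ, c₀ = 0 ∨ c₀ = 2 → ∀ X : ℕ, ∑ c ∈ Ioc 0 X with c % 4 = c₀,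
      ((4 * c).totient : ℝ) / (4 * c : ℕ) ≤ (1 / Real.pi ^ 2 + δ) * X + (X₀ + X₂) := by
    have h0 : (0 : ℝ) ≤ X₀ := by positivity
    have h2 : (0 : ℝ) ≤ X₂ := by positivity
    rintro c₀ (rfl | rfl) X
    · linarith [hX₀ X]
    · linarith [hX₂ X]
  set K₁ : ℝ := A * (X₀ + X₂) + C * c₁ with hK₁
  set K₂ : ℝ := C * c₁ * c₁ with hK₂
  have hK₁0 : 0 ≤ K₁ := by positivity
  have hK₂0 : 0 ≤ K₂ := by positivity
  set S₀ : ℝ := 2 * (K₁ + K₂) / ε + Z + 1 with hS₀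
  refine ⟨⌈S₀ ^ 2⌉₊ + 3, fun p hp hP a₀ b₀ c₀ ha₀ hb₀ hc₀ T hT => ?_⟩
  set s : ℝ := √p with hs
  have hss : s ^ 2 = p := Real.sq_sqrt (by positivity)
  have hsS : S₀ ≤ s := by
    refine Real.le_sqrt_of_sq_le ((Nat.le_ceil _).trans ?_)
    exact_mod_cast (by omega : ⌈S₀ ^ 2⌉₊ ≤ p)
  have hKε : 0 ≤ 2 * (K₁ + K₂) / ε := by positivity
  have hs1 : 1 ≤ s := by linarith
  have hsZ : Z < s := by linarith
  have hsK : 2 * (K₁ + K₂) ≤ ε * s := by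
    have : 2 * (K₁ + K₂) / ε ≤ s := by linarith
    rwa [div_le_iff₀ hε, mul_comm s ε] at this
  have key := card_inCell_le_sum hT (f := fun c => A * s * (((4 * c).totient : ℝ) / (4 * c : ℕ)) +
    δ * (s + Z * s) + if c < c₁ then C * (s + c₁) else 0) (by
      intro c hc hcZ S hS
      have hcp : c < p := by
        have : (c : ℝ) < p := by rw [← hss]; nlinarith
        exact_mod_cast this
      obtain ⟨h1, h2⟩ := hC p hp (by omega) a₀ b₀ ha₀ hb₀ c hc hcp S hS
      have hr : 0 ≤ A * s * (((4 * c).totient : ℝ) / (4 * c : ℕ)) := by positivity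
      have hr' : 0 ≤ δ * (s + Z * s) := by positivity
      split_ifs with h
      · have h' : (c : ℝ) ≤ c₁ := by exact_mod_cast h.le
        have : C * (√p + c) ≤ C * (s + c₁) := by gcongr
        linarith
      · have h3 := h2 (by omega)
        have : δ * (√p + c) ≤ δ * (s + Z * s) := by gcongr
        have e : (t₁ - t₀) * (x₁ - x₀) * √p / 8 = A * s := by rw [hA]; ring
        rw [e] at h3
        linarith)
  rw [Finset.sum_add_distrib, Finset.sum_add_distrib, ← Finset.mul_sum, ← Finset.sum_filter,
    Finset.sum_const, Finset.sum_const, nsmul_eq_mul, nsmul_eq_mul] at key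
  set X := ⌊Z * √p⌋₊ with hX
  have hXZ : (X : ℝ) ≤ Z * s := Nat.floor_le (by positivity)
  have hn1 : ((#{c ∈ Ioc 0 X | c % 4 = c₀} : ℕ) : ℝ) ≤ Z * s := by
    refine le_trans ?_ hXZ
    exact_mod_cast (Finset.card_filter_le _ _).trans (by simp)
  have hn2 : ((#{c ∈ {c ∈ Ioc 0 X | c % 4 = c₀} | c < c₁} : ℕ) : ℝ) ≤ c₁ := by
    have : {c ∈ {c ∈ Ioc 0 X | c % 4 = c₀} | c < c₁} ⊆ Finset.range c₁ := by
      intro c hc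
      exact Finset.mem_range.2 (Finset.mem_filter.1 hc).2
    exact_mod_cast (Finset.card_le_card this).trans (by simp)
  have e1 : A * s * (∑ c ∈ Ioc 0 X with c % 4 = c₀, ((4 * c).totient : ℝ) / (4 * c : ℕ)) ≤
      A * s * ((1 / Real.pi ^ 2 + δ) * (Z * s) + (X₀ + X₂)) := by
    have := hmean c₀ hc₀ X
    have h' : (1 / Real.pi ^ 2 + δ) * X ≤ (1 / Real.pi ^ 2 + δ) * (Z * s) := by gcongr
    exact mul_le_mul_of_nonneg_left (by linarith) (by positivity)
  have e2 : ((#{c ∈ Ioc 0 X | c % 4 = c₀} : ℕ) : ℝ) * (δ * (s + Z * s)) ≤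
      Z * s * (δ * (s + Z * s)) := by gcongr
  have e3 : ((#{c ∈ {c ∈ Ioc 0 X | c % 4 = c₀} | c < c₁} : ℕ) : ℝ) * (C * (s + c₁)) ≤
      c₁ * (C * (s + c₁)) := by gcongr
  have e4 : p * ((x₁ - x₀) * (t₁ - t₀) * Z / (8 * Real.pi ^ 2) + ε) =
      s ^ 2 * (A * Z * (1 / Real.pi ^ 2)) + s ^ 2 * ε := by
    rw [hss, hA]; field_simp
  have e5 : s ^ 2 * (δ * (A * Z + Z + Z ^ 2)) ≤ s ^ 2 * (ε / 2) := by gcongr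
  have e6 : s * (2 * (K₁ + K₂)) ≤ s * (ε * s) := by gcongr
  have e7 : K₂ ≤ s * K₂ := le_mul_of_one_le_left hK₂0 hs1
  rw [e4]
  have e8 : A * s * ((1 / Real.pi ^ 2 + δ) * (Z * s) + (X₀ + X₂)) + Z * s * (δ * (s + Z * s)) +
      c₁ * (C * (s + c₁)) = s ^ 2 * (A * Z * (1 / Real.pi ^ 2)) +
      s ^ 2 * (δ * (A * Z + Z + Z ^ 2)) + s * K₁ + K₂ := by
    rw [hK₁, hK₂]; ring
  have e9 : s ^ 2 * (ε / 2) + s ^ 2 * (ε / 2) = s ^ 2 * ε := by ring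
  have e10 : s * (2 * (K₁ + K₂)) = 2 * (s * K₁) + 2 * (s * K₂) := by ring
  have e11 : s * (ε * s) = 2 * (s ^ 2 * (ε / 2)) := by ring
  linarith

end

section
open Topology

theorem exists_mem_Icc_of_chain {u : ℕ → ℝ} {x : ℝ} (n : ℕ) (h0 : u 0 ≤ x) (hn : 0 < n)
    (hx : x ≤ u n) : ∃ i < n, u i ≤ x ∧ x ≤ u (i + 1) := by
  induction n with
  | zero => exact absurd hn (lt_irrefl 0)
  | succ n ih =>
    rcases le_total (u n) x with h | h
    · exact ⟨n, n.lt_succ_self, h, hx⟩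
    · rcases Nat.eq_zero_or_pos n with rfl | hn'
      · exact ⟨0, Nat.one_pos, h0, hx⟩
      · obtain ⟨i, hi, h'⟩ := ih hn' h
        exact ⟨i, by omega, h'⟩

theorem exists_upper_riemann_sum {f : ℝ → ℝ} {a b ε : ℝ} (hab : a ≤ b)
    (hf : ContinuousOn f (Set.Icc a b)) (hf0 : ∀ x, 0 ≤ f x) (hε : 0 < ε) :
    ∃ (n : ℕ) (u M : ℕ → ℝ), Monotone u ∧ u 0 = a ∧ u n = b ∧ 0 < n ∧
      (∀ i < n, 0 ≤ M i ∧ ∀ x, u i ≤ x → x ≤ u (i + 1) → f x ≤ M i) ∧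
      ∑ i ∈ range n, (u (i + 1) - u i) * M i ≤ (∫ x in a..b, f x) + ε := by
  have hba : 0 ≤ b - a := sub_nonneg.2 hab
  set η := ε / (2 * (b - a) + 1) with hη
  have hη0 : 0 < η := by positivity
  obtain ⟨δ, hδ, hu⟩ := Metric.uniformContinuousOn_iff.1
    (isCompact_Icc.uniformContinuousOn_of_continuous hf) η hη0
  obtain ⟨n, hn⟩ := exists_nat_gt ((b - a) / δ)
  have hn0 : (0 : ℝ) < n := lt_of_le_of_lt (by positivity) hn
  set w := (b - a) / n with hw
  have hw0 : 0 ≤ w := by positivity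
  have hwδ : w < δ := by
    rw [div_lt_iff₀ hδ] at hn
    rw [hw, div_lt_iff₀ hn0]; linarith
  set u : ℕ → ℝ := fun i => a + i * w with hu'
  have hmono : Monotone u := fun i j hij => by
    have : (i : ℝ) ≤ j := by exact_mod_cast hij
    simp only [hu']
    gcongr
  have hu0 : u 0 = a := by simp [hu']
  have hun : u n = b := by simp only [hu', hw]; field_simp; ring
  have hstep : ∀ i, u (i + 1) - u i = w := fun i => by simp only [hu']; push_cast; ring
  have hmem : ∀ i < n, ∀ x, u i ≤ x → x ≤ u (i + 1) → x ∈ Set.Icc a b := fun i hi x h1 h2 =>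
    ⟨by rw [← hu0]; exact (hmono (Nat.zero_le i)).trans h1,
      by rw [← hun]; exact h2.trans (hmono hi)⟩
  have hclose : ∀ i < n, ∀ x, u i ≤ x → x ≤ u (i + 1) → |f x - f (u i)| < η := by
    intro i hi x h1 h2
    refine hu x (hmem i hi x h1 h2) (u i) (hmem i hi _ le_rfl (hmono i.le_succ)) ?_
    rw [Real.dist_eq, abs_of_nonneg (sub_nonneg.2 h1)]
    have := hstep i
    linarith
  have hfi : ∀ i < n, IntervalIntegrable f MeasureTheory.volume (u i) (u (i + 1)) := by
    intro i hi
    refine ContinuousOn.intervalIntegrable (hf.mono ?_)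
    rw [Set.uIcc_of_le (hmono i.le_succ)]
    exact fun x hx => hmem i hi x hx.1 hx.2
  refine ⟨n, u, fun i => f (u i) + η, hmono, hu0, hun, by exact_mod_cast hn0, ?_, ?_⟩
  · intro i hi
    refine ⟨by have := hf0 (u i); positivity, fun x h1 h2 => ?_⟩
    have := (abs_lt.1 (hclose i hi x h1 h2)).2
    linarith
  · rw [← hu0, ← hun, ← intervalIntegral.sum_integral_adjacent_intervals hfi]
    have hcell : ∀ i ∈ range n, (u (i + 1) - u i) * (f (u i) + η) ≤
        (∫ x in u i..u (i + 1), f x) + 2 * η * w := by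
      intro i hi
      have hi' := Finset.mem_range.1 hi
      have h1 : ∫ x in u i..u (i + 1), (f (u i) - η) ≤ ∫ x in u i..u (i + 1), f x := by
        refine intervalIntegral.integral_mono_on (hmono i.le_succ) (by simp) (hfi i hi') ?_
        intro x hx
        have := (abs_lt.1 (hclose i hi' x hx.1 hx.2)).1
        linarith
      rw [intervalIntegral.integral_const, smul_eq_mul, hstep] at h1
      rw [hstep]
      nlinarith
    refine (Finset.sum_le_sum hcell).trans ?_
    rw [Finset.sum_add_distrib, Finset.sum_const, Finset.card_range, nsmul_eq_mul]
    have e : (n : ℝ) * (2 * η * w) = 2 * (b - a) * η := by rw [hw]; field_simp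
    have e2 : 2 * (b - a) * η ≤ ε := by
      rw [hη, mul_div_assoc', div_le_iff₀ (by positivity)]
      nlinarith
    linarith

theorem integral_one_div_sqrt_one_sub_sq :
    ∫ x in (-(1 / 2) : ℝ)..(1 / 2), 1 / √(1 - x ^ 2) = Real.pi / 3 := by
  rw [intervalIntegral.integral_eq_sub_of_hasDerivAt (f := Real.arcsin)]
  · have h : Real.arcsin (1 / 2) = Real.pi / 6 := by
      rw [← Real.sin_pi_div_six, Real.arcsin_sin] <;> linarith [Real.pi_pos]
    rw [Real.arcsin_neg, h]
    ring
  · intro x hx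
    rw [Set.uIcc_of_le (by norm_num)] at hx
    exact Real.hasDerivAt_arcsin (by linarith [hx.1]) (by linarith [hx.2])
  · refine ContinuousOn.intervalIntegrable ?_
    rw [Set.uIcc_of_le (by norm_num)]
    refine ContinuousOn.div continuousOn_const (by fun_prop) fun x hx => ?_
    have : 0 < 1 - x ^ 2 := by nlinarith [hx.1, hx.2]
    positivity

theorem continuousOn_one_div_sqrt_one_sub_sq :
    ContinuousOn (fun x : ℝ => 1 / √(1 - x ^ 2)) (Set.Icc (-(1 / 2)) (1 / 2)) := by
  refine ContinuousOn.div continuousOn_const (by fun_prop) fun x hx => ?_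
  have : 0 < 1 - x ^ 2 := by nlinarith [hx.1, hx.2]
  positivity

theorem integral_sqrt_four_sub_sq : ∫ t in (-2 : ℝ)..2, √(4 - t ^ 2) = 2 * Real.pi := by
  have h := intervalIntegral.integral_comp_mul_left (fun t : ℝ => √(4 - t ^ 2))
    (c := 2) (a := -1) (b := 1) two_ne_zero
  have e : ∀ x : ℝ, √(4 - (2 * x) ^ 2) = 2 * √(1 - x ^ 2) := fun x => by
    rw [show 4 - (2 * x) ^ 2 = 2 ^ 2 * (1 - x ^ 2) by ring, Real.sqrt_mul (by positivity),
      Real.sqrt_sq (by norm_num)]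
  simp only [e, intervalIntegral.integral_const_mul, integral_sqrt_one_sub_sq] at h
  norm_num at h
  linarith

end

section
open Topology

theorem RedTriple.le_mul_sqrt {p : ℕ} {a₀ b₀ c₀ : ℤ} {w : ℤ × ℤ × ℤ} (hp : 0 < p)
    (hw : RedTriple p a₀ b₀ c₀ w) :
    (w.1 : ℝ) ≤ 1 / 2 * (1 / √(1 - (((w.2.1 : ℝ) - w.2.2) / (2 * w.1)) ^ 2)) *
      √(4 - (((w.2.1 : ℝ) + w.2.2) / √p) ^ 2) * √p := by
  obtain ⟨h0, -, -, -, h1, h2⟩ := hw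
  have hc : (0 : ℝ) < w.1 := by exact_mod_cast h0
  have h2' : ((w.2.1 : ℝ) + w.2.2) ^ 2 + 4 * w.1 ^ 2 ≤ 4 * p + ((w.2.1 : ℝ) - w.2.2) ^ 2 := by
    exact_mod_cast h2
  have h1' : |((w.2.1 : ℝ) - w.2.2)| ≤ w.1 := by exact_mod_cast h1
  set s := √(p : ℝ) with hs
  have hs0 : 0 < s := Real.sqrt_pos.2 (by exact_mod_cast hp)
  have hss : s ^ 2 = p := Real.sq_sqrt (by positivity)
  set x := ((w.2.1 : ℝ) - w.2.2) / (2 * w.1) with hx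
  set t := ((w.2.1 : ℝ) + w.2.2) / s with ht
  have ex : (w.2.1 : ℝ) - w.2.2 = 2 * w.1 * x := by rw [hx]; field_simp
  have et : (w.2.1 : ℝ) + w.2.2 = t * s := by rw [ht]; field_simp
  rw [ex, et, ← hss] at h2'
  have hx1 : x ^ 2 < 1 := by
    rw [ex, abs_le] at h1'
    have : x ≤ 1 / 2 := by nlinarith
    have : -(1 / 2) ≤ x := by nlinarith
    nlinarith
  have hg : 0 < √(1 - x ^ 2) := Real.sqrt_pos.2 (by linarith)
  have key : 2 * w.1 * √(1 - x ^ 2) ≤ √(4 - t ^ 2) * s := by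
    have e : √(4 - t ^ 2) * s = √((4 - t ^ 2) * s ^ 2) := by
      rw [Real.sqrt_mul' _ (by positivity), Real.sqrt_sq hs0.le]
    rw [e]
    refine Real.le_sqrt_of_sq_le ?_
    rw [mul_pow, Real.sq_sqrt (by linarith)]
    nlinarith
  rw [show 1 / 2 * (1 / √(1 - x ^ 2)) * √(4 - t ^ 2) * s =
    √(4 - t ^ 2) * s / (2 * √(1 - x ^ 2)) by field_simp, le_div_iff₀ (by positivity)]
  linarith

theorem RedTriple.inCell {p : ℕ} {a₀ b₀ c₀ : ℤ} {w : ℤ × ℤ × ℤ} (hp : 0 < p)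
    (hw : RedTriple p a₀ b₀ c₀ w) {x₀ x₁ t₀ t₁ G H : ℝ} (hH : 0 ≤ H)
    (hx₀ : x₀ ≤ ((w.2.1 : ℝ) - w.2.2) / (2 * w.1)) (hx₁ : ((w.2.1 : ℝ) - w.2.2) / (2 * w.1) ≤ x₁)
    (ht₀ : t₀ ≤ ((w.2.1 : ℝ) + w.2.2) / √p) (ht₁ : ((w.2.1 : ℝ) + w.2.2) / √p ≤ t₁)
    (hG : 1 / √(1 - (((w.2.1 : ℝ) - w.2.2) / (2 * w.1)) ^ 2) ≤ G)
    (hHt : √(4 - (((w.2.1 : ℝ) + w.2.2) / √p) ^ 2) ≤ H) :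
    InCell p a₀ b₀ c₀ (1 / 2 * G * H) x₀ x₁ t₀ t₁ w := by
  have hz := hw.le_mul_sqrt hp
  obtain ⟨h0, hc, ha, hd, h1, h2⟩ := hw
  have hs0 : 0 < √(p : ℝ) := Real.sqrt_pos.2 (by exact_mod_cast hp)
  have e : ((w.1.toNat : ℕ) : ℤ) = w.1 := Int.toNat_of_nonneg h0.le
  have e' : ((w.1.toNat : ℕ) : ℝ) = w.1 := by exact_mod_cast e
  refine ⟨h0, ?_, hc, ha, ?_, ?_, ?_, ?_⟩
  · refine hz.trans ?_
    have hG0 : 0 ≤ G := le_trans (by positivity) hG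
    gcongr
  · rw [e]; exact hd
  · rw [e']; exact ⟨hx₀, hx₁⟩
  · exact (le_div_iff₀ hs0).1 ht₀
  · exact (div_le_iff₀ hs0).1 ht₁

theorem exists_card_redTriple_le {α β ε : ℝ} (hα : -2 ≤ α) (hαβ : α ≤ β) (hβ : β ≤ 2)
    (hε : 0 < ε) : ∃ P₀ : ℕ, ∀ (p : ℕ) (_ : p.Prime) (_ : P₀ ≤ p) (a₀ b₀ : ℤ) (c₀ : ℕ)
      (_ : a₀ = 1 ∨ a₀ = 3) (_ : Even b₀) (_ : c₀ = 0 ∨ c₀ = 2) (T : Finset (ℤ × ℤ × ℤ)),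
      (∀ w ∈ T, RedTriple p a₀ b₀ c₀ w ∧ α ≤ ((w.2.1 : ℝ) + w.2.2) / √p ∧
        ((w.2.1 : ℝ) + w.2.2) / √p ≤ β) →
      (#T : ℝ) ≤ p * (1 / (48 * Real.pi) * (∫ t in α..β, √(4 - t ^ 2)) + ε) := by
  set I := ∫ t in α..β, √(4 - t ^ 2) with hI
  have hI0 : 0 ≤ I := intervalIntegral.integral_nonneg hαβ fun t _ => Real.sqrt_nonneg _
  have hpi := Real.pi_pos
  have hpi3 := Real.pi_gt_three
  obtain ⟨η, hη0, hη1, hη⟩ : ∃ η : ℝ, 0 < η ∧ η ≤ 1 ∧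
      (Real.pi / 3 + η) * (I + η) ≤ Real.pi / 3 * I + 8 * Real.pi ^ 2 * ε := by
    refine ⟨min 1 (ε / (Real.pi / 3 + I + 1)), by positivity, min_le_left _ _, ?_⟩
    set η := min 1 (ε / (Real.pi / 3 + I + 1))
    have h1 : η ≤ 1 := min_le_left _ _
    have h0 : 0 < η := by positivity
    have h2 : η * (Real.pi / 3 + I + 1) ≤ ε := (le_div_iff₀ (by positivity)).1 (min_le_right _ _)
    have h3 : (1 : ℝ) ≤ 8 * Real.pi ^ 2 := by nlinarith
    nlinarith
  obtain ⟨n, u, G, hu, hu0, hun, hn, hG, hGs⟩ := exists_upper_riemann_sum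
    (show (-(1 / 2) : ℝ) ≤ 1 / 2 by norm_num) continuousOn_one_div_sqrt_one_sub_sq
    (fun x => by positivity) hη0
  obtain ⟨m, v, H, hv, hv0, hvm, hm, hH, hHs⟩ := exists_upper_riemann_sum hαβ
    (f := fun t => √(4 - t ^ 2)) (by fun_prop) (fun x => Real.sqrt_nonneg _) hη0
  rw [integral_one_div_sqrt_one_sub_sq] at hGs
  have hcell : ∀ i ∈ range n, ∀ j ∈ range m, ∃ P₀ : ℕ, ∀ (p : ℕ) (_ : p.Prime) (_ : P₀ ≤ p)
      (a₀ b₀ : ℤ) (c₀ : ℕ) (_ : a₀ = 1 ∨ a₀ = 3)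
      (_ : Even b₀) (_ : c₀ = 0 ∨ c₀ = 2) (T : Finset (ℤ × ℤ × ℤ)),
      (∀ w ∈ T, InCell p a₀ b₀ c₀ (1 / 2 * G i * H j) (u i) (u (i + 1)) (v j) (v (j + 1)) w) →
      (#T : ℝ) ≤ p * ((u (i + 1) - u i) * (v (j + 1) - v j) * (1 / 2 * G i * H j) /
        (8 * Real.pi ^ 2) + ε / 2 / (n * m)) := by
    intro i hi j hj
    have hi := Finset.mem_range.1 hi
    have hj := Finset.mem_range.1 hj
    have h1 := hu (Nat.zero_le i)
    have h2 := hu (show i + 1 ≤ n from hi)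
    have h3 := hv (Nat.zero_le j)
    have h4 := hv (show j + 1 ≤ m from hj)
    have hGi := (hG i hi).1
    have hHj := (hH j hj).1
    exact exists_card_inCell_le (hu i.le_succ) (by linarith) (hv j.le_succ) (by linarith)
      (by positivity) (by positivity)
  choose! P hP using hcell
  refine ⟨(∑ i ∈ range n, ∑ j ∈ range m, P i j) + 1,
    fun p hp hPp a₀ b₀ c₀ ha₀ hb₀ hc₀ T hT => ?_⟩
  classical
  have hs0 : 0 < √(p : ℝ) := Real.sqrt_pos.2 (by exact_mod_cast hp.pos)
  set F : ℕ × ℕ → Finset (ℤ × ℤ × ℤ) := fun q => {w ∈ T | InCell p a₀ b₀ c₀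
    (1 / 2 * G q.1 * H q.2) (u q.1) (u (q.1 + 1)) (v q.2) (v (q.2 + 1)) w} with hF
  have hcover : T ⊆ (range n ×ˢ range m).biUnion F := by
    intro w hw
    obtain ⟨hr, hα', hβ'⟩ := hT w hw
    have hc : (0 : ℝ) < w.1 := by exact_mod_cast hr.1
    have h1 : |((w.2.1 : ℝ) - w.2.2)| ≤ w.1 := by exact_mod_cast hr.2.2.2.2.1
    obtain ⟨h1l, h1r⟩ := abs_le.1 h1
    obtain ⟨i, hi, hi1, hi2⟩ := exists_mem_Icc_of_chain (u := u)
      (x := ((w.2.1 : ℝ) - w.2.2) / (2 * w.1)) n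
      (by rw [hu0, le_div_iff₀ (by positivity)]; linarith) hn
      (by rw [hun, div_le_iff₀ (by positivity)]; linarith)
    obtain ⟨j, hj, hj1, hj2⟩ := exists_mem_Icc_of_chain (u := v)
      (x := ((w.2.1 : ℝ) + w.2.2) / √p) m (by rw [hv0]; exact hα') hm (by rw [hvm]; exact hβ')
    refine Finset.mem_biUnion.2 ⟨(i, j), Finset.mem_product.2
      ⟨Finset.mem_range.2 hi, Finset.mem_range.2 hj⟩, Finset.mem_filter.2 ⟨hw, ?_⟩⟩
    exact hr.inCell hp.pos (hH j hj).1 hi1 hi2 hj1 hj2 ((hG i hi).2 _ hi1 hi2)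
      ((hH j hj).2 _ hj1 hj2)
  have h1 : (#T : ℝ) ≤ ∑ q ∈ range n ×ˢ range m, (#(F q) : ℝ) := by
    exact_mod_cast (Finset.card_le_card hcover).trans Finset.card_biUnion_le
  have h2 : ∀ i ∈ range n, ∀ j ∈ range m, (#(F (i, j)) : ℝ) ≤
      p * ((u (i + 1) - u i) * (v (j + 1) - v j) * (1 / 2 * G i * H j) /
        (8 * Real.pi ^ 2) + ε / 2 / (n * m)) := by
    intro i hi j hj
    refine hP i hi j hj p hp ?_ a₀ b₀ c₀ ha₀ hb₀ hc₀ _ fun w hw => (Finset.mem_filter.1 hw).2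
    have e1 : P i j ≤ ∑ j ∈ range m, P i j :=
      Finset.single_le_sum (f := fun j => P i j) (fun _ _ => Nat.zero_le _) hj
    have e2 : ∑ j ∈ range m, P i j ≤ ∑ i ∈ range n, ∑ j ∈ range m, P i j :=
      Finset.single_le_sum (f := fun i => ∑ j ∈ range m, P i j) (fun _ _ => Nat.zero_le _) hi
    omega
  rw [Finset.sum_product] at h1
  have h3 : ∑ i ∈ range n, ∑ j ∈ range m,
      (p : ℝ) * ((u (i + 1) - u i) * (v (j + 1) - v j) * (1 / 2 * G i * H j) /
        (8 * Real.pi ^ 2) + ε / 2 / (n * m)) = p * (((∑ i ∈ range n, (u (i + 1) - u i) * G i) *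
        (∑ j ∈ range m, (v (j + 1) - v j) * H j)) / (16 * Real.pi ^ 2) + ε / 2) := by
    simp only [← Finset.mul_sum, Finset.sum_add_distrib, Finset.sum_const, Finset.card_range,
      nsmul_eq_mul, ← Finset.sum_div]
    congr 2
    · have hS : ∑ i ∈ range n, ∑ j ∈ range m,
          (u (i + 1) - u i) * (v (j + 1) - v j) * (1 / 2 * G i * H j) =
          1 / 2 * ((∑ i ∈ range n, (u (i + 1) - u i) * G i) *
            (∑ j ∈ range m, (v (j + 1) - v j) * H j)) := by
        rw [Finset.sum_mul_sum, Finset.mul_sum]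
        refine Finset.sum_congr rfl fun i _ => ?_
        rw [Finset.mul_sum]
        exact Finset.sum_congr rfl fun j _ => by ring
      rw [hS]
      ring
    · have : (n : ℝ) ≠ 0 := by positivity
      have : (m : ℝ) ≠ 0 := by positivity
      field_simp
  refine h1.trans ((Finset.sum_le_sum fun i hi => Finset.sum_le_sum fun j hj =>
    h2 i hi j hj).trans ?_)
  rw [h3]
  have h4 : (∑ i ∈ range n, (u (i + 1) - u i) * G i) *
      (∑ j ∈ range m, (v (j + 1) - v j) * H j) ≤ (Real.pi / 3 + η) * (I + η) := by
    refine mul_le_mul hGs hHs (Finset.sum_nonneg fun j hj => ?_) (by positivity)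
    exact mul_nonneg (sub_nonneg.2 (hv j.le_succ)) (hH j (Finset.mem_range.1 hj)).1
  have h5 := h4.trans hη
  have h6 : (∑ i ∈ range n, (u (i + 1) - u i) * G i) *
      (∑ j ∈ range m, (v (j + 1) - v j) * H j) / (16 * Real.pi ^ 2) ≤
      1 / (48 * Real.pi) * I + ε / 2 := by
    rw [div_le_iff₀ (by positivity)]
    refine h5.trans (le_of_eq ?_)
    field_simp
    ring
  have hp0 : (0 : ℝ) ≤ p := by positivity
  exact mul_le_mul_of_nonneg_left (by linarith) hp0

end

section
open Topology

/-- The number of `l ≠ 0, 1` whose normalized Legendre trace lies in `[α, β]`. -/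
noncomputable def traceCount (p : ℕ) [Fact p.Prime] (α β : ℝ) : ℕ :=
  {l : ZMod p | l ≠ 0 ∧ l ≠ 1 ∧ α ≤ (legTrace l : ℝ) / √(p : ℝ) ∧
    (legTrace l : ℝ) / √(p : ℝ) ≤ β}.ncard

theorem exists_traceCount_le {α β ε : ℝ} (hα : -2 ≤ α) (hαβ : α ≤ β) (hβ : β ≤ 2)
    (hε : 0 < ε) : ∃ P₀ : ℕ, ∀ (p : ℕ) [Fact p.Prime], P₀ ≤ p →
      (traceCount p α β : ℝ) ≤ p * (1 / (2 * Real.pi) * (∫ t in α..β, √(4 - t ^ 2)) + ε) := by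
  obtain ⟨P₀, hP⟩ := exists_card_redTriple_le hα hαβ hβ (show 0 < ε / 24 by positivity)
  refine ⟨P₀ + 5, fun p hp hPp => ?_⟩
  have hp' : p.Prime := Fact.out
  set I := ∫ t in α..β, √(4 - t ^ 2) with hI
  have hI0 : 0 ≤ I := intervalIntegral.integral_nonneg hαβ fun t _ => Real.sqrt_nonneg _
  have hpi := Real.pi_pos
  set Q : ℝ := p * (1 / (48 * Real.pi) * I + ε / 24) with hQ
  have h := card_legTrace_le (p := p) (by omega)
    (I := {t : ℤ | α ≤ (t : ℝ) / √(p : ℝ) ∧ (t : ℝ) / √(p : ℝ) ≤ β}) (B := ⌊Q⌋₊) (by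
      intro a₀ b₀ c₀ ha₀ hb₀ hc₀ T hT
      refine Nat.le_floor ?_
      obtain ⟨k, hk, rfl⟩ : ∃ k : ℕ, (k = 0 ∨ k = 2) ∧ (k : ℤ) = c₀ := by
        rcases hc₀ with rfl | rfl
        · exact ⟨0, Or.inl rfl, rfl⟩
        · exact ⟨2, Or.inr rfl, rfl⟩
      refine hP p hp' (by omega) a₀ b₀ k ha₀ ?_ hk T fun w hw => ?_
      · rcases hb₀ with rfl | rfl
        · exact Even.zero
        · exact even_two
      · have := hT w hw
        simp only [Set.mem_ofPred_eq, Int.cast_add] at this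
        exact this)
  have h' : (traceCount p α β : ℝ) ≤ 24 * ⌊Q⌋₊ := by
    have : traceCount p α β ≤ 24 * ⌊Q⌋₊ := by
      unfold traceCount
      simp only [Set.mem_ofPred_eq] at h
      omega
    exact_mod_cast this
  have hfl : (⌊Q⌋₊ : ℝ) ≤ Q := Nat.floor_le (by positivity)
  refine h'.trans (le_trans (mul_le_mul_of_nonneg_left hfl (by norm_num)) (le_of_eq ?_))
  rw [hQ]
  field_simp
  ring

theorem abs_legTrace_div_sqrt_le {p : ℕ} [Fact p.Prime] (hp5 : 5 ≤ p) {l : ZMod p} (h0 : l ≠ 0)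
    (h1 : l ≠ 1) : |(legTrace l : ℝ) / √(p : ℝ)| ≤ 2 := by
  have h := card_legTrace_le (p := p) hp5 (I := {t : ℤ | 4 * (p : ℤ) < t ^ 2}) (B := 0) (by
    intro a₀ b₀ c₀ _ _ _ T hT
    rw [Nat.le_zero, Finset.card_eq_zero, Finset.eq_empty_iff_forall_notMem]
    intro w hw
    obtain ⟨⟨hc, -, -, -, h1, h2⟩, h3⟩ := hT w hw
    have h3' : 4 * (p : ℤ) < (w.2.1 + w.2.2) ^ 2 := h3
    have : (w.2.1 - w.2.2) ^ 2 ≤ w.1 ^ 2 := sq_le_sq' (abs_le.1 h1).1 (abs_le.1 h1).2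
    nlinarith)
  have h' : {l : ZMod p | l ≠ 0 ∧ l ≠ 1 ∧ legTrace l ∈ {t : ℤ | 4 * (p : ℤ) < t ^ 2}} = ∅ := by
    rw [← Set.ncard_eq_zero]
    omega
  have hl : ¬ 4 * (p : ℤ) < legTrace l ^ 2 := fun hlt => by
    have : l ∈ {l : ZMod p | l ≠ 0 ∧ l ≠ 1 ∧ legTrace l ∈ {t : ℤ | 4 * (p : ℤ) < t ^ 2}} :=
      ⟨h0, h1, hlt⟩
    rw [h'] at this
    exact this
  have hl' : (legTrace l : ℝ) ^ 2 ≤ 4 * p := by exact_mod_cast not_lt.1 hl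
  have hp0 : (0 : ℝ) < p := by exact_mod_cast (by omega : 0 < p)
  have hs0 : 0 < √(p : ℝ) := Real.sqrt_pos.2 hp0
  refine abs_le_of_sq_le_sq ?_ (by norm_num)
  rw [div_pow, Real.sq_sqrt hp0.le, div_le_iff₀ hp0]
  linarith

theorem le_sum_traceCount {p : ℕ} [Fact p.Prime] (hp5 : 5 ≤ p) (a b : ℝ) :
    p ≤ traceCount p (-2) a + traceCount p a b + traceCount p b 2 + 2 := by
  have hcov : (Set.univ : Set (ZMod p)) ⊆
      {l : ZMod p | l ≠ 0 ∧ l ≠ 1 ∧ -2 ≤ (legTrace l : ℝ) / √(p : ℝ) ∧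
        (legTrace l : ℝ) / √(p : ℝ) ≤ a} ∪
      {l : ZMod p | l ≠ 0 ∧ l ≠ 1 ∧ a ≤ (legTrace l : ℝ) / √(p : ℝ) ∧
        (legTrace l : ℝ) / √(p : ℝ) ≤ b} ∪
      {l : ZMod p | l ≠ 0 ∧ l ≠ 1 ∧ b ≤ (legTrace l : ℝ) / √(p : ℝ) ∧
        (legTrace l : ℝ) / √(p : ℝ) ≤ 2} ∪ {0, 1} := by
    intro l _
    by_cases h0 : l = 0
    · exact Or.inr (Or.inl h0)
    by_cases h1 : l = 1
    · exact Or.inr (Or.inr h1)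
    obtain ⟨hl, hr⟩ := abs_le.1 (abs_legTrace_div_sqrt_le hp5 h0 h1)
    rcases le_total ((legTrace l : ℝ) / √(p : ℝ)) a with ha | ha
    · exact Or.inl (Or.inl (Or.inl ⟨h0, h1, hl, ha⟩))
    · rcases le_total ((legTrace l : ℝ) / √(p : ℝ)) b with hb | hb
      · exact Or.inl (Or.inl (Or.inr ⟨h0, h1, ha, hb⟩))
      · exact Or.inl (Or.inr ⟨h0, h1, hb, hr⟩)
  have h := Set.ncard_le_ncard hcov (Set.toFinite _)
  rw [Set.ncard_univ, Nat.card_zmod] at h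
  refine h.trans ((Set.ncard_union_le _ _).trans (add_le_add ((Set.ncard_union_le _ _).trans
    (add_le_add (Set.ncard_union_le _ _) le_rfl)) ?_))
  exact (Set.ncard_insert_le _ _).trans (by rw [Set.ncard_singleton])

theorem exists_abs_traceCount_sub_le {a b ε : ℝ} (ha : -2 ≤ a) (hab : a ≤ b) (hb : b ≤ 2)
    (hε : 0 < ε) : ∃ P₀ : ℕ, ∀ (p : ℕ) [Fact p.Prime], P₀ ≤ p →
      |(traceCount p a b : ℝ) / p - 1 / (2 * Real.pi) * (∫ t in a..b, √(4 - t ^ 2))| ≤ ε := by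
  have hε3 : 0 < ε / 3 := by positivity
  obtain ⟨P₁, hP₁⟩ := exists_traceCount_le le_rfl ha (hab.trans hb) hε3
  obtain ⟨P₂, hP₂⟩ := exists_traceCount_le ha hab hb hε3
  obtain ⟨P₃, hP₃⟩ := exists_traceCount_le (ha.trans hab) hb le_rfl hε3
  refine ⟨P₁ + P₂ + P₃ + 5 + ⌈2 / (ε / 3)⌉₊, fun p _ hp => ?_⟩
  have h1 := hP₁ p (by omega)
  have h2 := hP₂ p (by omega)
  have h3 := hP₃ p (by omega)
  have h4 : (p : ℝ) ≤ traceCount p (-2) a + traceCount p a b + traceCount p b 2 + 2 := by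
    exact_mod_cast le_sum_traceCount (by omega) a b
  have h5 : 2 ≤ p * (ε / 3) := by
    rw [← div_le_iff₀ hε3]
    exact (Nat.le_ceil _).trans (by exact_mod_cast (by omega))
  have hp0 : (0 : ℝ) < p := by exact_mod_cast (by omega : 0 < p)
  have hfi : ∀ x y : ℝ, IntervalIntegrable (fun t => √(4 - t ^ 2)) MeasureTheory.volume x y :=
    fun x y => Continuous.intervalIntegrable (by fun_prop) x y
  have h6 := integral_sqrt_four_sub_sq
  rw [← intervalIntegral.integral_add_adjacent_intervals (hfi (-2) a) (hfi a 2),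
    ← intervalIntegral.integral_add_adjacent_intervals (hfi a b) (hfi b 2)] at h6
  set I₁ := ∫ t in (-2 : ℝ)..a, √(4 - t ^ 2)
  set I₂ := ∫ t in a..b, √(4 - t ^ 2)
  set I₃ := ∫ t in b..2, √(4 - t ^ 2)
  have h7 : 1 / (2 * Real.pi) * I₁ + 1 / (2 * Real.pi) * I₂ + 1 / (2 * Real.pi) * I₃ = 1 := by
    have hpi := Real.pi_pos
    rw [← mul_add, ← mul_add, add_assoc, h6]
    field_simp
  set J₁ := 1 / (2 * Real.pi) * I₁
  set J₂ := 1 / (2 * Real.pi) * I₂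
  set J₃ := 1 / (2 * Real.pi) * I₃
  have e1 : (traceCount p a b : ℝ) / p ≤ J₂ + ε := by
    rw [div_le_iff₀ hp0]
    nlinarith
  have e2 : J₂ - ε ≤ (traceCount p a b : ℝ) / p := by
    rw [le_div_iff₀ hp0]
    have : (J₂ - ε) * p = p * 1 - p * (J₁ + ε / 3) - p * (J₃ + ε / 3) - p * (ε / 3) := by
      rw [← h7]; ring
    rw [this]
    linarith
  exact abs_le.2 ⟨by linarith, by linarith⟩

end

/-- **Semicircular distribution for the `₆G₆` family.**
Let `-2 ≤ a < b ≤ 2`. For primes `p ≡ 2 (mod 3)`, let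
`a_p(λ) = -∑_{x ∈ F_p} φ(x(x-1)(x-λ))` where `φ` is the quadratic character of `F_p`.
Then, as `p → ∞` through primes `p ≡ 2 (mod 3)`, the proportion of `λ ∈ F_p`,
`λ ≠ 0, 1`, with `φ(-1)·a_p(λ)/√p ∈ [a, b]` converges to
`(1/(2π)) ∫_a^b √(4 - t²) dt`. -/
theorem sato_tate_6G6 (a b : ℝ) (ha : -2 ≤ a) (hab : a < b) (hb : b ≤ 2) :
    Tendsto
      (fun p : Nat.Primes =>
        haveI : Fact (p : ℕ).Prime := ⟨p.property⟩
        (({l : ZMod p | l ≠ 0 ∧ l ≠ 1 ∧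
            a ≤ ((quadraticChar (ZMod p) (-1) *
              (-∑ x : ZMod p, quadraticChar (ZMod p) (x * (x - 1) * (x - l))) : ℤ) : ℝ) /
                Real.sqrt (p : ℕ) ∧
            ((quadraticChar (ZMod p) (-1) *
              (-∑ x : ZMod p, quadraticChar (ZMod p) (x * (x - 1) * (x - l))) : ℤ) : ℝ) /
                Real.sqrt (p : ℕ) ≤ b}.ncard : ℝ) / (p : ℕ)))
      (Filter.comap ((↑) : Nat.Primes → ℕ) atTop ⊓
        Filter.principal {p : Nat.Primes | (p : ℕ) % 3 = 2})
      (nhds ((1 / (2 * Real.pi)) * ∫ t in a..b, Real.sqrt (4 - t ^ 2))) := by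
  refine Tendsto.mono_left ?_ inf_le_left
  rw [Metric.tendsto_nhds]
  intro ε hε
  obtain ⟨P₀, hP₀⟩ := exists_abs_traceCount_sub_le ha hab.le hb (half_pos hε)
  filter_upwards [preimage_mem_comap (Ici_mem_atTop P₀)] with p hp
  haveI : Fact (p : ℕ).Prime := ⟨p.property⟩
  rw [Real.dist_eq]
  exact (hP₀ p hp).trans_lt (half_lt_self hε)
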